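/- Let R be a commutative Noetherian ring admitting a dualizing complex and M a nonzero finitely generated R-module. Then M is G–Gorenstein (i.e., its Cousin complex with respect to the M-height filtration is a Gorenstein injective resolution of M) if and only if for every prime p in Supp M, depth_{R_p} M_p = ht_M p = Gid_{R_p} M_p = depth R_p. -/

import Mathlib

universe u

namespace GG

open RingTheory.Sequence

variable (R : Type u) [CommRing R]

/-- A module `N` is Gorenstein injective if it is a kernel in a `Hom(Inj,−)`-exact exact
doubly infinite complex of injective modules. -/
def IsGorensteinInjective (N : Type u) [AddCommGroup N] [Module R N] : Prop :=
  ∃ (X : ℤ → ModuleCat.{u} R) (d : ∀ n : ℤ, X n →ₗ[R] X (n + 1)),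
    (∀ n, Module.Injective R (X n)) ∧
    (∀ n, LinearMap.range (d n) = LinearMap.ker (d (n + 1))) ∧
    (∀ (I : ModuleCat.{u} R), Module.Injective R I →
      ∀ (n : ℤ) (φ : I →ₗ[R] X (n + 1)), (d (n + 1)).comp φ = 0 →
        ∃ ψ : I →ₗ[R] X n, (d n).comp ψ = φ) ∧
    Nonempty (N ≃ₗ[R] LinearMap.ker (d 0))

/-- A module `N` is Gorenstein projective if it is a kernel in a `Hom(−,Proj)`-exact exact
doubly infinite complex of projective modules. -/
def IsGorensteinProjective (N : Type u) [AddCommGroup N] [Module R N] : Prop :=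
  ∃ (X : ℤ → ModuleCat.{u} R) (d : ∀ n : ℤ, X n →ₗ[R] X (n + 1)),
    (∀ n, Module.Projective R (X n)) ∧
    (∀ n, LinearMap.range (d n) = LinearMap.ker (d (n + 1))) ∧
    (∀ (P : ModuleCat.{u} R), Module.Projective R P →
      ∀ (n : ℤ) (φ : X (n + 1) →ₗ[R] P), φ.comp (d n) = 0 →
        ∃ ψ : X (n + 1 + 1) →ₗ[R] P, ψ.comp (d (n + 1)) = φ) ∧
    Nonempty (N ≃ₗ[R] LinearMap.ker (d 0))

/-- A module `N` is Gorenstein flat if it is a kernel in an `(Inj ⊗ −)`-exact exact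
doubly infinite complex of flat modules. -/
def IsGorensteinFlat (N : Type u) [AddCommGroup N] [Module R N] : Prop :=
  ∃ (X : ℤ → ModuleCat.{u} R) (d : ∀ n : ℤ, X n →ₗ[R] X (n + 1)),
    (∀ n, Module.Flat R (X n)) ∧
    (∀ n, LinearMap.range (d n) = LinearMap.ker (d (n + 1))) ∧
    (∀ (I : ModuleCat.{u} R), Module.Injective R I →
      ∀ n : ℤ, LinearMap.range (LinearMap.lTensor (R := R) I (d n)) =
        LinearMap.ker (LinearMap.lTensor (R := R) I (d (n + 1)))) ∧
    Nonempty (N ≃ₗ[R] LinearMap.ker (d 0))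

/-- Existence of a right resolution of length `≤ n` by modules satisfying `P`. -/
def CoresolutionLE (P : ModuleCat.{u} R → Prop) (M : Type u) [AddCommGroup M] [Module R M]
    (n : ℕ) : Prop :=
  ∃ (G : ℕ → ModuleCat.{u} R) (d : ∀ i : ℕ, G i →ₗ[R] G (i + 1)) (ε : M →ₗ[R] G 0),
    (∀ i, P (G i)) ∧ Function.Injective ε ∧
    LinearMap.range ε = LinearMap.ker (d 0) ∧
    (∀ i, LinearMap.range (d i) = LinearMap.ker (d (i + 1))) ∧
    (∀ i, n < i → ∀ x : G i, x = 0)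

/-- Existence of a left resolution of length `≤ n` by modules satisfying `P`. -/
def ResolutionLE (P : ModuleCat.{u} R → Prop) (M : Type u) [AddCommGroup M] [Module R M]
    (n : ℕ) : Prop :=
  ∃ (G : ℕ → ModuleCat.{u} R) (d : ∀ i : ℕ, G (i + 1) →ₗ[R] G i) (ε : G 0 →ₗ[R] M),
    (∀ i, P (G i)) ∧ Function.Surjective ε ∧
    LinearMap.ker ε = LinearMap.range (d 0) ∧
    (∀ i, LinearMap.ker (d i) = LinearMap.range (d (i + 1))) ∧
    (∀ i, n < i → ∀ x : G i, x = 0)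

/-- `Gid_R M ≤ n`. -/
def gidLE (M : Type u) [AddCommGroup M] [Module R M] (n : ℕ) : Prop :=
  CoresolutionLE R (fun N => IsGorensteinInjective R N) M n

/-- `id_R M ≤ n`. -/
def idLE (M : Type u) [AddCommGroup M] [Module R M] (n : ℕ) : Prop :=
  CoresolutionLE R (fun N => Module.Injective R N) M n

/-- `pd_R M ≤ n`. -/
def pdLE (M : Type u) [AddCommGroup M] [Module R M] (n : ℕ) : Prop :=
  ResolutionLE R (fun N => Module.Projective R N) M n

/-- `fd_R M ≤ n`. -/
def fdLE (M : Type u) [AddCommGroup M] [Module R M] (n : ℕ) : Prop :=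
  ResolutionLE R (fun N => Module.Flat R N) M n

/-- `Gfd_R M ≤ n`. -/
def gfdLE (M : Type u) [AddCommGroup M] [Module R M] (n : ℕ) : Prop :=
  ResolutionLE R (fun N => IsGorensteinFlat R N) M n

/-- Gorenstein injective dimension, as an extended natural number. -/
noncomputable def gid (M : Type u) [AddCommGroup M] [Module R M] : ℕ∞ :=
  sInf {c : ℕ∞ | ∃ n : ℕ, c = n ∧ gidLE R M n}

/-- The depth of a module over a local ring: the supremum of the lengths of regular
sequences contained in the maximal ideal. -/
noncomputable def mdepth [IsLocalRing R] (M : Type u) [AddCommGroup M] [Module R M] : ℕ∞ :=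
  sSup {c : ℕ∞ | ∃ rs : List R, c = rs.length ∧
    (∀ r ∈ rs, r ∈ IsLocalRing.maximalIdeal R) ∧ RingTheory.Sequence.IsRegular M rs}

/-- The Krull dimension of a module: the Krull dimension of its support. -/
noncomputable def mdim (M : Type u) [AddCommGroup M] [Module R M] : WithBot ℕ∞ :=
  Order.krullDim ↥(Module.support R M)

/-- The height of a prime in the support of `M`. -/
noncomputable def htM (M : Type u) [AddCommGroup M] [Module R M] (p : PrimeSpectrum R) : ℕ∞ :=
  ⨆ h : p ∈ Module.support R M, Order.height (⟨p, h⟩ : ↥(Module.support R M))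

/-- A Cohen–Macaulay module over a local ring: depth equals Krull dimension. -/
def IsCMModule [IsLocalRing R] (M : Type u) [AddCommGroup M] [Module R M] : Prop :=
  (mdepth R M : WithBot ℕ∞) = mdim R M

/-- A maximal Cohen–Macaulay module over a local ring. -/
def IsMaximalCM [IsLocalRing R] (M : Type u) [AddCommGroup M] [Module R M] : Prop :=
  IsCMModule R M ∧ mdim R M = ringKrullDim R

/-- A Cohen–Macaulay local ring. -/
def IsCMLocalRing [IsLocalRing R] : Prop :=
  (mdepth R R : WithBot ℕ∞) = ringKrullDim R

/-- A Gorenstein local ring: a Noetherian local ring of finite self-injective dimension. -/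
def IsGorensteinLocalRing [IsLocalRing R] : Prop :=
  IsNoetherianRing R ∧ ∃ n : ℕ, idLE R R n

/-- A regular local ring: Noetherian, and the maximal ideal is generated by `dim R` elements. -/
def IsRegularLocal [IsLocalRing R] : Prop :=
  IsNoetherianRing R ∧ ∃ s : Finset R, Ideal.span (s : Set R) = IsLocalRing.maximalIdeal R ∧
    (s.card : WithBot ℕ∞) = ringKrullDim R

/-- A (not necessarily local) Gorenstein ring: all localizations at primes are Gorenstein. -/
def IsGorensteinRing : Prop :=
  ∀ p : PrimeSpectrum R, ∃ n : ℕ,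
    idLE (Localization.AtPrime p.asIdeal) (Localization.AtPrime p.asIdeal) n

/-- `R` admits a dualizing complex; by Kawasaki's theorem this is equivalent to being a
homomorphic image of a finite-dimensional Gorenstein ring. -/
def HasDualizingComplex : Prop :=
  ∃ Q : CommRingCat.{u}, IsNoetherianRing Q ∧ ringKrullDim Q < ⊤ ∧ IsGorensteinRing Q ∧
    ∃ f : Q →+* R, Function.Surjective f

section Cousin

/-- The product of the localizations of `N` at the primes in `S`. -/
noncomputable abbrev locProd (S : Set (PrimeSpectrum R)) (N : Type u) [AddCommGroup N]
    [Module R N] : Type u :=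
  Π p : S, LocalizedModule p.1.asIdeal.primeCompl N

/-- The submodule of the product of localizations consisting of finitely supported families;
this is the direct sum `⊕_{p ∈ S} N_p`. -/
noncomputable def finSupp (S : Set (PrimeSpectrum R)) (N : Type u) [AddCommGroup N]
    [Module R N] : Submodule R (locProd R S N) where
  carrier := {f | {p : S | f p ≠ 0}.Finite}
  add_mem' := by
    intro f g hf hg
    refine (hf.union hg).subset ?_
    intro p hp
    by_contra h
    simp only [Set.mem_union, Set.mem_setOf_eq, not_or, not_not] at h
    exact hp (by simp [Pi.add_apply, h.1, h.2])
  zero_mem' := by simp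
  smul_mem' := by
    intro c f hf
    refine hf.subset ?_
    intro p hp
    by_contra h
    simp only [Set.mem_setOf_eq, not_not] at h
    exact hp (by simp [Pi.smul_apply, h])

/-- The canonical map `N → ∏_{p ∈ S} N_p`. -/
noncomputable def thetaFull (S : Set (PrimeSpectrum R)) (N : Type u) [AddCommGroup N]
    [Module R N] : N →ₗ[R] locProd R S N :=
  LinearMap.pi fun p => LocalizedModule.mkLinearMap p.1.asIdeal.primeCompl N

/-- The cokernel of `N → ⊕_{p ∈ S} N_p` (computed inside the direct sum). -/
noncomputable abbrev nextKType (S : Set (PrimeSpectrum R)) (N : Type u) [AddCommGroup N]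
    [Module R N] : Type u :=
  ↥(finSupp R S N) ⧸
    (Submodule.comap (finSupp R S N).subtype (LinearMap.range (thetaFull R S N)))

/-- The sequence of "kernel/cokernel" modules in the inductive construction
of the Cousin complex of `M` with respect to the filtration `F`. -/
noncomputable def cousinK (F : ℕ → Set (PrimeSpectrum R)) (M : ModuleCat.{u} R) :
    ℕ → ModuleCat.{u} R
  | 0 => M
  | n + 1 => ModuleCat.of R (nextKType R (F n \ F (n + 1)) (cousinK F M n))

/-- The `n`-th term `M^n = ⊕_{p ∈ ∂F_n} (coker d^{n-2})_p` of the Cousin complex. -/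
noncomputable abbrev cousinC (F : ℕ → Set (PrimeSpectrum R)) (M : ModuleCat.{u} R) (n : ℕ) :
    Type u :=
  ↥(finSupp R (F n \ F (n + 1)) (cousinK R F M n))

/-- The canonical map from the `n`-th cokernel into the product of its localizations. -/
noncomputable def cousinTheta (F : ℕ → Set (PrimeSpectrum R)) (M : ModuleCat.{u} R) (n : ℕ) :
    (cousinK R F M n) →ₗ[R] locProd R (F n \ F (n + 1)) (cousinK R F M n) :=
  thetaFull R _ _

/-- The (full) `n`-th differential of the Cousin complex, from `M^n` to the product at
level `n+1` (it lands inside the direct sum `M^{n+1}`). -/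
noncomputable def cousinD (F : ℕ → Set (PrimeSpectrum R)) (M : ModuleCat.{u} R) (n : ℕ) :
    (cousinC R F M n) →ₗ[R] locProd R (F (n + 1) \ F (n + 2)) (cousinK R F M (n + 1)) :=
  (cousinTheta R F M (n + 1)).comp
    (Submodule.mkQ (Submodule.comap (finSupp R (F n \ F (n + 1)) (cousinK R F M n)).subtype
      (LinearMap.range (thetaFull R (F n \ F (n + 1)) (cousinK R F M n)))))

/-- `F` is a filtration of `Spec R`: descending, and every element of `∂F_n = F_n \ F_{n+1}`
is a minimal member of `F_n`. -/
def IsFiltration (F : ℕ → Set (PrimeSpectrum R)) : Prop :=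
  (∀ n, F (n + 1) ⊆ F n) ∧
    ∀ n, ∀ p ∈ F n \ F (n + 1), ∀ q ∈ F n, q ≤ p → q = p

/-- The filtration `F` admits `M`. -/
def Admits (F : ℕ → Set (PrimeSpectrum R)) (M : Type u) [AddCommGroup M] [Module R M] : Prop :=
  Module.support R M ⊆ F 0

/-- The `M`-height filtration `K_i = {p ∈ Supp M | ht_M p ≥ i}`. -/
noncomputable def heightFiltration (M : Type u) [AddCommGroup M] [Module R M] :
    ℕ → Set (PrimeSpectrum R) :=
  fun i => {p | p ∈ Module.support R M ∧ (i : ℕ∞) ≤ htM R M p}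

/-- The Cousin complex `C(F, M)` is exact at `M, M⁰, …, M^t`
(together with the well-definedness of the differentials into the direct sums). -/
def CousinPartiallyExact (F : ℕ → Set (PrimeSpectrum R)) (M : ModuleCat.{u} R) (t : ℕ) : Prop :=
  (∀ n, LinearMap.range (cousinTheta R F M n) ≤ finSupp R (F n \ F (n + 1)) (cousinK R F M n)) ∧
  Function.Injective (cousinTheta R F M 0) ∧
  (∀ n ≤ t, LinearMap.ker (cousinD R F M n) =
    Submodule.comap (finSupp R (F n \ F (n + 1)) (cousinK R F M n)).subtype
      (LinearMap.range (cousinTheta R F M n)))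

/-- The Cousin complex `C(F, M)` is exact and all of its terms satisfy `P`, i.e. it provides
a `P`-resolution of `M`. -/
def CousinResolves (F : ℕ → Set (PrimeSpectrum R)) (M : ModuleCat.{u} R)
    (P : ModuleCat.{u} R → Prop) : Prop :=
  (∀ n, LinearMap.range (cousinTheta R F M n) ≤ finSupp R (F n \ F (n + 1)) (cousinK R F M n)) ∧
  Function.Injective (cousinTheta R F M 0) ∧
  (∀ n, LinearMap.ker (cousinD R F M n) =
    Submodule.comap (finSupp R (F n \ F (n + 1)) (cousinK R F M n)).subtype
      (LinearMap.range (cousinTheta R F M n))) ∧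
  (∀ n, P (ModuleCat.of R (cousinC R F M n)))

/-- A G–Gorenstein module: a nonzero finitely generated module whose Cousin complex with
respect to the `M`-height filtration is a Gorenstein injective resolution. -/
def IsGGorenstein (M : ModuleCat.{u} R) : Prop :=
  (∃ x : M, x ≠ 0) ∧ Module.Finite R M ∧
    CousinResolves R (heightFiltration R M) M (fun N => IsGorensteinInjective R N)

/-- A Gorenstein module: a nonzero finitely generated module whose Cousin complex with
respect to the `M`-height filtration is an injective resolution. -/
def IsGorensteinModule (M : ModuleCat.{u} R) : Prop :=
  (∃ x : M, x ≠ 0) ∧ Module.Finite R M ∧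
    CousinResolves R (heightFiltration R M) M (fun N => Module.Injective R N)

end Cousin

/-- A system of parameters of a local ring. -/
def IsSOP [IsLocalRing R] (rs : List R) : Prop :=
  (rs.length : WithBot ℕ∞) = ringKrullDim R ∧
    (∀ r ∈ rs, r ∈ IsLocalRing.maximalIdeal R) ∧
    IsLocalRing.maximalIdeal R ≤ (Ideal.span {r | r ∈ rs}).radical

/-- A balanced big Cohen–Macaulay module: every system of parameters of `R` is a regular
sequence on `M`. -/
def IsBalancedBigCM [IsLocalRing R] (M : Type u) [AddCommGroup M] [Module R M] : Prop :=
  ∀ rs : List R, IsSOP R rs → RingTheory.Sequence.IsRegular M rs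

end GG

namespace GGP
open CategoryTheory CategoryTheory.Abelian

section toolkit
variable {R : Type u} [CommRing R]

/-- short exactness of a pair of linear maps -/
structure SE {A B C : Type u} [AddCommGroup A] [Module R A] [AddCommGroup B] [Module R B]
    [AddCommGroup C] [Module R C] (f : A →ₗ[R] B) (g : B →ₗ[R] C) : Prop where
  inj : Function.Injective f
  ex : Function.Exact f g
  surj : Function.Surjective g

/-- vanishing of Ext -/
def EV (R : Type u) [CommRing R] (n : ℕ) (L N : Type u) [AddCommGroup L] [Module R L]
    [AddCommGroup N] [Module R N] : Prop :=
  Subsingleton (Ext (ModuleCat.of R L) (ModuleCat.of R N) n)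

variable {A B C L N : Type u} [AddCommGroup A] [Module R A] [AddCommGroup B] [Module R B]
    [AddCommGroup C] [Module R C] [AddCommGroup L] [Module R L] [AddCommGroup N] [Module R N]

theorem SE.zero {f : A →ₗ[R] B} {g : B →ₗ[R] C} (h : SE f g) : g.comp f = 0 :=
  h.ex.linearMap_comp_eq_zero

/-- associated short complex -/
abbrev scx (f : A →ₗ[R] B) (g : B →ₗ[R] C) (h : SE f g) : ShortComplex (ModuleCat.{u} R) :=
  ShortComplex.mk (ModuleCat.ofHom f) (ModuleCat.ofHom g) (by
    rw [← ModuleCat.ofHom_comp, h.zero]; rfl)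

theorem scx_se {f : A →ₗ[R] B} {g : B →ₗ[R] C} (h : SE f g) : (scx f g h).ShortExact := by
  refine ShortComplex.ShortExact.mk' ?_ ?_ ?_
  · rw [ShortComplex.ShortExact.moduleCat_exact_iff_function_exact]
    exact h.ex
  · rw [ModuleCat.mono_iff_injective]; exact h.inj
  · rw [ModuleCat.epi_iff_surjective]; exact h.surj

theorem EV.iff {n : ℕ} : EV R n L N ↔
    ∀ x : Ext (ModuleCat.of R L) (ModuleCat.of R N) n, x = 0 :=
  ⟨fun h x => h.elim _ _, fun h => ⟨fun a b => (h a).trans (h b).symm⟩⟩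

theorem EV.mid₂ {f : A →ₗ[R] B} {g : B →ₗ[R] C} (h : SE f g) {n : ℕ} (h1 : EV R n L A)
    (h2 : EV R n L C) : EV R n L B := by
  rw [EV.iff] at *
  intro x
  obtain ⟨y, hy⟩ := Ext.covariant_sequence_exact₂ (ModuleCat.of R L) (scx_se h) x (h2 _)
  rw [← hy, h1 y, Ext.zero_comp]

theorem EV.right₂ {f : A →ₗ[R] B} {g : B →ₗ[R] C} (h : SE f g) {n : ℕ} (h1 : EV R n L B)
    (h2 : EV R (n+1) L A) : EV R n L C := by
  rw [EV.iff] at *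
  intro x
  obtain ⟨y, hy⟩ := Ext.covariant_sequence_exact₃ (ModuleCat.of R L) (scx_se h) x rfl (h2 _)
  rw [← hy, h1 y, Ext.zero_comp]

theorem EV.left₂ {f : A →ₗ[R] B} {g : B →ₗ[R] C} (h : SE f g) {n : ℕ} (h1 : EV R n L C)
    (h2 : EV R (n+1) L B) : EV R (n+1) L A := by
  rw [EV.iff] at *
  intro x
  obtain ⟨y, hy⟩ := Ext.covariant_sequence_exact₁ (ModuleCat.of R L) (scx_se h) x (h2 _) rfl
  rw [← hy, h1 y, Ext.zero_comp]

theorem EV.mid₁ {f : A →ₗ[R] B} {g : B →ₗ[R] C} (h : SE f g) {n : ℕ} (h1 : EV R n A N)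
    (h2 : EV R n C N) : EV R n B N := by
  rw [EV.iff] at *
  intro x
  obtain ⟨y, hy⟩ := Ext.contravariant_sequence_exact₂ (scx_se h) (ModuleCat.of R N) x (h1 _)
  rw [← hy, h2 y, Ext.comp_zero]

theorem EV.left₁ {f : A →ₗ[R] B} {g : B →ₗ[R] C} (h : SE f g) {n : ℕ} (h1 : EV R n B N)
    (h2 : EV R (n+1) C N) : EV R n A N := by
  rw [EV.iff] at *
  intro x
  obtain ⟨y, hy⟩ := Ext.contravariant_sequence_exact₁ (scx_se h) (ModuleCat.of R N) x
    (add_comm 1 n) (h2 _)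
  rw [← hy, h1 y, Ext.comp_zero]

theorem EV.right₁ {f : A →ₗ[R] B} {g : B →ₗ[R] C} (h : SE f g) {n : ℕ} (h1 : EV R n A N)
    (h2 : EV R (n+1) B N) : EV R (n+1) C N := by
  rw [EV.iff] at *
  intro x
  obtain ⟨y, hy⟩ := Ext.contravariant_sequence_exact₃ (scx_se h) (ModuleCat.of R N) x
    (h2 _) (add_comm 1 n)
  rw [← hy, h1 y, Ext.comp_zero]

theorem EV.zero_iff : EV R 0 L N ↔ ∀ f : L →ₗ[R] N, f = 0 := by
  rw [EV.iff]
  constructor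
  · intro h f
    have := h (Ext.mk₀ (ModuleCat.ofHom f))
    rw [Ext.mk₀_eq_zero_iff] at this
    have h2 := congrArg ModuleCat.Hom.hom this
    simpa using h2
  · intro h x
    obtain ⟨g, rfl⟩ := Ext.addEquiv₀.symm.surjective x
    have : g = 0 := by
      ext1
      exact h _
    rw [this, map_zero]

theorem EV.of_projective [Module.Projective R L] (n : ℕ) : EV R (n+1) L N := by
  rw [EV.iff]; intro x
  have : Projective (ModuleCat.of R L) := (IsProjective.iff_projective L).1 inferInstance
  exact x.eq_zero_of_projective

theorem EV.of_injective (h : Module.Injective R N) (n : ℕ) : EV R (n+1) L N := by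
  rw [EV.iff]; intro x
  have : Injective (ModuleCat.of R N) := (Module.injective_iff_injective_object R N).1 h
  exact x.eq_zero_of_injective

theorem EV.lift {f : A →ₗ[R] B} {g : B →ₗ[R] C} (h : SE f g) (h1 : EV R 1 L A)
    (φ : L →ₗ[R] C) : ∃ ψ : L →ₗ[R] B, g.comp ψ = φ := by
  rw [EV.iff] at h1
  obtain ⟨y, hy⟩ := Ext.covariant_sequence_exact₃ (ModuleCat.of R L) (scx_se h)
    (Ext.mk₀ (ModuleCat.ofHom φ)) rfl (h1 _)
  obtain ⟨k, rfl⟩ := (Ext.mk₀_bijective _ _).2 y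
  rw [Ext.mk₀_comp_mk₀] at hy
  have := (Ext.mk₀_bijective _ _).1 hy
  refine ⟨k.hom, ?_⟩
  have h2 := congrArg ModuleCat.Hom.hom this
  simpa using h2

theorem EV.extend {f : A →ₗ[R] B} {g : B →ₗ[R] C} (h : SE f g) (h1 : EV R 1 C N)
    (φ : A →ₗ[R] N) : ∃ ψ : B →ₗ[R] N, ψ.comp f = φ := by
  rw [EV.iff] at h1
  obtain ⟨y, hy⟩ := Ext.contravariant_sequence_exact₁ (scx_se h) (ModuleCat.of R N)
    (Ext.mk₀ (ModuleCat.ofHom φ)) rfl (h1 _)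
  obtain ⟨k, rfl⟩ := (Ext.mk₀_bijective _ _).2 y
  rw [Ext.mk₀_comp_mk₀] at hy
  have := (Ext.mk₀_bijective _ _).1 hy
  refine ⟨k.hom, ?_⟩
  have h2 := congrArg ModuleCat.Hom.hom this
  simpa using h2

theorem EV.one_of_lift {f : A →ₗ[R] B} {g : B →ₗ[R] C} (h : SE f g) (hB : EV R 1 L B)
    (hl : ∀ φ : L →ₗ[R] C, ∃ ψ : L →ₗ[R] B, g.comp ψ = φ) : EV R 1 L A := by
  rw [EV.iff] at *
  intro x
  obtain ⟨y, hy⟩ := Ext.covariant_sequence_exact₁ (ModuleCat.of R L) (scx_se h) x (hB _)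
    (n₀ := 0) rfl
  obtain ⟨k, rfl⟩ := (Ext.mk₀_bijective _ _).2 y
  obtain ⟨ψ, hψ⟩ := hl k.hom
  have : k = ModuleCat.ofHom ψ ≫ (scx f g h).g := by
    ext1
    simpa using hψ.symm
  rw [← hy, this, ← Ext.mk₀_comp_mk₀, Ext.comp_assoc_of_second_deg_zero,
    ShortComplex.ShortExact.comp_extClass, Ext.comp_zero]

theorem EV.one_of_extend {f : A →ₗ[R] B} {g : B →ₗ[R] C} (h : SE f g) (hB : EV R 1 B N)
    (hl : ∀ φ : A →ₗ[R] N, ∃ ψ : B →ₗ[R] N, ψ.comp f = φ) : EV R 1 C N := by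
  rw [EV.iff] at *
  intro x
  obtain ⟨y, hy⟩ := Ext.contravariant_sequence_exact₃ (scx_se h) (ModuleCat.of R N) x
    (hB _) (n₀ := 0) rfl
  obtain ⟨k, rfl⟩ := (Ext.mk₀_bijective _ _).2 y
  obtain ⟨ψ, hψ⟩ := hl k.hom
  have : k = (scx f g h).f ≫ ModuleCat.ofHom ψ := by
    ext1
    simpa using hψ.symm
  rw [← hy, this, ← Ext.mk₀_comp_mk₀, ShortComplex.ShortExact.extClass_comp_assoc]

/-! ### Standard short exact sequences -/

theorem SE.ker (g : B →ₗ[R] C) (hg : Function.Surjective g) :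
    SE (LinearMap.ker g).subtype g :=
  ⟨Subtype.val_injective, LinearMap.exact_subtype_ker_map g, hg⟩

theorem SE.quot (P : Submodule R B) : SE P.subtype P.mkQ :=
  ⟨Subtype.val_injective, LinearMap.exact_subtype_mkQ P, P.mkQ_surjective⟩

theorem SE.coker (f : A →ₗ[R] B) (hf : Function.Injective f) :
    SE f (LinearMap.range f).mkQ :=
  ⟨hf, LinearMap.exact_map_mkQ_range f, Submodule.mkQ_surjective _⟩

theorem SE.equiv_left {f : A →ₗ[R] B} {g : B →ₗ[R] C} (h : SE f g) (e : L ≃ₗ[R] A) :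
    SE (f.comp e.toLinearMap) g := by
  refine ⟨h.inj.comp e.injective, ?_, h.surj⟩
  intro x
  rw [h.ex x]
  constructor
  · rintro ⟨y, rfl⟩; exact ⟨e.symm y, by simp⟩
  · rintro ⟨y, rfl⟩; exact ⟨e y, by simp⟩

theorem SE.equiv_right {f : A →ₗ[R] B} {g : B →ₗ[R] C} (h : SE f g) (e : C ≃ₗ[R] L) :
    SE f (e.toLinearMap.comp g) := by
  refine ⟨h.inj, ?_, e.surjective.comp h.surj⟩
  intro x
  rw [← h.ex x]; simp

theorem SE.inl_snd : SE (LinearMap.inl R A B) (LinearMap.snd R A B) :=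
  ⟨LinearMap.inl_injective, Function.Exact.inl_snd, LinearMap.snd_surjective⟩

theorem SE.of_equiv (e : A ≃ₗ[R] B) (hC : Subsingleton C) : SE e.toLinearMap (0 : B →ₗ[R] C) :=
  ⟨e.injective, fun x => ⟨fun _ => e.surjective x, fun _ => rfl⟩, fun x => ⟨0, Subsingleton.elim _ _⟩⟩

theorem EV.of_subsingleton_right [Subsingleton N] (n : ℕ) : EV R n L N := by
  rcases n with _ | n
  · rw [EV.zero_iff]; intro f; ext x; exact Subsingleton.elim _ _
  · refine EV.of_injective ⟨?_⟩ n
    intros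
    exact ⟨0, fun _ => Subsingleton.elim _ _⟩

theorem EV.of_subsingleton_left [Subsingleton L] (n : ℕ) : EV R n L N := by
  rcases n with _ | n
  · rw [EV.zero_iff]; intro f; ext x; rw [Subsingleton.elim x 0]; simp
  · have : Module.Projective R L := inferInstance
    exact EV.of_projective n

theorem EV.congr_right (e : A ≃ₗ[R] B) {n : ℕ} (h : EV R n L A) : EV R n L B :=
  EV.mid₂ (SE.of_equiv e (C := PUnit) inferInstance) h (EV.of_subsingleton_right n)

theorem EV.congr_left (e : A ≃ₗ[R] B) {n : ℕ} (h : EV R n A N) : EV R n B N :=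
  EV.mid₁ (SE.of_equiv e (C := PUnit) inferInstance) h (EV.of_subsingleton_left n)

theorem EV.prod_right {n : ℕ} (h1 : EV R n L A) (h2 : EV R n L B) : EV R n L (A × B) :=
  EV.mid₂ SE.inl_snd h1 h2

theorem EV.prod_left {n : ℕ} (h1 : EV R n A N) (h2 : EV R n B N) : EV R n (A × B) N :=
  EV.mid₁ SE.inl_snd h1 h2

/-- a module is injective iff Ext one vanishes on all modules -/
theorem injective_of_EV (h : ∀ I : Ideal R, EV R 1 (R ⧸ I) N) : Module.Injective R N := by
  rw [← Module.Baer.iff_injective]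
  intro I φ
  obtain ⟨ψ, hψ⟩ := EV.extend (SE.quot (R := R) I) (h I) φ
  exact ⟨ψ, fun x hx => by rw [← hψ]; rfl⟩

theorem extend_of_injective (hN : Module.Injective R N) {f : A →ₗ[R] B}
    (hf : Function.Injective f) (φ : A →ₗ[R] N) : ∃ ψ : B →ₗ[R] N, ψ.comp f = φ :=
  EV.extend (SE.coker f hf) (EV.of_injective hN 0) φ

theorem lift_of_projective [Module.Projective R L] {g : B →ₗ[R] C}
    (hg : Function.Surjective g) (φ : L →ₗ[R] C) : ∃ ψ : L →ₗ[R] B, g.comp ψ = φ :=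
  Module.projective_lifting_property g φ hg

theorem injective_congr (e : A ≃ₗ[R] B) (h : Module.Injective R A) : Module.Injective R B :=
  injective_of_EV fun _ => (EV.of_injective h 0).congr_right e

theorem injective_of_retract (i : A →ₗ[R] B) (r : B →ₗ[R] A) (h : r.comp i = LinearMap.id)
    (hB : Module.Injective R B) : Module.Injective R A := by
  refine ⟨fun X Y _ _ _ _ f hf g => ?_⟩
  obtain ⟨ψ, hψ⟩ := extend_of_injective hB hf (i.comp g)
  refine ⟨r.comp ψ, fun x => ?_⟩
  have := LinearMap.congr_fun hψ x
  simp only [LinearMap.comp_apply] at this ⊢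
  rw [this]; exact LinearMap.congr_fun h _

/-- enough injectives, unbundled -/
theorem exists_inj_embed (R : Type u) [CommRing R] (N : Type u) [AddCommGroup N] [Module R N] :
    ∃ (I : Type u) (_ : AddCommGroup I) (_ : Module R I) (f : N →ₗ[R] I),
      Module.Injective R I ∧ Function.Injective f := by
  let I := Injective.under (ModuleCat.of R N)
  refine ⟨I, inferInstance, inferInstance, (Injective.ι (ModuleCat.of R N)).hom, ?_, ?_⟩
  · exact (Module.injective_iff_injective_object R I).2
      (inferInstanceAs (Injective (Injective.under (ModuleCat.of R N))))
  · exact (ModuleCat.mono_iff_injective _).1 inferInstance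

/-! ### endomorphism tricks -/

/-- if `u` kills `L` and acts bijectively on `N`, all Ext vanish -/
theorem EV.of_mul_trick (u : R) (hL : ∀ x : L, u • x = 0)
    (hN : Function.Bijective fun x : N => u • x) (n : ℕ) : EV R n L N := by
  rw [EV.iff]
  intro x
  let e : N ≃ₗ[R] N := LinearEquiv.ofBijective (LinearMap.lsmul R N u) hN
  have h1 : x.comp (Ext.mk₀ (ModuleCat.ofHom e.toLinearMap)) (add_zero n) = 0 := by
    have h2 : (ModuleCat.ofHom e.toLinearMap : ModuleCat.of R N ⟶ ModuleCat.of R N)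
        = u • 𝟙 (ModuleCat.of R N) := by
      ext1; ext y; rfl
    have h3 : u • 𝟙 (ModuleCat.of R L) = 0 := by
      ext1; ext y; exact hL y
    rw [h2, Ext.mk₀_smul, Ext.comp_smul, Ext.comp_mk₀_id, ← Ext.mk₀_id_comp x, ← Ext.smul_comp,
      ← Ext.mk₀_smul, h3, Ext.mk₀_zero, Ext.zero_comp]
  have h4 : x = (x.comp (Ext.mk₀ (ModuleCat.ofHom e.toLinearMap)) (add_zero n)).comp
      (Ext.mk₀ (ModuleCat.ofHom e.symm.toLinearMap)) (add_zero n) := by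
    rw [Ext.comp_assoc_of_third_deg_zero, Ext.mk₀_comp_mk₀, ← ModuleCat.ofHom_comp]
    have : e.symm.toLinearMap.comp e.toLinearMap = LinearMap.id := by ext y; simp
    rw [this]
    exact (Ext.comp_mk₀_id x).symm
  rw [h4, h1, Ext.zero_comp]

/-- surjectivity of multiplication from vanishing, first variable -/
theorem EV.mul_surj₁ [IsNoetherianRing R] [IsLocalRing R] [Module.Finite R L] [Module.Finite R N]
    {x : R} (hx : x ∈ IsLocalRing.maximalIdeal R) (hf : Function.Injective fun y : L => x • y)
    {n : ℕ} (h : EV R (n+1) (L ⧸ LinearMap.range (LinearMap.lsmul R L x)) N) : EV R n L N := by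
  have hse : SE (LinearMap.lsmul R L x) (LinearMap.range (LinearMap.lsmul R L x)).mkQ :=
    SE.coker _ hf
  have hfin : Module.Finite R (Ext (ModuleCat.of R L) (ModuleCat.of R N) n) :=
    ModuleCat.finite_ext _ _ _ _
  rw [EV.iff] at h
  have key : (⊤ : Submodule R (Ext (ModuleCat.of R L) (ModuleCat.of R N) n)) ≤
      IsLocalRing.maximalIdeal R • ⊤ := by
    intro y _
    obtain ⟨z, hz⟩ := Ext.contravariant_sequence_exact₁ (scx_se hse) (ModuleCat.of R N)
      y (add_comm 1 n) (h _)
    have h2 : (scx _ _ hse).f = x • 𝟙 (ModuleCat.of R L) := by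
      ext1; ext y; rfl
    rw [h2] at hz
    have : y = x • z := by
      rw [← hz, Ext.mk₀_smul, Ext.smul_comp]
      congr 1
      exact (Ext.mk₀_id_comp z)
    rw [this]
    exact Submodule.smul_mem_smul hx trivial
  have := Submodule.eq_bot_of_le_smul_of_le_jacobson_bot (IsLocalRing.maximalIdeal R) ⊤
    (Module.Finite.fg_top) key (IsLocalRing.maximalIdeal_le_jacobson _)
  rw [EV.iff]
  intro y
  have : y ∈ (⊥ : Submodule R _) := this ▸ trivial
  simpa using this

theorem EV.mul_surj₂ [IsNoetherianRing R] [IsLocalRing R] [Module.Finite R L] [Module.Finite R N]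
    {x : R} (hx : x ∈ IsLocalRing.maximalIdeal R) (hf : Function.Injective fun y : N => x • y)
    {n : ℕ} (h : EV R n L (N ⧸ LinearMap.range (LinearMap.lsmul R N x))) : EV R n L N := by
  have hse : SE (LinearMap.lsmul R N x) (LinearMap.range (LinearMap.lsmul R N x)).mkQ :=
    SE.coker _ hf
  have hfin : Module.Finite R (Ext (ModuleCat.of R L) (ModuleCat.of R N) n) :=
    ModuleCat.finite_ext _ _ _ _
  rw [EV.iff] at h
  have key : (⊤ : Submodule R (Ext (ModuleCat.of R L) (ModuleCat.of R N) n)) ≤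
      IsLocalRing.maximalIdeal R • ⊤ := by
    intro y _
    obtain ⟨z, hz⟩ := Ext.covariant_sequence_exact₂ (ModuleCat.of R L) (scx_se hse)
      y (h _)
    have h2 : (scx _ _ hse).f = x • 𝟙 (ModuleCat.of R N) := by
      ext1; ext y; rfl
    rw [h2] at hz
    have : y = x • z := by
      rw [← hz, Ext.mk₀_smul, Ext.comp_smul]
      congr 1
      exact (Ext.comp_mk₀_id z)
    rw [this]
    exact Submodule.smul_mem_smul hx trivial
  have := Submodule.eq_bot_of_le_smul_of_le_jacobson_bot (IsLocalRing.maximalIdeal R) ⊤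
    (Module.Finite.fg_top) key (IsLocalRing.maximalIdeal_le_jacobson _)
  rw [EV.iff]
  intro y
  have : y ∈ (⊥ : Submodule R _) := this ▸ trivial
  simpa using this

end toolkit
end GGP

namespace GGP

section
variable {R : Type u} [CommRing R]
variable {A B C L N : Type u} [AddCommGroup A] [Module R A] [AddCommGroup B] [Module R B]
    [AddCommGroup C] [Module R C] [AddCommGroup L] [Module R L] [AddCommGroup N] [Module R N]

/-- free cover with kernel -/
theorem exists_free_cover (R : Type u) [CommRing R] (L : Type u) [AddCommGroup L] [Module R L] :
    ∃ (F L' : Type u) (_ : AddCommGroup F) (_ : Module R F) (_ : AddCommGroup L') (_ : Module R L')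
      (f : L' →ₗ[R] F) (g : F →ₗ[R] L), Module.Projective R F ∧ SE f g := by
  refine ⟨L →₀ R, LinearMap.ker (Finsupp.linearCombination R (id : L → L)), inferInstance,
    inferInstance, inferInstance, inferInstance, (LinearMap.ker _).subtype,
    Finsupp.linearCombination R (id : L → L), inferInstance, SE.ker _ ?_⟩
  exact Finsupp.linearCombination_id_surjective R L

theorem exists_fin_cover (R : Type u) [CommRing R] [IsNoetherianRing R]
    (L : Type u) [AddCommGroup L] [Module R L] [Module.Finite R L] :
    ∃ (F L' : Type u) (_ : AddCommGroup F) (_ : Module R F) (_ : AddCommGroup L') (_ : Module R L')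
      (f : L' →ₗ[R] F) (g : F →ₗ[R] L), Module.Projective R F ∧ Module.Finite R F ∧
      Module.Finite R L' ∧ SE f g := by
  obtain ⟨n, g, hg⟩ := Module.Finite.exists_fin' R L
  exact ⟨Fin n → R, LinearMap.ker g, inferInstance,
    inferInstance, inferInstance, inferInstance, (LinearMap.ker _).subtype, g,
    inferInstance, inferInstance, inferInstance, SE.ker _ hg⟩

theorem EV.shift_iff {f : A →ₗ[R] B} {g : B →ₗ[R] C} (h : SE f g) [Module.Projective R B]
    {n : ℕ} : EV R (n+2) C N ↔ EV R (n+1) A N :=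
  ⟨fun h1 => EV.left₁ h (EV.of_projective n) h1, fun h1 => EV.right₁ h h1 (EV.of_projective _)⟩

theorem EV.shift_inj_iff {f : A →ₗ[R] B} {g : B →ₗ[R] C} (h : SE f g) (hB : Module.Injective R B)
    {n : ℕ} : EV R (n+2) L A ↔ EV R (n+1) L C :=
  ⟨fun h1 => EV.right₂ h (EV.of_injective hB n) h1, fun h1 => EV.left₂ h h1 (EV.of_injective hB _)⟩

/-! ### finitely supported products -/

/-- finitely supported families -/
def finPi (R : Type u) [CommRing R] {ι : Type u} (N : ι → Type u) [∀ i, AddCommGroup (N i)]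
    [∀ i, Module R (N i)] : Submodule R (Π i, N i) where
  carrier := {f | {i | f i ≠ 0}.Finite}
  add_mem' := by
    intro f g hf hg
    refine (hf.union hg).subset ?_
    intro p hp
    by_contra h
    simp only [Set.mem_union, Set.mem_ofPred_eq, not_or, not_not] at h
    exact hp (by simp [Pi.add_apply, h.1, h.2])
  zero_mem' := by simp
  smul_mem' := by
    intro c f hf
    refine hf.subset ?_
    intro p hp
    by_contra h
    simp only [Set.mem_ofPred_eq, not_not] at h
    exact hp (by simp [Pi.smul_apply, h])

theorem finSupp_eq_finPi (S : Set (PrimeSpectrum R)) (N : Type u) [AddCommGroup N] [Module R N] :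
    GG.finSupp R S N = finPi R (fun p : S => LocalizedModule p.1.asIdeal.primeCompl N) := rfl

/-- extension into finitely supported families -/
theorem finPi_extend {ι : Type u} (N : ι → Type u) [∀ i, AddCommGroup (N i)]
    [∀ i, Module R (N i)] [Module.Finite R A] (f : A →ₗ[R] B)
    (h : ∀ i, ∀ φ : A →ₗ[R] N i, ∃ ψ : B →ₗ[R] N i, ψ.comp f = φ) (φ : A →ₗ[R] finPi R N) :
    Module.Finite R B → ∃ ψ : B →ₗ[R] finPi R N, ψ.comp f = φ := by
  intro hB
  classical
  have h' : ∀ i, ∃ ψ : B →ₗ[R] N i, ψ.comp f = ((LinearMap.proj i).comp (finPi R N).subtype).comp φ ∧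
      (((LinearMap.proj i).comp (finPi R N).subtype).comp φ = 0 → ψ = 0) := by
    intro i
    by_cases h0 : ((LinearMap.proj i).comp (finPi R N).subtype).comp φ = 0
    · exact ⟨0, by rw [h0]; simp, fun _ => rfl⟩
    · obtain ⟨ψ, hψ⟩ := h i (((LinearMap.proj i).comp (finPi R N).subtype).comp φ)
      exact ⟨ψ, hψ, fun h => (h0 h).elim⟩
  choose ψ hψ hψ0 using h'
  obtain ⟨s, hs⟩ := Module.Finite.fg_top (R := R) (M := A)
  have hfin : {i | ψ i ≠ 0}.Finite := by
    have : (⋃ a ∈ s, {i | (φ a).1 i ≠ 0}).Finite :=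
      s.finite_toSet.biUnion fun a _ => (φ a).2
    refine this.subset ?_
    intro i hi
    by_contra hcon
    apply hi
    apply hψ0
    apply LinearMap.ext_on_range (v := fun a : s => (a : A)) (by simpa using hs)
    intro a
    by_contra h1
    exact hcon (Set.mem_iUnion₂.2 ⟨a, a.2, h1⟩)
  refine ⟨LinearMap.codRestrict _ (LinearMap.pi ψ) ?_, ?_⟩
  · intro b
    refine hfin.subset ?_
    intro i hi h0
    apply hi
    simp only [LinearMap.pi_apply, h0, LinearMap.zero_apply]
  · apply LinearMap.ext
    intro a
    apply Subtype.ext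
    funext i
    exact LinearMap.congr_fun (hψ i) a

theorem EV.finPi [IsNoetherianRing R] {ι : Type u} (N : ι → Type u) [∀ i, AddCommGroup (N i)]
    [∀ i, Module R (N i)] {n : ℕ} [hL : Module.Finite R L] (h : ∀ i, EV R n L (N i)) :
    EV R n L (finPi R N) := by
  rcases n with _ | n
  · rw [EV.zero_iff]
    intro f
    apply LinearMap.ext
    intro x
    apply Subtype.ext
    funext i
    have := EV.zero_iff.1 (h i) (((LinearMap.proj i).comp (GGP.finPi R N).subtype).comp f)
    exact LinearMap.congr_fun this x
  · induction n generalizing L with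
    | zero =>
      obtain ⟨F, L', _, _, _, _, f, g, hF, hF1, hL1, hse⟩ := exists_fin_cover R L
      refine EV.one_of_extend hse (EV.of_projective 0) fun φ => ?_
      exact finPi_extend N f (fun i φ => EV.extend hse (h i) φ) φ hF1
    | succ n ih =>
      obtain ⟨F, L', _, _, _, _, f, g, hF, hF1, hL1, hse⟩ := exists_fin_cover R L
      rw [EV.shift_iff hse]
      exact ih fun i => (EV.shift_iff hse).1 (h i)

/-- Bass–Papp -/
theorem injective_finPi [IsNoetherianRing R] {ι : Type u} (N : ι → Type u)
    [∀ i, AddCommGroup (N i)] [∀ i, Module R (N i)] (h : ∀ i, Module.Injective R (N i)) :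
    Module.Injective R (finPi R N) :=
  injective_of_EV fun _ => EV.finPi N fun i => EV.of_injective (h i) 0

/-! ### localization -/

variable (S : Submonoid R)

/-- localized map -/
noncomputable abbrev lmap (f : A →ₗ[R] B) :
    LocalizedModule S A →ₗ[Localization S] LocalizedModule S B := LocalizedModule.map S f

theorem lmap_mk (f : A →ₗ[R] B) (x : A) :
    lmap S f (LocalizedModule.mkLinearMap S A x) = LocalizedModule.mkLinearMap S B (f x) := by
  simp [lmap, LocalizedModule.mkLinearMap_apply]

theorem SE.loc {f : A →ₗ[R] B} {g : B →ₗ[R] C} (h : SE f g) : SE (lmap S f) (lmap S g) :=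
  ⟨LocalizedModule.map_injective S f h.inj, LocalizedModule.map_exact S f g h.ex,
    LocalizedModule.map_surjective S g h.surj⟩

section base
variable {V : Type u} [AddCommGroup V] [Module R V] [Module (Localization S) V]
  [IsScalarTower R (Localization S) V]

theorem loc_smul_bij (s : S) : Function.Bijective fun x : V => (s : R) • x := by
  have hu : IsUnit (algebraMap R (Localization S) s) := IsLocalization.map_units _ s
  obtain ⟨v, hv⟩ := hu
  constructor
  · intro x y hxy
    simp only at hxy
    rw [← algebraMap_smul (Localization S) (s : R) x, ← algebraMap_smul (Localization S) (s : R) y,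
      ← hv] at hxy
    have := congrArg (fun z => (↑v⁻¹ : Localization S) • z) hxy
    simpa [smul_smul] using this
  · intro y
    refine ⟨(↑v⁻¹ : Localization S) • y, ?_⟩
    simp only
    rw [← algebraMap_smul (Localization S) (s : R), ← hv, smul_smul]
    simp

theorem loc_units (s : S) : IsUnit (algebraMap R (Module.End R V) s) :=
  (Module.End.isUnit_iff _).2 (loc_smul_bij S s)

theorem hom_loc_exists (φ : L →ₗ[R] V) : ∃ Φ : LocalizedModule S L →ₗ[Localization S] V,
    ∀ x, Φ (LocalizedModule.mkLinearMap S L x) = φ x := by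
  refine ⟨(LocalizedModule.lift S φ (loc_units S)).extendScalarsOfIsLocalization S _, fun x => ?_⟩
  have := LocalizedModule.lift_comp S φ (loc_units S)
  exact LinearMap.congr_fun this x

theorem hom_loc_ext (Φ Ψ : LocalizedModule S L →ₗ[Localization S] V)
    (h : ∀ x, Φ (LocalizedModule.mkLinearMap S L x) = Ψ (LocalizedModule.mkLinearMap S L x)) :
    Φ = Ψ := by
  have := IsLocalizedModule.ext S (LocalizedModule.mkLinearMap S L) (loc_units S (V := V))
    (j := Φ.restrictScalars R) (k := Ψ.restrictScalars R) (by ext x; exact h x)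
  ext x
  exact LinearMap.congr_fun this x

/-- restriction along the localization map -/
theorem hom_loc_restrict (Φ : LocalizedModule S L →ₗ[Localization S] V) (x : L) :
    ((Φ.restrictScalars R).comp (LocalizedModule.mkLinearMap S L)) x
      = Φ (LocalizedModule.mkLinearMap S L x) := rfl

theorem EV.loc_iff {n : ℕ} :
    EV R n L V ↔ EV (Localization S) n (LocalizedModule S L) V := by
  rcases n with _ | n
  · rw [EV.zero_iff, EV.zero_iff]
    constructor
    · intro h Φ
      apply hom_loc_ext S
      intro x
      rw [← hom_loc_restrict, h ((Φ.restrictScalars R).comp (LocalizedModule.mkLinearMap S L))]; simp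
    · intro h φ
      obtain ⟨Φ, hΦ⟩ := hom_loc_exists S φ
      ext x
      rw [← hΦ, h Φ]; simp
  · induction n generalizing L with
    | zero =>
      obtain ⟨F, L', _, _, _, _, f, g, hF, hse⟩ := exists_free_cover R L
      have hF' : Module.Projective (Localization S) (LocalizedModule S F) :=
        Module.projective_of_isLocalizedModule S (LocalizedModule.mkLinearMap S F)
      constructor
      · intro h
        refine EV.one_of_extend (hse.loc S) (EV.of_projective 0) fun φ => ?_
        obtain ⟨ψ, hψ⟩ := EV.extend hse h
          ((φ.restrictScalars R).comp (LocalizedModule.mkLinearMap S L'))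
        obtain ⟨Ψ, hΨ⟩ := hom_loc_exists S ψ
        refine ⟨Ψ, hom_loc_ext S _ _ fun x => ?_⟩
        rw [LinearMap.comp_apply, lmap_mk, hΨ]
        exact LinearMap.congr_fun hψ x
      · intro h
        refine EV.one_of_extend hse (EV.of_projective 0) fun φ => ?_
        obtain ⟨Φ, hΦ⟩ := hom_loc_exists S φ
        obtain ⟨Ψ, hΨ⟩ := EV.extend (hse.loc S) h Φ
        refine ⟨(Ψ.restrictScalars R).comp (LocalizedModule.mkLinearMap S F), ?_⟩
        ext x
        rw [← hΦ, ← hΨ]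
        change Ψ (LocalizedModule.mkLinearMap S F (f x)) = Ψ (lmap S f _)
        rw [lmap_mk]
    | succ n ih =>
      obtain ⟨F, L', _, _, _, _, f, g, hF, hse⟩ := exists_free_cover R L
      have hF' : Module.Projective (Localization S) (LocalizedModule S F) :=
        Module.projective_of_isLocalizedModule S (LocalizedModule.mkLinearMap S F)
      rw [EV.shift_iff hse, EV.shift_iff (hse.loc S)]
      exact ih
end base

theorem EV.localize [IsNoetherianRing R] [hL : Module.Finite R L] {n : ℕ} (h : EV R n L N) :
    EV R n L (LocalizedModule S N) := by
  rcases n with _ | n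
  · rw [EV.zero_iff] at *
    intro φ
    have : Module.FinitePresentation R L := Module.finitePresentation_of_finite R L
    obtain ⟨g, s, hs⟩ := Module.FinitePresentation.exists_lift_of_isLocalizedModule S
      (LocalizedModule.mkLinearMap S N) φ
    ext x
    apply (loc_smul_bij S s).1
    have := LinearMap.congr_fun hs x
    rw [h g] at this
    simpa [Submonoid.smul_def] using this.symm
  · induction n generalizing L with
    | zero =>
      obtain ⟨F, L', _, _, _, _, f, g, hF, hF1, hL1, hse⟩ := exists_fin_cover R L
      refine EV.one_of_extend hse (EV.of_projective 0) fun φ => ?_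
      have : Module.FinitePresentation R L' := Module.finitePresentation_of_finite R L'
      obtain ⟨g, s, hs⟩ := Module.FinitePresentation.exists_lift_of_isLocalizedModule S
        (LocalizedModule.mkLinearMap S N) φ
      obtain ⟨G, hG⟩ := EV.extend hse h g
      let e := LinearEquiv.ofBijective (LinearMap.lsmul R (LocalizedModule S N) s)
        (loc_smul_bij S s)
      refine ⟨e.symm.toLinearMap.comp ((LocalizedModule.mkLinearMap S N).comp G), ?_⟩
      ext x
      apply e.injective
      simp only [LinearMap.comp_apply, LinearEquiv.coe_coe, LinearEquiv.apply_symm_apply]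
      have h1 := LinearMap.congr_fun hs x
      have h2 := LinearMap.congr_fun hG x
      simp only [LinearMap.comp_apply] at h1 h2
      rw [h2, h1]
      rfl
    | succ n ih =>
      obtain ⟨F, L', _, _, _, _, f, g, hF, hF1, hL1, hse⟩ := exists_fin_cover R L
      rw [EV.shift_iff hse]
      exact ih ((EV.shift_iff hse).1 h)

theorem EV.of_local [IsNoetherianRing R] [hL : Module.Finite R L] {n : ℕ}
    (h : ∀ p : PrimeSpectrum R, EV R n L (LocalizedModule p.asIdeal.primeCompl N)) :
    EV R n L N := by
  rcases n with _ | n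
  · rw [EV.zero_iff]
    intro f
    ext x
    by_contra h0
    obtain ⟨m, hm, hle⟩ := Ideal.exists_le_maximal (Ideal.torsionOf R N (f x))
      (by rw [Ideal.ne_top_iff_one]; intro h1; apply h0; simpa using h1)
    have := EV.zero_iff.1 (h ⟨m, hm.isPrime⟩) ((LocalizedModule.mkLinearMap _ N).comp f)
    have h2 := LinearMap.congr_fun this x
    simp only [LinearMap.comp_apply, LinearMap.zero_apply] at h2
    obtain ⟨c, hc⟩ := (IsLocalizedModule.eq_zero_iff m.primeCompl _).1 h2
    exact c.2 (hle hc)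
  · induction n generalizing L with
    | zero =>
      obtain ⟨F, L', _, _, _, _, f, g, hF, hF1, hL1, hse⟩ := exists_fin_cover R L
      refine EV.one_of_extend hse (EV.of_projective 0) fun φ => ?_
      let I : Ideal R :=
        Submodule.comap (LinearMap.toSpanSingleton R _ φ) (LinearMap.range (LinearMap.lcomp R N f))
      have hI : I = ⊤ := by
        by_contra hne
        obtain ⟨m, hm, hle⟩ := Ideal.exists_le_maximal I hne
        obtain ⟨ψ, hψ⟩ := EV.extend hse (h ⟨m, hm.isPrime⟩) ((LocalizedModule.mkLinearMap _ N).comp φ)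
        have : Module.FinitePresentation R F := Module.finitePresentation_of_finite R F
        obtain ⟨g, s, hs⟩ := Module.FinitePresentation.exists_lift_of_isLocalizedModule m.primeCompl
          (LocalizedModule.mkLinearMap m.primeCompl N) ψ
        have : (LocalizedModule.mkLinearMap m.primeCompl N).comp (g.comp f) =
            (LocalizedModule.mkLinearMap m.primeCompl N).comp ((s : R) • φ) := by
          ext x
          have h1 := LinearMap.congr_fun hs (f x)
          have h2 := LinearMap.congr_fun hψ x
          simp only [LinearMap.comp_apply, LinearMap.smul_apply, map_smul] at h1 h2 ⊢
          rw [h1]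
          rw [← h2]
          rfl
        obtain ⟨t, ht⟩ := Module.Finite.exists_smul_of_comp_eq_of_isLocalizedModule m.primeCompl
          (LocalizedModule.mkLinearMap m.primeCompl N) _ _ this
        have hmem : (t : R) * (s : R) ∈ I := by
          refine ⟨(t : R) • g, ?_⟩
          ext x
          have h1 := LinearMap.congr_fun ht x
          simp only [LinearMap.smul_apply, LinearMap.comp_apply, Submonoid.smul_def] at h1
          simp [h1, mul_smul]
        exact (m.primeCompl.mul_mem t.2 s.2) (hle hmem)
      have h1 : (1 : R) ∈ I := hI ▸ trivial
      obtain ⟨ψ, hψ⟩ := h1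
      exact ⟨ψ, by simpa [LinearMap.lcomp_apply'] using hψ⟩
    | succ n ih =>
      obtain ⟨F, L', _, _, _, _, f, g, hF, hF1, hL1, hse⟩ := exists_fin_cover R L
      rw [EV.shift_iff hse]
      exact ih fun p => (EV.shift_iff hse).1 (h p)

end
end GGP

namespace GGP

section diag
variable {R : Type u} [CommRing R]
variable {A B C L N A1 C1 A2 B2 C2 : Type u} [AddCommGroup A] [Module R A] [AddCommGroup B]
    [Module R B]
    [AddCommGroup C] [Module R C] [AddCommGroup L] [Module R L] [AddCommGroup N] [Module R N]
    [AddCommGroup A1] [Module R A1] [AddCommGroup C1] [Module R C1]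
    [AddCommGroup A2] [Module R A2] [AddCommGroup B2] [Module R B2] [AddCommGroup C2] [Module R C2]

theorem exists_desc {g : B →ₗ[R] C} (hg : Function.Surjective g) (φ : B →ₗ[R] N)
    (h : ∀ x, g x = 0 → φ x = 0) : ∃ ψ : C →ₗ[R] N, ∀ x, ψ (g x) = φ x := by
  have hk : LinearMap.ker g ≤ LinearMap.ker φ := fun x hx => h x hx
  refine ⟨(Submodule.liftQ _ φ hk).comp (g.quotKerEquivOfSurjective hg).symm.toLinearMap, ?_⟩
  intro x
  have : (g.quotKerEquivOfSurjective hg).symm (g x) = Submodule.Quotient.mk x := by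
    rw [LinearEquiv.symm_apply_eq]; rfl
  simp only [LinearMap.comp_apply, LinearEquiv.coe_coe, this]
  rfl

theorem exists_factor {f : A →ₗ[R] B} (hf : Function.Injective f) (φ : L →ₗ[R] B)
    (h : ∀ x, ∃ y, f y = φ x) : ∃ ψ : L →ₗ[R] A, ∀ x, f (ψ x) = φ x := by
  refine ⟨(LinearEquiv.ofInjective f hf).symm.toLinearMap.comp
    (LinearMap.codRestrict (LinearMap.range f) φ h), fun x => ?_⟩
  have := (LinearEquiv.ofInjective f hf).apply_symm_apply ⟨φ x, h x⟩
  exact congrArg Subtype.val this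

theorem SE.comp_apply {f : A →ₗ[R] B} {g : B →ₗ[R] C} (h : SE f g) (x : A) : g (f x) = 0 :=
  (h.ex _).2 ⟨x, rfl⟩

theorem SE.lift_elem {f : A →ₗ[R] B} {g : B →ₗ[R] C} (h : SE f g) {x : B} (hx : g x = 0) :
    ∃ y, f y = x := (h.ex x).1 hx

theorem SE.equiv_ker {f : A →ₗ[R] B} {g : B →ₗ[R] C} (h : SE f g) :
    Nonempty (A ≃ₗ[R] LinearMap.ker g) := by
  have e := LinearEquiv.ofInjective f h.inj
  have : LinearMap.range f = LinearMap.ker g := by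
    ext x; exact (h.ex x).symm
  exact ⟨e.trans (LinearEquiv.ofEq _ _ this)⟩

/-- cokernels of the same injective map are isomorphic -/
theorem SE.coker_unique {f : A →ₗ[R] B} {g : B →ₗ[R] C} (h : SE f g) {g' : B →ₗ[R] L}
    (h' : SE f g') : Nonempty (C ≃ₗ[R] L) := by
  obtain ⟨φ, hφ⟩ := exists_desc h.surj g' (fun x hx => by
    obtain ⟨y, rfl⟩ := h.lift_elem hx; exact h'.comp_apply y)
  obtain ⟨ψ, hψ⟩ := exists_desc h'.surj g (fun x hx => by
    obtain ⟨y, rfl⟩ := h'.lift_elem hx; exact h.comp_apply y)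
  refine ⟨LinearEquiv.ofLinearMap φ ψ ?_ ?_⟩
  · apply LinearMap.ext; intro x; obtain ⟨y, rfl⟩ := h'.surj x; simp [hφ, hψ]
  · apply LinearMap.ext; intro x; obtain ⟨y, rfl⟩ := h.surj x; simp [hφ, hψ]

/-- pushout -/
theorem pushout_exists {f : A →ₗ[R] B} {f' : B →ₗ[R] B2} (hf : SE f f') {g : A →ₗ[R] C}
    {g' : C →ₗ[R] C2} (hg : SE g g') :
    ∃ (P : Type u) (_ : AddCommGroup P) (_ : Module R P) (i : B →ₗ[R] P) (j : C →ₗ[R] P)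
      (p : P →ₗ[R] C2) (q : P →ₗ[R] B2), SE i p ∧ SE j q := by
  let k : A →ₗ[R] B × C := f.prod (-g)
  have hk : ∀ x, k x = (f x, -g x) := fun x => rfl
  obtain ⟨p, hp⟩ := exists_desc (LinearMap.range k).mkQ_surjective
    (g'.comp (LinearMap.snd R B C)) (by
      intro x hx
      simp only [Submodule.mkQ_apply, Submodule.Quotient.mk_eq_zero] at hx
      obtain ⟨a, rfl⟩ := hx
      simp [hk, hg.comp_apply])
  obtain ⟨q, hq⟩ := exists_desc (LinearMap.range k).mkQ_surjective
    (f'.comp (LinearMap.fst R B C)) (by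
      intro x hx
      simp only [Submodule.mkQ_apply, Submodule.Quotient.mk_eq_zero] at hx
      obtain ⟨a, rfl⟩ := hx
      simp [hk, hf.comp_apply])
  refine ⟨(B × C) ⧸ LinearMap.range k, inferInstance, inferInstance,
    (LinearMap.range k).mkQ.comp (LinearMap.inl R B C),
    (LinearMap.range k).mkQ.comp (LinearMap.inr R B C), p, q, ⟨?_, ?_, ?_⟩, ⟨?_, ?_, ?_⟩⟩
  · rw [injective_iff_map_eq_zero]
    intro b hb
    simp only [LinearMap.comp_apply, Submodule.mkQ_apply, Submodule.Quotient.mk_eq_zero] at hb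
    obtain ⟨a, ha⟩ := hb
    rw [hk] at ha
    simp only [LinearMap.inl_apply, Prod.mk.injEq, neg_eq_zero] at ha
    rw [← ha.1, hg.inj (ha.2.trans (map_zero g).symm), map_zero]
  · intro y
    obtain ⟨⟨b, c⟩, rfl⟩ := (LinearMap.range k).mkQ_surjective y
    rw [hp]
    constructor
    · intro h
      obtain ⟨a, ha⟩ := hg.lift_elem (show g' c = 0 from h)
      refine ⟨b + f a, ?_⟩
      simp only [LinearMap.comp_apply]
      rw [← sub_eq_zero, ← map_sub]
      simp only [Submodule.mkQ_apply, Submodule.Quotient.mk_eq_zero]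
      exact ⟨a, by rw [hk]; simp [ha]⟩
    · rintro ⟨b', hb'⟩
      rw [← hp, ← hb']
      simp only [LinearMap.comp_apply]
      rw [hp]; simp
  · intro y; obtain ⟨c, rfl⟩ := hg.surj y
    exact ⟨_, hp (0, c)⟩
  · rw [injective_iff_map_eq_zero]
    intro b hb
    simp only [LinearMap.comp_apply, Submodule.mkQ_apply, Submodule.Quotient.mk_eq_zero] at hb
    obtain ⟨a, ha⟩ := hb
    rw [hk] at ha
    simp only [LinearMap.inr_apply, Prod.mk.injEq] at ha
    rw [← ha.2, hf.inj (ha.1.trans (map_zero f).symm), map_zero, neg_zero]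
  · intro y
    obtain ⟨⟨b, c⟩, rfl⟩ := (LinearMap.range k).mkQ_surjective y
    rw [hq]
    constructor
    · intro h
      obtain ⟨a, ha⟩ := hf.lift_elem (show f' b = 0 from h)
      refine ⟨c + g a, ?_⟩
      simp only [LinearMap.comp_apply]
      rw [← sub_eq_zero, ← map_sub]
      simp only [Submodule.mkQ_apply, Submodule.Quotient.mk_eq_zero]
      exact ⟨-a, by rw [hk]; simp [ha]⟩
    · rintro ⟨b', hb'⟩
      rw [← hq, ← hb']
      simp only [LinearMap.comp_apply]
      rw [hq]; simp
  · intro y; obtain ⟨c, rfl⟩ := hf.surj y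
    exact ⟨_, hq (c, 0)⟩

/-- pullback -/
theorem pullback_exists {f' : A2 →ₗ[R] B} {f : B →ₗ[R] N} (hf : SE f' f) {g' : C2 →ₗ[R] C}
    {g : C →ₗ[R] N} (hg : SE g' g) :
    ∃ (P : Type u) (_ : AddCommGroup P) (_ : Module R P) (p : P →ₗ[R] B) (q : P →ₗ[R] C)
      (i : C2 →ₗ[R] P) (j : A2 →ₗ[R] P), SE i p ∧ SE j q := by
  let k : B × C →ₗ[R] N := f.comp (LinearMap.fst R B C) - g.comp (LinearMap.snd R B C)
  have hk : ∀ b c, k (b, c) = f b - g c := fun b c => rfl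
  refine ⟨LinearMap.ker k, inferInstance, inferInstance,
    (LinearMap.fst R B C).comp (LinearMap.ker k).subtype,
    (LinearMap.snd R B C).comp (LinearMap.ker k).subtype,
    LinearMap.codRestrict _ ((LinearMap.inr R B C).comp g') (fun x => by
      simp [LinearMap.mem_ker, hk, hg.comp_apply]),
    LinearMap.codRestrict _ ((LinearMap.inl R B C).comp f') (fun x => by
      simp [LinearMap.mem_ker, hk, hf.comp_apply]), ⟨?_, ?_, ?_⟩, ⟨?_, ?_, ?_⟩⟩
  · intro x y hxy
    exact hg.inj (congrArg (fun z => z.1.2) hxy : g' x = g' y)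
  · rintro ⟨⟨b, c⟩, h⟩
    rw [LinearMap.mem_ker, hk, sub_eq_zero] at h
    constructor
    · intro hb
      change b = 0 at hb
      subst hb
      rw [map_zero] at h
      obtain ⟨y, rfl⟩ := hg.lift_elem h.symm
      exact ⟨y, rfl⟩
    · rintro ⟨y, hy⟩
      rw [← hy]; rfl
  · intro b
    obtain ⟨c, hc⟩ := hg.surj (f b)
    exact ⟨⟨(b, c), by rw [LinearMap.mem_ker, hk, hc, sub_self]⟩, rfl⟩
  · intro x y hxy
    exact hf.inj (congrArg (fun z => z.1.1) hxy : f' x = f' y)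
  · rintro ⟨⟨b, c⟩, h⟩
    rw [LinearMap.mem_ker, hk, sub_eq_zero] at h
    constructor
    · intro hb
      change c = 0 at hb
      subst hb
      rw [map_zero] at h
      obtain ⟨y, rfl⟩ := hf.lift_elem h
      exact ⟨y, rfl⟩
    · rintro ⟨y, hy⟩
      rw [← hy]; rfl
  · intro b
    obtain ⟨c, hc⟩ := hf.surj (g b)
    exact ⟨⟨(c, b), by rw [LinearMap.mem_ker, hk, hc, sub_self]⟩, rfl⟩

/-- horseshoe for embeddings -/
theorem horseshoe_coker {f : A →ₗ[R] B} {g : B →ₗ[R] C} (h : SE f g)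
    {a : A →ₗ[R] A1} {a' : A1 →ₗ[R] A2} (ha : SE a a') (hA1 : Module.Injective R A1)
    {c : C →ₗ[R] C1} {c' : C1 →ₗ[R] C2} (hc : SE c c') :
    ∃ (P : Type u) (_ : AddCommGroup P) (_ : Module R P) (b : B →ₗ[R] A1 × C1)
      (b' : A1 × C1 →ₗ[R] P) (i : A2 →ₗ[R] P) (p : P →ₗ[R] C2), SE b b' ∧ SE i p := by
  obtain ⟨e, he⟩ := extend_of_injective hA1 h.inj a
  have he' : ∀ x, e (f x) = a x := fun x => LinearMap.congr_fun he x
  let b : B →ₗ[R] A1 × C1 := e.prod (c.comp g)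
  have hb : ∀ x, b x = (e x, c (g x)) := fun x => rfl
  have hbi : Function.Injective b := by
    rw [injective_iff_map_eq_zero]
    intro x hx
    rw [hb, Prod.mk_eq_zero] at hx
    obtain ⟨y, rfl⟩ := h.lift_elem (hc.inj (hx.2.trans (map_zero c).symm))
    rw [he'] at hx
    rw [ha.inj (hx.1.trans (map_zero a).symm), map_zero]
  have hse := SE.coker b hbi
  obtain ⟨i, hi⟩ := exists_desc ha.surj ((LinearMap.range b).mkQ.comp (LinearMap.inl R A1 C1)) (by
    intro x hx
    obtain ⟨y, rfl⟩ := ha.lift_elem hx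
    have : LinearMap.inl R A1 C1 (a y) = b (f y) := by
      rw [hb, he', h.comp_apply, map_zero]; rfl
    rw [LinearMap.comp_apply, this]; exact hse.comp_apply _)
  obtain ⟨p, hp⟩ := exists_desc hse.surj (c'.comp (LinearMap.snd R A1 C1)) (by
    intro x hx
    obtain ⟨y, rfl⟩ := hse.lift_elem hx
    rw [hb]; exact hc.comp_apply _)
  refine ⟨_, inferInstance, inferInstance, b, (LinearMap.range b).mkQ, i, p, hse, ?_, ?_, ?_⟩
  · rw [injective_iff_map_eq_zero]
    intro x hx
    obtain ⟨y, rfl⟩ := ha.surj x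
    rw [hi] at hx
    obtain ⟨z, hz⟩ := hse.lift_elem (show (LinearMap.range b).mkQ (y, 0) = 0 from hx)
    rw [hb, Prod.mk.injEq] at hz
    obtain ⟨w, rfl⟩ := h.lift_elem (hc.inj (hz.2.trans (map_zero c).symm))
    rw [he'] at hz
    rw [← hz.1, ha.comp_apply]
  · intro y
    obtain ⟨⟨y1, y2⟩, rfl⟩ := hse.surj y
    rw [hp]
    constructor
    · intro h0
      obtain ⟨z, rfl⟩ := hc.lift_elem (show c' y2 = 0 from h0)
      obtain ⟨w, rfl⟩ := h.surj z
      refine ⟨a' (y1 - e w), ?_⟩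
      rw [hi, LinearMap.comp_apply, ← sub_eq_zero, ← map_sub]
      have : LinearMap.inl R A1 C1 (y1 - e w) - (y1, c (g w)) = b (-w) := by
        rw [map_neg, hb]; simp
      rw [this]; exact hse.comp_apply _
    · rintro ⟨x, hx⟩
      obtain ⟨x', rfl⟩ := ha.surj x
      rw [← hp, ← hx, hi, LinearMap.comp_apply, hp]; simp
  · intro y
    obtain ⟨y', rfl⟩ := hc.surj y
    exact ⟨_, hp (0, y')⟩

/-- horseshoe for covers -/
theorem horseshoe_ker {f : A →ₗ[R] B} {g : B →ₗ[R] C} (h : SE f g)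
    {a' : A2 →ₗ[R] A1} {a : A1 →ₗ[R] A} (ha : SE a' a)
    {c' : C2 →ₗ[R] C1} {c : C1 →ₗ[R] C} (hc : SE c' c) (hl : ∃ e : C1 →ₗ[R] B, g.comp e = c) :
    ∃ (P : Type u) (_ : AddCommGroup P) (_ : Module R P) (b' : P →ₗ[R] A1 × C1)
      (b : A1 × C1 →ₗ[R] B) (i : A2 →ₗ[R] P) (p : P →ₗ[R] C2), SE b' b ∧ SE i p := by
  obtain ⟨e, he⟩ := hl
  have he' : ∀ x, g (e x) = c x := fun x => LinearMap.congr_fun he x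
  let b : A1 × C1 →ₗ[R] B := (f.comp a).coprod e
  have hb : ∀ x y, b (x, y) = f (a x) + e y := fun x y => rfl
  have hbs : Function.Surjective b := by
    intro x
    obtain ⟨y, hy⟩ := hc.surj (g x)
    obtain ⟨z, hz⟩ := h.lift_elem (show g (x - e y) = 0 by rw [map_sub, he', hy, sub_self])
    obtain ⟨w, rfl⟩ := ha.surj z
    exact ⟨(w, y), by rw [hb, hz]; simp⟩
  have hse := SE.ker b hbs
  obtain ⟨i, hi⟩ := exists_factor hse.inj ((LinearMap.inl R A1 C1).comp a') (by
    intro x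
    apply hse.lift_elem
    rw [LinearMap.comp_apply, LinearMap.inl_apply, hb, ha.comp_apply]; simp)
  obtain ⟨p, hp⟩ := exists_factor hc.inj ((LinearMap.snd R A1 C1).comp (LinearMap.ker b).subtype) (by
    rintro ⟨⟨x, y⟩, hx⟩
    apply hc.lift_elem
    have := congrArg g (LinearMap.mem_ker.1 hx)
    rw [hb, map_add, h.comp_apply, he', map_zero, zero_add] at this
    exact this)
  refine ⟨_, inferInstance, inferInstance, (LinearMap.ker b).subtype, b, i, p, hse, ?_, ?_, ?_⟩
  · intro x y hxy
    have := congrArg (LinearMap.ker b).subtype hxy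
    rw [hi, hi] at this
    exact ha.inj (LinearMap.inl_injective this)
  · rintro ⟨⟨x, y⟩, hx⟩
    rw [← map_eq_zero_iff c' hc.inj, hp]
    constructor
    · intro hy
      change y = 0 at hy
      subst hy
      rw [LinearMap.mem_ker, hb, map_zero, add_zero] at hx
      obtain ⟨z, rfl⟩ := ha.lift_elem (h.inj (hx.trans (map_zero f).symm))
      exact ⟨z, hse.inj (hi z)⟩
    · rintro ⟨z, hz⟩
      rw [LinearMap.comp_apply, ← hz, hi]; rfl
  · intro y
    obtain ⟨z, hz⟩ := h.lift_elem (show g (e (c' y)) = 0 by rw [he', hc.comp_apply])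
    obtain ⟨w, rfl⟩ := ha.surj z
    refine ⟨⟨(-w, c' y), by rw [LinearMap.mem_ker, hb, map_neg, map_neg, hz]; simp⟩, hc.inj ?_⟩
    rw [hp]; rfl

/-- splitting on the left -/
theorem SE.split_left {f : A →ₗ[R] B} {g : B →ₗ[R] C} (h : SE f g)
    (hr : ∃ r : B →ₗ[R] A, r.comp f = LinearMap.id) : Nonempty (B ≃ₗ[R] A × C) := by
  obtain ⟨r, hr⟩ := hr
  have hr' : ∀ x, r (f x) = x := fun x => LinearMap.congr_fun hr x
  refine ⟨LinearEquiv.ofBijective (r.prod g) ⟨?_, ?_⟩⟩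
  · rw [injective_iff_map_eq_zero]
    intro x hx
    have h1 : r x = 0 := congrArg Prod.fst hx
    have h2 : g x = 0 := congrArg Prod.snd hx
    obtain ⟨y, rfl⟩ := h.lift_elem h2
    rw [hr'] at h1; rw [h1, map_zero]
  · rintro ⟨x, y⟩
    obtain ⟨z, rfl⟩ := h.surj y
    refine ⟨z + f (x - r z), ?_⟩
    simp [hr', h.comp_apply]

theorem SE.split_of_injective {f : A →ₗ[R] B} {g : B →ₗ[R] C} (h : SE f g)
    (hA : Module.Injective R A) : Nonempty (B ≃ₗ[R] A × C) :=
  h.split_left (extend_of_injective hA h.inj _)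

theorem SE.split_of_EV {f : A →ₗ[R] B} {g : B →ₗ[R] C} (h : SE f g)
    (hA : EV R 1 C A) : Nonempty (B ≃ₗ[R] A × C) :=
  h.split_left (EV.extend h hA _)

theorem injective_prod (h1 : Module.Injective R A) (h2 : Module.Injective R B) :
    Module.Injective R (A × B) :=
  injective_of_EV fun _ => EV.prod_right (EV.of_injective h1 0) (EV.of_injective h2 0)

/-- composition of an inclusion into the middle of a SES: quotient sequence. -/
theorem SE.third {f : A →ₗ[R] B} {g : B →ₗ[R] C} (h : SE f g) {a : B →ₗ[R] L} {a' : L →ₗ[R] N}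
    (ha : SE a a') : ∃ (Q : Type u) (_ : AddCommGroup Q) (_ : Module R Q) (k : L →ₗ[R] Q)
      (i : C →ₗ[R] Q) (p : Q →ₗ[R] N), SE (a.comp f) k ∧ SE i p := by
  have hse := SE.coker (a.comp f) (ha.inj.comp h.inj)
  obtain ⟨i, hi⟩ := exists_desc h.surj ((LinearMap.range (a.comp f)).mkQ.comp a) (by
    intro x hx
    obtain ⟨y, rfl⟩ := h.lift_elem hx
    exact hse.comp_apply y)
  obtain ⟨p, hp⟩ := exists_desc hse.surj a' (by
    intro x hx
    obtain ⟨y, rfl⟩ := hse.lift_elem hx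
    exact ha.comp_apply _)
  refine ⟨_, inferInstance, inferInstance, _, i, p, hse, ?_, ?_, ?_⟩
  · rw [injective_iff_map_eq_zero]
    intro x hx
    obtain ⟨y, rfl⟩ := h.surj x
    rw [hi] at hx
    obtain ⟨z, hz⟩ := hse.lift_elem (show (LinearMap.range (a.comp f)).mkQ (a y) = 0 from hx)
    rw [← ha.inj hz, h.comp_apply]
  · intro y
    obtain ⟨x, rfl⟩ := hse.surj y
    rw [hp]
    constructor
    · intro hx
      obtain ⟨z, rfl⟩ := ha.lift_elem hx
      exact ⟨g z, hi z⟩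
    · rintro ⟨z, hz⟩
      obtain ⟨w, rfl⟩ := h.surj z
      rw [← hp, ← hz, hi, LinearMap.comp_apply, hp, ha.comp_apply]
  · intro y; obtain ⟨x, rfl⟩ := ha.surj y; exact ⟨_, hp x⟩

/-- dual of `third`: kernel of a composite. -/
theorem SE.third' {f : A →ₗ[R] B} {g : B →ₗ[R] C} (h : SE f g) {a' : L →ₗ[R] N} {a : N →ₗ[R] B}
    (ha : SE a' a) : ∃ (K : Type u) (_ : AddCommGroup K) (_ : Module R K) (k : K →ₗ[R] N)
      (i : L →ₗ[R] K) (p : K →ₗ[R] A), SE k (g.comp a) ∧ SE i p := by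
  have hse := SE.ker (g.comp a) (h.surj.comp ha.surj)
  obtain ⟨i, hi⟩ := exists_factor hse.inj a' (by
    intro x; apply hse.lift_elem; rw [LinearMap.comp_apply, ha.comp_apply, map_zero])
  obtain ⟨p, hp⟩ := exists_factor h.inj (a.comp (LinearMap.ker (g.comp a)).subtype) (by
    intro x; apply h.lift_elem; exact x.2)
  refine ⟨_, inferInstance, inferInstance, _, i, p, hse, ?_, ?_, ?_⟩
  · intro x y hxy
    have := congrArg (LinearMap.ker (g.comp a)).subtype hxy
    rw [hi, hi] at this; exact ha.inj this
  · intro x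
    rw [← map_eq_zero_iff f h.inj, hp]
    constructor
    · intro hx
      obtain ⟨z, hz⟩ := ha.lift_elem (show a x.1 = 0 from hx)
      exact ⟨z, hse.inj ((hi z).trans hz)⟩
    · rintro ⟨z, rfl⟩
      rw [LinearMap.comp_apply, hi, ha.comp_apply]
  · intro y
    obtain ⟨x, hx⟩ := ha.surj (f y)
    refine ⟨⟨x, by rw [LinearMap.mem_ker, LinearMap.comp_apply, hx, h.comp_apply]⟩, h.inj ?_⟩
    rw [hp]; exact hx

end diag
end GGP

namespace GGP
section
variable {R : Type u} [CommRing R]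
variable {A B C L N X A1 C1 A2 B2 C2 : Type u} [AddCommGroup A] [Module R A] [AddCommGroup B]
    [Module R B]
    [AddCommGroup C] [Module R C] [AddCommGroup L] [Module R L] [AddCommGroup N] [Module R N]
    [AddCommGroup X] [Module R X]

/-- coinductive closure conditions -/
structure GIClass (C : ModuleCat.{u} R → Prop) : Prop where
  ev : ∀ N, C N → ∀ (I : Type u) [AddCommGroup I] [Module R I], Module.Injective R I → EV R 1 I N
  prv : ∀ N, C N → ∃ (N' X : ModuleCat.{u} R) (f : N' →ₗ[R] X) (g : X →ₗ[R] N),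
    Module.Injective R X ∧ C N' ∧ SE f g
  nxt : ∀ N, C N → ∃ (X N' : ModuleCat.{u} R) (f : N →ₗ[R] X) (g : X →ₗ[R] N'),
    Module.Injective R X ∧ C N' ∧ SE f g

/-- Gorenstein injective, coinductive version -/
def GI (R : Type u) [CommRing R] (N : Type u) [AddCommGroup N] [Module R N] : Prop :=
  ∃ C : ModuleCat.{u} R → Prop, GIClass C ∧ C (ModuleCat.of R N)

theorem GI.ev (h : GI R N) {I : Type u} [AddCommGroup I] [Module R I] (hI : Module.Injective R I) :
    EV R 1 I N := by
  obtain ⟨C, hC, hN⟩ := h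
  exact hC.ev _ hN I hI

theorem GI.prv (h : GI R N) : ∃ (N' X : ModuleCat.{u} R) (f : N' →ₗ[R] X) (g : X →ₗ[R] N),
    Module.Injective R X ∧ GI R N' ∧ SE f g := by
  obtain ⟨C, hC, hN⟩ := h
  obtain ⟨N', X, f, g, h1, h2, h3⟩ := hC.prv _ hN
  exact ⟨N', X, f, g, h1, ⟨C, hC, h2⟩, h3⟩

theorem GI.nxt (h : GI R N) : ∃ (X N' : ModuleCat.{u} R) (f : N →ₗ[R] X) (g : X →ₗ[R] N'),
    Module.Injective R X ∧ GI R N' ∧ SE f g := by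
  obtain ⟨C, hC, hN⟩ := h
  obtain ⟨N', X, f, g, h1, h2, h3⟩ := hC.nxt _ hN
  exact ⟨N', X, f, g, h1, ⟨C, hC, h2⟩, h3⟩

theorem GI.mk (h1 : ∀ (I : Type u) [AddCommGroup I] [Module R I], Module.Injective R I → EV R 1 I N)
    {N' X' X N'' : Type u} [AddCommGroup N'] [Module R N'] [AddCommGroup X'] [Module R X']
    [AddCommGroup X] [Module R X] [AddCommGroup N''] [Module R N'']
    {f : N' →ₗ[R] X'} {g : X' →ₗ[R] N} (h2 : SE f g) (hX' : Module.Injective R X') (hN' : GI R N')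
    {f' : N →ₗ[R] X} {g' : X →ₗ[R] N''} (h3 : SE f' g') (hX : Module.Injective R X)
    (hN'' : GI R N'') : GI R N := by
  refine ⟨fun P => GI R P ∨ P = ModuleCat.of R N, ⟨?_, ?_, ?_⟩, Or.inr rfl⟩
  · rintro P (h | rfl) I _ _ hI
    · exact h.ev hI
    · exact h1 I hI
  · rintro P (h | rfl)
    · obtain ⟨N', X, f, g, h1, h2, h3⟩ := h.prv
      exact ⟨N', X, f, g, h1, Or.inl h2, h3⟩
    · exact ⟨ModuleCat.of R N', ModuleCat.of R X', f, g, hX', Or.inl hN', h2⟩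
  · rintro P (h | rfl)
    · obtain ⟨N', X, f, g, h1, h2, h3⟩ := h.nxt
      exact ⟨N', X, f, g, h1, Or.inl h2, h3⟩
    · exact ⟨ModuleCat.of R X, ModuleCat.of R N'', f', g', hX, Or.inl hN'', h3⟩

theorem injective_subsingleton [Subsingleton N] : Module.Injective R N :=
  injective_of_EV fun _ => EV.of_subsingleton_right _

theorem SE.id_zero [Subsingleton C] : SE (LinearMap.id : A →ₗ[R] A) (0 : A →ₗ[R] C) :=
  SE.of_equiv (LinearEquiv.refl R A) inferInstance

theorem SE.zero_equiv [Subsingleton C] (e : A ≃ₗ[R] B) : SE (0 : C →ₗ[R] A) e.toLinearMap :=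
  ⟨fun x y _ => Subsingleton.elim _ _, fun x => ⟨fun h => ⟨0, by
    rw [LinearMap.zero_apply]; exact (e.map_eq_zero_iff.1 h).symm⟩, by
    rintro ⟨y, rfl⟩; simp⟩, e.surjective⟩

theorem GI.of_injective (h : Module.Injective R N) : GI R N := by
  refine ⟨fun P => Module.Injective R P, ⟨?_, ?_, ?_⟩, h⟩
  · intro P h I _ _ hI
    exact EV.of_injective h 0
  · intro P h
    exact ⟨ModuleCat.of R PUnit, P, 0, LinearMap.id, h, injective_subsingleton,
      SE.zero_equiv (LinearEquiv.refl R P)⟩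
  · intro P h
    exact ⟨P, ModuleCat.of R PUnit, LinearMap.id, 0, h, injective_subsingleton, SE.id_zero⟩

theorem GI.of_subsingleton [Subsingleton N] : GI R N := GI.of_injective injective_subsingleton

theorem GI.ext {f : A →ₗ[R] B} {g : B →ₗ[R] C} (h : SE f g) (hA : GI R A) (hC : GI R C) :
    GI R B := by
  refine ⟨fun P => ∃ (A C : ModuleCat.{u} R) (f : A →ₗ[R] P) (g : P →ₗ[R] C), GI R A ∧ GI R C ∧
    SE f g, ⟨?_, ?_, ?_⟩, ⟨ModuleCat.of R A, ModuleCat.of R C, f, g, hA, hC, h⟩⟩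
  · rintro P ⟨A, C, f, g, hA, hC, h⟩ I _ _ hI
    exact EV.mid₂ h (hA.ev hI) (hC.ev hI)
  · rintro P ⟨A, C, f, g, hA, hC, h⟩
    obtain ⟨A', X, a, a', hX, hA', ha⟩ := hA.prv
    obtain ⟨C', Y, c, c', hY, hC', hc⟩ := hC.prv
    obtain ⟨Q, _, _, b', b, i, p, h1, h2⟩ := horseshoe_ker h ha hc
      (EV.lift h (hA.ev hY) c')
    exact ⟨ModuleCat.of R Q, ModuleCat.of R (X × Y), b', b, injective_prod hX hY,
      ⟨A', C', i, p, hA', hC', h2⟩, h1⟩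
  · rintro P ⟨A, C, f, g, hA, hC, h⟩
    obtain ⟨X, A', a, a', hX, hA', ha⟩ := hA.nxt
    obtain ⟨Y, C', c, c', hY, hC', hc⟩ := hC.nxt
    obtain ⟨Q, _, _, b', b, i, p, h1, h2⟩ := horseshoe_coker h ha hX hc
    exact ⟨ModuleCat.of R (X × Y), ModuleCat.of R Q, b', b, injective_prod hX hY,
      ⟨A', C', i, p, hA', hC', h2⟩, h1⟩

theorem GI.congr (e : A ≃ₗ[R] B) (h : GI R A) : GI R B :=
  GI.ext (SE.of_equiv e (C := PUnit) inferInstance) h GI.of_subsingleton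

theorem GI.prod (hA : GI R A) (hB : GI R B) : GI R (A × B) := GI.ext SE.inl_snd hA hB

theorem SE.inr_fst : SE (LinearMap.inr R A B) (LinearMap.fst R A B) :=
  ⟨LinearMap.inr_injective, Function.Exact.inr_fst, LinearMap.fst_surjective⟩

theorem GI.of_prod_injective (h : GI R (N × X)) (hX : Module.Injective R X) : GI R N := by
  obtain ⟨X1, N1, f, g, hX1, hN1, h1⟩ := h.nxt
  obtain ⟨N2, X2, f', g', hX2, hN2, h2⟩ := h.prv
  obtain ⟨Q, _, _, k, i, p, h3, h4⟩ := (SE.inl_snd (R := R) (A := N) (B := X)).third h1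
  obtain ⟨K, _, _, k', i', p', h5, h6⟩ := (SE.inr_fst (R := R) (A := N) (B := X)).third' h2
  exact GI.mk (fun I _ _ hI => EV.right₂ (SE.inr_fst (R := R) (A := N) (B := X)) (h.ev hI)
      (EV.of_injective hX _)) h5 hX2 (GI.ext h6 hN2 (GI.of_injective hX)) h3 hX1
      (GI.ext h4 (GI.of_injective hX) hN1)

theorem GI.coker {f : A →ₗ[R] B} {g : B →ₗ[R] C} (h : SE f g) (hA : GI R A) (hB : GI R B) :
    GI R C := by
  obtain ⟨X, A', a, a', hX, hA', ha⟩ := hA.nxt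
  obtain ⟨P, _, _, i, j, p, q, h1, h2⟩ := pushout_exists h ha
  obtain ⟨e⟩ := h2.split_of_injective hX
  exact GI.of_prod_injective (((GI.ext h1 hB hA').congr e).congr (LinearEquiv.prodComm R X C)) hX

theorem GI.kernel {f : A →ₗ[R] B} {g : B →ₗ[R] C} (h : SE f g) (hB : Module.Injective R B)
    (hC : GI R C) (hev : ∀ (I : Type u) [AddCommGroup I] [Module R I], Module.Injective R I →
      EV R 1 I A) : GI R A := by
  obtain ⟨N', X, a, a', hX, hN', ha⟩ := hC.prv
  obtain ⟨P, _, _, p, q, i, j, h1, h2⟩ := pullback_exists h ha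
  obtain ⟨e⟩ := h2.split_of_EV (hev X hX)
  exact GI.of_prod_injective ((GI.ext h1 hN' (GI.of_injective hB)).congr e) hX

theorem GI.ev' (n : ℕ) : ∀ {N : Type u} [AddCommGroup N] [Module R N] (_ : GI R N) {I : Type u}
    [AddCommGroup I] [Module R I] (_ : Module.Injective R I), EV R (n+1) I N := by
  induction n with
  | zero => intro N _ _ h I _ _ hI; exact h.ev hI
  | succ n ih =>
    intro N _ _ h I _ _ hI
    obtain ⟨X, N', f, g, hX, hN', hs⟩ := h.nxt
    exact (EV.shift_inj_iff hs hX).2 (ih hN' hI)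

/-- modules of finite projective dimension -/
theorem GI.ev_pd {j : ℕ} (hL : ∀ (N : Type u) [AddCommGroup N] [Module R N], ∀ i, j ≤ i → EV R i L N)
    (n : ℕ) (h : GI R N) : EV R (n+1) L N := by
  have key : ∀ k n, j ≤ n + 1 + k → ∀ (N : Type u) [AddCommGroup N] [Module R N] (_ : GI R N),
      EV R (n+1) L N := by
    intro k
    induction k with
    | zero => intro n hn N _ _ _; exact hL N _ (by omega)
    | succ k ih =>
      intro n hn N _ _ h
      obtain ⟨N', X, f, g, hX, hN', hs⟩ := h.prv
      exact (EV.shift_inj_iff hs hX).1 (ih (n+1) (by omega) N' hN')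
  exact key j n (by omega) N h

/-- Gorenstein injective dimension at most n, recursive version -/
def GD (R : Type u) [CommRing R] : ℕ → ModuleCat.{u} R → Prop
  | 0, M => GI R M
  | n+1, M => ∃ (Y M' : ModuleCat.{u} R) (f : M →ₗ[R] Y) (g : Y →ₗ[R] M'), SE f g ∧ GI R Y ∧
      GD R n M'

theorem GD.H1 : ∀ (k : ℕ) {Y P M : Type u} [AddCommGroup Y] [Module R Y] [AddCommGroup P]
    [Module R P] [AddCommGroup M] [Module R M] {f : Y →ₗ[R] P} {g : P →ₗ[R] M} (_ : SE f g)
    (_ : GI R Y) (_ : GD R k (ModuleCat.of R M)), GD R k (ModuleCat.of R P) := by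
  intro k
  induction k with
  | zero => intro Y P M _ _ _ _ _ _ f g h hY hM; exact GI.ext h hY hM
  | succ k ih =>
    intro Y P M _ _ _ _ _ _ f g h hY hM
    obtain ⟨Y1, M1, a, b, hs, hY1, hM1⟩ := hM
    obtain ⟨X, Y2, c, d, hX, hY2, hc⟩ := hY.nxt
    obtain ⟨Q, _, _, b', b, i, p, h1, h2⟩ := horseshoe_coker h hc hX hs
    exact ⟨ModuleCat.of R (X × Y1), ModuleCat.of R Q, b', b, h1, (GI.of_injective hX).prod hY1,
      ih h2 hY2 hM1⟩

theorem GD.H2 (k : ℕ) {Y P M : Type u} [AddCommGroup Y] [Module R Y] [AddCommGroup P]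
    [Module R P] [AddCommGroup M] [Module R M] {f : Y →ₗ[R] P} {g : P →ₗ[R] M} (h : SE f g)
    (hY : GI R Y) (hP : GD R k (ModuleCat.of R P)) : GD R k (ModuleCat.of R M) := by
  rcases k with _ | k
  · exact GI.coker h hY hP
  · obtain ⟨Y1, P1, a, b, hs, hY1, hP1⟩ := hP
    obtain ⟨Q, _, _, k', i, p, h3, h4⟩ := h.third hs
    exact ⟨ModuleCat.of R Q, P1, i, p, h4, GI.coker h3 hY hY1, hP1⟩

/-- Holm -/
theorem GD.step {k : ℕ} {M Y M' : Type u} [AddCommGroup Y] [Module R Y] [AddCommGroup M]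
    [Module R M] [AddCommGroup M'] [Module R M'] {f : M →ₗ[R] Y} {g : Y →ₗ[R] M'} (h : SE f g)
    (hY : GI R Y) (hM : GD R (k+1) (ModuleCat.of R M)) : GD R k (ModuleCat.of R M') := by
  obtain ⟨Y0, M0, a, b, hs, hY0, hM0⟩ := hM
  obtain ⟨P, _, _, i, j, p, q, h1, h2⟩ := pushout_exists h hs
  exact GD.H2 k h2 hY0 (GD.H1 k h1 hY hM0)

theorem GD.congr {k : ℕ} (e : A ≃ₗ[R] B) (h : GD R k (ModuleCat.of R A)) :
    GD R k (ModuleCat.of R B) :=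
  GD.H1 k (SE.zero_equiv (C := PUnit) e.symm) GI.of_subsingleton h

theorem GD.ev_pd {j : ℕ}
    (hL : ∀ (N : Type u) [AddCommGroup N] [Module R N], ∀ i, j ≤ i → EV R i L N) :
    ∀ (k : ℕ) (M : ModuleCat.{u} R) (_ : GD R k M) (n : ℕ), EV R (k+n+1) L M := by
  intro k
  induction k with
  | zero => intro M hM n; rw [zero_add]; exact GI.ev_pd hL n hM
  | succ k ih =>
    intro M hM n
    obtain ⟨Y, M', f, g, hs, hY, hM'⟩ := hM
    have h1 := ih M' hM' n
    have h2 : EV R (k+n+1+1) L Y := GI.ev_pd hL _ hY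
    have := EV.left₂ hs h1 h2
    rwa [show k + 1 + n + 1 = k + n + 1 + 1 by omega]
end
end GGP

namespace GGP
section
variable {R : Type u} [CommRing R]
variable {A B C L N X : Type u} [AddCommGroup A] [Module R A] [AddCommGroup B]
    [Module R B]
    [AddCommGroup C] [Module R C] [AddCommGroup L] [Module R L] [AddCommGroup N] [Module R N]
    [AddCommGroup X] [Module R X]

theorem SE.of_range_eq {f : A →ₗ[R] B} {g : B →ₗ[R] C} (h : LinearMap.range f = LinearMap.ker g) :
    ∃ k : A →ₗ[R] LinearMap.ker g, (∀ x, (k x : B) = f x) ∧ SE (LinearMap.ker f).subtype k := by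
  refine ⟨f.codRestrict (LinearMap.ker g) (fun x => h ▸ ⟨x, rfl⟩), fun x => rfl, ⟨?_, ?_, ?_⟩⟩
  · exact Subtype.val_injective
  · intro x
    constructor
    · intro hx
      exact ⟨⟨x, congrArg Subtype.val hx⟩, rfl⟩
    · rintro ⟨y, rfl⟩
      exact Subtype.ext y.2
  · rintro ⟨y, hy⟩
    rw [← h] at hy
    obtain ⟨x, rfl⟩ := hy
    exact ⟨x, rfl⟩

theorem GI.of_isGI (h : GG.IsGorensteinInjective R N) : GI R N := by
  obtain ⟨X, d, hX, hd, hI, ⟨e⟩⟩ := h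
  refine ⟨fun P => ∃ n, Nonempty (P ≃ₗ[R] LinearMap.ker (d n)), ⟨?_, ?_, ?_⟩, ⟨0, ⟨e⟩⟩⟩
  · rintro P ⟨n, ⟨e⟩⟩ I _ _ hinj
    obtain ⟨k, hk, hs⟩ := SE.of_range_eq (hd n)
    refine EV.congr_right e.symm (EV.one_of_lift hs (EV.of_injective (hX n) 0) ?_)
    intro φ
    obtain ⟨ψ, hψ⟩ := hI (ModuleCat.of R I) hinj n ((LinearMap.ker (d (n+1))).subtype.comp φ) (by
      apply LinearMap.ext; intro x; exact (φ x).2)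
    refine ⟨ψ, ?_⟩
    apply LinearMap.ext; intro x; apply Subtype.ext
    rw [LinearMap.comp_apply, hk]
    exact LinearMap.congr_fun hψ x
  · rintro P ⟨n, ⟨e⟩⟩
    obtain ⟨m, rfl⟩ : ∃ m, n = m + 1 := ⟨n - 1, by omega⟩
    obtain ⟨k, hk, hs⟩ := SE.of_range_eq (hd m)
    exact ⟨ModuleCat.of R (LinearMap.ker (d m)), X m, _, _, hX m,
      ⟨m, ⟨LinearEquiv.refl R _⟩⟩, hs.equiv_right e.symm⟩
  · rintro P ⟨n, ⟨e⟩⟩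
    obtain ⟨k, hk, hs⟩ := SE.of_range_eq (hd n)
    exact ⟨X n, ModuleCat.of R (LinearMap.ker (d (n+1))), _, _, hX n,
      ⟨n+1, ⟨LinearEquiv.refl R _⟩⟩, hs.equiv_left e⟩

theorem GI.seq (h : GI R N) : ∃ Z : ℤ → ModuleCat.{u} R, Z 0 = ModuleCat.of R N ∧
    ∀ n, GI R (Z n) ∧ ∃ (X : ModuleCat.{u} R) (f : Z n →ₗ[R] X) (g : X →ₗ[R] Z (n+1)),
      Module.Injective R X ∧ SE f g := by
  choose nx hnx using fun P : {P : ModuleCat.{u} R // GI R P} =>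
    (show ∃ P' : {P : ModuleCat.{u} R // GI R P}, ∃ (X : ModuleCat.{u} R) (f : P.1 →ₗ[R] X)
        (g : X →ₗ[R] P'.1), Module.Injective R X ∧ SE f g by
      obtain ⟨X, N', f, g, hX, hN', hs⟩ := P.2.nxt
      exact ⟨⟨N', hN'⟩, X, f, g, hX, hs⟩)
  choose pv hpv using fun P : {P : ModuleCat.{u} R // GI R P} =>
    (show ∃ P' : {P : ModuleCat.{u} R // GI R P}, ∃ (X : ModuleCat.{u} R) (f : P'.1 →ₗ[R] X)
        (g : X →ₗ[R] P.1), Module.Injective R X ∧ SE f g by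
      obtain ⟨N', X, f, g, hX, hN', hs⟩ := P.2.prv
      exact ⟨⟨N', hN'⟩, X, f, g, hX, hs⟩)
  let P0 : {P : ModuleCat.{u} R // GI R P} := ⟨ModuleCat.of R N, h⟩
  let pos : ℕ → {P : ModuleCat.{u} R // GI R P} := fun n => Nat.rec P0 (fun _ x => nx x) n
  let neg : ℕ → {P : ModuleCat.{u} R // GI R P} := fun n => Nat.rec P0 (fun _ x => pv x) n
  let Z : ℤ → {P : ModuleCat.{u} R // GI R P} := fun n => Int.rec (fun k => pos k)
    (fun k => neg (k+1)) n
  refine ⟨fun n => (Z n).1, rfl, fun n => ⟨(Z n).2, ?_⟩⟩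
  rcases n with k | k
  · exact hnx (pos k)
  · rcases k with _ | k
    · exact hpv (neg 0)
    · exact hpv (neg (k+1))

theorem GI.isGI (h : GI R N) : GG.IsGorensteinInjective R N := by
  obtain ⟨Z, hZ, hZ'⟩ := h.seq
  choose hG X f g hX hs using hZ'
  have hker : ∀ n, LinearMap.ker ((f (n+1)).comp (g n)) = LinearMap.range (f n) := by
    intro n
    ext x
    rw [LinearMap.mem_ker, LinearMap.comp_apply, map_eq_zero_iff _ (hs (n+1)).inj]
    exact (hs n).ex x
  refine ⟨X, fun n => (f (n+1)).comp (g n), hX, ?_, ?_, ?_⟩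
  · intro n
    rw [hker (n+1), LinearMap.range_comp, LinearMap.range_eq_top.2 (hs n).surj, Submodule.map_top]
  · intro I hI n φ hφ
    obtain ⟨χ, hχ⟩ := exists_factor (hs (n+1)).inj φ (by
      intro x
      have : φ x ∈ LinearMap.ker ((f (n+1+1)).comp (g (n+1))) := LinearMap.congr_fun hφ x
      rw [hker] at this; exact this)
    obtain ⟨ψ, hψ⟩ := EV.lift (hs n) ((hG n).ev hI) χ
    refine ⟨ψ, ?_⟩
    apply LinearMap.ext; intro x
    rw [← hχ, ← hψ]; rfl
  · rw [hker 0]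
    have e := LinearEquiv.ofInjective (f 0) (hs 0).inj
    have e2 : N ≃ₗ[R] Z 0 := by rw [hZ]
    exact ⟨e2.trans e⟩

theorem isGI_iff : GG.IsGorensteinInjective R N ↔ GI R N := ⟨GI.of_isGI, GI.isGI⟩

/-- Countable products -/
theorem SE.pi {ι : Type} {A B C : ι → Type u} [∀ i, AddCommGroup (A i)] [∀ i, Module R (A i)]
    [∀ i, AddCommGroup (B i)] [∀ i, Module R (B i)] [∀ i, AddCommGroup (C i)] [∀ i, Module R (C i)]
    {f : ∀ i, A i →ₗ[R] B i} {g : ∀ i, B i →ₗ[R] C i} (h : ∀ i, SE (f i) (g i)) :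
    SE (LinearMap.pi fun i => (f i).comp (LinearMap.proj i))
      (LinearMap.pi fun i => (g i).comp (LinearMap.proj i)) := by
  refine ⟨?_, ?_, ?_⟩
  · intro x y hxy
    funext i
    exact (h i).inj (congrFun hxy i)
  · intro x
    constructor
    · intro hx
      choose y hy using fun i => (h i).lift_elem (congrFun hx i)
      exact ⟨y, funext hy⟩
    · rintro ⟨y, rfl⟩
      funext i
      exact (h i).comp_apply _
  · intro z
    choose y hy using fun i => (h i).surj (z i)
    exact ⟨y, funext hy⟩

theorem injective_pi {ι : Type} {B : ι → Type u} [∀ i, AddCommGroup (B i)] [∀ i, Module R (B i)]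
    (h : ∀ i, Module.Injective R (B i)) : Module.Injective R (∀ i, B i) := by
  refine ⟨fun X Y _ _ _ _ f hf g => ?_⟩
  choose ψ hψ using fun i => extend_of_injective (h i) hf ((LinearMap.proj i).comp g)
  exact ⟨LinearMap.pi ψ, fun x => funext fun i => LinearMap.congr_fun (hψ i) x⟩

theorem GI.pi {ι : Type} {N : ι → Type u} [∀ i, AddCommGroup (N i)] [∀ i, Module R (N i)]
    (h : ∀ i, GI R (N i)) : GI R (∀ i, N i) := by
  refine ⟨fun P => ∃ Ns : ι → ModuleCat.{u} R, (∀ i, GI R (Ns i)) ∧ Nonempty (P ≃ₗ[R] (∀ i, Ns i)),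
    ⟨?_, ?_, ?_⟩, ⟨fun i => ModuleCat.of R (N i), h, ⟨LinearEquiv.refl R _⟩⟩⟩
  · rintro P ⟨Ns, hN, ⟨e⟩⟩ I _ _ hI
    refine EV.congr_right e.symm ?_
    choose N' X f g hX hN' hs using fun i => (hN i).nxt
    refine EV.one_of_lift (SE.pi hs) (EV.of_injective (injective_pi hX) 0) ?_
    intro φ
    choose ψ hψ using fun i => EV.lift (hs i) ((hN i).ev hI) ((LinearMap.proj i).comp φ)
    refine ⟨LinearMap.pi ψ, ?_⟩
    apply LinearMap.ext; intro x
    funext i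
    exact LinearMap.congr_fun (hψ i) x
  · rintro P ⟨Ns, hN, ⟨e⟩⟩
    choose N' X f g hX hN' hs using fun i => (hN i).prv
    exact ⟨ModuleCat.of R (∀ i, N' i), ModuleCat.of R (∀ i, X i), _, _, injective_pi hX,
      ⟨N', hN', ⟨LinearEquiv.refl R _⟩⟩, (SE.pi hs).equiv_right e.symm⟩
  · rintro P ⟨Ns, hN, ⟨e⟩⟩
    choose X N' f g hX hN' hs using fun i => (hN i).nxt
    exact ⟨ModuleCat.of R (∀ i, X i), ModuleCat.of R (∀ i, N' i), _, _, injective_pi hX,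
      ⟨N', hN', ⟨LinearEquiv.refl R _⟩⟩, (SE.pi hs).equiv_left e⟩

/-- swindle -/
theorem GI.of_prod (h : GI R (A × B)) : GI R A := by
  have hW : GI R (ℕ → A × B) := GI.pi (fun _ => h)
  -- W ≃ A × W' with W' = B × W, and A × W ≃ ... use the sequence shifting the A coordinates
  let s : (ℕ → A × B) →ₗ[R] (ℕ → A × B) :=
    LinearMap.pi fun n => match n with
      | 0 => (LinearMap.inr R A B).comp ((LinearMap.snd R A B).comp (LinearMap.proj 0))
      | n+1 => ((LinearMap.fst R A B).comp (LinearMap.proj n)).prod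
          ((LinearMap.snd R A B).comp (LinearMap.proj (n+1)))
  let p : (ℕ → A × B) →ₗ[R] A := (LinearMap.fst R A B).comp (LinearMap.proj 0)
  have hs : SE s p := by
    refine ⟨?_, ?_, ?_⟩
    · rw [injective_iff_map_eq_zero]
      intro x hx
      funext n
      have h1 : (x n).1 = 0 := congrArg Prod.fst (congrFun hx (n+1))
      have h2 : (x n).2 = 0 := by
        rcases n with _ | n
        · exact congrArg Prod.snd (congrFun hx 0)
        · exact congrArg Prod.snd (congrFun hx (n+1))
      exact Prod.ext h1 h2
    · intro x
      constructor
      · intro hx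
        change (x 0).1 = 0 at hx
        refine ⟨fun n => ((x (n+1)).1, (x n).2), ?_⟩
        funext n
        rcases n with _ | n
        · exact Prod.ext hx.symm rfl
        · rfl
      · rintro ⟨y, rfl⟩
        rfl
    · intro a
      exact ⟨fun _ => (a, 0), rfl⟩
  exact GI.coker hs hW hW

theorem gidLE_of_GD : ∀ (n : ℕ) (M : ModuleCat.{u} R), GD R n M → GG.gidLE R M n := by
  intro n
  induction n with
  | zero =>
    intro M h
    refine ⟨fun i => match i with
      | 0 => M
      | _+1 => ModuleCat.of R PUnit, fun i => 0, LinearMap.id, ?_, Function.injective_id, ?_, ?_, ?_⟩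
    · intro i
      rcases i with _ | i
      · exact GI.isGI h
      · exact GI.isGI GI.of_subsingleton
    · simp
    · intro i
      ext x
      have : x = 0 := rfl
      subst this
      simp
    · intro i hi x
      rcases i with _ | i
      · omega
      · rfl
  | succ n ih =>
    intro M h
    obtain ⟨Y, M', f, g, hs, hY, hM'⟩ := h
    obtain ⟨G, d, ε, hG, hε, h0, h1, h2⟩ := ih M' hM'
    refine ⟨fun i => match i with
      | 0 => Y
      | i+1 => G i, fun i => match i with
      | 0 => ε.comp g
      | i+1 => d i, f, ?_, hs.inj, ?_, ?_, ?_⟩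
    · intro i
      rcases i with _ | i
      · exact hY.isGI
      · exact hG i
    · ext x
      change x ∈ LinearMap.range f ↔ ε (g x) = 0
      rw [map_eq_zero_iff _ hε]
      exact (hs.ex x).symm
    · intro i
      rcases i with _ | i
      · change LinearMap.range (ε.comp g) = LinearMap.ker (d 0)
        rw [LinearMap.range_comp, LinearMap.range_eq_top.2 hs.surj, Submodule.map_top, h0]
      · exact h1 i
    · intro i hi x
      rcases i with _ | i
      · omega
      · exact h2 i (by omega) x

theorem GD_of_gidLE : ∀ (n : ℕ) (M : ModuleCat.{u} R), GG.gidLE R M n → GD R n M := by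
  intro n
  induction n with
  | zero =>
    intro M h
    obtain ⟨G, d, ε, hG, hε, h0, h1, h2⟩ := h
    have : LinearMap.ker (d 0) = ⊤ := by
      rw [eq_top_iff]; intro x _; exact h2 1 (by omega) _
    have hb : Function.Bijective ε := ⟨hε, LinearMap.range_eq_top.1 (h0.trans this)⟩
    exact (GI.of_isGI (hG 0)).congr (LinearEquiv.ofBijective ε hb).symm
  | succ n ih =>
    intro M h
    obtain ⟨G, d, ε, hG, hε, h0, h1, h2⟩ := h
    obtain ⟨k, hk, hs⟩ := SE.of_range_eq (h1 0)
    have e := LinearEquiv.ofInjective ε hε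
    rw [h0] at e
    refine ⟨G 0, ModuleCat.of R (LinearMap.ker (d 1)), _, _, hs.equiv_left e, GI.of_isGI (hG 0), ?_⟩
    apply ih
    refine ⟨fun i => G (i+1), fun i => d (i+1), (LinearMap.ker (d 1)).subtype, fun i => hG _,
      Subtype.val_injective, ?_, fun i => h1 _, fun i hi => h2 _ (by omega)⟩
    exact Submodule.range_subtype _

theorem gidLE_iff {M : Type u} [AddCommGroup M] [Module R M] {n : ℕ} :
    GG.gidLE R M n ↔ GD R n (ModuleCat.of R M) :=
  ⟨GD_of_gidLE n (ModuleCat.of R M), gidLE_of_GD n (ModuleCat.of R M)⟩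
end
end GGP

namespace GGP
section
variable {R : Type u} [CommRing R]
variable {F J I T : Type u} [AddCommGroup F] [Module R F] [AddCommGroup J] [Module R J]
  [AddCommGroup I] [Module R I] [AddCommGroup T] [Module R T]

/-- action of a matrix on tuples of elements of a module -/
def act {a b : ℕ} (M : Matrix (Fin b) (Fin a) R) (F : Type u) [AddCommGroup F] [Module R F] :
    (Fin a → F) →ₗ[R] (Fin b → F) :=
  LinearMap.pi fun i => ∑ j, M i j • LinearMap.proj j

theorem act_apply {a b : ℕ} (M : Matrix (Fin b) (Fin a) R) (v : Fin a → F) (i : Fin b) :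
    act M F v i = ∑ j, M i j • v j := by
  simp [act, LinearMap.sum_apply]

theorem act_mul {a b c : ℕ} (M : Matrix (Fin b) (Fin a) R) (N : Matrix (Fin c) (Fin b) R)
    (v : Fin a → F) : act N F (act M F v) = act (N * M) F v := by
  funext i
  simp only [act_apply, Matrix.mul_apply, Finset.sum_smul, Finset.smul_sum, mul_smul]
  rw [Finset.sum_comm]

theorem act_zero {a b : ℕ} (v : Fin a → F) : act (0 : Matrix (Fin b) (Fin a) R) F v = 0 := by
  funext i; simp [act_apply]

theorem act_map {a b : ℕ} (M : Matrix (Fin b) (Fin a) R) (φ : F →ₗ[R] J) (v : Fin a → F) :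
    act M J (fun i => φ (v i)) = fun i => φ (act M F v i) := by
  funext i; simp [act_apply, map_sum]

/-- pairing of a tuple of maps with a tuple of elements -/
theorem act_pair {a b : ℕ} (M : Matrix (Fin b) (Fin a) R) (w : Fin a → (F →ₗ[R] J)) (x : Fin b → F) :
    ∑ i, (∑ j, M i j • w j) (x i) = ∑ j, w j (act M.transpose F x j) := by
  simp only [act_apply, LinearMap.sum_apply, map_sum, LinearMap.smul_apply, map_smul,
    Matrix.transpose_apply]
  rw [Finset.sum_comm]

theorem act_pair' {a b : ℕ} (M : Matrix (Fin b) (Fin a) R) (w : Fin a → J) (x : Fin b → R) :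
    ∑ i, x i • (act M J w i) = ∑ j, (act M.transpose R x j) • w j := by
  simp only [act_apply, Finset.smul_sum, Finset.sum_smul, Matrix.transpose_apply, smul_eq_mul]
  rw [Finset.sum_comm]
  refine Finset.sum_congr rfl fun i _ => Finset.sum_congr rfl fun j _ => ?_
  rw [smul_smul, mul_comm]

/-- matrix with prescribed range -/
theorem exists_act_range [IsNoetherianRing R] {a : ℕ} (U : Submodule R (Fin a → R)) :
    ∃ (c : ℕ) (C : Matrix (Fin a) (Fin c) R), LinearMap.range (act C R) = U := by
  obtain ⟨c, s, hs⟩ := Submodule.fg_iff_exists_fin_generating_family.1 (IsNoetherian.noetherian U)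
  refine ⟨c, Matrix.of fun i j => s j i, ?_⟩
  have : act (Matrix.of fun i j => s j i : Matrix (Fin a) (Fin c) R) R =
      Fintype.linearCombination R s := by
    apply LinearMap.ext; intro v
    funext i
    rw [act_apply]
    simp [Fintype.linearCombination_apply, Finset.sum_apply, mul_comm]
  rw [this, Fintype.range_linearCombination, hs]

theorem act_eq_zero {a b : ℕ} (M : Matrix (Fin b) (Fin a) R) (h : ∀ v, act M R v = 0) : M = 0 := by
  ext i j
  have := congrFun (h (Pi.single j 1)) i
  rw [act_apply] at this
  simpa [Pi.single_apply] using this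

theorem mul_eq_zero_of_transpose {a b c : ℕ} (M : Matrix (Fin b) (Fin a) R)
    (N : Matrix (Fin c) (Fin b) R)
    (h : ∀ v, act M.transpose R (act N.transpose R v) = 0) : N * M = 0 := by
  have h0 : M.transpose * N.transpose = 0 := act_eq_zero _ fun v => by rw [← act_mul, h]
  rw [← Matrix.transpose_mul] at h0
  exact Matrix.transpose_eq_zero.1 h0

/-- complex of matrices attached to a module -/
structure MC (R : Type u) [CommRing R] (T : Type u) [AddCommGroup T] [Module R T] where
  k : ℤ → ℕ
  B : ∀ m : ℤ, Matrix (Fin (k (m+1))) (Fin (k m)) R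
  hz : ∀ m, B (m+1) * B m = 0
  pos : ∀ m, 0 ≤ m → ∀ v : Fin (k (m+1)) → R, act (B m).transpose R v = 0 →
    ∃ w, act (B (m+1)).transpose R w = v
  neg : ∀ m, m < 0 → ∀ v : Fin (k (m+1)) → R, act (B (m+1)) R v = 0 → ∃ w, act (B m) R w = v
  e : ((Fin (k 0) → R) ⧸ LinearMap.range (act (B 0).transpose R)) ≃ₗ[R] T

theorem exists_MC (R : Type u) [CommRing R] [IsNoetherianRing R] (T : Type u) [AddCommGroup T]
    [Module R T] [Module.Finite R T] : Nonempty (MC R T) := by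
  obtain ⟨k0, t, ht⟩ := Module.Finite.exists_fin (R := R) (M := T)
  let p : (Fin k0 → R) →ₗ[R] T := Fintype.linearCombination R t
  have hp : Function.Surjective p := by
    rw [← LinearMap.range_eq_top, Fintype.range_linearCombination, ht]
  choose c C hC using fun P : (Σ a : ℕ, Submodule R (Fin a → R)) => exists_act_range P.2
  let nx : (Σ a : ℕ, Submodule R (Fin a → R)) → (Σ a : ℕ, Submodule R (Fin a → R)) :=
    fun P => ⟨c P, LinearMap.ker (act (C P) R)⟩
  let P0 : (Σ a : ℕ, Submodule R (Fin a → R)) := ⟨k0, LinearMap.ker p⟩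
  let N0 : (Σ a : ℕ, Submodule R (Fin a → R)) := ⟨k0, LinearMap.ker (act (C P0).transpose R)⟩
  let ps : ℕ → (Σ a : ℕ, Submodule R (Fin a → R)) := fun n => Nat.rec P0 (fun _ x => nx x) n
  let ng : ℕ → (Σ a : ℕ, Submodule R (Fin a → R)) := fun n => Nat.rec N0 (fun _ x => nx x) n
  let k : ℤ → ℕ := fun n => Int.rec (fun k => (ps k).1) (fun k => (ng (k+1)).1) n
  let B : ∀ m : ℤ, Matrix (Fin (k (m+1))) (Fin (k m)) R := fun m => match m with
    | Int.ofNat n => (C (ps n)).transpose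
    | Int.negSucc 0 => C (ng 0)
    | Int.negSucc (n+1) => C (ng (n+1))
  have hps : ∀ n, LinearMap.range (act (C (ps (n+1))) R) = LinearMap.ker (act (C (ps n)) R) :=
    fun n => hC _
  have hng : ∀ n, LinearMap.range (act (C (ng (n+1))) R) = LinearMap.ker (act (C (ng n)) R) :=
    fun n => hC _
  have hn0 : LinearMap.range (act (C (ng 0)) R) = LinearMap.ker (act (C (ps 0)).transpose R) :=
    hC _
  have pos : ∀ m, 0 ≤ m → LinearMap.range (act (B (m+1)).transpose R) =
      LinearMap.ker (act (B m).transpose R) := by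
    intro m hm
    rcases m with n | n
    · exact hps n
    · exact absurd hm (by omega)
  have neg : ∀ m, m < 0 → LinearMap.range (act (B m) R) = LinearMap.ker (act (B (m+1)) R) := by
    intro m hm
    rcases m with n | n
    · exact absurd hm (by simp)
    · rcases n with _ | n
      · exact hn0
      · rcases n with _ | n
        · exact hng 0
        · exact hng (n+1)
  refine ⟨⟨k, B, ?_, ?_, ?_, ?_⟩⟩
  · intro m
    rcases lt_or_ge m 0 with hm | hm
    · apply act_eq_zero
      intro v
      rw [← act_mul]
      have : act (B m) R v ∈ LinearMap.ker (act (B (m+1)) R) := by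
        rw [← neg m hm]; exact LinearMap.mem_range_self _ _
      exact this
    · refine mul_eq_zero_of_transpose _ _ fun v => ?_
      have : act (B (m+1)).transpose R v ∈ LinearMap.ker (act (B m).transpose R) := by
        rw [← pos m hm]; exact LinearMap.mem_range_self _ _
      exact this
  · intro m hm v hv
    have : v ∈ LinearMap.range (act (B (m+1)).transpose R) := by rw [pos m hm]; exact hv
    exact this
  · intro m hm v hv
    have : v ∈ LinearMap.range (act (B m) R) := by rw [neg m hm]; exact hv
    exact this
  · have : LinearMap.range (act (B 0).transpose R) = LinearMap.ker p := hC P0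
    exact (Submodule.quotEquivOfEq _ _ this).trans (p.quotKerEquivOfSurjective hp)

/-- total reflexivity at a prime -/
def MC.TR (m : MC R T) (q : Ideal R) : Prop :=
  (∀ n, ∃ s, s ∉ q ∧ ∀ v, act (m.B (n+1)) R v = 0 → ∃ w, act (m.B n) R w = s • v) ∧
  (∀ n, ∃ s, s ∉ q ∧ ∀ v, act (m.B n).transpose R v = 0 → ∃ w, act (m.B (n+1)).transpose R w = s • v)

theorem tr_uniform [IsNoetherianRing R] {q : Ideal R} [q.IsPrime] {a b c : ℕ}
    (M : Matrix (Fin b) (Fin a) R) (N : Matrix (Fin a) (Fin c) R)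
    (h : ∀ v, act M R v = 0 → ∃ s, s ∉ q ∧ ∃ w, act N R w = s • v) :
    ∃ s, s ∉ q ∧ ∀ v, act M R v = 0 → ∃ w, act N R w = s • v := by
  obtain ⟨n, g, hg⟩ := Submodule.fg_iff_exists_fin_generating_family.1
    (IsNoetherian.noetherian (LinearMap.ker (act M R)))
  have hgm : ∀ i, act M R (g i) = 0 := fun i => by
    have : g i ∈ LinearMap.ker (act M R) := hg ▸ Submodule.subset_span ⟨i, rfl⟩
    exact this
  choose s hs hs' using fun i => h (g i) (hgm i)
  refine ⟨∏ i, s i, ?_, ?_⟩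
  · intro hmem
    obtain ⟨i, _, hi⟩ := (Ideal.IsPrime.prod_mem_iff).1 hmem
    exact hs i hi
  · have : LinearMap.ker (act M R) ≤ (LinearMap.range (act N R)).comap
        (LinearMap.lsmul R _ (∏ i, s i)) := by
      rw [← hg, Submodule.span_le]
      rintro _ ⟨i, rfl⟩
      obtain ⟨w, hw⟩ := hs' i
      refine ⟨(∏ j ∈ Finset.univ.erase i, s j) • w, ?_⟩
      rw [map_smul, hw, smul_smul, Finset.prod_erase_mul _ _ (Finset.mem_univ i)]
      rfl
    intro v hv
    exact this hv

theorem exists_functional (hJ : Module.Injective R J) {q : Ideal R} {e : J} (he : e ≠ 0)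
    (hq : ∀ r ∈ q, r • e = 0) {X : Type u} [AddCommGroup X] [Module R X] (x : X)
    (hx : ∀ s, s ∉ q → s • x ≠ 0) : ∃ φ : X →ₗ[R] J, φ x ≠ 0 := by
  have hle : LinearMap.ker (LinearMap.toSpanSingleton R X x) ≤
      LinearMap.ker (LinearMap.toSpanSingleton R J e) := by
    intro r hr
    by_contra h
    exact hx r (fun hrq => h (hq r hrq)) hr
  have hse : Function.Injective (Submodule.liftQ _ (LinearMap.toSpanSingleton R X x) le_rfl) := by
    rw [← LinearMap.ker_eq_bot]
    exact Submodule.ker_liftQ_eq_bot _ _ _ le_rfl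
  obtain ⟨φ, hφ⟩ := extend_of_injective hJ hse (Submodule.liftQ _ _ hle)
  refine ⟨φ, ?_⟩
  have := LinearMap.congr_fun hφ (Submodule.Quotient.mk 1)
  simp only [LinearMap.comp_apply, Submodule.liftQ_apply, LinearMap.toSpanSingleton_apply, one_smul]
    at this
  rw [this]; exact he

/-- functionals on a cokernel of a matrix -/
theorem exists_pairing (hJ : Module.Injective R J) {q : Ideal R} {e : J} (he : e ≠ 0)
    (hq : ∀ r ∈ q, r • e = 0) {a c : ℕ} (N : Matrix (Fin a) (Fin c) R) (v : Fin a → R)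
    (h : ¬ ∃ s, s ∉ q ∧ ∃ w, act N R w = s • v) :
    ∃ y : Fin a → J, act N.transpose J y = 0 ∧ ∑ i, v i • y i ≠ 0 := by
  obtain ⟨φ, hφ⟩ := exists_functional hJ he hq
    (Submodule.Quotient.mk (p := LinearMap.range (act N R)) v) (by
      intro s hs h0
      rw [← Submodule.Quotient.mk_smul, Submodule.Quotient.mk_eq_zero] at h0
      exact h ⟨s, hs, h0⟩)
  let ψ : (Fin a → R) →ₗ[R] J := φ.comp (Submodule.mkQ _)
  have hψ : ∀ v, ψ v = ∑ i, v i • ψ (Pi.single i 1) := fun v => by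
    conv_lhs => rw [pi_eq_sum_univ' v]
    rw [map_sum]
    refine Finset.sum_congr rfl fun i _ => ?_
    rw [← map_smul]
  refine ⟨fun i => ψ (Pi.single i 1), ?_, ?_⟩
  · funext j
    have h1 : ψ (act N R (Pi.single j 1)) = 0 := by
      change φ (Submodule.Quotient.mk _) = 0
      rw [(Submodule.Quotient.mk_eq_zero _).2 (LinearMap.mem_range_self _ _), map_zero]
    rw [hψ] at h1
    rw [act_apply, Pi.zero_apply, ← h1]
    refine Finset.sum_congr rfl fun i _ => ?_
    rw [act_apply]
    simp [Pi.single_apply]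
  · rw [← hψ]; exact hφ

end
end GGP

namespace GGP
section
variable {R : Type u} [CommRing R]
variable {F J : Type u} [AddCommGroup F] [Module R F] [AddCommGroup J] [Module R J]

theorem extend_of_ker (hJ : Module.Injective R J) {X Y : Type u} [AddCommGroup X] [Module R X]
    [AddCommGroup Y] [Module R Y] (f : X →ₗ[R] Y) (φ : X →ₗ[R] J)
    (h : ∀ x, f x = 0 → φ x = 0) : ∃ ψ : Y →ₗ[R] J, ∀ x, ψ (f x) = φ x := by
  obtain ⟨χ, hχ⟩ := exists_desc (g := f.rangeRestrict) f.surjective_rangeRestrict φ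
    (fun x hx => h x (congrArg Subtype.val hx))
  obtain ⟨ψ, hψ⟩ := extend_of_injective hJ (f := (LinearMap.range f).subtype)
    Subtype.val_injective χ
  refine ⟨ψ, fun x => ?_⟩
  rw [← hχ]
  exact LinearMap.congr_fun hψ (f.rangeRestrict x)

theorem exists_W (hJ : Module.Injective R J) {a b : ℕ} (M : Matrix (Fin b) (Fin a) R)
    (V : Fin b → (F →ₗ[R] J))
    (h : ∀ x : Fin b → F, act M.transpose F x = 0 → ∑ i, V i (x i) = 0) :
    ∃ W : Fin a → (F →ₗ[R] J), ∀ i, ∑ j, M i j • W j = V i := by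
  let φ : (Fin b → F) →ₗ[R] J := ∑ i, (V i).comp (LinearMap.proj i)
  have hφ : ∀ x, φ x = ∑ i, V i (x i) := fun x => by simp [φ, LinearMap.sum_apply]
  obtain ⟨Φ, hΦ⟩ := extend_of_ker hJ (act M.transpose F) φ (fun x hx => by rw [hφ]; exact h x hx)
  refine ⟨fun j => Φ.comp (LinearMap.single R (fun _ => F) j), fun i => ?_⟩
  apply LinearMap.ext; intro x
  have h1 := hΦ (Pi.single i x)
  rw [hφ, Finset.sum_eq_single i (by
    intro b _ hb; rw [Pi.single_eq_of_ne hb, map_zero]) (by simp), Pi.single_eq_same] at h1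
  rw [← h1, LinearMap.sum_apply]
  have h2 : act M.transpose F (Pi.single i x) = ∑ j, M i j • (Pi.single j x : Fin a → F) := by
    funext j
    rw [act_apply, Finset.sum_apply, Finset.sum_eq_single i (by
      intro b _ hb; rw [Pi.single_eq_of_ne hb, smul_zero]) (by simp), Pi.single_eq_same]
    rw [Finset.sum_eq_single j (by
      intro b _ hb; rw [Pi.smul_apply, Pi.single_eq_of_ne' hb, smul_zero]) (by simp)]
    simp
  rw [h2, map_sum]
  refine Finset.sum_congr rfl fun j _ => ?_
  rw [map_smul]; rfl

theorem exists_w (hJ : Module.Injective R J) {a b : ℕ} (M : Matrix (Fin b) (Fin a) R)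
    (v : Fin b → J)
    (h : ∀ x : Fin b → R, act M.transpose R x = 0 → ∑ i, x i • v i = 0) :
    ∃ w : Fin a → J, act M J w = v := by
  obtain ⟨W, hW⟩ := exists_W hJ M (fun i => LinearMap.toSpanSingleton R J (v i)) (by
    intro x hx
    simpa using h x hx)
  refine ⟨fun j => W j 1, ?_⟩
  funext i
  have := LinearMap.congr_fun (hW i) 1
  rw [LinearMap.sum_apply, LinearMap.toSpanSingleton_apply, one_smul] at this
  rw [act_apply, ← this]; rfl

end
section
variable {R A : Type u} [CommRing R] [CommRing A] [Algebra R A]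
variable {F J T : Type u} [AddCommGroup F] [Module R F] [AddCommGroup J] [Module R J]
  [Module A F] [Module A J] [IsScalarTower R A F] [IsScalarTower R A J] [AddCommGroup T] [Module R T]

/-- matrix action as a linear map over an algebra -/
def actA (A : Type u) [CommRing A] [Algebra R A] {a b : ℕ} (M : Matrix (Fin b) (Fin a) R)
    (F : Type u) [AddCommGroup F] [Module A F] : (Fin a → F) →ₗ[A] (Fin b → F) :=
  act (M.map (algebraMap R A)) F

theorem actA_eq {a b : ℕ} (M : Matrix (Fin b) (Fin a) R) (v : Fin a → F) :
    actA A M F v = act M F v := by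
  funext i
  rw [actA, act_apply, act_apply]
  simp [algebraMap_smul]

theorem exists_WA (hJ : Module.Injective A J) {a b : ℕ} (M : Matrix (Fin b) (Fin a) R)
    (V : Fin b → (F →ₗ[A] J))
    (h : ∀ x : Fin b → F, act M.transpose F x = 0 → ∑ i, V i (x i) = 0) :
    ∃ W : Fin a → (F →ₗ[A] J), ∀ i x, act M J (fun j => W j x) i = V i x := by
  obtain ⟨W, hW⟩ := exists_W hJ (M.map (algebraMap R A)) V (by
    intro x hx
    refine h x ?_
    rw [← hx, ← actA_eq (A := A)]; rfl)
  refine ⟨W, fun i x => ?_⟩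
  rw [← hW, act_apply, LinearMap.sum_apply]
  simp [algebraMap_smul]

/-- injectives over `A` are injective over `R` -/
def IR (R A : Type u) [CommRing R] [CommRing A] [Algebra R A] : Prop :=
  ∀ (I : Type u) [AddCommGroup I] [Module R I] [Module A I] [IsScalarTower R A I],
    Module.Injective A I → Module.Injective R I

theorem injective_finpow {R : Type u} [CommRing R] {J : Type u} [AddCommGroup J] [Module R J]
    (hJ : Module.Injective R J) (k : ℕ) : Module.Injective R (Fin k → J) :=
  injective_pi (fun _ => hJ)

theorem smulR_map {I : Type u} [AddCommGroup I] [Module R I] [Module A I] [IsScalarTower R A I]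
    (V : I →ₗ[A] J) (s : R) (x : I) : V (s • x) = s • V x := by
  rw [← algebraMap_smul A s x, map_smul, algebraMap_smul]

theorem act_range_le (m : MC R T) (n : ℤ) :
    LinearMap.range (actA A (m.B n) J) ≤ LinearMap.ker (actA A (m.B (n+1)) J) := by
  rintro _ ⟨x, rfl⟩
  rw [LinearMap.mem_ker, actA_eq, actA_eq, act_mul, m.hz, act_zero]

theorem GI_of_TR (hAR : IR R A) (m : MC R T) (hJ : Module.Injective A J)
    (h : ∀ y : J, y ≠ 0 → ∃ q : Ideal R, m.TR q ∧ ∀ s, s ∉ q → s • y ≠ 0) :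
    GI A (LinearMap.ker (actA A (m.B 0) J)) := by
  have hJR : Module.Injective R J := hAR J hJ
  apply GI.of_isGI
  refine ⟨fun n => ModuleCat.of A (Fin (m.k n) → J), fun n => actA A (m.B n) J,
    fun n => injective_finpow hJ _, ?_, ?_, ⟨LinearEquiv.refl A _⟩⟩
  · intro n
    refine le_antisymm (act_range_le m n) ?_
    intro v hv
    have hv' : act (m.B (n+1)) J v = 0 := by rw [← actA_eq (A := A)]; exact hv
    obtain ⟨w, hw⟩ := exists_w hJR (m.B n) v (by
      intro x hx
      by_contra hy
      obtain ⟨q, hq, hs⟩ := h _ hy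
      obtain ⟨s, hsq, hs'⟩ := hq.2 n
      obtain ⟨z, hz⟩ := hs' x hx
      apply hs s hsq
      have := act_pair' (m.B (n+1)) v z
      rw [hv', hz] at this
      simp only [Pi.zero_apply, smul_zero, Finset.sum_const_zero, Pi.smul_apply, smul_eq_mul,
        mul_smul] at this
      rw [Finset.smul_sum, ← this])
    exact ⟨w, by rw [← hw, actA_eq]⟩
  · intro I hI n φ hφ
    letI : Module R I := Module.compHom I (algebraMap R A)
    haveI : IsScalarTower R A I := ⟨fun r a x => by
      rw [Algebra.smul_def, mul_smul]; rfl⟩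
    have hIR : Module.Injective R I := hAR I hI
    have hφ' : ∀ x : I, act (m.B (n+1)) J (φ x) = 0 := fun x => by
      rw [← actA_eq (A := A)]; exact LinearMap.congr_fun hφ x
    obtain ⟨W, hW⟩ := exists_WA hJ (m.B n) (fun i => (LinearMap.proj i).comp φ) (by
      intro x hx
      by_contra hy
      obtain ⟨q, hq, hs⟩ := h _ hy
      obtain ⟨s, hsq, hs'⟩ := hq.1 n
      obtain ⟨z, hz⟩ := exists_w hIR (m.B (n+1)).transpose (s • x) (by
        intro u hu
        obtain ⟨w, hw⟩ := hs' u hu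
        have := act_pair' (m.B n).transpose x w
        rw [hx, Matrix.transpose_transpose, hw] at this
        simp only [Pi.zero_apply, smul_zero, Finset.sum_const_zero, Pi.smul_apply, smul_eq_mul]
          at this
        rw [this]
        refine Finset.sum_congr rfl fun i _ => ?_
        rw [Pi.smul_apply, smul_smul, mul_comm])
      apply hs s hsq
      rw [Finset.smul_sum]
      have h1 : ∀ i, s • ((LinearMap.proj i).comp φ) (x i) =
          ((LinearMap.proj i : (Fin (m.k (n+1)) → J) →ₗ[A] J).comp φ)
            (act (m.B (n+1)).transpose I z i) := by
        intro i
        rw [← smulR_map, hz]; rfl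
      rw [Finset.sum_congr rfl fun i _ => h1 i]
      have h2 : ∀ i, ((LinearMap.proj i : (Fin (m.k (n+1)) → J) →ₗ[A] J).comp φ)
            (act (m.B (n+1)).transpose I z i) = ∑ j, m.B (n+1) j i • φ (z j) i := by
        intro i
        rw [act_apply, map_sum]
        refine Finset.sum_congr rfl fun j _ => ?_
        rw [smulR_map]; rfl
      rw [Finset.sum_congr rfl fun i _ => h2 i, Finset.sum_comm]
      refine Finset.sum_eq_zero fun j _ => ?_
      have := congrFun (hφ' (z j)) j
      rw [act_apply] at this
      exact this)
    refine ⟨LinearMap.pi W, ?_⟩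
    apply LinearMap.ext; intro x
    change actA A (m.B n) J (LinearMap.pi W x) = φ x
    rw [actA_eq]
    funext i
    exact hW i x


theorem ExB_of_pos {R : Type u} [CommRing R] {T J : Type u} [AddCommGroup T] [Module R T]
    [AddCommGroup J] [Module R J] (m : MC R T) (hJ : Module.Injective R J) {n : ℤ} (hn : 0 ≤ n)
    (v : Fin (m.k (n+1)) → J) (hv : act (m.B (n+1)) J v = 0) : ∃ w, act (m.B n) J w = v := by
  refine exists_w hJ (m.B n) v fun x hx => ?_
  obtain ⟨z, rfl⟩ := m.pos n hn x hx
  rw [← act_pair', hv]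
  simp

theorem ExBT_of_neg {R : Type u} [CommRing R] {T J : Type u} [AddCommGroup T] [Module R T]
    [AddCommGroup J] [Module R J] (m : MC R T) (hJ : Module.Injective R J) {n : ℤ} (hn : n < 0)
    (v : Fin (m.k (n+1)) → J) (hv : act (m.B n).transpose J v = 0) :
    ∃ w, act (m.B (n+1)).transpose J w = v := by
  refine exists_w hJ (m.B (n+1)).transpose v fun x hx => ?_
  obtain ⟨z, rfl⟩ := m.neg n hn x hx
  have := act_pair' (m.B n).transpose v z
  rw [hv, Matrix.transpose_transpose] at this
  rw [← this]
  simp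

theorem TR_of_GI [IsNoetherianRing R] (hAR : IR R A) (m : MC R T) (hJ : Module.Injective A J)
    (hGI : GI A (LinearMap.ker (actA A (m.B 0) J))) (q : Ideal R) [hqp : q.IsPrime] (e : J)
    (he : e ≠ 0) (hq : ∀ r ∈ q, r • e = 0) : m.TR q := by
  have hJR : Module.Injective R J := hAR J hJ
  have h1q : (1 : R) ∉ q := (Ideal.ne_top_iff_one q).1 hqp.ne_top
  have hpos : ∀ n : ℤ, 0 ≤ n → LinearMap.range (actA A (m.B n) J) =
      LinearMap.ker (actA A (m.B (n+1)) J) := by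
    intro n hn
    refine le_antisymm (act_range_le m n) fun v hv => ?_
    rw [LinearMap.mem_ker, actA_eq] at hv
    obtain ⟨w, hw⟩ := ExB_of_pos m hJR hn v hv
    exact ⟨w, by rw [actA_eq, hw]⟩
  have hGpos : ∀ n : ℤ, 0 ≤ n → GI A (LinearMap.ker (actA A (m.B n) J)) := by
    intro n hn
    induction n, hn using Int.leInduction with
    | base => exact hGI
    | succ n hn ih =>
      obtain ⟨k, hk, hse⟩ := SE.of_range_eq (hpos n hn)
      exact GI.coker hse ih (GI.of_injective (injective_finpow hJ _))
  have hneg : ∀ n : ℤ, n < 0 → GI A (LinearMap.ker (actA A (m.B (n+1)) J)) →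
      LinearMap.range (actA A (m.B n) J) = LinearMap.ker (actA A (m.B (n+1)) J) ∧
      GI A (LinearMap.ker (actA A (m.B n) J)) := by
    intro n hn hG
    have key : ∀ (I : Type u) [AddCommGroup I] [Module A I], Module.Injective A I →
        ∀ φ : I →ₗ[A] (Fin (m.k (n+1)) → J), (∀ x, actA A (m.B (n+1)) J (φ x) = 0) →
        ∃ ψ : I →ₗ[A] (Fin (m.k n) → J), ∀ x, actA A (m.B n) J (ψ x) = φ x := by
      intro I _ _ hI φ hφ
      let : Module R I := Module.compHom I (algebraMap R A)
      have : IsScalarTower R A I := ⟨fun r a x => by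
        rw [Algebra.smul_def, mul_smul]; rfl⟩
      have hIR : Module.Injective R I := hAR I hI
      have hφ' : ∀ x : I, act (m.B (n+1)) J (φ x) = 0 := fun x => by
        rw [← actA_eq (A := A)]; exact hφ x
      obtain ⟨W, hW⟩ := exists_WA hJ (m.B n) (fun i => (LinearMap.proj i).comp φ) (by
        intro x hx
        obtain ⟨z, hz⟩ := ExBT_of_neg m hIR hn x hx
        have h2 : ∀ i, ((LinearMap.proj i : (Fin (m.k (n+1)) → J) →ₗ[A] J).comp φ)
              (x i) = ∑ j, m.B (n+1) j i • φ (z j) i := by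
          intro i
          rw [← hz, act_apply, map_sum]
          refine Finset.sum_congr rfl fun j _ => ?_
          rw [smulR_map]; rfl
        rw [Finset.sum_congr rfl fun i _ => h2 i, Finset.sum_comm]
        refine Finset.sum_eq_zero fun j _ => ?_
        have := congrFun (hφ' (z j)) j
        rw [act_apply] at this
        exact this)
      refine ⟨LinearMap.pi W, fun x => ?_⟩
      rw [actA_eq]
      funext i
      exact hW i x
    have hr : LinearMap.range (actA A (m.B n) J) = LinearMap.ker (actA A (m.B (n+1)) J) := by
      refine le_antisymm (act_range_le m n) fun v hv => ?_
      obtain ⟨N', X, f, g, hX, -, hse⟩ := hG.prv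
      obtain ⟨x, hx⟩ := hse.surj ⟨v, hv⟩
      obtain ⟨ψ, hψ⟩ := key X hX ((Submodule.subtype _).comp g) (fun x => (g x).2)
      refine ⟨ψ x, ?_⟩
      rw [hψ]
      exact congrArg Subtype.val hx
    refine ⟨hr, ?_⟩
    obtain ⟨k, hk, hse⟩ := SE.of_range_eq hr
    refine GI.kernel hse (injective_finpow hJ _) hG ?_
    intro I _ _ hI
    refine EV.one_of_lift hse (EV.of_injective (injective_finpow hJ _) 0) fun φ => ?_
    obtain ⟨ψ, hψ⟩ := key I hI ((Submodule.subtype _).comp φ) (fun x => (φ x).2)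
    refine ⟨ψ, ?_⟩
    apply LinearMap.ext; intro x
    apply Subtype.ext
    rw [LinearMap.comp_apply, hk, hψ]; rfl
  have hGneg : ∀ n : ℕ, GI A (LinearMap.ker (actA A (m.B (-n)) J)) := by
    intro n
    induction n with
    | zero => simpa using hGI
    | succ n ih =>
      have h1 : (-((n+1 : ℕ) : ℤ)) < 0 := by omega
      refine (hneg _ h1 ?_).2
      have : (-((n+1 : ℕ) : ℤ)) + 1 = -(n : ℤ) := by push_cast; ring
      rw [this]; exact ih
  refine ⟨fun n => ?_, fun n => ?_⟩
  · refine tr_uniform _ _ fun v hv => ?_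
    rcases lt_or_ge n 0 with hn | hn
    · obtain ⟨w, hw⟩ := m.neg n hn v hv
      exact ⟨1, h1q, w, by rw [one_smul, hw]⟩
    · by_contra hcon
      obtain ⟨y, hy1, hy2⟩ := exists_pairing hJR he hq _ _ hcon
      obtain ⟨k, hk, hse⟩ := SE.of_range_eq (hpos n hn)
      let φ : J →ₗ[A] (Fin (m.k (n+1)) → J) := LinearMap.pi fun i => algebraMap R A (v i) • LinearMap.id
      have hφ : ∀ x i, φ x i = v i • x := fun x i => by
        change algebraMap R A (v i) • x = _
        rw [algebraMap_smul]
      have hφk : ∀ x, φ x ∈ LinearMap.ker (actA A (m.B (n+1)) J) := by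
        intro x
        rw [LinearMap.mem_ker, actA_eq]
        funext i
        rw [act_apply]
        have := congrFun hv i
        rw [act_apply] at this
        simp only [hφ, smul_smul, ← Finset.sum_smul]
        simp only [smul_eq_mul] at this
        rw [this]; simp
      obtain ⟨ψ, hψ⟩ := EV.lift hse ((hGpos n hn).ev hJ) (φ.codRestrict _ hφk)
      have hψ' : ∀ x, act (m.B n) J (ψ x) = φ x := fun x => by
        rw [← actA_eq (A := A), ← hk]
        exact congrArg Subtype.val (LinearMap.congr_fun hψ x)
      apply hy2
      have h3 : ∀ i, v i • y i = ∑ j, m.B n i j • ψ (y i) j := fun i => by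
        rw [← hφ, ← hψ', act_apply]
      rw [Finset.sum_congr rfl fun i _ => h3 i, Finset.sum_comm]
      refine Finset.sum_eq_zero fun j _ => ?_
      have h4 : ψ (∑ i, m.B n i j • y i) j = ∑ i, m.B n i j • ψ (y i) j := by
        rw [map_sum, Finset.sum_apply]
        refine Finset.sum_congr rfl fun i _ => ?_
        rw [smulR_map]; rfl
      rw [← h4]
      have := congrFun hy1 j
      rw [act_apply] at this
      simp only [Matrix.transpose_apply] at this
      rw [this]; simp
  · refine tr_uniform _ _ fun v hv => ?_
    rcases lt_or_ge n 0 with hn | hn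
    · by_contra hcon
      obtain ⟨y, hy1, hy2⟩ := exists_pairing hJR he hq _ _ hcon
      rw [Matrix.transpose_transpose] at hy1
      have hG1 : GI A (LinearMap.ker (actA A (m.B (n+1)) J)) := by
        have := hGneg (-(n+1)).toNat
        rwa [Int.toNat_of_nonneg (by omega), neg_neg] at this
      have hy3 : y ∈ LinearMap.range (actA A (m.B n) J) := by
        rw [(hneg n hn hG1).1, LinearMap.mem_ker, actA_eq, hy1]
      obtain ⟨w, rfl⟩ := hy3
      apply hy2
      rw [actA_eq, act_pair', hv]
      simp
    · obtain ⟨w, hw⟩ := m.pos n hn v hv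
      exact ⟨1, h1q, w, by rw [one_smul, hw]⟩

theorem IR_self (R : Type u) [CommRing R] : IR R R := by
  intro I _ m1 m2 ht h
  have : m1 = m2 := by
    refine Module.ext (funext fun r => funext fun x => ?_)
    have := ht.smul_assoc r (1 : R) x
    rw [smul_eq_mul, mul_one, one_smul] at this
    exact this.symm
  subst this
  exact h

theorem IR_loc {R : Type u} [CommRing R] (S : Submonoid R) : IR R (Localization S) := by
  intro I _ _ _ _ h
  refine injective_of_EV fun L => ?_
  rw [EV.loc_iff S]
  exact EV.of_injective h 0

end
end GGP

namespace GGP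
section
open GG
variable {R : Type u} [CommRing R] 

theorem loc_mk_eq_zero {K : Type u} [AddCommGroup K] [Module R K] {S : Submonoid R} {k : K} :
    LocalizedModule.mkLinearMap S K k = 0 ↔ ∃ s ∈ S, s • k = 0 := by
  rw [IsLocalizedModule.eq_zero_iff S (LocalizedModule.mkLinearMap S K)]
  constructor
  · rintro ⟨s, hs⟩; exact ⟨s, s.2, hs⟩
  · rintro ⟨s, h, hs⟩; exact ⟨⟨s, h⟩, hs⟩

theorem loc_exists_mk {K : Type u} [AddCommGroup K] [Module R K] {S : Submonoid R}
    (x : LocalizedModule S K) : ∃ (k : K) (s : R), s ∈ S ∧ s • x = LocalizedModule.mkLinearMap S K k := by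
  obtain ⟨⟨k, s⟩, h⟩ := IsLocalizedModule.surj S (LocalizedModule.mkLinearMap S K) x
  exact ⟨k, s, s.2, h⟩

theorem mem_supp_iff {K : Type u} [AddCommGroup K] [Module R K] {p : PrimeSpectrum R} :
    p ∈ Module.support R K ↔ ∃ k : K, ∀ s, s • k = 0 → s ∈ p.asIdeal := by
  rw [Module.mem_support_iff_exists_annihilator]
  apply exists_congr
  intro k
  constructor
  · intro h s hs
    exact h (by rw [Submodule.mem_annihilator_span_singleton]; exact hs)
  · intro h s hs
    rw [Submodule.mem_annihilator_span_singleton] at hs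
    exact h s hs

theorem torsion_of_min {K : Type u} [AddCommGroup K] [Module R K] {p : PrimeSpectrum R}
    (hmin : ∀ q ∈ Module.support R K, q ≤ p → q = p) {r : R} (hr : r ∈ p.asIdeal)
    (x : LocalizedModule p.asIdeal.primeCompl K) : ∃ n : ℕ, r ^ n • x = 0 := by
  by_contra hcon
  push Not at hcon
  obtain ⟨k, s, hs, hk⟩ := loc_exists_mk x
  have h1 : ∀ n : ℕ, ∀ t ∉ p.asIdeal, (t * r ^ n) • k ≠ 0 := by
    intro n t ht h0
    apply hcon n
    apply (loc_smul_bij p.asIdeal.primeCompl ⟨s * t, mul_mem hs ht⟩).1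
    show (s * t) • r ^ n • x = (s * t) • 0
    rw [smul_zero, smul_smul, show s * t * r ^ n = (t * r ^ n) * s by ring, mul_smul, hk,
      ← map_smul, h0, map_zero]
  have hd : Disjoint ((R ∙ k).annihilator : Set R) ((p.asIdeal.primeCompl ⊔ Submonoid.powers r : Submonoid R) : Set R) := by
    rw [Set.disjoint_left]
    intro a ha ha'
    obtain ⟨t, ht, _, ⟨n, rfl⟩, rfl⟩ := Submonoid.mem_sup.1 ha'
    exact h1 n t ht (Submodule.mem_annihilator_span_singleton _ _ |>.1 ha)
  obtain ⟨q, hq, hkq, hqd⟩ := Ideal.exists_le_prime_disjoint _ _ hd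
  have h2 : (⟨q, hq⟩ : PrimeSpectrum R) ∈ Module.support R K :=
    Module.mem_support_iff_exists_annihilator.2 ⟨k, hkq⟩
  have h3 : (⟨q, hq⟩ : PrimeSpectrum R) ≤ p := by
    intro a ha
    by_contra h
    exact Set.disjoint_left.1 hqd ha (Submonoid.mem_sup_left (S := p.asIdeal.primeCompl) (T := Submonoid.powers r) h)
  have h4 := hmin _ h2 h3
  have : r ∈ q := by
    have : r ∈ (⟨q, hq⟩ : PrimeSpectrum R).asIdeal := by rw [h4]; exact hr
    exact this
  exact Set.disjoint_left.1 hqd this (Submonoid.mem_sup_right (S := p.asIdeal.primeCompl) (T := Submonoid.powers r) ⟨1, by simp⟩)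

variable {K : Type u} [AddCommGroup K] [Module R K] {S : Set (PrimeSpectrum R)}

theorem range_theta_le [IsNoetherianRing R] (hmin : ∀ p ∈ S, ∀ q ∈ Module.support R K, q ≤ p → q = p) :
    LinearMap.range (thetaFull R S K) ≤ finSupp R S K := by
  rintro _ ⟨k, rfl⟩
  have hfin := Ideal.finite_minimalPrimes_of_isNoetherianRing R (R ∙ k).annihilator
  have : ({p : S | thetaFull R S K k p ≠ 0}).Finite := by
    refine Set.Finite.of_finite_image (f := fun p : S => p.1.asIdeal) (hfin.subset ?_) ?_
    · rintro _ ⟨p, hp, rfl⟩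
      have hp' : LocalizedModule.mkLinearMap p.1.asIdeal.primeCompl K k ≠ 0 := hp
      rw [Ne, loc_mk_eq_zero] at hp'
      push Not at hp'
      have hle : (R ∙ k).annihilator ≤ p.1.asIdeal := by
        intro a ha
        by_contra h
        exact hp' a h (Submodule.mem_annihilator_span_singleton _ _ |>.1 ha)
      refine ⟨⟨p.1.2, hle⟩, ?_⟩
      rintro q ⟨hq, hq2⟩ hqp
      have := hmin p.1 p.2 ⟨q, hq⟩ (Module.mem_support_iff_exists_annihilator.2 ⟨k, hq2⟩) hqp
      show p.1.asIdeal ≤ q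
      rw [← this]
    · intro a _ b _ h
      exact Subtype.ext (PrimeSpectrum.ext h)
  exact this

theorem finSupp_kill (hmin : ∀ p ∈ S, ∀ q ∈ Module.support R K, q ≤ p → q = p)
    (q : PrimeSpectrum R) (y : locProd R S K) (hy : y ∈ finSupp R S K)
    (h : ∀ p : S, p.1 ≤ q → y p = 0) : ∃ s ∉ q.asIdeal, s • y = 0 := by
  classical
  have hfin : ({p : S | y p ≠ 0}).Finite := hy
  have h1 : ∀ p : S, ∃ s ∉ q.asIdeal, s • y p = 0 := by
    intro p
    by_cases hp : p.1 ≤ q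
    · exact ⟨1, q.asIdeal.ne_top_iff_one.1 q.2.ne_top, by rw [h p hp, smul_zero]⟩
    · obtain ⟨r, hr, hrq⟩ := Set.not_subset.1 hp
      obtain ⟨n, hn⟩ := torsion_of_min (hmin p.1 p.2) hr (y p)
      exact ⟨r ^ n, fun h => hrq (q.2.mem_of_pow_mem n h), hn⟩
  choose s hs hs2 using h1
  refine ⟨∏ p ∈ hfin.toFinset, s p, ?_, ?_⟩
  · intro hcon
    obtain ⟨p, -, hp⟩ := (Ideal.IsPrime.prod_mem_iff (hp := q.2)).1 hcon
    exact hs p hp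
  · funext p
    by_cases hp : y p = 0
    · simp [hp]
    · have : p ∈ hfin.toFinset := by simpa using hp
      rw [← Finset.prod_erase_mul _ _ this, mul_smul]
      show (∏ x ∈ hfin.toFinset.erase p, s x) • (s p • y p) = 0
      rw [hs2, smul_zero]

theorem supp_next (hmin : ∀ p ∈ S, ∀ q ∈ Module.support R K, q ≤ p → q = p)
    (hrange : LinearMap.range (thetaFull R S K) ≤ finSupp R S K)
    {q : PrimeSpectrum R} (hq : q ∈ Module.support R (nextKType R S K)) :
    (∃ p ∈ S, p ∈ Module.support R K ∧ p ≤ q) ∧ q ∉ S := by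
  classical
  obtain ⟨z, hz⟩ := mem_supp_iff.1 hq
  obtain ⟨⟨y, hy⟩, rfl⟩ := Submodule.mkQ_surjective _ z
  constructor
  · by_contra hcon
    push Not at hcon
    obtain ⟨s, hs, hsy⟩ := finSupp_kill hmin q y hy (by
      intro p hp
      by_contra h0
      refine hcon p.1 p.2 ?_ hp
      rw [Module.mem_support_iff]
      exact ⟨⟨y p, 0, h0⟩⟩)
    apply hs
    apply hz
    rw [← map_smul]
    have : s • (⟨y, hy⟩ : finSupp R S K) = 0 := Subtype.ext hsy
    rw [this, map_zero]
  · intro hqS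
    obtain ⟨k, t, ht, hk⟩ := loc_exists_mk (y ⟨q, hqS⟩)
    obtain ⟨s, hs, hsy⟩ := finSupp_kill hmin q (t • y - thetaFull R S K k)
      (sub_mem (Submodule.smul_mem _ _ hy) (hrange ⟨k, rfl⟩)) (by
      intro p hp
      by_cases hpq : p = ⟨q, hqS⟩
      · subst hpq
        show t • y _ - LocalizedModule.mkLinearMap _ K k = 0
        rw [hk, sub_self]
      · have : Subsingleton (LocalizedModule p.1.asIdeal.primeCompl K) := by
          rw [← Module.notMem_support_iff]
          intro h
          exact hpq (Subtype.ext (hmin q hqS p.1 h hp))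
        exact Subsingleton.elim _ _)
    have h2 : s * t ∈ q.asIdeal := by
      apply hz
      rw [← map_smul]
      apply (Submodule.Quotient.mk_eq_zero _).2
      refine ⟨s • k, ?_⟩
      rw [map_smul]
      show _ = (s * t) • y
      rw [mul_smul, ← sub_eq_zero, ← smul_sub, ← neg_sub, smul_neg, hsy, neg_zero]
    rcases q.2.mem_or_mem h2 with h | h
    · exact hs h
    · exact ht h

end
end GGP

namespace GGP
section
open GG
variable {R : Type u} [CommRing R] 

/-- direct sums of `p`-primary `R_p`-modules, `p ∈ S`. -/
def TypeOn (S : Set (PrimeSpectrum R)) (N : Type u) [AddCommGroup N] [Module R N] : Prop :=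
  ∃ P : PrimeSpectrum R → ModuleCat.{u} R,
    (∀ p, ∀ s ∉ p.asIdeal, Function.Bijective fun x : P p => s • x) ∧
    (∀ p, ∀ r ∈ p.asIdeal, ∀ x : P p, ∃ n : ℕ, r ^ n • x = 0) ∧
    (∀ p ∉ S, Subsingleton (P p)) ∧ Nonempty (N ≃ₗ[R] finPi R (fun p => P p))

theorem finPi_kill {P : PrimeSpectrum R → Type u} [∀ p, AddCommGroup (P p)] [∀ p, Module R (P p)]
    (ht : ∀ p, ∀ r ∈ p.asIdeal, ∀ x : P p, ∃ n : ℕ, r ^ n • x = 0)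
    (q : PrimeSpectrum R) (y : finPi R P)
    (h : ∀ p, p ≤ q → y.1 p = 0) : ∃ s ∉ q.asIdeal, s • y = 0 := by
  classical
  have hfin : ({p | y.1 p ≠ 0}).Finite := y.2
  have h1 : ∀ p, ∃ s ∉ q.asIdeal, s • y.1 p = 0 := by
    intro p
    by_cases hp : p ≤ q
    · exact ⟨1, q.asIdeal.ne_top_iff_one.1 q.2.ne_top, by rw [h p hp, smul_zero]⟩
    · obtain ⟨r, hr, hrq⟩ := Set.not_subset.1 hp
      obtain ⟨n, hn⟩ := ht p r hr (y.1 p)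
      exact ⟨r ^ n, fun h => hrq (q.2.mem_of_pow_mem n h), hn⟩
  choose s hs hs2 using h1
  refine ⟨∏ p ∈ hfin.toFinset, s p, ?_, ?_⟩
  · intro hcon
    obtain ⟨p, -, hp⟩ := (Ideal.IsPrime.prod_mem_iff (hp := q.2)).1 hcon
    exact hs p hp
  · apply Subtype.ext
    funext p
    show (∏ x ∈ hfin.toFinset, s x) • y.1 p = 0
    by_cases hp : y.1 p = 0
    · simp [hp]
    · have : p ∈ hfin.toFinset := by simpa using hp
      rw [← Finset.prod_erase_mul _ _ this, mul_smul, hs2, smul_zero]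

theorem TypeOn.supp {S : Set (PrimeSpectrum R)} {N : Type u} [AddCommGroup N] [Module R N]
    (h : TypeOn S N) {q : PrimeSpectrum R} (hq : q ∈ Module.support R N) : ∃ p ∈ S, p ≤ q := by
  obtain ⟨P, h1, h2, h3, ⟨e⟩⟩ := h
  obtain ⟨x, hx⟩ := mem_supp_iff.1 hq
  by_contra hcon
  push Not at hcon
  obtain ⟨s, hs, hs2⟩ := finPi_kill h2 q (e x) (by
    intro p hp
    have := h3 p (fun h => hcon p h hp)
    exact Subsingleton.elim _ _)
  apply hs
  apply hx
  apply e.injective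
  rw [map_smul, hs2, map_zero]

/-- single element -/
noncomputable def finSingle {ι : Type u} (P : ι → Type u) [∀ p, AddCommGroup (P p)] [∀ p, Module R (P p)]
    (p : ι) : P p →ₗ[R] finPi R P := by
  classical
  exact (LinearMap.single R P p).codRestrict _ (by
    intro x
    refine (Set.finite_singleton p).subset ?_
    intro q hq
    by_contra h
    apply hq
    have h' : q ≠ p := h
    simp [h'])

theorem finSingle_same {ι : Type u} (P : ι → Type u) [∀ p, AddCommGroup (P p)] [∀ p, Module R (P p)]
    (p : ι) (x : P p) : (finSingle (R := R) P p x).1 p = x := by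
  classical
  exact Pi.single_eq_same p x

theorem finSingle_ne {ι : Type u} (P : ι → Type u) [∀ p, AddCommGroup (P p)] [∀ p, Module R (P p)]
    (p q : ι) (h : q ≠ p) (x : P p) : (finSingle (R := R) P p x).1 q = 0 := by
  classical
  exact Pi.single_eq_of_ne h x

/-- evaluation -/
noncomputable def finEval {ι : Type u} (P : ι → Type u) [∀ p, AddCommGroup (P p)] [∀ p, Module R (P p)]
    (p : ι) : finPi R P →ₗ[R] P p := (LinearMap.proj p).comp (finPi R P).subtype

theorem finEval_apply {ι : Type u} (P : ι → Type u) [∀ p, AddCommGroup (P p)] [∀ p, Module R (P p)]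
    (p : ι) (x : finPi R P) : finEval P p x = x.1 p := rfl

variable {Z Y C : Type u} [AddCommGroup Z] [Module R Z] [AddCommGroup Y] [Module R Y]
  [AddCommGroup C] [Module R C] {S : Set (PrimeSpectrum R)}

theorem cousin_S3 {f : Z →ₗ[R] Y} {g : Y →ₗ[R] C} (h : SE f g) (hY : TypeOn S Y)
    (hanti : ∀ p ∈ S, ∀ q ∈ S, q ≤ p → q = p) (hC : ∀ p ∈ S, p ∉ Module.support R C) :
    LinearMap.range (thetaFull R S Z) ≤ finSupp R S Z ∧ Function.Injective (thetaFull R S Z) ∧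
    Nonempty (finSupp R S Z ≃ₗ[R] Y) ∧ Nonempty (nextKType R S Z ≃ₗ[R] C) := by
  classical
  obtain ⟨P, h1, h2, h3, ⟨e⟩⟩ := hY
  have hloc : ∀ p : S, IsLocalizedModule p.1.asIdeal.primeCompl
      ((finEval (R := R) (fun p => P p) p.1).comp (e.toLinearMap.comp f)) := by
    intro p
    refine ⟨?_, ?_, ?_⟩
    · intro s
      exact (Module.End.isUnit_iff _).2 (h1 p.1 s s.2)
    · intro y
      have hc := hC p.1 p.2
      rw [Module.notMem_support_iff'] at hc
      obtain ⟨s, hs, hs2⟩ := hc (g (e.symm (finSingle (fun p => P p) p.1 y)))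
      rw [← map_smul] at hs2
      obtain ⟨z, hz⟩ := h.lift_elem hs2
      refine ⟨⟨z, s, hs⟩, ?_⟩
      show s • y = finEval (fun p => P p) p.1 (e (f z))
      rw [hz, map_smul, LinearEquiv.apply_symm_apply, map_smul, finEval_apply, finSingle_same]
    · intro z1 z2 hz
      obtain ⟨s, hs, hs2⟩ := finPi_kill (P := fun p => P p) h2 p.1 (e (f (z1 - z2))) (by
        intro q hq
        by_cases hqS : q ∈ S
        · have := hanti p.1 p.2 q hqS hq
          subst this
          have hz' : finEval (fun p => P p) p.1 (e (f z1)) = finEval (fun p => P p) p.1 (e (f z2)) := hz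
          rw [← finEval_apply, map_sub, map_sub, map_sub, hz', sub_self]
        · have := h3 q hqS
          exact Subsingleton.elim _ _)
      refine ⟨⟨s, hs⟩, ?_⟩
      show s • z1 = s • z2
      rw [← map_smul, ← map_smul] at hs2
      have h0 : s • (z1 - z2) = 0 := by
        apply h.inj
        apply e.injective
        rw [hs2, map_zero, map_zero]
      rwa [smul_sub, sub_eq_zero] at h0
  let iso : ∀ p : S, LocalizedModule p.1.asIdeal.primeCompl Z ≃ₗ[R] P p.1 := fun p =>
    have := hloc p
    IsLocalizedModule.iso p.1.asIdeal.primeCompl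
      ((finEval (R := R) (fun p => P p) p.1).comp (e.toLinearMap.comp f))
  have hiso : ∀ (p : S) (z : Z), iso p (LocalizedModule.mkLinearMap _ Z z) = (e (f z)).1 p.1 := by
    intro p z
    have := hloc p
    exact IsLocalizedModule.iso_mk_one _ ((finEval (R := R) (fun p => P p) p.1).comp (e.toLinearMap.comp f)) z
  let E0 : Y →ₗ[R] locProd R S Z :=
    LinearMap.pi fun p => (iso p).symm.toLinearMap.comp ((finEval (fun p => P p) p.1).comp e.toLinearMap)
  have hE0 : ∀ y p, E0 y p = (iso p).symm ((e y).1 p.1) := fun y p => rfl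
  have hmem : ∀ y, E0 y ∈ finSupp R S Z := by
    intro y
    have : ({p : PrimeSpectrum R | (e y).1 p ≠ 0}).Finite := (e y).2
    refine Set.Finite.of_finite_image (f := fun p : S => p.1) (this.subset ?_) Subtype.val_injective.injOn
    rintro _ ⟨p, hp, rfl⟩
    intro h0
    apply hp
    rw [hE0, h0, map_zero]
  let E : Y →ₗ[R] finSupp R S Z := E0.codRestrict _ hmem
  have hE : Function.Bijective E := by
    constructor
    · rw [injective_iff_map_eq_zero]
      intro y hy
      have hy' : E0 y = 0 := congrArg Subtype.val hy
      apply e.injective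
      rw [map_zero]
      apply Subtype.ext
      funext p
      by_cases hp : p ∈ S
      · have := congrFun hy' ⟨p, hp⟩
        rw [hE0] at this
        exact (LinearEquiv.map_eq_zero_iff _).1 this
      · have := h3 p hp
        exact Subsingleton.elim _ _
    · intro w
      let v : Π p, P p := fun p => if hp : p ∈ S then iso ⟨p, hp⟩ (w.1 ⟨p, hp⟩) else 0
      have hv : v ∈ finPi R (fun p => P p) := by
        have : ({p : S | w.1 p ≠ 0}).Finite := w.2
        refine (this.image (fun p => p.1)).subset ?_
        intro p hp
        have hp' : v p ≠ 0 := hp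
        by_cases hpS : p ∈ S
        · refine ⟨⟨p, hpS⟩, ?_, rfl⟩
          intro h0
          apply hp'
          simp only [v, dif_pos hpS]
          rw [h0, map_zero]
        · exact (hp' (by simp only [v, dif_neg hpS])).elim
      refine ⟨e.symm ⟨v, hv⟩, ?_⟩
      apply Subtype.ext
      funext p
      show E0 _ p = w.1 p
      rw [hE0, LinearEquiv.apply_symm_apply]
      simp only [v, dif_pos p.2]
      exact (iso p).symm_apply_apply _
  have hθ : ∀ z, E0 (f z) = thetaFull R S Z z := by
    intro z
    funext p
    rw [hE0, ← hiso, LinearEquiv.symm_apply_apply]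
    rfl
  have hr : LinearMap.range (thetaFull R S Z) ≤ finSupp R S Z := by
    rintro _ ⟨z, rfl⟩
    rw [← hθ]
    exact hmem _
  have hi : Function.Injective (thetaFull R S Z) := by
    intro a b hab
    apply h.inj
    apply hE.1
    apply Subtype.ext
    show E0 _ = E0 _
    rw [hθ, hθ, hab]
  let EE := LinearEquiv.ofBijective E hE
  refine ⟨hr, hi, ⟨EE.symm⟩, ?_⟩
  have hse1 : SE (E.comp f) (Submodule.mkQ (Submodule.comap (finSupp R S Z).subtype (LinearMap.range (thetaFull R S Z)))) := by
    refine ⟨hE.1.comp h.inj, ?_, Submodule.mkQ_surjective _⟩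
    intro y
    rw [Submodule.mkQ_apply, Submodule.Quotient.mk_eq_zero]
    constructor
    · rintro ⟨z, hz⟩
      refine ⟨z, Subtype.ext ?_⟩
      show E0 (f z) = y.1
      rw [hθ, hz]; rfl
    · rintro ⟨z, rfl⟩
      exact ⟨z, (hθ z).symm⟩
  have hse2 : SE (E.comp f) (g.comp EE.symm.toLinearMap) := by
    refine ⟨hE.1.comp h.inj, ?_, h.surj.comp EE.symm.surjective⟩
    intro y
    obtain ⟨y, rfl⟩ := hE.2 y
    have : EE.symm (E y) = y := EE.symm_apply_apply y
    show g (EE.symm (E y)) = 0 ↔ _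
    rw [this, h.ex]
    constructor
    · rintro ⟨z, rfl⟩; exact ⟨z, rfl⟩
    · rintro ⟨z, hz⟩; exact ⟨z, hE.1 hz⟩
  exact hse1.coker_unique hse2

/-- filtrations -/
structure Filt (F : ℕ → Set (PrimeSpectrum R)) : Prop where
  anti : ∀ n, F (n + 1) ⊆ F n
  min : ∀ n, ∀ p ∈ F n \ F (n + 1), ∀ q ∈ F n, q ≤ p → q = p
  up : ∀ n, ∀ p ∈ F n, ∀ q, p ≤ q → q ∈ F n

/-- exactness of the Cousin complex -/
def CExact (F : ℕ → Set (PrimeSpectrum R)) (M : ModuleCat.{u} R) : Prop :=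
  ∀ n, LinearMap.range (cousinTheta R F M n) ≤ finSupp R (F n \ F (n + 1)) (cousinK R F M n) ∧
    Function.Injective (cousinTheta R F M n)

theorem cexact_iff (F : ℕ → Set (PrimeSpectrum R)) (M : ModuleCat.{u} R)
    (P : ModuleCat.{u} R → Prop) : CousinResolves R F M P ↔
      CExact F M ∧ ∀ n, P (ModuleCat.of R (cousinC R F M n)) := by
  have key : ∀ n, (LinearMap.ker (cousinD R F M n) =
    Submodule.comap (finSupp R (F n \ F (n + 1)) (cousinK R F M n)).subtype
      (LinearMap.range (cousinTheta R F M n))) ↔ Function.Injective (cousinTheta R F M (n + 1)) := by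
    intro n
    let mq := (Submodule.mkQ (Submodule.comap (finSupp R (F n \ F (n + 1)) (cousinK R F M n)).subtype
      (LinearMap.range (thetaFull R (F n \ F (n + 1)) (cousinK R F M n)))))
    have hs : Function.Surjective mq := Submodule.mkQ_surjective _
    have hk : ∀ x, mq x = 0 ↔ x ∈ Submodule.comap (finSupp R (F n \ F (n + 1)) (cousinK R F M n)).subtype
      (LinearMap.range (cousinTheta R F M n)) := fun x => Submodule.Quotient.mk_eq_zero _
    have hD : ∀ x, cousinD R F M n x = cousinTheta R F M (n + 1) (mq x) := fun x => rfl
    rw [injective_iff_map_eq_zero]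
    constructor
    · intro h a ha
      obtain ⟨x, rfl⟩ := hs a
      have : x ∈ LinearMap.ker (cousinD R F M n) := by
        rw [LinearMap.mem_ker, hD]; exact ha
      rw [h] at this
      exact (hk x).2 this
    · intro h
      apply Submodule.ext
      intro x
      rw [← hk, LinearMap.mem_ker, hD]
      constructor
      · exact fun hx => h _ hx
      · intro hx; rw [hx]; exact map_zero _
  unfold CousinResolves CExact
  constructor
  · rintro ⟨h1, h2, h3, h4⟩
    refine ⟨fun n => ⟨h1 n, ?_⟩, h4⟩
    rcases n with _ | n
    · exact h2
    · exact (key n).1 (h3 n)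
  · rintro ⟨h1, h2⟩
    exact ⟨fun n => (h1 n).1, (h1 0).2, fun n => (key n).2 (h1 (n + 1)).2, h2⟩

theorem cousin_unique {F : ℕ → Set (PrimeSpectrum R)} (hF : Filt F) (M : ModuleCat.{u} R)
    (Z Y : ℕ → ModuleCat.{u} R) (f : ∀ n, Z n →ₗ[R] Y n) (g : ∀ n, Y n →ₗ[R] Z (n + 1))
    (h : ∀ n, SE (f n) (g n)) (hY : ∀ n, TypeOn (F n \ F (n + 1)) (Y n)) (e : M ≃ₗ[R] Z 0) :
    CExact F M ∧ ∀ n, Nonempty (cousinC R F M n ≃ₗ[R] Y n) := by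
  have key : ∀ n, ∀ K : ModuleCat.{u} R, Nonempty (K ≃ₗ[R] Z n) →
      LinearMap.range (thetaFull R (F n \ F (n + 1)) K) ≤ finSupp R (F n \ F (n + 1)) K ∧
      Function.Injective (thetaFull R (F n \ F (n + 1)) K) ∧
    Nonempty (finSupp R (F n \ F (n + 1)) K ≃ₗ[R] Y n) ∧
    Nonempty (nextKType R (F n \ F (n + 1)) K ≃ₗ[R] Z (n + 1)) := by
    rintro n K ⟨e⟩
    refine cousin_S3 ((h n).equiv_left e) (hY n) ?_ ?_
    · intro p hp q hq hqp
      exact hF.min n p hp q hq.1 hqp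
    · intro p hp hps
      have := Module.support_subset_of_injective (f (n + 1)) (h (n + 1)).inj hps
      obtain ⟨q, hq, hqp⟩ := (hY (n + 1)).supp this
      exact hp.2 (hF.up _ q hq.1 p hqp)
  have hK : ∀ n, Nonempty (cousinK R F M n ≃ₗ[R] Z n) := by
    intro n
    induction n with
    | zero => exact ⟨e⟩
    | succ n ih => exact (key n _ ih).2.2.2
  exact ⟨fun n => ⟨(key n _ (hK n)).1, (key n _ (hK n)).2.1⟩, fun n => (key n _ (hK n)).2.2.1⟩

end
end GGP

namespace GGP
section
open GG
variable {R : Type u} [CommRing R] 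

theorem EV.zero_quot_iff {N : Type u} [AddCommGroup N] [Module R N] {I : Ideal R} :
    EV R 0 (R ⧸ I) N ↔ ∀ y : N, (∀ r ∈ I, r • y = 0) → y = 0 := by
  rw [EV.zero_iff]
  constructor
  · intro h y hy
    have := h (Submodule.liftQ I (LinearMap.toSpanSingleton R N y) (by
      intro r hr; simpa using hy r hr))
    have h1 := LinearMap.congr_fun this (Submodule.Quotient.mk 1)
    rw [LinearMap.zero_apply, Submodule.liftQ_apply] at h1
    simpa using h1
  · intro h f
    apply LinearMap.ext
    intro x
    obtain ⟨r, rfl⟩ := Submodule.Quotient.mk_surjective _ x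
    have h1 : f (Submodule.Quotient.mk 1) = 0 := by
      apply h
      intro s hs
      rw [← map_smul, ← Submodule.Quotient.mk_smul]
      have : (Submodule.Quotient.mk (s • (1 : R)) : R ⧸ I) = 0 := by
        rw [Submodule.Quotient.mk_eq_zero]; simpa using hs
      rw [this, map_zero]
    have h2 : (Submodule.Quotient.mk r : R ⧸ I) = r • Submodule.Quotient.mk 1 := by
      rw [← Submodule.Quotient.mk_smul]; simp
    rw [h2, map_smul, h1, smul_zero, LinearMap.zero_apply]

theorem exists_assoc [IsNoetherianRing R] {N : Type u} [AddCommGroup N] [Module R N]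
    (N' : Submodule R N) {x : N} (hx : x ∈ N') (h0 : x ≠ 0) :
    ∃ (p : PrimeSpectrum R), ∃ y ∈ N', y ≠ 0 ∧ ∀ r : R, r • y = 0 ↔ r ∈ p.asIdeal := by
  obtain ⟨P, hP, -⟩ := exists_le_isAssociatedPrime_of_isNoetherianRing R (⟨x, hx⟩ : N')
    (fun h => h0 (congrArg Subtype.val h))
  rw [isAssociatedPrime_iff] at hP
  obtain ⟨hp, y, rfl⟩ := hP
  refine ⟨⟨_, hp⟩, y.1, y.2, ?_, ?_⟩
  · intro h
    apply hp.ne_top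
    rw [Ideal.eq_top_iff_one]
    rw [Submodule.mem_colon_singleton]
    simp [Subtype.ext_iff, h]
  · intro r
    rw [Submodule.mem_colon_singleton, Submodule.mem_bot, Subtype.ext_iff]
    rfl

/-- depth vanishing -/
abbrev EL (p : PrimeSpectrum R) (i : ℕ) (K : Type u) [AddCommGroup K] [Module R K] : Prop :=
  EV R i (R ⧸ p.asIdeal) (LocalizedModule p.asIdeal.primeCompl K)

theorem SE.locR {A B C : Type u} [AddCommGroup A] [Module R A] [AddCommGroup B] [Module R B]
    [AddCommGroup C] [Module R C] {f : A →ₗ[R] B} {g : B →ₗ[R] C} (h : SE f g) (S : Submonoid R) :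
    SE ((lmap S f).restrictScalars R) ((lmap S g).restrictScalars R) :=
  ⟨(h.loc S).inj, (h.loc S).ex, (h.loc S).surj⟩

theorem theta_SE {K : Type u} [AddCommGroup K] [Module R K] {S : Set (PrimeSpectrum R)}
    (hr : LinearMap.range (thetaFull R S K) ≤ finSupp R S K)
    (hi : Function.Injective (thetaFull R S K)) :
    SE ((thetaFull R S K).codRestrict (finSupp R S K) (fun k => hr ⟨k, rfl⟩))
      (Submodule.mkQ (Submodule.comap (finSupp R S K).subtype (LinearMap.range (thetaFull R S K)))) := by
  refine ⟨fun a b hab => hi (congrArg Subtype.val hab), ?_, Submodule.mkQ_surjective _⟩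
  intro y
  rw [Submodule.mkQ_apply, Submodule.Quotient.mk_eq_zero]
  constructor
  · rintro ⟨z, hz⟩
    exact ⟨z, Subtype.ext hz⟩
  · rintro ⟨z, rfl⟩
    exact ⟨z, rfl⟩

/-! heights -/
section
variable (M : Type u) [AddCommGroup M] [Module R M]

theorem htM_eq {p : PrimeSpectrum R} (h : p ∈ Module.support R M) :
    htM R M p = Order.height (⟨p, h⟩ : ↥(Module.support R M)) := by
  unfold htM
  exact ciSup_pos h

theorem htM_succ_le {p q : PrimeSpectrum R} (hq : q ∈ Module.support R M)
    (hqp : q < p) : htM R M q + 1 ≤ htM R M p := by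
  have hp := Module.mem_support_mono hqp.le hq
  rw [htM_eq M hp, htM_eq M hq]
  exact Order.height_add_one_le (by exact hqp)

theorem htM_mono {p q : PrimeSpectrum R} (hq : q ∈ Module.support R M)
    (hqp : q ≤ p) : htM R M q ≤ htM R M p := by
  have hp := Module.mem_support_mono hqp hq
  rw [htM_eq M hp, htM_eq M hq]
  exact Order.height_mono hqp

theorem filt_height : Filt (heightFiltration R M) := by
  refine ⟨?_, ?_, ?_⟩
  · intro n p hp
    exact ⟨hp.1, le_trans (by exact_mod_cast Nat.le_succ n) hp.2⟩
  · intro n p hp q hq hqp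
    rcases hqp.lt_or_eq with h | h
    · exfalso
      apply hp.2
      refine ⟨hp.1.1, ?_⟩
      refine le_trans ?_ (htM_succ_le M hq.1 h)
      push_cast
      gcongr
      exact hq.2
    · exact h
  · intro n p hp q hpq
    exact ⟨Module.mem_support_mono hpq hp.1, hp.2.trans (htM_mono M hp.1 hpq)⟩

theorem htM_le_height (p : PrimeSpectrum R) : htM R M p ≤ Order.height p := by
  unfold htM
  refine iSup_le fun h => ?_
  exact Order.height_le_height_apply_of_strictMono (fun x : Module.support R M => x.1) (fun a b h => h) ⟨p, h⟩

end

variable [IsNoetherianRing R]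

theorem EV_finSupp {K : Type u} [AddCommGroup K] [Module R K] {S : Set (PrimeSpectrum R)}
    {p : PrimeSpectrum R} (hp : ∀ q ∈ S, ¬ p ≤ q) (i : ℕ) :
    EV R i (R ⧸ p.asIdeal) (finSupp R S K) := by
  rw [finSupp_eq_finPi]
  refine EV.finPi _ ?_
  intro q
  obtain ⟨u, hu, huq⟩ := Set.not_subset.1 (hp q.1 q.2)
  refine EV.of_mul_trick u ?_ (loc_smul_bij q.1.asIdeal.primeCompl ⟨u, huq⟩) i
  intro x
  obtain ⟨r, rfl⟩ := Submodule.Quotient.mk_surjective _ x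
  rw [← Submodule.Quotient.mk_smul, Submodule.Quotient.mk_eq_zero]
  exact Ideal.mul_mem_right _ _ hu

theorem Filt.not_le {F : ℕ → Set (PrimeSpectrum R)} (hF : Filt F) {n : ℕ} {p : PrimeSpectrum R}
    (hp : p ∈ F (n + 1)) : ∀ q ∈ F n \ F (n + 1), ¬ p ≤ q := by
  intro q hq hpq
  have := hF.min n q hq p (hF.anti n hp) hpq
  subst this
  exact hq.2 hp

theorem EL_step {F : ℕ → Set (PrimeSpectrum R)} (hF : Filt F) {K : Type u} [AddCommGroup K] [Module R K] {n : ℕ}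
    (hr : LinearMap.range (thetaFull R (F n \ F (n + 1)) K) ≤ finSupp R (F n \ F (n + 1)) K)
    (hi : Function.Injective (thetaFull R (F n \ F (n + 1)) K)) {p : PrimeSpectrum R} (hp : p ∈ F (n + 1))
    (i : ℕ) : EL p i (nextKType R (F n \ F (n + 1)) K) ↔ EL p (i + 1) K := by
  have hse := (theta_SE hr hi).locR p.asIdeal.primeCompl
  have hC : ∀ i, EV R i (R ⧸ p.asIdeal) (LocalizedModule p.asIdeal.primeCompl (finSupp R (F n \ F (n + 1)) K)) :=
    fun i => EV.localize _ (EV_finSupp (hF.not_le hp) i)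
  exact ⟨fun h => EV.left₂ hse h (hC _), fun h => EV.right₂ hse (hC _) h⟩

theorem Filt.anti_le {F : ℕ → Set (PrimeSpectrum R)} (hF : Filt F) {m n : ℕ} (h : m ≤ n) : F n ⊆ F m := by
  induction h with
  | refl => exact subset_rfl
  | step _ ih => exact (hF.anti _).trans ih

theorem EL_general {F : ℕ → Set (PrimeSpectrum R)} (hF : Filt F) (M : ModuleCat.{u} R) (n : ℕ)
    (h : ∀ j < n, LinearMap.range (cousinTheta R F M j) ≤ finSupp R (F j \ F (j + 1)) (cousinK R F M j) ∧
      Function.Injective (cousinTheta R F M j)) {p : PrimeSpectrum R} (hp : p ∈ F n) (i : ℕ) :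
    EL p i (cousinK R F M n) ↔ EL p (i + n) M := by
  induction n generalizing i with
  | zero => rfl
  | succ n ih =>
    have h1 := EL_step hF (h n (Nat.lt_succ_self n)).1 (h n (Nat.lt_succ_self n)).2 hp i
    rw [show i + (n + 1) = (i + 1) + n by ring,
      ← ih (fun j hj => h j (hj.trans (Nat.lt_succ_self n))) (hF.anti n hp)]
    exact h1

theorem EL_of_cexact {F : ℕ → Set (PrimeSpectrum R)} (hF : Filt F) (M : ModuleCat.{u} R)
    (h : CExact F M) {n : ℕ} {p : PrimeSpectrum R} (hp : p ∈ F (n + 1)) : EL p n M := by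
  have h1 := (EL_general hF M n (fun j _ => h j) (hF.anti n hp) 0)
  rw [zero_add] at h1
  apply h1.1
  apply EV.localize
  have hse := theta_SE (h n).1 (h n).2
  have hC := EV_finSupp (K := cousinK R F M n) (hF.not_le hp) 0
  rw [EV.zero_quot_iff] at hC ⊢
  intro y hy
  apply hse.inj
  rw [map_zero]
  apply hC
  intro r hr
  rw [← map_smul, hy r hr, map_zero]

theorem cexact_of_EL {F : ℕ → Set (PrimeSpectrum R)} (hF : Filt F) (M : ModuleCat.{u} R)
    (hS : Module.support R M ⊆ F 0)
    (h : ∀ n, ∀ p ∈ F (n + 1), EL p n M) :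
    CExact F M ∧ ∀ n, Module.support R (cousinK R F M n) ⊆ F n := by
  have key : ∀ n, (∀ j < n, LinearMap.range (cousinTheta R F M j) ≤ finSupp R (F j \ F (j + 1)) (cousinK R F M j) ∧
      Function.Injective (cousinTheta R F M j)) ∧ Module.support R (cousinK R F M n) ⊆ F n := by
    intro n
    induction n with
    | zero => exact ⟨fun j hj => by omega, hS⟩
    | succ n ih =>
      obtain ⟨ih, ihS⟩ := ih
      have hmin : ∀ p ∈ F n \ F (n + 1), ∀ q ∈ Module.support R (cousinK R F M n), q ≤ p → q = p :=
        fun p hp q hq hqp => hF.min n p hp q (ihS hq) hqp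
      have hr : LinearMap.range (thetaFull R (F n \ F (n + 1)) (cousinK R F M n)) ≤
        finSupp R (F n \ F (n + 1)) (cousinK R F M n) := range_theta_le hmin
      have hi : Function.Injective (thetaFull R (F n \ F (n + 1)) (cousinK R F M n)) := by
        rw [← LinearMap.ker_eq_bot, Submodule.eq_bot_iff]
        intro x hx
        by_contra h0
        obtain ⟨p, y, hy, hy0, hyp⟩ := exists_assoc _ hx h0
        have hps : p ∈ Module.support R (cousinK R F M n) :=
          mem_supp_iff.2 ⟨y, fun s hs => (hyp s).1 hs⟩
        have hy1 : LocalizedModule.mkLinearMap p.asIdeal.primeCompl _ y ≠ 0 := by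
          rw [Ne, loc_mk_eq_zero]
          rintro ⟨s, hs, hsy⟩
          exact hs ((hyp s).1 hsy)
        by_cases hp : p ∈ F (n + 1)
        · have h1 := (EL_general hF M n ih (hF.anti n hp) 0).2 (by rw [zero_add]; exact h n p hp)
          rw [EL, EV.zero_quot_iff] at h1
          apply hy1
          apply h1
          intro r hr
          rw [← map_smul, (hyp r).2 hr, map_zero]
        · apply hy1
          exact congrFun hy ⟨p, ihS hps, hp⟩
      refine ⟨?_, ?_⟩
      · intro j hj
        rcases Nat.lt_succ_iff_lt_or_eq.1 hj with hj | rfl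
        · exact ih j hj
        · exact ⟨hr, hi⟩
      · intro q hq
        obtain ⟨⟨p, hp, -, hpq⟩, hq2⟩ := supp_next hmin hr hq
        by_contra h3
        exact hq2 ⟨hF.up _ p hp.1 q hpq, h3⟩
  exact ⟨fun n => (key (n + 1)).1 n (Nat.lt_succ_self n), fun n => (key n).2⟩

theorem htM_lt_top (M : Type u) [AddCommGroup M] [Module R M] (p : PrimeSpectrum R) : htM R M p < ⊤ := by
  refine (htM_le_height M p).trans_lt ?_
  have := Ideal.height_lt_top_of_isPrime (I := p.asIdeal)
  rwa [PrimeSpectrum.height_eq_orderHeight] at this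

end
end GGP

namespace GGP
section
open GG
variable {R : Type u} [CommRing R] 

/-- iterated localization -/
theorem loc_loc {M : Type u} [AddCommGroup M] [Module R M] {S T : Submonoid R} (hST : T ≤ S) :
    Nonempty (LocalizedModule S (LocalizedModule T M) ≃ₗ[R] LocalizedModule S M) := by
  have : IsLocalizedModule S ((LocalizedModule.mkLinearMap S (LocalizedModule T M)).comp
      (LocalizedModule.mkLinearMap T M)) := by
    refine ⟨?_, ?_, ?_⟩
    · intro s
      exact loc_units S s
    · intro y
      obtain ⟨z, s, hs, hz⟩ := loc_exists_mk y
      obtain ⟨m, t, ht, hm⟩ := loc_exists_mk z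
      refine ⟨⟨m, ⟨t * s, mul_mem (hST ht) hs⟩⟩, ?_⟩
      show (t * s) • y = LocalizedModule.mkLinearMap S _ (LocalizedModule.mkLinearMap T M m)
      rw [mul_smul, hz, ← map_smul, hm]
    · intro a b hab
      have h0 : LocalizedModule.mkLinearMap S _ (LocalizedModule.mkLinearMap T M (a - b)) = 0 := by
        rw [map_sub, map_sub, sub_eq_zero]; exact hab
      obtain ⟨s, hs, h1⟩ := loc_mk_eq_zero.1 h0
      rw [← map_smul] at h1
      obtain ⟨t, ht, h2⟩ := loc_mk_eq_zero.1 h1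
      refine ⟨⟨t * s, mul_mem (hST ht) hs⟩, ?_⟩
      show (t * s) • a = (t * s) • b
      rw [← sub_eq_zero, ← smul_sub, mul_smul, h2]
  exact ⟨(IsLocalizedModule.iso S ((LocalizedModule.mkLinearMap S (LocalizedModule T M)).comp
      (LocalizedModule.mkLinearMap T M))).symm⟩

theorem quot_smul_zero {I : Ideal R} {u : R} (hu : u ∈ I) (x : R ⧸ I) : u • x = 0 := by
  obtain ⟨r, rfl⟩ := Submodule.Quotient.mk_surjective _ x
  rw [← Submodule.Quotient.mk_smul, Submodule.Quotient.mk_eq_zero]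
  exact Ideal.mul_mem_right _ _ hu

theorem quot_smul_inj (p : PrimeSpectrum R) {u : R} (hu : u ∉ p.asIdeal) :
    Function.Injective fun x : R ⧸ p.asIdeal => u • x := by
  have : Function.Injective (LinearMap.lsmul R (R ⧸ p.asIdeal) u) := by
    rw [injective_iff_map_eq_zero]
    intro x hx
    obtain ⟨r, rfl⟩ := Submodule.Quotient.mk_surjective _ x
    have hx' : u • (Submodule.Quotient.mk r : R ⧸ p.asIdeal) = 0 := hx
    rw [← Submodule.Quotient.mk_smul, Submodule.Quotient.mk_eq_zero] at hx'
    rw [Submodule.Quotient.mk_eq_zero]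
    exact (p.2.mem_or_mem hx').resolve_left hu
  exact this

theorem mem_supp_quot {I : Ideal R} {q : PrimeSpectrum R} (hq : I ≤ q.asIdeal) :
    q ∈ Module.support R (R ⧸ I) := by
  rw [Module.support_eq_zeroLocus, Ideal.annihilator_quotient]
  exact hq

theorem le_of_mem_supp {L : Type u} [AddCommGroup L] [Module R L] {q : PrimeSpectrum R}
    (hq : q ∈ Module.support R L) {r : R} (hr : ∀ x : L, r • x = 0) : r ∈ q.asIdeal := by
  obtain ⟨k, hk⟩ := mem_supp_iff.1 hq
  exact hk r (hr k)

variable [IsNoetherianRing R]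

theorem EV.prime_filt {n : ℕ} {N : Type u} [AddCommGroup N] [Module R N] (L : Type u)
    [AddCommGroup L] [Module R L] [hL : Module.Finite R L]
    (h : ∀ p ∈ Module.support R L, EV R n (R ⧸ p.asIdeal) N) : EV R n L N := by
  revert h
  refine IsNoetherianRing.induction_on_isQuotientEquivQuotientPrime R (M := L) hL
    (motive := fun L' _ _ _ => (∀ p ∈ Module.support R L', EV R n (R ⧸ p.asIdeal) N) → EV R n L' N) ?_ ?_ ?_
  · intro L' _ _ _ _ _
    exact EV.of_subsingleton_left n
  · intro L' _ _ _ p e h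
    have hp : p ∈ Module.support R L' := by
      rw [e.support_eq]
      exact mem_supp_quot le_rfl
    exact EV.congr_left e.symm (h p hp)
  · intro L1 _ _ _ L2 _ _ _ L3 _ _ _ f g hf hg hfg h1 h3 h
    refine EV.mid₁ ⟨hf, hfg, hg⟩ (h1 fun p hp => h p ?_) (h3 fun p hp => h p ?_)
    · exact Module.support_subset_of_injective f hf hp
    · exact Module.support_subset_of_surjective g hg hp

theorem EV.prime_filt_loc {n : ℕ} {N : Type u} [AddCommGroup N] [Module R N] (p : PrimeSpectrum R) (L : Type u)
    [AddCommGroup L] [Module R L] [hL : Module.Finite R L]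
    (h : ∀ q ∈ Module.support R L, q ≤ p → EV R n (R ⧸ q.asIdeal) (LocalizedModule p.asIdeal.primeCompl N)) :
    EV R n L (LocalizedModule p.asIdeal.primeCompl N) := by
  refine EV.prime_filt L fun q hq => ?_
  by_cases hqp : q ≤ p
  · exact h q hq hqp
  · obtain ⟨u, hu, hup⟩ := Set.not_subset.1 hqp
    exact EV.of_mul_trick u (quot_smul_zero hu) (loc_smul_bij p.asIdeal.primeCompl ⟨u, hup⟩) n

theorem EV.mul_surj_loc {n : ℕ} {N : Type u} [AddCommGroup N] [Module R N] [Module.Finite R N]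
    (p : PrimeSpectrum R) (L : Type u)
    [AddCommGroup L] [Module R L] [hL : Module.Finite R L] {x : R} (hx : x ∈ p.asIdeal)
    (hi : Function.Injective fun y : L => x • y)
    (h : EV R (n + 1) (L ⧸ LinearMap.range (LinearMap.lsmul R L x)) (LocalizedModule p.asIdeal.primeCompl N)) :
    EV R n L (LocalizedModule p.asIdeal.primeCompl N) := by
  let S := p.asIdeal.primeCompl
  have hse : SE (LinearMap.lsmul R L x) (LinearMap.range (LinearMap.lsmul R L x)).mkQ :=
    SE.coker _ hi
  have hse2 := hse.loc S
  have h1 := (EV.loc_iff S).1 h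
  rw [EV.loc_iff S]
  have hxm : algebraMap R (Localization.AtPrime p.asIdeal) x ∈
      IsLocalRing.maximalIdeal (Localization.AtPrime p.asIdeal) := by
    rw [← Localization.AtPrime.map_eq_maximalIdeal]
    exact Ideal.mem_map_of_mem _ hx
  have hact : ∀ z, lmap S (LinearMap.lsmul R L x) z =
      LinearMap.lsmul (Localization S) (LocalizedModule S L) (algebraMap R _ x) z := by
    intro z
    induction z using LocalizedModule.induction_on with
    | h m s =>
      rw [LinearMap.lsmul_apply, algebraMap_smul]
      show LocalizedModule.map S _ _ = _
      rw [LocalizedModule.map_mk, LocalizedModule.smul'_mk]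
      rfl
  have heq : lmap S (LinearMap.lsmul R L x) =
      LinearMap.lsmul (Localization S) (LocalizedModule S L) (algebraMap R _ x) :=
    LinearMap.ext hact
  rw [heq] at hse2
  have hse3 := SE.coker _ hse2.inj
  obtain ⟨e⟩ := hse2.coker_unique hse3
  have := EV.mul_surj₁ (R := Localization.AtPrime p.asIdeal) (L := LocalizedModule S L)
    (N := LocalizedModule S N) (n := n) hxm hse2.inj (EV.congr_left e h1)
  exact this

theorem lemmaV {M : Type u} [AddCommGroup M] [Module R M] [Module.Finite R M] {p q : PrimeSpectrum R}
    (hqp : q < p) (hcov : ∀ q', q < q' → q' ≤ p → q' = p) {i : ℕ} (h : EL p (i + 1) M) : EL q i M := by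
  obtain ⟨x, hx, hxq⟩ := Set.not_subset.1 hqp.not_ge
  have h1 : EV R i (R ⧸ q.asIdeal) (LocalizedModule p.asIdeal.primeCompl M) := by
    refine EV.mul_surj_loc p _ hx (quot_smul_inj q hxq) ?_
    refine EV.prime_filt_loc p _ ?_
    intro q' hq' hq'p
    have h2 : q ≤ q' := by
      intro r hr
      refine le_of_mem_supp hq' ?_
      intro z
      obtain ⟨z, rfl⟩ := Submodule.Quotient.mk_surjective _ z
      rw [← Submodule.Quotient.mk_smul, quot_smul_zero hr]; rfl
    have h3 : x ∈ q'.asIdeal := by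
      refine le_of_mem_supp hq' ?_
      intro z
      obtain ⟨z, rfl⟩ := Submodule.Quotient.mk_surjective _ z
      rw [← Submodule.Quotient.mk_smul, Submodule.Quotient.mk_eq_zero]
      exact ⟨z, rfl⟩
    have h4 : q < q' := lt_of_le_of_ne h2 (fun h => hxq (h ▸ h3))
    rw [hcov q' h4 hq'p]
    exact h
  have h5 := EV.localize q.asIdeal.primeCompl h1
  have hle : p.asIdeal.primeCompl ≤ q.asIdeal.primeCompl := fun s hs hq => hs (hqp.le hq)
  obtain ⟨e⟩ := loc_loc (M := M) hle
  exact EV.congr_right e h5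

theorem exists_cov {p q : PrimeSpectrum R} (hqp : q < p) :
    ∃ q', q ≤ q' ∧ q' < p ∧ ∀ q'', q' < q'' → q'' ≤ p → q'' = p := by
  have hwf : WellFounded (fun a b : PrimeSpectrum R => b < a) := by
    have : WellFounded (fun a b : Ideal R => b < a) := (inferInstance : WellFoundedGT (Ideal R)).wf
    exact InvImage.wf PrimeSpectrum.asIdeal this
  obtain ⟨q', ⟨h1, h2⟩, h3⟩ := hwf.has_min {q' | q ≤ q' ∧ q' < p} ⟨q, le_rfl, hqp⟩
  refine ⟨q', h1, h2, ?_⟩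
  intro q'' h4 h5
  by_contra hne
  exact h3 q'' ⟨h1.trans h4.le, lt_of_le_of_ne h5 hne⟩ h4

theorem depth_le_ht (M : Type u) [AddCommGroup M] [Module R M] [Module.Finite R M] (n : ℕ)
    (p : PrimeSpectrum R) (hp : p ∈ Module.support R M) (hn : htM R M p = n) :
    ∃ i ≤ n, ¬ EL p i M := by
  induction n using Nat.strong_induction_on generalizing p with
  | _ n ih =>
    by_cases hmin : ∀ q ∈ Module.support R M, q ≤ p → q = p
    · refine ⟨0, Nat.zero_le _, ?_⟩
      rw [EL, EV.zero_quot_iff]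
      intro h
      rw [Module.mem_support_iff] at hp
      obtain ⟨x, hx⟩ := exists_ne (0 : LocalizedModule p.asIdeal.primeCompl M)
      obtain ⟨q, y, -, hy, hyq⟩ := exists_assoc (R := R) ⊤ (Submodule.mem_top (x := x)) hx
      have h1 : q ≤ p := by
        intro r hr
        by_contra hrp
        apply hy
        apply (loc_smul_bij p.asIdeal.primeCompl ⟨r, hrp⟩).1
        show r • y = r • 0
        rw [smul_zero]
        exact (hyq r).2 hr
      have h2 : q ∈ Module.support R M := by
        obtain ⟨m, s, hs, hm⟩ := loc_exists_mk y
        refine mem_supp_iff.2 ⟨m, fun r hr => ?_⟩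
        rw [← hyq]
        apply (loc_smul_bij p.asIdeal.primeCompl ⟨s, hs⟩).1
        show s • r • y = s • 0
        rw [smul_comm, hm, ← map_smul, hr, map_zero, smul_zero]
      have := hmin q h2 h1
      subst this
      exact hy (h y fun r hr => (hyq r).2 hr)
    · push Not at hmin
      obtain ⟨q0, hq0, hq0p, hne⟩ := hmin
      obtain ⟨q, hq, hqp, hcov⟩ := exists_cov (lt_of_le_of_ne hq0p hne)
      have hqS := Module.mem_support_mono hq hq0
      have h1 := htM_succ_le M hqS hqp
      obtain ⟨m, hm⟩ := ENat.ne_top_iff_exists.1 (htM_lt_top M q).ne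
      rw [← hm, hn] at h1
      have h2 : m + 1 ≤ n := by exact_mod_cast h1
      obtain ⟨i, hi, hi2⟩ := ih m (by omega) q hqS hm.symm
      exact ⟨i + 1, by omega, fun h => hi2 (lemmaV hqp hcov h)⟩

/-- Cohen--Macaulayness -/
def CM (R : Type u) [CommRing R] (M : Type u) [AddCommGroup M] [Module R M] : Prop :=
  ∀ p ∈ Module.support R M, ∀ i : ℕ, (i : ℕ∞) < htM R M p → EL p i M

theorem CM.ht_cov {M : Type u} [AddCommGroup M] [Module R M] [Module.Finite R M] (h : CM R M)
    {p q : PrimeSpectrum R} (hq : q ∈ Module.support R M)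
    (hqp : q < p) (hcov : ∀ q', q < q' → q' ≤ p → q' = p) : htM R M p = htM R M q + 1 := by
  refine le_antisymm ?_ (htM_succ_le M hq hqp)
  obtain ⟨m, hm⟩ := ENat.ne_top_iff_exists.1 (htM_lt_top M q).ne
  obtain ⟨i, hi, hi2⟩ := depth_le_ht M m q hq hm.symm
  by_contra hlt
  push Not at hlt
  apply hi2
  apply lemmaV hqp hcov
  apply h p (Module.mem_support_mono hqp.le hq)
  refine lt_of_le_of_lt ?_ hlt
  rw [← hm]
  exact_mod_cast Nat.succ_le_succ hi

/-- residue field -/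
theorem EL_iff_res {N : Type u} [AddCommGroup N] [Module R N] (p : PrimeSpectrum R) (i : ℕ) :
    EL p i N ↔ EV (Localization.AtPrime p.asIdeal) i
      (Localization.AtPrime p.asIdeal ⧸ IsLocalRing.maximalIdeal (Localization.AtPrime p.asIdeal))
      (LocalizedModule p.asIdeal.primeCompl N) := by
  let S := p.asIdeal.primeCompl
  let A := Localization.AtPrime p.asIdeal
  let k1 : LocalizedModule S (R ⧸ p.asIdeal) := LocalizedModule.mkLinearMap S _ (Submodule.Quotient.mk 1)
  let ψ : A →ₗ[A] LocalizedModule S (R ⧸ p.asIdeal) := LinearMap.toSpanSingleton A _ k1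
  have hs : Function.Surjective ψ := by
    intro y
    obtain ⟨z, s, hs, hz⟩ := loc_exists_mk y
    obtain ⟨r, rfl⟩ := Submodule.Quotient.mk_surjective _ z
    refine ⟨IsLocalization.mk' A r ⟨s, hs⟩, ?_⟩
    apply (loc_smul_bij S ⟨s, hs⟩).1
    show s • ψ _ = s • y
    rw [hz, ← algebraMap_smul A s (ψ _), ← map_smul, smul_eq_mul, IsLocalization.mk'_spec'_mk]
    show algebraMap R A r • k1 = _
    rw [algebraMap_smul, ← map_smul, ← Submodule.Quotient.mk_smul]
    simp
  have hk : LinearMap.ker ψ = IsLocalRing.maximalIdeal A := by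
    ext a
    obtain ⟨r, s, rfl⟩ := IsLocalization.exists_mk'_eq S a
    rw [IsLocalization.AtPrime.mk'_mem_maximal_iff A p.asIdeal, LinearMap.mem_ker]
    have h1 : (s : R) • ψ (IsLocalization.mk' A r s) = LocalizedModule.mkLinearMap S _ (Submodule.Quotient.mk r) := by
      rw [← algebraMap_smul A (s : R) (ψ _), ← map_smul, smul_eq_mul, IsLocalization.mk'_spec']
      show algebraMap R A r • k1 = _
      rw [algebraMap_smul, ← map_smul, ← Submodule.Quotient.mk_smul]
      simp
    have h2 : ψ (IsLocalization.mk' A r s) = 0 ↔ (s : R) • ψ (IsLocalization.mk' A r s) = 0 := by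
      constructor
      · intro h; rw [h, smul_zero]
      · intro h
        apply (loc_smul_bij S s).1
        show (s : R) • ψ _ = (s : R) • 0
        rw [h, smul_zero]
    rw [h2, h1, loc_mk_eq_zero]
    constructor
    · rintro ⟨t, ht, h⟩
      rw [← Submodule.Quotient.mk_smul, Submodule.Quotient.mk_eq_zero] at h
      exact (p.2.mem_or_mem h).resolve_left ht
    · intro h
      exact ⟨1, one_mem _, by rw [one_smul, Submodule.Quotient.mk_eq_zero]; exact h⟩
  have e := (LinearMap.quotKerEquivOfSurjective ψ hs)
  rw [hk] at e
  rw [EL, EV.loc_iff S]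
  exact ⟨fun h => EV.congr_left e.symm h, fun h => EV.congr_left e h⟩

end
end GGP

namespace GGP
section
open GG CategoryTheory Abelian IsLocalRing
variable {R : Type u} [CommRing R]

theorem EV.mul_zero₂ {L N : Type u} [AddCommGroup L] [Module R L] [AddCommGroup N] [Module R N]
    {x : R} (hL : ∀ y : L, x • y = 0) (hx : Function.Injective fun y : N => x • y) {n : ℕ}
    (h : EV R n L (N ⧸ LinearMap.range (LinearMap.lsmul R N x))) : EV R (n + 1) L N := by
  have hse : SE (LinearMap.lsmul R N x) (LinearMap.range (LinearMap.lsmul R N x)).mkQ :=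
    SE.coker _ hx
  rw [EV.iff] at h ⊢
  intro y
  obtain ⟨z, hz⟩ := Ext.covariant_sequence_exact₁ (ModuleCat.of R L) (scx_se hse) y (by
    have h2 : (scx _ _ hse).f = x • 𝟙 (ModuleCat.of R N) := by
      ext1; ext y; rfl
    have h3 : x • 𝟙 (ModuleCat.of R L) = 0 := by
      ext1; ext y; exact hL y
    rw [h2, Ext.mk₀_smul, Ext.comp_smul]
    refine (congrArg _ (Ext.comp_mk₀_id y)).trans ?_
    rw [← Ext.mk₀_id_comp y, ← Ext.smul_comp,
      ← Ext.mk₀_smul, h3, Ext.mk₀_zero, Ext.zero_comp]) rfl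
  rw [← hz]
  have hz0 : z = 0 := h z
  rw [hz0, Ext.zero_comp]

/-- `Hom(W, g)` -/
def hmap (W : Type u) [AddCommGroup W] [Module R W] {A B : Type u} [AddCommGroup A] [Module R A]
    [AddCommGroup B] [Module R B] (g : A →ₗ[R] B) : (W →ₗ[R] A) →ₗ[R] (W →ₗ[R] B) where
  toFun φ := g.comp φ
  map_add' a b := LinearMap.comp_add _ _ _
  map_smul' r a := LinearMap.comp_smul _ _ _

theorem hmap_apply (W : Type u) [AddCommGroup W] [Module R W] {A B : Type u} [AddCommGroup A] [Module R A]
    [AddCommGroup B] [Module R B] (g : A →ₗ[R] B) (φ : W →ₗ[R] A) (w : W) :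
    hmap W g φ w = g (φ w) := rfl

theorem SE.hom {A B C : Type u} [AddCommGroup A] [Module R A]
    [AddCommGroup B] [Module R B] [AddCommGroup C] [Module R C] {f : A →ₗ[R] B} {g : B →ₗ[R] C}
    (hse : SE f g) (W : Type u) [AddCommGroup W] [Module R W] (hW : EV R 1 W A) :
    SE (hmap W f) (hmap W g) := by
  refine ⟨?_, ?_, ?_⟩
  · intro a b hab
    apply LinearMap.ext
    intro w
    exact hse.inj (LinearMap.congr_fun hab w)
  · intro φ
    constructor
    · intro hφ
      obtain ⟨ψ, hψ⟩ := exists_factor hse.inj φ (fun w => (hse.ex _).1 (LinearMap.congr_fun hφ w))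
      exact ⟨ψ, LinearMap.ext hψ⟩
    · rintro ⟨ψ, rfl⟩
      apply LinearMap.ext
      intro w
      exact (hse.ex _).2 ⟨ψ w, rfl⟩
  · intro φ
    obtain ⟨ψ, hψ⟩ := EV.lift hse hW φ
    exact ⟨ψ, by first | exact hψ | exact LinearMap.ext hψ⟩

variable [IsNoetherianRing R] [IsLocalRing R]

theorem exists_reg {N : Type u} [AddCommGroup N] [Module R N] [Module.Finite R N]
    (h : EV R 0 (R ⧸ maximalIdeal R) N) :
    ∃ x ∈ maximalIdeal R, Function.Injective fun y : N => x • y := by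
  rw [EV.zero_iff] at h
  have h1 : Subsingleton ((R ⧸ maximalIdeal R) →ₗ[R] N) := ⟨fun a b => by rw [h a, h b]⟩
  rw [IsSMulRegular.subsingleton_linearMap_iff] at h1
  obtain ⟨r, hr, h2⟩ := h1
  rw [Ideal.annihilator_quotient] at hr
  exact ⟨r, hr, h2⟩

theorem k_embed (d : ℕ) : ∀ (L0 : Type u) [AddCommGroup L0] [Module R L0] [Module.Finite R L0],
    (∀ i < d, EV R i (R ⧸ maximalIdeal R) L0) → ¬ EV R d (R ⧸ maximalIdeal R) L0 →
    ∃ (L : ModuleCat.{u} R) (f : (R ⧸ maximalIdeal R) →ₗ[R] L), Module.Finite R L ∧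
      Function.Injective f ∧ ∀ (N : Type u) [AddCommGroup N] [Module R N] (m : ℕ),
        (∀ i > m, EV R i L0 N) → ∀ i > m + d, EV R i L N := by
  induction d with
  | zero =>
    intro L0 _ _ _ _ h
    rw [EV.zero_quot_iff] at h
    push Not at h
    obtain ⟨y, hy, hy0⟩ := h
    refine ⟨ModuleCat.of R L0, Submodule.liftQ _ (LinearMap.toSpanSingleton R L0 y) (by
      intro r hr; simpa using hy r hr), inferInstance, ?_, ?_⟩
    · rw [injective_iff_map_eq_zero]
      intro z hz
      obtain ⟨r, rfl⟩ := Submodule.Quotient.mk_surjective _ z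
      rw [Submodule.liftQ_apply, LinearMap.toSpanSingleton_apply] at hz
      rw [Submodule.Quotient.mk_eq_zero, mem_maximalIdeal]
      intro hu
      obtain ⟨u, rfl⟩ := hu
      apply hy0
      have : (↑u⁻¹ : R) • ((u : R) • y) = 0 := by rw [hz, smul_zero]
      rwa [smul_smul, Units.inv_mul, one_smul] at this
    · intro N _ _ m h i hi
      exact h i hi
  | succ d ih =>
    intro L0 _ _ _ h0 h1
    obtain ⟨x, hx, hxi⟩ := exists_reg (h0 0 (Nat.succ_pos _))
    have hse : SE (LinearMap.lsmul R L0 x) (LinearMap.range (LinearMap.lsmul R L0 x)).mkQ :=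
      SE.coker _ hxi
    obtain ⟨L, f, hL, hf, h⟩ := ih (L0 ⧸ LinearMap.range (LinearMap.lsmul R L0 x))
      (fun i hi => EV.right₂ hse (h0 i (by omega)) (h0 (i+1) (by omega)))
      (fun h => h1 (EV.mul_zero₂ (quot_smul_zero hx) hxi h))
    refine ⟨L, f, hL, hf, ?_⟩
    intro N _ _ m hm i hi
    refine h N (m + 1) ?_ i (by omega)
    intro j hj
    obtain ⟨j, rfl⟩ : ∃ j', j = j' + 1 := ⟨j - 1, by omega⟩
    exact EV.right₁ hse (hm j (by omega)) (hm (j+1) (by omega))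

/-- Hom depth lemma -/
theorem EV_of_hom (t : ℕ) (W : Type u) [AddCommGroup W] [Module R W] [Module.Finite R W] [Nontrivial W] :
    ∀ (N : Type u) [AddCommGroup N] [Module R N] [Module.Finite R N],
    (∀ i, EV R (i + 1) W N) → (∀ i ≤ t, EV R i (R ⧸ maximalIdeal R) (W →ₗ[R] N)) →
    ∀ i ≤ t, EV R i (R ⧸ maximalIdeal R) N := by
  have base : ∀ (N : Type u) [AddCommGroup N] [Module R N],
      EV R 0 (R ⧸ maximalIdeal R) (W →ₗ[R] N) → EV R 0 (R ⧸ maximalIdeal R) N := by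
    intro N _ _ h
    rw [EV.zero_quot_iff] at h ⊢
    intro y hy
    -- nonzero map W → k
    have hne : (maximalIdeal R) • (⊤ : Submodule R W) ≠ ⊤ := by
      intro h
      have := Submodule.eq_bot_of_le_smul_of_le_jacobson_bot (maximalIdeal R) (⊤ : Submodule R W)
        (Module.Finite.fg_top) h.ge (maximalIdeal_le_jacobson _)
      exact top_ne_bot this
    let V := W ⧸ (maximalIdeal R) • (⊤ : Submodule R W)
    have hV : Nontrivial V := Submodule.Quotient.nontrivial_iff.2 hne
    let κ := ResidueField R
    have htors : Module.IsTorsionBySet R V (maximalIdeal R) := by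
      intro v r
      obtain ⟨w, rfl⟩ := Submodule.Quotient.mk_surjective _ v
      show (r : R) • _ = _
      rw [← Submodule.Quotient.mk_smul, Submodule.Quotient.mk_eq_zero]
      exact Submodule.smul_mem_smul r.2 trivial
    let inst : Module (R ⧸ maximalIdeal R) V := htors.module
    let instF : Field (R ⧸ maximalIdeal R) := Ideal.Quotient.field _
    obtain ⟨v, hv⟩ := exists_ne (0 : V)
    obtain ⟨w, rfl⟩ := Submodule.Quotient.mk_surjective _ v
    obtain ⟨φ, hφ⟩ := Module.Projective.exists_dual_ne_zero (R ⧸ maximalIdeal R) hv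
    have hφR : ∀ (r : R) (v : V), φ (r • v) = r • φ v := by
      intro r v
      have h1 : r • v = (Ideal.Quotient.mk (maximalIdeal R) r) • v := rfl
      rw [h1, map_smul]
      rfl
    let ψ : W →ₗ[R] (R ⧸ maximalIdeal R) :=
      { toFun := fun w => φ (Submodule.Quotient.mk w)
        map_add' := fun a b => by rw [Submodule.Quotient.mk_add, map_add]
        map_smul' := fun r a => by rw [Submodule.Quotient.mk_smul, hφR]; rfl }
    let η : (R ⧸ maximalIdeal R) →ₗ[R] N := Submodule.liftQ _ (LinearMap.toSpanSingleton R N y) (by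
      intro r hr; simpa using hy r hr)
    have hz := h (η.comp ψ) (by
      intro r hr
      apply LinearMap.ext
      intro w
      rw [LinearMap.smul_apply, LinearMap.comp_apply, ← map_smul, quot_smul_zero hr, map_zero]
      rfl)
    obtain ⟨r, hr⟩ := Submodule.Quotient.mk_surjective _ (φ (Submodule.Quotient.mk w))⁻¹
    have h2 : η (ψ (r • w)) = 0 := LinearMap.congr_fun hz (r • w)
    have h3 : ψ (r • w) = (1 : R ⧸ maximalIdeal R) := by
      rw [map_smul]
      show r • φ (Submodule.Quotient.mk w) = 1
      have : r • φ (Submodule.Quotient.mk w) = (Ideal.Quotient.mk _ r) * φ (Submodule.Quotient.mk w) := by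
        rw [Algebra.smul_def]; rfl
      rw [this]
      have hr' : Ideal.Quotient.mk _ r = (φ (Submodule.Quotient.mk w))⁻¹ := hr
      rw [hr', inv_mul_cancel₀ hφ]
    rw [h3] at h2
    have h4 : η 1 = y := by
      show η (Submodule.Quotient.mk 1) = y
      rw [Submodule.liftQ_apply]; simp
    rw [← h4, h2]
  induction t with
  | zero =>
    intro N _ _ _ _ h i hi
    obtain rfl : i = 0 := by omega
    exact base N (h 0 le_rfl)
  | succ t ih =>
    intro N _ _ _ hW h i hi
    have h0 := base N (h 0 (by omega))
    rcases i with _ | i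
    · exact h0
    obtain ⟨x, hx, hxi⟩ := exists_reg h0
    have hse : SE (LinearMap.lsmul R N x) (LinearMap.range (LinearMap.lsmul R N x)).mkQ :=
      SE.coker _ hxi
    refine EV.mul_zero₂ (quot_smul_zero hx) hxi ?_
    refine ih _ (fun i => EV.right₂ hse (hW i) (hW (i+1))) ?_ i (by omega)
    intro j hj
    have hse2 := SE.hom hse W (hW 0)
    exact EV.right₂ hse2 (h j (by omega)) (h (j+1) (by omega))

theorem mdepth_eq {N : Type u} [AddCommGroup N] [Module R N] [Module.Finite R N] [Nontrivial N]
    {n : ℕ} (h : ∀ i < n, EV R i (R ⧸ maximalIdeal R) N) (hn : ¬ EV R n (R ⧸ maximalIdeal R) N) :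
    mdepth R N = n := by
  have hlt : (maximalIdeal R) • (⊤ : Submodule R N) < ⊤ := by
    rw [lt_top_iff_ne_top]
    intro h
    have := Submodule.eq_bot_of_le_smul_of_le_jacobson_bot (maximalIdeal R) (⊤ : Submodule R N)
        (Module.Finite.fg_top) h.ge (maximalIdeal_le_jacobson _)
    exact top_ne_bot this
  have hsupp : Module.support R (ModuleCat.of R (R ⧸ maximalIdeal R)) =
      PrimeSpectrum.zeroLocus (maximalIdeal R) := by
    show Module.support R (R ⧸ maximalIdeal R) = _
    rw [Module.support_eq_zeroLocus, Ideal.annihilator_quotient]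
  apply le_antisymm
  · refine sSup_le ?_
    rintro c ⟨rs, rfl, hm, hr⟩
    have := ModuleCat.subsingleton_ext_of_exists_isRegular (maximalIdeal R)
      (ModuleCat.of R (R ⧸ maximalIdeal R)) hsupp.le (ModuleCat.of R N) hlt rs hm hr
    by_contra hc
    push Not at hc
    exact hn (this n (by exact_mod_cast hc))
  · obtain ⟨rs, h1, h2, h3⟩ := ModuleCat.exists_isRegular_of_exists_subsingleton_ext (maximalIdeal R) n
      (ModuleCat.of R N) hlt (ModuleCat.of R (R ⧸ maximalIdeal R)) hsupp (fun i hi => h i hi)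
    exact le_sSup ⟨rs, by rw [h1], h2, h3⟩

end
end GGP

namespace GGP
section
open GG CategoryTheory Abelian IsLocalRing
variable {R : Type u} [CommRing R]

theorem EV_of_idLE (n : ℕ) : ∀ (M : Type u) [AddCommGroup M] [Module R M], idLE R M n →
    ∀ (L : Type u) [AddCommGroup L] [Module R L], ∀ i > n, EV R i L M := by
  induction n with
  | zero =>
    rintro M _ _ ⟨G, d, ε, hG, hε, h0, hd, hn⟩ L _ _ i hi
    obtain ⟨i, rfl⟩ : ∃ j, i = j + 1 := ⟨i - 1, by omega⟩
    have hs : Function.Surjective ε := by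
      intro y
      have : y ∈ LinearMap.ker (d 0) := hn 1 (by omega) _
      rw [← h0] at this
      exact this
    exact EV.of_injective (injective_congr (LinearEquiv.ofBijective ε ⟨hε, hs⟩).symm (hG 0)) i
  | succ n ih =>
    rintro M _ _ ⟨G, d, ε, hG, hε, h0, hd, hn⟩ L _ _ i hi
    obtain ⟨i, rfl⟩ : ∃ j, i = j + 1 := ⟨i - 1, by omega⟩
    have hid : idLE R (LinearMap.range (d 0)) n := by
      refine ⟨fun i => G (i + 1), fun i => d (i + 1), (LinearMap.range (d 0)).subtype,
        fun i => hG _, Submodule.subtype_injective _, ?_, fun i => hd _, fun i hi => hn _ (by omega)⟩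
      rw [Submodule.range_subtype]
      exact hd 0
    have hse : SE ε (d 0).rangeRestrict := by
      refine ⟨hε, ?_, LinearMap.surjective_rangeRestrict _⟩
      intro y
      have : y ∈ LinearMap.range ε ↔ y ∈ LinearMap.ker (d 0) := by rw [h0]
      rw [LinearMap.mem_range, LinearMap.mem_ker] at this
      rw [← Set.mem_range] at this
      rw [this, ← Subtype.coe_inj]
      rfl
    exact EV.left₂ hse (ih _ hid L i (by omega)) (EV.of_injective (hG 0) i)

variable [IsNoetherianRing R]

section
variable [IsLocalRing R]

theorem EV_of_res {N : Type u} [AddCommGroup N] [Module R N] [Module.Finite R N] {n0 : ℕ}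
    (h : ∀ i ≥ n0, EV R i (R ⧸ maximalIdeal R) N) (L : Type u) [AddCommGroup L] [Module R L]
    [Module.Finite R L] : ∀ i ≥ n0, EV R i L N := by
  intro i hi
  have hwf : WellFounded (fun a b : PrimeSpectrum R => b < a) := by
    have : WellFounded (fun a b : Ideal R => b < a) := (inferInstance : WellFoundedGT (Ideal R)).wf
    exact InvImage.wf PrimeSpectrum.asIdeal this
  have key : ∀ q : PrimeSpectrum R, ∀ i ≥ n0, EV R i (R ⧸ q.asIdeal) N := by
    intro q
    induction q using hwf.induction with
    | _ q ih =>
      intro i hi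
      by_cases hq : q.asIdeal = maximalIdeal R
      · rw [hq]; exact h i hi
      · have hlt : ¬ maximalIdeal R ≤ q.asIdeal := fun h2 =>
          hq (le_antisymm (le_maximalIdeal q.2.ne_top) h2)
        obtain ⟨x, hx, hxq⟩ := Set.not_subset.1 hlt
        refine EV.mul_surj₁ hx (quot_smul_inj q hxq) ?_
        refine EV.prime_filt _ ?_
        intro q' hq'
        have h2 : q ≤ q' := by
          intro r hr
          refine le_of_mem_supp hq' ?_
          intro z
          obtain ⟨z, rfl⟩ := Submodule.Quotient.mk_surjective _ z
          rw [← Submodule.Quotient.mk_smul, quot_smul_zero hr]; rfl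
        have h3 : x ∈ q'.asIdeal := by
          refine le_of_mem_supp hq' ?_
          intro z
          obtain ⟨z, rfl⟩ := Submodule.Quotient.mk_surjective _ z
          rw [← Submodule.Quotient.mk_smul, Submodule.Quotient.mk_eq_zero]
          exact ⟨z, rfl⟩
        exact ih q' (lt_of_le_of_ne h2 (fun h => hxq (h ▸ h3))) (i + 1) (by omega)
  exact EV.prime_filt L fun q _ => key q i hi

theorem EV_self_zero {n : ℕ} (h : ∀ i > n, ∀ (L : Type u) [AddCommGroup L] [Module R L], EV R i L R) :
    ∃ t, ∀ i, EV R i (R ⧸ maximalIdeal R) R ↔ i ≠ t := by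
  classical
  have hex : ∃ t, ¬ EV R t (R ⧸ maximalIdeal R) R := by
    by_contra hc
    push Not at hc
    have h0 := EV_of_res (N := R) (n0 := 0) (fun i _ => hc i) R 0 le_rfl
    rw [EV.zero_iff] at h0
    have := LinearMap.congr_fun (h0 LinearMap.id) 1
    exact one_ne_zero this
  let d := Nat.find hex
  have hd : ¬ EV R d (R ⧸ maximalIdeal R) R := Nat.find_spec hex
  have hdm : ∀ i < d, EV R i (R ⧸ maximalIdeal R) R := fun i hi => by
    have := Nat.find_min hex hi
    rwa [not_not] at this
  obtain ⟨L, f, hL, hf, hLN⟩ := k_embed d R hdm hd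
  have hL0 : ∀ i > d, EV R i L R := by
    intro i hi
    refine hLN R 0 ?_ i (by omega)
    intro j hj
    obtain ⟨j, rfl⟩ : ∃ k, j = k + 1 := ⟨j - 1, by omega⟩
    exact EV.of_projective j
  have hse := SE.coker f hf
  -- descending induction
  have hbig : ∀ m i, i > d → i + m > n → EV R i (R ⧸ maximalIdeal R) R := by
    intro m
    induction m with
    | zero => intro i _ hi; exact h i hi _
    | succ m ih =>
      intro i hi1 hi2
      refine EV.left₁ hse (hL0 i hi1) ?_
      refine EV_of_res (N := R) (n0 := i + 1) ?_ _ (i + 1) le_rfl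
      intro j hj
      exact ih j (by omega) (by omega)
  refine ⟨d, fun i => ⟨?_, ?_⟩⟩
  · rintro h rfl; exact hd h
  · intro hi
    rcases lt_or_gt_of_ne hi with h | h
    · exact hdm i h
    · exact hbig (n+1) i h (by omega)
end

theorem locSelf (S : Submonoid R) : Nonempty (Localization S ≃ₗ[Localization S] LocalizedModule S R) := by
  have e : Localization S ≃ₗ[R] LocalizedModule S R :=
    IsLocalizedModule.linearEquiv S (Algebra.linearMap R (Localization S)) (LocalizedModule.mkLinearMap S R)
  exact ⟨e.extendScalarsOfIsLocalization S (Localization S)⟩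

theorem gor_t (hQ : IsGorensteinRing R) (p : PrimeSpectrum R) : ∃ t : ℕ, ∀ i, EL p i R ↔ i ≠ t := by
  obtain ⟨n, hn⟩ := hQ p
  obtain ⟨t, ht⟩ := EV_self_zero (R := Localization.AtPrime p.asIdeal) (n := n)
    (fun i hi L _ _ => EV_of_idLE n _ hn L i hi)
  refine ⟨t, fun i => ?_⟩
  rw [EL_iff_res, ← ht]

theorem mem_supp_self (p : PrimeSpectrum R) : p ∈ Module.support R R :=
  mem_supp_iff.2 ⟨1, fun s hs => by
    have : s = 0 := by simpa using hs
    rw [this]; exact zero_mem _⟩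

theorem gor_ht (hQ : IsGorensteinRing R) (p : PrimeSpectrum R) : ∃ t : ℕ, (∀ i, EL p i R ↔ i ≠ t) ∧
    htM R R p = t ∧ Order.height p = t := by
  choose t ht using gor_t hQ
  have hcov : ∀ q p : PrimeSpectrum R, q < p → (∀ q', q < q' → q' ≤ p → q' = p) → t p = t q + 1 := by
    intro q p hqp hc
    by_contra hne
    have h1 := lemmaV hqp hc ((ht p (t q + 1)).2 (fun h => hne h.symm))
    exact (ht q (t q)).1 h1 rfl
  have hlt : ∀ n, ∀ q p : PrimeSpectrum R, t p = n → q < p → t q < t p := by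
    intro n
    induction n using Nat.strong_induction_on with
    | _ n ih =>
      intro q p hp hqp
      obtain ⟨q', h1, h2, h3⟩ := exists_cov hqp
      have h4 := hcov q' p h2 h3
      rcases h1.eq_or_lt with h | h
      · rw [h]; omega
      · have := ih (t q') (by omega) q q' rfl h
        omega
  have hle : ∀ n, ∀ p : PrimeSpectrum R, t p = n → Order.height p ≤ n := by
    intro n
    induction n using Nat.strong_induction_on with
    | _ n ih =>
      intro p hp
      rw [Order.height_le_coe_iff]
      intro q hq
      have h1 := hlt _ q p rfl hq
      refine (ih (t q) (by omega) q rfl).trans_lt ?_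
      rw [← hp]
      exact_mod_cast h1
  have h1 := hle _ p rfl
  obtain ⟨m, hm⟩ := ENat.ne_top_iff_exists.1 (htM_lt_top R p).ne
  obtain ⟨i, hi, hi2⟩ := depth_le_ht R m p (mem_supp_self p) hm.symm
  have h2 : i = t p := by
    by_contra hne
    exact hi2 ((ht p i).2 hne)
  have h3 : (t p : ℕ∞) ≤ htM R R p := by
    rw [← hm]; exact_mod_cast h2 ▸ hi
  have h4 := htM_le_height R p
  exact ⟨t p, ht p, le_antisymm (h4.trans h1) h3, le_antisymm h1 (h3.trans h4)⟩

/-- `p`-torsion local modules with vanishing `Ext^1(R/p, -)` are injective -/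
theorem injective_of_torsion (p : PrimeSpectrum R) {K : Type u} [AddCommGroup K] [Module R K]
    (ht : ∀ r ∈ p.asIdeal, ∀ x : LocalizedModule p.asIdeal.primeCompl K, ∃ n : ℕ, r ^ n • x = 0)
    (h : EL p 1 K) : Module.Injective R (LocalizedModule p.asIdeal.primeCompl K) := by
  let V := LocalizedModule p.asIdeal.primeCompl K
  -- every element killed by a power of p
  have hpow : ∀ x : V, ∃ n : ℕ, ∀ r ∈ p.asIdeal ^ n, r • x = 0 := by
    intro x
    let a : Ideal R := LinearMap.ker (LinearMap.toSpanSingleton R V x)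
    have h1 : p.asIdeal ≤ a.radical := by
      intro r hr
      obtain ⟨n, hn⟩ := ht r hr x
      exact ⟨n, by simpa [a] using hn⟩
    obtain ⟨n, hn⟩ := Ideal.exists_pow_le_of_le_radical_of_fg h1 (IsNoetherian.noetherian _)
    refine ⟨n, fun r hr => ?_⟩
    have := hn hr
    simpa [a] using this
  refine Module.Baer.injective ?_
  intro I φ
  -- uniform power
  obtain ⟨N, hN⟩ : ∃ N : ℕ, ∀ i : I, ∀ r ∈ p.asIdeal ^ N, r • φ i = 0 := by
    obtain ⟨s, hs⟩ := (IsNoetherian.noetherian (⊤ : Submodule R I))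
    choose n hn using fun x : I => hpow (φ x)
    refine ⟨s.sup n, fun i r hr => ?_⟩
    have hi : i ∈ Submodule.span R (s : Set I) := hs ▸ trivial
    induction hi using Submodule.span_induction with
    | mem x hx => exact hn x r (Ideal.pow_le_pow_right (Finset.le_sup (f := n) hx) hr)
    | zero => rw [map_zero, smul_zero]
    | add x y _ _ hx hy => rw [map_add, smul_add, hx, hy, add_zero]
    | smul c x _ hx => rw [map_smul, smul_comm, hx, smul_zero]
  obtain ⟨k, hk⟩ := Ideal.exists_pow_inf_eq_pow_smul p.asIdeal (M := R) I
  let J : Ideal R := p.asIdeal ^ (N + k)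
  have hkill : ∀ i : I, (i : R) ∈ J → φ i = 0 := by
    intro i hi
    have h1 : (i : R) ∈ p.asIdeal ^ (N + k) • (⊤ : Submodule R R) ⊓ I := by
      refine ⟨?_, i.2⟩
      rw [show (i : R) = (i : R) • (1 : R) by simp]
      exact Submodule.smul_mem_smul hi trivial
    rw [hk (N + k) (by omega), Nat.add_sub_cancel] at h1
    have h2 : (i : R) ∈ p.asIdeal ^ N • (I : Submodule R R) :=
      Submodule.smul_mono le_rfl inf_le_right h1
    have h3 : ∀ y ∈ p.asIdeal ^ N • (I : Submodule R R), ∃ hy : y ∈ I, φ ⟨y, hy⟩ = 0 := by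
      intro y hy
      induction hy using Submodule.smul_induction_on' with
      | smul r hr n hn =>
        refine ⟨I.smul_mem r hn, ?_⟩
        have := hN ⟨n, hn⟩ r hr
        rw [← map_smul] at this
        exact this
      | add x hx y hy h1 h2 =>
        obtain ⟨hx1, hx2⟩ := h1
        obtain ⟨hy1, hy2⟩ := h2
        refine ⟨I.add_mem hx1 hy1, ?_⟩
        have : φ (⟨x, hx1⟩ + ⟨y, hy1⟩) = 0 := by rw [map_add, hx2, hy2, add_zero]
        exact this
    obtain ⟨_, h4⟩ := h3 _ h2
    exact h4
  let K' : Ideal R := I ⊔ J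
  let σ : (I × J) →ₗ[R] K' :=
    LinearMap.coprod (Submodule.inclusion le_sup_left) (Submodule.inclusion le_sup_right)
  have hσ : Function.Surjective σ := by
    rintro ⟨y, hy⟩
    obtain ⟨a, ha, b, hb, rfl⟩ := Submodule.mem_sup.1 hy
    exact ⟨(⟨a, ha⟩, ⟨b, hb⟩), rfl⟩
  obtain ⟨ψ, hψ⟩ := exists_desc hσ (φ.comp (LinearMap.fst R I J)) (by
    rintro ⟨a, b⟩ hab
    have h1 : (a : R) + (b : R) = 0 := congrArg Subtype.val hab
    apply hkill
    show (a : R) ∈ J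
    rw [eq_neg_of_add_eq_zero_left h1]
    exact J.neg_mem b.2)
  have hse : SE (Submodule.subtype K') (Submodule.mkQ K') := SE.quot _
  have hEV : EV R 1 (R ⧸ K') V := by
    refine EV.prime_filt_loc p _ ?_
    intro q hq hqp
    have : p ≤ q := by
      intro r hr
      have h1 : ∀ x : R ⧸ K', r ^ (N + k) • x = 0 :=
        quot_smul_zero (show r ^ (N + k) ∈ K' from (le_sup_right : J ≤ K') (Ideal.pow_mem_pow hr _))
      exact q.2.mem_of_pow_mem _ (le_of_mem_supp hq h1)
    rw [le_antisymm hqp this]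
    exact h
  obtain ⟨χ, hχ⟩ := EV.extend hse hEV ψ
  refine ⟨χ, fun x hx => ?_⟩
  have h1 : χ x = ψ ⟨x, (le_sup_left : I ≤ K') hx⟩ :=
    LinearMap.congr_fun hχ ⟨x, (le_sup_left : I ≤ K') hx⟩
  have h2 := hψ (⟨x, hx⟩, 0)
  have h3 : σ (⟨x, hx⟩, 0) = ⟨x, (le_sup_left : I ≤ K') hx⟩ := by
    apply Subtype.ext
    show x + 0 = x
    rw [add_zero]
  rw [h1, ← h3, h2]
  rfl

end
end GGP

namespace GGP
section
open GG CategoryTheory Abelian IsLocalRing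
variable {R : Type u} [CommRing R]

/-- the Cousin resolution of a Gorenstein ring, as abstract data -/
structure QRes (R : Type u) [CommRing R] where
  K : ℕ → ModuleCat.{u} R
  P : ℕ → PrimeSpectrum R → ModuleCat.{u} R
  f : ∀ n, K n →ₗ[R] finPi R (fun p => P n p)
  g : ∀ n, finPi R (fun p => P n p) →ₗ[R] K (n + 1)
  se : ∀ n, SE (f n) (g n)
  e : R ≃ₗ[R] K 0
  inj : ∀ n p, Module.Injective R (P n p)
  bij : ∀ n p, ∀ s ∉ p.asIdeal, Function.Bijective fun x : P n p => s • x
  tors : ∀ n p, ∀ r ∈ p.asIdeal, ∀ x : P n p, ∃ m : ℕ, r ^ m • x = 0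
  sub : ∀ (n : ℕ) p, htM R R p ≠ n → Subsingleton (P n p)
  soc : ∀ (n : ℕ) p, htM R R p = n → ∃ x : P n p, x ≠ 0 ∧ ∀ r ∈ p.asIdeal, r • x = 0
  ess : ∀ n, ∀ I : Ideal R, (∀ k : K n, (∀ r ∈ I, r • k = 0) → k = 0) →
    ∀ y : finPi R (fun p => P n p), (∀ r ∈ I, r • y = 0) → y = 0
  bd : ∃ d : ℕ, ∀ n > d, Subsingleton (K n)

/-- component supported on a condition -/
abbrev Opt (c : Prop) (N : Type u) : Type u := PLift c → N

def optEquiv {c : Prop} (hc : c) (N : Type u) [AddCommGroup N] [Module R N] : Opt c N ≃ₗ[R] N where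
  toFun x := x ⟨hc⟩
  invFun y := fun _ => y
  map_add' _ _ := rfl
  map_smul' _ _ := rfl
  left_inv x := by funext ⟨_⟩; rfl
  right_inv _ := rfl

/-- reindexing -/
noncomputable def finSuppEquiv (S : Set (PrimeSpectrum R)) (K : Type u) [AddCommGroup K] [Module R K] :
    finSupp R S K ≃ₗ[R] finPi R (fun p : PrimeSpectrum R => Opt (p ∈ S) (LocalizedModule p.asIdeal.primeCompl K)) where
  toFun x := ⟨fun p h => x.1 ⟨p, h.down⟩, by
    refine (x.2.image Subtype.val).subset ?_
    intro p hp
    have hp' : (fun h : PLift (p ∈ S) => x.1 ⟨p, h.down⟩) ≠ 0 := hp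
    by_contra hcon
    apply hp'
    funext h
    by_contra hne
    exact hcon ⟨⟨p, h.down⟩, hne, rfl⟩⟩
  invFun y := ⟨fun p => y.1 p.1 ⟨p.2⟩, by
    refine (y.2.preimage (f := fun p : S => p.1) Subtype.val_injective.injOn).subset ?_
    intro p hp h
    apply hp
    exact congrFun h ⟨p.2⟩⟩
  map_add' _ _ := rfl
  map_smul' _ _ := rfl
  left_inv _ := rfl
  right_inv _ := rfl

theorem finSuppEquiv_apply (S : Set (PrimeSpectrum R)) (K : Type u) [AddCommGroup K] [Module R K]
    (x : finSupp R S K) (p : PrimeSpectrum R) (h : PLift (p ∈ S)) :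
    (finSuppEquiv S K x).1 p h = x.1 ⟨p, h.down⟩ := rfl

theorem SE.trans_equiv {A B C B' : Type u} [AddCommGroup A] [Module R A] [AddCommGroup B] [Module R B]
    [AddCommGroup C] [Module R C] [AddCommGroup B'] [Module R B'] {f : A →ₗ[R] B} {g : B →ₗ[R] C} (h : SE f g)
    (e : B ≃ₗ[R] B') : SE (e.toLinearMap.comp f) (g.comp e.symm.toLinearMap) := by
  refine ⟨e.injective.comp h.inj, ?_, h.surj.comp e.symm.surjective⟩
  intro y
  show g (e.symm y) = 0 ↔ _
  rw [h.ex (e.symm y)]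
  constructor
  · rintro ⟨a, ha⟩
    exact ⟨a, by show e (f a) = y; rw [ha, e.apply_symm_apply]⟩
  · rintro ⟨a, ha⟩
    exact ⟨a, by rw [← ha]; exact (e.symm_apply_apply _).symm⟩

variable [IsNoetherianRing R]

theorem exists_QRes (hQ : IsGorensteinRing R) (hdim : ringKrullDim R < ⊤) : Nonempty (QRes R) := by
  classical
  let M := ModuleCat.of R R
  let F := heightFiltration R M
  have hF : Filt F := filt_height R
  have hFm : ∀ n p, p ∈ F n ↔ (n : ℕ∞) ≤ htM R R p := fun n p =>
    ⟨fun h => h.2, fun h => ⟨mem_supp_self p, h⟩⟩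
  have hS : ∀ n p, p ∈ F n \ F (n + 1) ↔ htM R R p = n := by
    intro n p
    rw [Set.mem_sdiff, hFm, hFm, not_le]
    obtain ⟨m, hm⟩ := ENat.ne_top_iff_exists.1 (htM_lt_top R p).ne
    rw [← hm]
    norm_cast
    omega
  have hEL : ∀ n, ∀ p ∈ F (n + 1), EL p n M := by
    intro n p hp
    rw [hFm] at hp
    obtain ⟨t, ht, ht2, -⟩ := gor_ht hQ p
    refine (ht n).2 ?_
    rw [ht2] at hp
    norm_cast at hp
    omega
  obtain ⟨hex, hsupp⟩ := cexact_of_EL hF M (fun p _ => (hFm 0 p).2 (by simp)) hEL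
  let K := cousinK R F M
  have htors : ∀ n, ∀ p ∈ F n \ F (n + 1), ∀ r ∈ p.asIdeal,
      ∀ x : LocalizedModule p.asIdeal.primeCompl (K n), ∃ m : ℕ, r ^ m • x = 0 := by
    intro n p hp r hr x
    exact torsion_of_min (fun q hq hqp => hF.min n p hp q (hsupp n hq) hqp) hr x
  have hgen : ∀ n, ∀ p ∈ F n, ∀ i, EL p i (K n) ↔ EL p (i + n) M := fun n p hp i =>
    EL_general hF M n (fun j _ => hex j) hp i
  have hinj : ∀ n, ∀ p ∈ F n \ F (n + 1), Module.Injective R (LocalizedModule p.asIdeal.primeCompl (K n)) := by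
    intro n p hp
    refine injective_of_torsion p (htors n p hp) ?_
    rw [hgen n p hp.1]
    obtain ⟨t, ht, ht2, -⟩ := gor_ht hQ p
    refine (ht _).2 ?_
    have := (hS n p).1 hp
    rw [ht2] at this
    norm_cast at this
    omega
  let P : ℕ → PrimeSpectrum R → ModuleCat.{u} R := fun n p =>
    ModuleCat.of R (Opt (p ∈ F n \ F (n + 1)) (LocalizedModule p.asIdeal.primeCompl (K n)))
  have hsub : ∀ (n : ℕ) p, htM R R p ≠ n → Subsingleton (P n p) := by
    intro n p hp
    have : IsEmpty (PLift (p ∈ F n \ F (n + 1))) := ⟨fun h => hp ((hS n p).1 h.down)⟩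
    exact inferInstanceAs (Subsingleton (PLift (p ∈ F n \ F (n + 1)) → LocalizedModule p.asIdeal.primeCompl (K n)))
  let E : ∀ n, finSupp R (F n \ F (n + 1)) (K n) ≃ₗ[R] finPi R (fun p => P n p) := fun n => finSuppEquiv _ _
  have hse := fun n => (theta_SE (hex n).1 (hex n).2).trans_equiv (E n)
  refine ⟨{ K := K, P := P, f := fun n => _, g := fun n => _, se := fun n => hse n, e := LinearEquiv.refl R R,
            inj := ?_, bij := ?_, tors := ?_, sub := hsub, soc := ?_, ess := ?_, bd := ?_ }⟩
  · intro n p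
    by_cases hp : p ∈ F n \ F (n + 1)
    · exact injective_congr (optEquiv hp _).symm (hinj n p hp)
    · have := hsub n p (fun h => hp ((hS n p).2 h))
      exact injective_subsingleton
  · intro n p s hs
    by_cases hp : p ∈ F n \ F (n + 1)
    · have h1 := loc_smul_bij (V := LocalizedModule p.asIdeal.primeCompl (K n)) p.asIdeal.primeCompl ⟨s, hs⟩
      let e := optEquiv (R := R) hp (LocalizedModule p.asIdeal.primeCompl (K n))
      have : (fun x : P n p => s • x) = e.symm ∘ (fun x => s • x) ∘ e := by
        funext x
        show s • x = e.symm (s • e x)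
        rw [map_smul, e.symm_apply_apply]
      rw [this]
      exact e.symm.bijective.comp (Function.Bijective.comp h1 e.bijective)
    · have := hsub n p (fun h => hp ((hS n p).2 h))
      exact ⟨fun _ _ _ => Subsingleton.elim _ _, fun y => ⟨y, Subsingleton.elim _ _⟩⟩
  · intro n p r hr x
    by_cases hp : p ∈ F n \ F (n + 1)
    · let e := optEquiv (R := R) hp (LocalizedModule p.asIdeal.primeCompl (K n))
      obtain ⟨m, hm⟩ := htors n p hp r hr (e x)
      refine ⟨m, e.injective ?_⟩
      rw [map_smul, hm, map_zero]
    · have := hsub n p (fun h => hp ((hS n p).2 h))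
      exact ⟨0, Subsingleton.elim _ _⟩
  · intro n p hn
    have hp := (hS n p).2 hn
    have h0 : ¬ EL p 0 (K n) := by
      rw [hgen n p hp.1]
      obtain ⟨t, ht, ht2, -⟩ := gor_ht hQ p
      rw [show EL p (0 + n) M = EL p (0 + n) R from rfl, ht, not_not]
      rw [ht2] at hn
      norm_cast at hn
      omega
    rw [EL, EV.zero_quot_iff] at h0
    push Not at h0
    obtain ⟨y, hy, hy0⟩ := h0
    let e := optEquiv (R := R) hp (LocalizedModule p.asIdeal.primeCompl (K n))
    refine ⟨e.symm y, fun h => hy0 (e.symm.injective (h.trans (map_zero _).symm)), fun r hr => ?_⟩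
    rw [← map_smul e.symm, hy r hr, map_zero]
  · intro n I hI y hy
    apply (E n).symm.injective
    rw [map_zero]
    apply Subtype.ext
    funext p
    show ((E n).symm y).1 p = 0
    let z : LocalizedModule p.1.asIdeal.primeCompl (K n) := ((E n).symm y).1 p
    have hz : ∀ r ∈ I, r • z = 0 := by
      intro r hr
      have h1 : r • (E n).symm y = 0 := by rw [← map_smul, hy r hr, map_zero]
      exact congrFun (congrArg Subtype.val h1) p
    show z = 0
    obtain ⟨k, s, hs, hk⟩ := loc_exists_mk z
    -- a uniform denominator
    have h1 : ∀ r ∈ I, ∃ t ∈ p.1.asIdeal.primeCompl, t • r • k = 0 := by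
      intro r hr
      apply loc_mk_eq_zero.1
      rw [map_smul, ← hk, smul_comm, hz r hr, smul_zero]
    have h2 : ∃ t ∈ p.1.asIdeal.primeCompl, ∀ r ∈ I, r • t • k = 0 := by
      obtain ⟨G, hG⟩ := (IsNoetherian.noetherian I)
      choose! t ht ht2 using h1
      refine ⟨∏ r ∈ G, t r, ?_, ?_⟩
      · refine Submonoid.prod_mem _ fun r hr => ht r (hG ▸ Submodule.subset_span hr)
      · intro r hr
        rw [← hG] at hr
        induction hr using Submodule.span_induction with
        | mem x hx =>
          have hx' : x ∈ G := hx
          rw [← Finset.prod_erase_mul _ _ hx', mul_smul, smul_comm, smul_comm x,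
            ht2 x (hG ▸ Submodule.subset_span hx), smul_zero]
        | zero => rw [zero_smul]
        | add x y _ _ hx hy => rw [add_smul, hx, hy, add_zero]
        | smul c x _ hx => rw [smul_assoc, hx, smul_zero]
    obtain ⟨t, ht, ht2⟩ := h2
    have h3 := hI (t • k) ht2
    have h4 : (t * s) • z = 0 := by rw [mul_smul, hk, ← map_smul, h3, map_zero]
    exact (loc_smul_bij p.1.asIdeal.primeCompl ⟨t * s, mul_mem ht hs⟩).1
      (h4.trans (smul_zero _).symm)
  · obtain ⟨d, hd⟩ : ∃ d : ℕ, ∀ p : PrimeSpectrum R, Order.height p ≤ d := by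
      have h1 : ringKrullDim R ≠ ⊤ := hdim.ne
      rcases isEmpty_or_nonempty (PrimeSpectrum R) with h | h
      · exact ⟨0, fun p => h.elim p⟩
      · have h2 : ringKrullDim R ≠ ⊥ := by
          rw [ringKrullDim, Order.krullDim_ne_bot_iff]; exact h
        obtain ⟨d', hd'⟩ := WithBot.ne_bot_iff_exists.1 h2
        have h3 : d' ≠ ⊤ := by rintro rfl; exact h1 hd'.symm
        obtain ⟨d, rfl⟩ := ENat.ne_top_iff_exists.1 h3
        refine ⟨d, fun p => ?_⟩
        have := Order.height_le_krullDim p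
        rw [← ringKrullDim, ← hd'] at this
        exact_mod_cast this
    refine ⟨d, fun n hn => ?_⟩
    refine ⟨fun a b => (hse n).inj ?_⟩
    apply Subtype.ext
    funext p
    have := hsub n p (by
      intro h
      have h1 := (htM_le_height R p).trans (hd p)
      rw [h] at h1
      norm_cast at h1
      omega)
    exact Subsingleton.elim (α := P n p) _ _

end
end GGP

namespace GGP
section
open GG CategoryTheory Abelian IsLocalRing
variable {R : Type u} [CommRing R]
variable {A B C E : Type u} [AddCommGroup A] [Module R A] [AddCommGroup B] [Module R B]
    [AddCommGroup C] [Module R C] [AddCommGroup E] [Module R E]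

/-- contravariant functoriality -/
def cmap (E : Type u) [AddCommGroup E] [Module R E] (g : A →ₗ[R] B) : (B →ₗ[R] E) →ₗ[R] (A →ₗ[R] E) where
  toFun φ := φ.comp g
  map_add' a b := LinearMap.add_comp _ _ _
  map_smul' r a := LinearMap.smul_comp _ _ _

theorem cmap_apply (g : A →ₗ[R] B) (φ : B →ₗ[R] E) (x : A) : cmap E g φ x = φ (g x) := rfl

theorem SE.chom {f : A →ₗ[R] B} {g : B →ₗ[R] C} (h : SE f g) (hC : EV R 1 C E) :
    SE (cmap E g) (cmap E f) := by
  refine ⟨?_, ?_, ?_⟩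
  · intro a b hab
    apply LinearMap.ext
    intro c
    obtain ⟨y, rfl⟩ := h.surj c
    exact LinearMap.congr_fun hab y
  · intro φ
    constructor
    · intro hφ
      obtain ⟨ψ, hψ⟩ := exists_desc h.surj φ (fun x hx => by
        obtain ⟨a, rfl⟩ := (h.ex x).1 hx
        exact LinearMap.congr_fun hφ a)
      exact ⟨ψ, LinearMap.ext fun x => hψ x⟩
    · rintro ⟨ψ, rfl⟩
      apply LinearMap.ext
      intro a
      show ψ (g (f a)) = 0
      rw [(h.ex (f a)).2 ⟨a, rfl⟩, map_zero]
  · intro φ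
    exact EV.extend h hC φ

/-- biduality map -/
def bdm (R : Type u) [CommRing R] (E : Type u) [AddCommGroup E] [Module R E] (M : Type u) [AddCommGroup M] [Module R M] :
    M →ₗ[R] ((M →ₗ[R] E) →ₗ[R] E) where
  toFun m :=
    { toFun := fun φ => φ m
      map_add' := fun _ _ => rfl
      map_smul' := fun _ _ => rfl }
  map_add' a b := LinearMap.ext fun φ => map_add φ a b
  map_smul' r a := LinearMap.ext fun φ => map_smul φ r a

theorem bdm_apply (M : Type u) [AddCommGroup M] [Module R M] (m : M) (φ : M →ₗ[R] E) :
    bdm R E M m φ = φ m := rfl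

theorem bdm_nat (f : A →ₗ[R] B) (x : A) : cmap E (cmap E f) (bdm R E A x) = bdm R E B (f x) := rfl

theorem bdm_surj {f : A →ₗ[R] B} {g : B →ₗ[R] C} (h : SE f g) (hC : EV R 1 C E)
    (hA : EV R 1 (A →ₗ[R] E) E) (hb : Function.Surjective (bdm R E B)) : Function.Surjective (bdm R E C) := by
  have h2 := (h.chom hC).chom hA
  intro y
  obtain ⟨z, rfl⟩ := h2.surj y
  obtain ⟨b, rfl⟩ := hb z
  exact ⟨g b, rfl⟩

theorem bdm_inj {f : A →ₗ[R] B} {g : B →ₗ[R] C} (h : SE f g) (hC : EV R 1 C E)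
    (hA : EV R 1 (A →ₗ[R] E) E) (hb : Function.Injective (bdm R E B)) (ha : Function.Surjective (bdm R E A)) :
    Function.Injective (bdm R E C) := by
  have h2 := (h.chom hC).chom hA
  rw [injective_iff_map_eq_zero]
  intro c hc
  obtain ⟨b, rfl⟩ := h.surj c
  obtain ⟨a', ha'⟩ := (h2.ex (bdm R E B b)).1 hc
  obtain ⟨a, rfl⟩ := ha a'
  rw [bdm_nat] at ha'
  rw [← hb ha']
  exact (h.ex _).2 ⟨a, rfl⟩

theorem bdm_mid {f : A →ₗ[R] B} {g : B →ₗ[R] C} (h : SE f g) (hC : EV R 1 C E)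
    (hA : EV R 1 (A →ₗ[R] E) E) (ha : Function.Bijective (bdm R E A)) (hc : Function.Bijective (bdm R E C)) :
    Function.Bijective (bdm R E B) := by
  have h2 := (h.chom hC).chom hA
  constructor
  · rw [injective_iff_map_eq_zero]
    intro b hb
    have h1 : bdm R E C (g b) = 0 := by rw [← bdm_nat, hb, map_zero]
    have h3 : g b = 0 := hc.1 (h1.trans (map_zero _).symm)
    obtain ⟨a, rfl⟩ := (h.ex b).1 h3
    rw [← bdm_nat] at hb
    have h4 : bdm R E A a = 0 := h2.inj (hb.trans (map_zero _).symm)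
    rw [ha.1 (h4.trans (map_zero _).symm), map_zero]
  · intro y
    obtain ⟨c, hc'⟩ := hc.2 (cmap E (cmap E g) y)
    obtain ⟨b, rfl⟩ := h.surj c
    have h3 : cmap E (cmap E g) (y - bdm R E B b) = 0 := by
      rw [map_sub, ← hc', bdm_nat, sub_self]
    obtain ⟨a', ha'⟩ := (h2.ex _).1 h3
    obtain ⟨a, rfl⟩ := ha.2 a'
    refine ⟨f a + b, ?_⟩
    rw [map_add, ← bdm_nat, ha', sub_add_cancel]

/-- good modules -/
structure Gd (R E B : Type u) [CommRing R] [AddCommGroup E] [Module R E] [AddCommGroup B] [Module R B] : Prop where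
  fin : Module.Finite R B
  fin' : Module.Finite R (B →ₗ[R] E)
  ev : ∀ i, EV R (i + 1) B E
  ev' : ∀ i, EV R (i + 1) (B →ₗ[R] E) E
  bd : Function.Bijective (bdm R E B)

theorem Gd.congr (e : A ≃ₗ[R] B) (h : Gd R E A) : Gd R E B := by
  have := h.fin
  have := h.fin'
  let e' : (A →ₗ[R] E) ≃ₗ[R] (B →ₗ[R] E) := LinearEquiv.congrLeft E R e
  refine ⟨Module.Finite.equiv e, Module.Finite.equiv e', fun i => EV.congr_left e (h.ev i),
    fun i => EV.congr_left e' (h.ev' i), ?_⟩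
  have hsub : Subsingleton (PUnit.{u+1} →ₗ[R] E) := ⟨fun a b => LinearMap.ext fun x => by
    rw [Subsingleton.elim x 0, map_zero, map_zero]⟩
  refine bdm_mid (SE.of_equiv e (C := PUnit) inferInstance) (EV.of_subsingleton_left 1) (h.ev' 0) h.bd ?_
  constructor
  · intro a b _; exact Subsingleton.elim _ _
  · intro y
    refine ⟨0, LinearMap.ext fun φ => ?_⟩
    rw [Subsingleton.elim φ 0, map_zero, map_zero]

theorem Gd.prod (h : Gd R E A) (h' : Gd R E B) : Gd R E (A × B) := by
  have := h.fin
  have := h.fin'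
  have := h'.fin
  have := h'.fin'
  let e : ((A →ₗ[R] E) × (B →ₗ[R] E)) ≃ₗ[R] (A × B →ₗ[R] E) := LinearMap.coprodEquiv R
  refine ⟨inferInstance, Module.Finite.equiv e, fun i => EV.prod_left (h.ev i) (h'.ev i),
    fun i => EV.congr_left e (EV.prod_left (h.ev' i) (h'.ev' i)), ?_⟩
  exact bdm_mid SE.inl_snd (h'.ev 0) (h.ev' 0) h.bd h'.bd

theorem Gd.zero (hA : Subsingleton A) : Gd R E A := by
  have hsub : Subsingleton (A →ₗ[R] E) := ⟨fun a b => LinearMap.ext fun x => by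
    rw [Subsingleton.elim x 0, map_zero, map_zero]⟩
  refine ⟨inferInstance, inferInstance, fun i => EV.of_subsingleton_left _, fun i => EV.of_subsingleton_left _, ?_, ?_⟩
  · intro a b _; exact Subsingleton.elim _ _
  · intro y
    refine ⟨0, LinearMap.ext fun φ => ?_⟩
    rw [Subsingleton.elim φ 0, map_zero, map_zero]

theorem Gd.pow (h : Gd R E A) : ∀ n : ℕ, Gd R E (Fin n → A)
  | 0 => Gd.zero inferInstance
  | n + 1 => (h.prod (h.pow n)).congr (Fin.consLinearEquiv R (fun _ : Fin (n + 1) => A))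

variable [IsNoetherianRing R]

theorem Gd.all (I : Ideal R) (hF : Gd R E (R ⧸ I)) (d : ℕ)
    (hd : ∀ i > d, ∀ (L : Type u) [AddCommGroup L] [Module R L], EV R i L E)
    (M : Type u) [AddCommGroup M] [Module R M] [Module.Finite R M]
    (hI : ∀ r ∈ I, ∀ m : M, r • m = 0) (hM : ∀ i, EV R (i + 1) M E) : Gd R E M := by
  have cover : ∀ (M : Type u) [AddCommGroup M] [Module R M] [Module.Finite R M],
      (∀ r ∈ I, ∀ m : M, r • m = 0) → ∃ (n : ℕ) (g : (Fin n → R ⧸ I) →ₗ[R] M), Function.Surjective g := by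
    intro M _ _ _ hI
    obtain ⟨n, g, hg⟩ := Module.Finite.exists_fin' R M
    let π : (Fin n → R) →ₗ[R] (Fin n → R ⧸ I) := LinearMap.pi fun i => I.mkQ.comp (LinearMap.proj i)
    have hπ : Function.Surjective π := by
      intro y
      choose z hz using fun i => I.mkQ_surjective (y i)
      exact ⟨z, funext hz⟩
    obtain ⟨ψ, hψ⟩ := exists_desc hπ g (fun x hx => by
      have hx' : ∀ i, x i ∈ I := fun i => by
        have := congrFun hx i
        exact (Submodule.Quotient.mk_eq_zero I).1 this
      rw [← Finset.univ_sum_single x, map_sum]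
      refine Finset.sum_eq_zero fun i _ => ?_
      have : Pi.single i (x i) = x i • (Pi.single i (1 : R) : Fin n → R) := by
        rw [← Pi.single_smul, smul_eq_mul, mul_one]
      rw [this, map_smul, hI _ (hx' i)])
    exact ⟨n, ψ, fun m => by obtain ⟨x, rfl⟩ := hg m; exact ⟨π x, hψ x⟩⟩
  have kerI : ∀ (M : Type u) [AddCommGroup M] [Module R M] (n : ℕ) (g : (Fin n → R ⧸ I) →ₗ[R] M),
      ∀ r ∈ I, ∀ m : LinearMap.ker g, r • m = 0 := by
    intro M _ _ n g r hr m
    apply Subtype.ext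
    funext i
    show r • (m.1 i) = 0
    obtain ⟨z, hz⟩ := I.mkQ_surjective (m.1 i)
    rw [← hz, ← map_smul]
    exact (Submodule.Quotient.mk_eq_zero I).2 (I.mul_mem_right _ hr)
  have ev' : ∀ k : ℕ, ∀ (M : Type u) [AddCommGroup M] [Module R M] [Module.Finite R M],
      (∀ r ∈ I, ∀ m : M, r • m = 0) → (∀ i, EV R (i + 1) M E) → ∀ i, i + 1 + k > d →
      EV R (i + 1) (M →ₗ[R] E) E := by
    intro k
    induction k with
    | zero => intro M _ _ _ _ _ i hi; exact hd _ hi _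
    | succ k ih =>
      intro M _ _ _ hI hM i hi
      obtain ⟨n, g, hg⟩ := cover M hI
      have hse := SE.ker g hg
      have hM' : ∀ i, EV R (i + 1) (LinearMap.ker g) E := fun i =>
        EV.left₁ hse ((hF.pow n).ev i) (hM (i + 1))
      exact EV.left₁ (hse.chom (hM 0)) ((hF.pow n).ev' i)
        (ih (LinearMap.ker g) (kerI M n g) hM' (i + 1) (by omega))
  have surj : ∀ (M : Type u) [AddCommGroup M] [Module R M] [Module.Finite R M],
      (∀ r ∈ I, ∀ m : M, r • m = 0) → (∀ i, EV R (i + 1) M E) → Function.Surjective (bdm R E M) := by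
    intro M _ _ _ hI hM
    obtain ⟨n, g, hg⟩ := cover M hI
    have hse := SE.ker g hg
    have hM' : ∀ i, EV R (i + 1) (LinearMap.ker g) E := fun i =>
      EV.left₁ hse ((hF.pow n).ev i) (hM (i + 1))
    exact bdm_surj hse (hM 0) (ev' (d + 1) (LinearMap.ker g) (kerI M n g) hM' 0 (by omega)) (hF.pow n).bd.2
  obtain ⟨n, g, hg⟩ := cover M hI
  have hse := SE.ker g hg
  have hM' : ∀ i, EV R (i + 1) (LinearMap.ker g) E := fun i =>
    EV.left₁ hse ((hF.pow n).ev i) (hM (i + 1))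
  refine ⟨inferInstance, ?_, hM, fun i => ev' (d + 1) M hI hM i (by omega), ?_, surj M hI hM⟩
  · have := (hF.pow n).fin'
    exact Module.Finite.of_injective (cmap E g) (hse.chom (hM 0)).inj
  · exact bdm_inj hse (hM 0) (ev' (d + 1) (LinearMap.ker g) (kerI M n g) hM' 0 (by omega)) (hF.pow n).bd.1
      (surj (LinearMap.ker g) (kerI M n g) hM')

end
end GGP

namespace GGP
section
open GG CategoryTheory Abelian IsLocalRing
variable {R : Type u} [CommRing R]

/-- cyclic map -/
theorem exists_cyc {N : Type u} [AddCommGroup N] [Module R N] (I : Ideal R) (e : N) (h : ∀ r ∈ I, r • e = 0) :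
    ∃ φ : (R ⧸ I) →ₗ[R] N, ∀ r, φ (I.mkQ r) = r • e := by
  obtain ⟨φ, hφ⟩ := exists_desc I.mkQ_surjective (LinearMap.toSpanSingleton R N e) (fun r hr => by
    exact h r ((Submodule.Quotient.mk_eq_zero I).1 hr))
  exact ⟨φ, fun r => by rw [hφ]; rfl⟩

theorem mkQ_zero {I : Ideal R} {r : R} : I.mkQ r = 0 ↔ r ∈ I := Submodule.Quotient.mk_eq_zero I

theorem smul_mkQ {I : Ideal R} {r a : R} (h : r ∈ I) : r • I.mkQ a = 0 := by
  rw [← map_smul, mkQ_zero]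
  exact I.mul_mem_right _ h

theorem Gd_cyc {E : Type u} [AddCommGroup E] [Module R E] (I : Ideal R) (e : E)
    (h1 : ∀ r, r • e = 0 ↔ r ∈ I) (h2 : ∀ y : E, (∀ r ∈ I, r • y = 0) → ∃ s : R, y = s • e)
    (h3 : ∀ i, EV R (i + 1) (R ⧸ I) E) : Gd R E (R ⧸ I) := by
  obtain ⟨φ, hφ⟩ := exists_cyc I e (fun r hr => (h1 r).2 hr)
  have hkill : ∀ r ∈ I, r • φ = 0 := by
    intro r hr
    apply LinearMap.ext
    intro a
    obtain ⟨a, rfl⟩ := I.mkQ_surjective a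
    show r • φ (I.mkQ a) = 0
    rw [← map_smul, smul_mkQ hr, map_zero]
  obtain ⟨Θ, hΘ⟩ := exists_cyc I φ hkill
  have hgen : ∀ ψ : (R ⧸ I) →ₗ[R] E, ∃ s : R, ψ = s • φ := by
    intro ψ
    obtain ⟨s, hs⟩ := h2 (ψ (I.mkQ 1)) (fun r hr => by rw [← map_smul, smul_mkQ hr, map_zero])
    refine ⟨s, LinearMap.ext fun a => ?_⟩
    obtain ⟨a, rfl⟩ := I.mkQ_surjective a
    have : I.mkQ a = a • I.mkQ 1 := by rw [← map_smul, smul_eq_mul, mul_one]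
    show ψ (I.mkQ a) = s • φ (I.mkQ a)
    rw [hφ, this, map_smul, hs, smul_comm]
  have hbij : Function.Bijective Θ := by
    constructor
    · rw [injective_iff_map_eq_zero]
      intro a ha
      obtain ⟨a, rfl⟩ := I.mkQ_surjective a
      rw [hΘ] at ha
      have := LinearMap.congr_fun ha (I.mkQ 1)
      have h4 : a • φ (I.mkQ 1) = 0 := this
      rw [hφ, one_smul, h1] at h4
      exact mkQ_zero.2 h4
    · intro ψ
      obtain ⟨s, rfl⟩ := hgen ψ
      exact ⟨I.mkQ s, hΘ s⟩
  let θ := LinearEquiv.ofBijective Θ hbij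
  refine ⟨inferInstance, Module.Finite.equiv θ, h3, fun i => EV.congr_left θ (h3 i), ?_, ?_⟩
  · rw [injective_iff_map_eq_zero]
    intro a ha
    obtain ⟨a, rfl⟩ := I.mkQ_surjective a
    have h4 : φ (I.mkQ a) = 0 := LinearMap.congr_fun ha φ
    rw [hφ, h1] at h4
    exact mkQ_zero.2 h4
  · intro Ψ
    obtain ⟨s, hs⟩ := h2 (Ψ φ) (fun r hr => by rw [← map_smul, hkill r hr, map_zero])
    refine ⟨I.mkQ s, LinearMap.ext fun ψ => ?_⟩
    obtain ⟨r, rfl⟩ := hgen ψ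
    show r • φ (I.mkQ s) = Ψ (r • φ)
    rw [hφ, map_smul Ψ, hs]

variable [IsNoetherianRing R]

abbrev QRes.J (q : QRes R) (n : ℕ) : Type u := finPi R (fun p => q.P n p)

theorem QRes.Jinj (q : QRes R) (n : ℕ) : Module.Injective R (q.J n) :=
  injective_finPi _ (q.inj n)

theorem QRes.fid (q : QRes R) : ∃ d : ℕ, ∀ (i n : ℕ), n + i > d → ∀ (L : Type u) [AddCommGroup L] [Module R L],
    EV R i L (q.K n) := by
  obtain ⟨d, hd⟩ := q.bd
  refine ⟨d, fun i => ?_⟩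
  induction i with
  | zero =>
    intro n hn L _ _
    have := hd n hn
    exact EV.of_subsingleton_right _
  | succ i ih =>
    intro n hn L _ _
    exact EV.left₂ (q.se n) (ih (n + 1) (by omega) L) (EV.of_injective (q.Jinj n) i)

theorem QRes.shift (q : QRes R) (n j i : ℕ) (L : Type u) [AddCommGroup L] [Module R L] :
    EV R (i + 1) L (q.K (n + j)) ↔ EV R (i + j + 1) L (q.K n) := by
  induction j generalizing i with
  | zero => rfl
  | succ j ih =>
    rw [← add_assoc n j 1, ← EV.shift_inj_iff (q.se (n + j)) (q.Jinj _), ih (i + 1)]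
    rw [show i + (j + 1) + 1 = i + 1 + j + 1 by omega]

theorem QRes.chain (q : QRes R) (M : Type u) [AddCommGroup M] [Module R M] [Module.Finite R M] (c : ℕ)
    (h0 : ∀ i < c, ∀ f : M →ₗ[R] q.J i, f = 0) : ∀ j ≤ c, ∃ I : Ideal R, (∀ r ∈ I, ∀ m : M, r • m = 0) ∧
      ∃ e : q.K j, (∀ r, r • e = 0 ↔ r ∈ I) ∧ (∀ y : q.K j, (∀ r ∈ I, r • y = 0) → ∃ s : R, y = s • e) ∧
      ∀ i, EV R (i + 1) (R ⧸ I) (q.K j) := by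
  intro j
  induction j with
  | zero =>
    intro _
    refine ⟨⊥, ?_, q.e 1, ?_, ?_, ?_⟩
    · intro r hr m
      rw [(Submodule.mem_bot R).1 hr, zero_smul]
    · intro r
      rw [← map_smul, smul_eq_mul, mul_one, map_eq_zero_iff _ q.e.injective, Submodule.mem_bot]
    · intro y _
      refine ⟨q.e.symm y, ?_⟩
      rw [← map_smul, smul_eq_mul, mul_one, LinearEquiv.apply_symm_apply]
    · intro i
      exact EV.congr_left (Submodule.quotEquivOfEqBot (⊥ : Ideal R) rfl).symm (EV.of_projective i)
  | succ j ih =>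
    intro hj
    obtain ⟨I, hI, e, h1, h2, h3⟩ := ih (by omega)
    obtain ⟨φ, hφ⟩ := exists_cyc I e (fun r hr => (h1 r).2 hr)
    have hφi : Function.Injective φ := by
      rw [injective_iff_map_eq_zero]
      intro a ha
      obtain ⟨a, rfl⟩ := I.mkQ_surjective a
      rw [hφ, h1] at ha
      exact mkQ_zero.2 ha
    have hsub : Subsingleton (M →ₗ[R] (R ⧸ I)) := by
      have : ∀ f : M →ₗ[R] (R ⧸ I), f = 0 := by
        intro f
        apply LinearMap.ext
        intro m
        apply hφi
        apply (q.se j).inj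
        have := LinearMap.congr_fun (h0 j (by omega) ((q.f j).comp (φ.comp f))) m
        rw [LinearMap.zero_apply, map_zero, map_zero]
        exact this
      exact ⟨fun a b => by rw [this a, this b]⟩
    rw [IsSMulRegular.subsingleton_linearMap_iff] at hsub
    obtain ⟨x, hx, hreg⟩ := hsub
    rw [Module.mem_annihilator] at hx
    have hreg' : ∀ r, x * r ∈ I → r ∈ I := by
      intro r hr
      apply mkQ_zero.1
      apply hreg
      show x • I.mkQ r = x • 0
      rw [← map_smul, smul_zero]
      exact mkQ_zero.2 hr
    let I' : Ideal R := I ⊔ Ideal.span {x}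
    have hI' : ∀ r, r ∈ I' ↔ ∃ s, r - s * x ∈ I := by
      intro r
      constructor
      · intro hr
        obtain ⟨a, ha, b, hb, rfl⟩ := Submodule.mem_sup.1 hr
        obtain ⟨s, rfl⟩ := Ideal.mem_span_singleton'.1 hb
        exact ⟨s, by rwa [add_sub_cancel_right]⟩
      · rintro ⟨s, hs⟩
        rw [← sub_add_cancel r (s * x)]
        exact add_mem (Ideal.mem_sup_left hs) (Ideal.mem_sup_right (Ideal.mul_mem_left _ _ (Ideal.mem_span_singleton_self x)))
    have hk' : ∀ (N : Type u) [AddCommGroup N] [Module R N] (y : N), (∀ r ∈ I, r • y = 0) → x • y = 0 →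
        ∀ r ∈ I', r • y = 0 := by
      intro N _ _ y hy hxy r hr
      obtain ⟨s, hs⟩ := (hI' r).1 hr
      rw [← sub_add_cancel r (s * x), add_smul, hy _ hs, mul_smul, hxy, smul_zero, add_zero]
    have hJ : ∀ y : q.J j, (∀ r ∈ I', r • y = 0) → y = 0 := by
      apply q.ess j I'
      intro k hk
      obtain ⟨s, rfl⟩ := h2 k (fun r hr => hk r (Ideal.mem_sup_left hr))
      have := hk x (Ideal.mem_sup_right (Ideal.mem_span_singleton_self x))
      rw [smul_smul, h1] at this
      exact (h1 s).2 (hreg' s this)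
    have hxinj : Function.Injective (LinearMap.lsmul R (R ⧸ I) x) := hreg
    obtain ⟨χ, hχ⟩ := extend_of_injective (q.Jinj j) hxinj ((q.f j).comp φ)
    let z : q.J j := χ (I.mkQ 1)
    have hIz : ∀ r ∈ I, r • z = 0 := fun r hr => by
      show r • χ _ = 0
      rw [← map_smul, smul_mkQ hr, map_zero]
    have hxz : x • z = q.f j e := by
      have := LinearMap.congr_fun hχ (I.mkQ 1)
      have h4 : χ (x • I.mkQ 1) = q.f j (φ (I.mkQ 1)) := this
      rw [hφ, one_smul, map_smul] at h4
      exact h4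
    have hker : ∀ w : q.J j, (∀ r ∈ I, r • w = 0) → q.g j w = 0 → ∃ s : R, w = (s * x) • z := by
      intro w hw hg
      obtain ⟨k, rfl⟩ := ((q.se j).ex w).1 hg
      obtain ⟨s, rfl⟩ := h2 k (fun r hr => (q.se j).inj (by rw [map_smul, hw r hr, map_zero]))
      exact ⟨s, by rw [mul_smul, hxz, map_smul]⟩
    have hse : SE (LinearMap.lsmul R (R ⧸ I) x) (Submodule.factor (le_sup_left : I ≤ I')) := by
      refine ⟨hxinj, ?_, Submodule.factor_surjective _⟩
      intro a
      obtain ⟨a, rfl⟩ := I.mkQ_surjective a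
      show I'.mkQ a = 0 ↔ _
      rw [mkQ_zero, hI']
      constructor
      · rintro ⟨s, hs⟩
        refine ⟨I.mkQ s, ?_⟩
        show x • I.mkQ s = I.mkQ a
        rw [← map_smul, smul_eq_mul, ← sub_eq_zero, ← map_sub, mkQ_zero, ← neg_mem_iff, neg_sub, mul_comm]
        exact hs
      · rintro ⟨s, hs⟩
        obtain ⟨s, rfl⟩ := I.mkQ_surjective s
        have hs' : x • I.mkQ s = I.mkQ a := hs
        refine ⟨s, ?_⟩
        rw [← map_smul, smul_eq_mul, ← sub_eq_zero, ← map_sub, mkQ_zero, ← neg_mem_iff, neg_sub, mul_comm] at hs'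
        exact hs'
    refine ⟨I', ?_, q.g j z, ?_, ?_, ?_⟩
    · intro r hr m
      exact hk' M m (fun r hr => hI r hr m) (hx m) r hr
    · intro r
      constructor
      · intro hr
        rw [← map_smul] at hr
        obtain ⟨s, hs⟩ := hker (r • z) (fun a ha => by rw [smul_comm, hIz a ha, smul_zero]) hr
        refine (hI' r).2 ⟨s, ?_⟩
        rw [← h1]
        apply (q.se j).inj
        have h6 : (r - s * x) • z = 0 := (sub_smul r (s * x) z).trans (by rw [hs, sub_self])
        rw [map_smul, ← hxz, smul_comm, h6, smul_zero, map_zero]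
      · refine hk' _ _ (fun a ha => by rw [← map_smul, hIz a ha, map_zero]) ?_ r
        rw [← map_smul, hxz]
        exact ((q.se j).ex _).2 ⟨e, rfl⟩
    · intro y hy
      obtain ⟨φy, hφy⟩ := exists_cyc I y (fun r hr => hy r (Ideal.mem_sup_left hr))
      obtain ⟨ψ, hψ⟩ := EV.lift (q.se j) (h3 0) φy
      let w := ψ (I.mkQ 1)
      have hIw : ∀ r ∈ I, r • w = 0 := fun r hr => by
        show r • ψ _ = 0
        rw [← map_smul, smul_mkQ hr, map_zero]
      have hgw : q.g j w = y := by
        have := LinearMap.congr_fun hψ (I.mkQ 1)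
        rw [hφy, one_smul] at this
        exact this
      obtain ⟨s, hs⟩ := hker (x • w) (fun a ha => by rw [smul_comm, hIw a ha, smul_zero])
        (by rw [map_smul, hgw]; exact hy x (Ideal.mem_sup_right (Ideal.mem_span_singleton_self x)))
      refine ⟨s, ?_⟩
      have h5 : w - s • z = 0 := by
        apply hJ
        refine hk' (q.J j) (w - s • z) ?_ ?_
        · intro r hr
          refine (smul_sub r w (s • z)).trans ?_
          rw [hIw r hr, smul_comm, hIz r hr, smul_zero, sub_zero]
        · refine (smul_sub x w (s • z)).trans ?_
          rw [hs, mul_comm, mul_smul, sub_self]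
      rw [← hgw, sub_eq_zero.1 h5, map_smul]
    · intro i
      exact (EV.shift_inj_iff (q.se j) (q.Jinj j)).1 (EV.right₁ hse (h3 i) (h3 (i + 1)))

theorem QRes.dual (q : QRes R) (M : Type u) [AddCommGroup M] [Module R M] [Module.Finite R M] (c : ℕ)
    (h0 : ∀ i < c, ∀ f : M →ₗ[R] q.J i, f = 0) (hE : ∀ i, EV R (i + 1) M (q.K c)) : Gd R (q.K c) M := by
  obtain ⟨I, hI, e, h1, h2, h3⟩ := q.chain M c h0 c le_rfl
  obtain ⟨d, hd⟩ := q.fid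
  exact Gd.all I (Gd_cyc I e h1 h2 h3) d (fun i hi L _ _ => hd i c (by omega) L) M hI hE

end
end GGP

namespace GGP
section
open GG CategoryTheory Abelian IsLocalRing
variable {R : Type u} [CommRing R]

theorem lmap_lsmul (S : Submonoid R) (M : Type u) [AddCommGroup M] [Module R M] (x : R) (y : LocalizedModule S M) :
    lmap S (LinearMap.lsmul R M x) y = x • y := by
  obtain ⟨k, s, hs, hk⟩ := loc_exists_mk y
  apply (loc_smul_bij S ⟨s, hs⟩).1
  show s • (lmap S (LinearMap.lsmul R M x)).restrictScalars R y = s • x • y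
  rw [← map_smul, smul_comm, hk]
  show lmap S (LinearMap.lsmul R M x) (LocalizedModule.mkLinearMap S M k) = _
  rw [lmap_mk, ← map_smul]
  rfl

theorem reg_iff (p : PrimeSpectrum R) (M : Type u) [AddCommGroup M] [Module R M] (x : R) :
    (Function.Injective fun y : LocalizedModule p.asIdeal.primeCompl M => x • y) ↔
      ∀ m : M, (∃ s ∉ p.asIdeal, s • x • m = 0) → ∃ s ∉ p.asIdeal, s • m = 0 := by
  constructor
  · intro h m ⟨s, hs, hm⟩
    have h1 : x • LocalizedModule.mkLinearMap p.asIdeal.primeCompl M m = 0 := by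
      rw [← map_smul]
      exact loc_mk_eq_zero.2 ⟨s, hs, hm⟩
    obtain ⟨s, hs, h2⟩ := loc_mk_eq_zero.1 (h (h1.trans (smul_zero x).symm))
    exact ⟨s, hs, h2⟩
  · intro h a b hab
    rw [← sub_eq_zero]
    have h1 : x • (a - b) = 0 := by rw [smul_sub]; exact sub_eq_zero.2 hab
    obtain ⟨k, s, hs, hk⟩ := loc_exists_mk (a - b)
    have h2 : LocalizedModule.mkLinearMap p.asIdeal.primeCompl M (x • k) = 0 := by
      rw [map_smul, ← hk, smul_comm, h1, smul_zero]
    obtain ⟨t, ht, h3⟩ := loc_mk_eq_zero.1 h2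
    obtain ⟨t, ht, h4⟩ := h k ⟨t, ht, h3⟩
    have h5 : LocalizedModule.mkLinearMap p.asIdeal.primeCompl M k = 0 := loc_mk_eq_zero.2 ⟨t, ht, h4⟩
    rw [h5] at hk
    apply (loc_smul_bij p.asIdeal.primeCompl ⟨s, hs⟩).1
    exact hk.trans (smul_zero s).symm

theorem loc_quot_SE (p : PrimeSpectrum R) (M : Type u) [AddCommGroup M] [Module R M] (x : R)
    (h : Function.Injective fun y : LocalizedModule p.asIdeal.primeCompl M => x • y) :
    SE (LinearMap.lsmul R (LocalizedModule p.asIdeal.primeCompl M) x)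
      ((lmap p.asIdeal.primeCompl (LinearMap.range (LinearMap.lsmul R M x)).mkQ).restrictScalars R) := by
  refine ⟨h, ?_, LocalizedModule.map_surjective _ _ (Submodule.mkQ_surjective _)⟩
  have h1 := LocalizedModule.map_exact p.asIdeal.primeCompl (LinearMap.lsmul R M x)
    (LinearMap.range (LinearMap.lsmul R M x)).mkQ (LinearMap.exact_map_mkQ_range _)
  intro y
  refine (h1 y).trans ?_
  constructor
  · rintro ⟨z, rfl⟩
    exact ⟨z, (lmap_lsmul _ M x z).symm⟩
  · rintro ⟨z, rfl⟩
    exact ⟨z, lmap_lsmul _ M x z⟩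

/-- elementary depth predicate -/
def DP (p : PrimeSpectrum R) : ℕ → ModuleCat.{u} R → Prop
  | 0, _ => True
  | n + 1, M => ∃ x ∈ p.asIdeal, (∀ m : M, (∃ s ∉ p.asIdeal, s • x • m = 0) → ∃ s ∉ p.asIdeal, s • m = 0) ∧
      DP p n (ModuleCat.of R (M ⧸ LinearMap.range (LinearMap.lsmul R M x)))

theorem DP_transfer {Q : Type u} [CommRing Q] (φ : Q →+* R) (hφ : Function.Surjective φ) (p : PrimeSpectrum R)
    (n : ℕ) : ∀ (M : ModuleCat.{u} R) (M' : ModuleCat.{u} Q) (e : M' ≃+ M), (∀ a m, e (a • m) = φ a • e m) →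
      (DP (PrimeSpectrum.comap φ p) n M' ↔ DP p n M) := by
  induction n with
  | zero => intro M M' e he; exact Iff.rfl
  | succ n ih =>
    intro M M' e he
    have hsm : ∀ (s : Q) (m : M'), s • m = 0 ↔ φ s • e m = 0 := by
      intro s m
      rw [← he, map_eq_zero_iff _ e.injective]
    have key : ∀ x : Q, (x ∈ (PrimeSpectrum.comap φ p).asIdeal ∧
        (∀ m : M', (∃ s ∉ (PrimeSpectrum.comap φ p).asIdeal, s • x • m = 0) →
          ∃ s ∉ (PrimeSpectrum.comap φ p).asIdeal, s • m = 0) ∧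
        DP (PrimeSpectrum.comap φ p) n (ModuleCat.of Q (M' ⧸ LinearMap.range (LinearMap.lsmul Q M' x)))) ↔
        (φ x ∈ p.asIdeal ∧ (∀ m : M, (∃ s ∉ p.asIdeal, s • φ x • m = 0) → ∃ s ∉ p.asIdeal, s • m = 0) ∧
        DP p n (ModuleCat.of R (M ⧸ LinearMap.range (LinearMap.lsmul R M (φ x))))) := by
      intro x
      refine and_congr Iff.rfl (and_congr ?_ ?_)
      · have h1 : ∀ m : M', (∃ s ∉ (PrimeSpectrum.comap φ p).asIdeal, s • m = 0) ↔ ∃ s ∉ p.asIdeal, s • e m = 0 := by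
          intro m
          constructor
          · rintro ⟨s, hs, h⟩
            exact ⟨φ s, hs, (hsm s m).1 h⟩
          · rintro ⟨s, hs, h⟩
            obtain ⟨s, rfl⟩ := hφ s
            exact ⟨s, hs, (hsm s m).2 h⟩
        constructor
        · intro h m hm
          obtain ⟨m, rfl⟩ := e.surjective m
          rw [← he] at hm
          exact (h1 m).1 (h m ((h1 _).2 hm))
        · intro h m hm
          rw [h1, he] at hm
          exact (h1 m).2 (h _ hm)
      · let e' : (M' ⧸ (LinearMap.range (LinearMap.lsmul Q M' x)).toAddSubgroup) ≃+
            (M ⧸ (LinearMap.range (LinearMap.lsmul R M (φ x))).toAddSubgroup) :=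
          QuotientAddGroup.congr _ _ e (by
            ext m
            constructor
            · rintro ⟨_, ⟨y, rfl⟩, rfl⟩
              exact ⟨e y, (he x y).symm⟩
            · rintro ⟨y, rfl⟩
              obtain ⟨y, rfl⟩ := e.surjective y
              exact ⟨x • y, ⟨y, rfl⟩, he x y⟩)
        refine ih _ _ e' ?_
        intro a m
        obtain ⟨m, rfl⟩ := Submodule.mkQ_surjective _ m
        show (LinearMap.range (LinearMap.lsmul R M (φ x))).mkQ (e (a • m)) =
          φ a • (LinearMap.range (LinearMap.lsmul R M (φ x))).mkQ (e m)
        rw [he, map_smul]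
    constructor
    · rintro ⟨x, hx⟩
      exact ⟨φ x, (key x).1 hx⟩
    · rintro ⟨x, hx⟩
      obtain ⟨x, rfl⟩ := hφ x
      exact ⟨x, (key x).2 hx⟩

variable [IsNoetherianRing R]

theorem DP_iff (p : PrimeSpectrum R) (n : ℕ) : ∀ (M : ModuleCat.{u} R) [Module.Finite R M],
    DP p n M ↔ ∀ i < n, EL p i M := by
  induction n with
  | zero => intro M _; exact ⟨fun _ i hi => by omega, fun _ => trivial⟩
  | succ n ih =>
    intro M _
    constructor
    · rintro ⟨x, hx, hreg, hD⟩
      have hinj := (reg_iff p M x).2 hreg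
      have hse := loc_quot_SE p M x hinj
      have h1 := (ih _).1 hD
      have hz : ∀ y : R ⧸ p.asIdeal, x • y = 0 := by
        intro y
        obtain ⟨y, rfl⟩ := p.asIdeal.mkQ_surjective y
        exact smul_mkQ hx
      intro i hi
      rcases i with _ | i
      · rw [EL, EV.zero_quot_iff]
        intro y hy
        exact hinj ((hy x hx).trans (smul_zero x).symm)
      · obtain ⟨e⟩ := hse.coker_unique (SE.coker _ hinj)
        exact EV.mul_zero₂ hz hinj (EV.congr_right e (h1 i (by omega)))
    · intro h
      have h0 := h 0 (by omega)
      rw [EL_iff_res] at h0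
      obtain ⟨x, hx, hi⟩ := exists_reg h0
      obtain ⟨r, s, rfl⟩ := IsLocalization.exists_mk'_eq p.asIdeal.primeCompl x
      rw [IsLocalization.AtPrime.mk'_mem_maximal_iff _ p.asIdeal] at hx
      have hinj : Function.Injective fun y : LocalizedModule p.asIdeal.primeCompl M => r • y := by
        intro a b hab
        apply hi
        apply (loc_smul_bij p.asIdeal.primeCompl s).1
        have h5 : ∀ c : LocalizedModule p.asIdeal.primeCompl M,
            (s : R) • (IsLocalization.mk' (Localization.AtPrime p.asIdeal) r s) • c = r • c := by
          intro c
          rw [← algebraMap_smul (Localization.AtPrime p.asIdeal) (s : R), smul_smul, IsLocalization.mk'_spec', algebraMap_smul]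
        exact (h5 a).trans (hab.trans (h5 b).symm)
      refine ⟨r, hx, (reg_iff p M r).1 hinj, (ih _).2 ?_⟩
      intro i hi
      exact EV.right₂ (loc_quot_SE p M r hinj) (h i (by omega)) (h (i + 1) (by omega))

theorem EL_transfer {Q : Type u} [CommRing Q] [IsNoetherianRing Q] (φ : Q →+* R) (hφ : Function.Surjective φ)
    (p : PrimeSpectrum R) (n : ℕ) (M : ModuleCat.{u} R) (M' : ModuleCat.{u} Q) [Module.Finite R M] [Module.Finite Q M']
    (e : M' ≃+ M) (he : ∀ a m, e (a • m) = φ a • e m) :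
      (∀ i < n, EL (PrimeSpectrum.comap φ p) i M') ↔ ∀ i < n, EL p i M := by
  rw [← DP_iff, ← DP_iff]
  exact DP_transfer φ hφ p n M M' e he

theorem ext_van [IsLocalRing R] (d : ℕ) (hd : ∀ i > d, ∀ (L : Type u) [AddCommGroup L] [Module R L] [Module.Finite R L], EV R i L R)
    (e : ℕ) : ∀ (N : Type u) [AddCommGroup N] [Module R N] [Module.Finite R N],
      (∀ i < e, EV R i (R ⧸ maximalIdeal R) N) → ∀ i, i + e > d → EV R i N R := by
  induction e with
  | zero => intro N _ _ _ _ i hi; exact hd i hi N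
  | succ e ih =>
    intro N _ _ _ h i hi
    obtain ⟨x, hx, hinj⟩ := exists_reg (h 0 (by omega))
    refine EV.mul_surj₁ hx hinj (ih _ ?_ (i + 1) (by omega))
    intro j hj
    exact EV.right₂ (SE.coker (LinearMap.lsmul R N x) hinj) (h j (by omega)) (h (j + 1) (by omega))

theorem gor_van {p : PrimeSpectrum R} {t : ℕ} (ht : ∀ i, EL p i R ↔ i ≠ t) :
    ∀ i > t, ∀ (L : Type u) [AddCommGroup L] [Module (Localization.AtPrime p.asIdeal) L]
      [Module.Finite (Localization.AtPrime p.asIdeal) L],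
      EV (Localization.AtPrime p.asIdeal) i L (Localization.AtPrime p.asIdeal) := by
  intro i hi L _ _ _
  obtain ⟨e⟩ := locSelf p.asIdeal.primeCompl
  refine EV_of_res (n0 := t + 1) ?_ L i hi
  intro j hj
  exact EV.congr_right e.symm ((EL_iff_res p j).1 ((ht j).2 (by omega)))

theorem pure_main (hQ : IsGorensteinRing R) (q : QRes R) (M : Type u) [AddCommGroup M] [Module R M] [Module.Finite R M]
    (c : ℕ) (n : PrimeSpectrum R → ℕ)
    (hM : ∀ p ∈ Module.support R M, htM R R p = ((n p + c : ℕ) : ℕ∞) ∧ ∀ i < n p, EL p i M) :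
    ∃ T : ModuleCat.{u} R, Module.Finite R T ∧ (∀ r : R, (∀ m : M, r • m = 0) → ∀ t : T, r • t = 0) ∧
      (∀ i, EV R (i + 1) T (q.K c)) ∧ Nonempty (M ≃ₗ[R] (T →ₗ[R] q.K c)) ∧
      ∀ p, ∀ i : ℕ, ((i + c : ℕ) : ℕ∞) < htM R R p → EL p i T := by
  have h0 : ∀ i < c, ∀ f : M →ₗ[R] q.J i, f = 0 := by
    intro i hi f
    apply LinearMap.ext
    intro m
    apply Subtype.ext
    funext p
    show (f m).1 p = 0
    by_cases hp : htM R R p = i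
    · have hps : p ∉ Module.support R M := by
        intro h
        rw [(hM p h).1] at hp
        norm_cast at hp
        omega
      rw [mem_supp_iff] at hps
      push Not at hps
      obtain ⟨s, hs, hsp⟩ := hps m
      apply (q.bij i p s hsp).1
      show s • (f m).1 p = s • 0
      rw [smul_zero]
      have : s • f m = 0 := by rw [← map_smul, hs, map_zero]
      exact congrFun (congrArg Subtype.val this) p
    · have := q.sub i p hp
      exact Subsingleton.elim (α := q.P i p) _ _
  have hE0 : ∀ i, EV R (i + c + 1) M R := by
    intro i
    apply EV.of_local
    intro p
    rw [EV.loc_iff p.asIdeal.primeCompl]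
    by_cases hp : p ∈ Module.support R M
    · obtain ⟨t, ht, ht2, -⟩ := gor_ht hQ p
      obtain ⟨h1, h2⟩ := hM p hp
      rw [ht2] at h1
      norm_cast at h1
      obtain ⟨e⟩ := locSelf p.asIdeal.primeCompl
      refine EV.congr_right e ?_
      refine ext_van t (gor_van ht) (n p) _ ?_ _ (by omega)
      intro j hj
      exact (EL_iff_res p j).1 (h2 j hj)
    · rw [Module.notMem_support_iff] at hp
      exact EV.of_subsingleton_left _
  have hE : ∀ i, EV R (i + 1) M (q.K c) := by
    intro i
    have := q.shift 0 c i M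
    rw [zero_add] at this
    rw [this]
    exact EV.congr_right q.e (hE0 i)
  have hG := q.dual M c h0 hE
  refine ⟨ModuleCat.of R (M →ₗ[R] q.K c), hG.fin', ?_, hG.ev', ⟨LinearEquiv.ofBijective _ hG.bd⟩, ?_⟩
  · intro r hr t
    apply LinearMap.ext
    intro m
    have t' : M →ₗ[R] q.K c := t
    show r • (t : M →ₗ[R] q.K c) m = 0
    rw [← map_smul, hr, map_zero]
  · intro p i hi
    have hfin := hG.fin'
    obtain ⟨t, ht, ht2, -⟩ := gor_ht hQ p
    rw [ht2] at hi
    norm_cast at hi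
    classical
    by_contra hcon
    have hex : ∃ s, ¬ EL p s (M →ₗ[R] q.K c) := ⟨i, hcon⟩
    let s := Nat.find hex
    have hs : ¬ EL p s (M →ₗ[R] q.K c) := Nat.find_spec hex
    have hsi : s ≤ i := Nat.find_min' hex hcon
    have hlt : ∀ j < s, EL p j (M →ₗ[R] q.K c) := fun j hj => not_not.1 (Nat.find_min hex hj)
    obtain ⟨L, f, hLf, hfi, hL⟩ := k_embed s (LocalizedModule p.asIdeal.primeCompl (M →ₗ[R] q.K c))
      (fun j hj => (EL_iff_res p j).1 (hlt j hj)) (fun h => hs ((EL_iff_res p s).2 h))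
    obtain ⟨e⟩ := locSelf p.asIdeal.primeCompl
    have h1 := hL (Localization.AtPrime p.asIdeal) c (fun j hj => by
      obtain ⟨j, rfl⟩ : ∃ k, j = k + c + 1 := ⟨j - c - 1, by omega⟩
      refine EV.congr_right e.symm ?_
      rw [← EV.loc_iff p.asIdeal.primeCompl]
      apply EV.localize
      have := q.shift 0 c j (M →ₗ[R] q.K c)
      rw [zero_add] at this
      exact EV.congr_right q.e.symm (this.1 (hG.ev' j))) t (by omega)
    have h2 := EV.left₁ (SE.coker f hfi) h1 (gor_van ht (t + 1) (by omega) _)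
    have h3 : EL p t R := by
      rw [EL_iff_res]
      exact EV.congr_right e h2
    exact (ht t).1 h3 rfl

end
end GGP

namespace GGP
section
open GG CategoryTheory Abelian IsLocalRing
variable {Q : Type u} [CommRing Q] {R : Type u} [CommRing R]

/-- the part of a `Q`-module killed by the kernel of a surjection -/
def TB (φ : Q →+* R) (X : Type u) [AddCommGroup X] [Module Q X] : Submodule Q X where
  carrier := {x | ∀ a, φ a = 0 → a • x = 0}
  add_mem' := by
    intro x y hx hy a ha
    rw [smul_add, hx a ha, hy a ha, add_zero]
  zero_mem' := fun a _ => smul_zero a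
  smul_mem' := by
    intro b x hx a ha
    rw [smul_comm, hx a ha, smul_zero]

instance TBgrp (φ : Q →+* R) (X : Type u) [AddCommGroup X] [Module Q X] : AddCommGroup (TB φ X) :=
  Submodule.addCommGroup _

theorem TB_eq (φ : Q →+* R) {X : Type u} [AddCommGroup X] [Module Q X] (x : TB φ X) {a b : Q} (h : φ a = φ b) :
    a • x = b • x := by
  rw [← sub_eq_zero, ← sub_smul]
  apply Subtype.ext
  exact x.2 _ (by rw [map_sub, h, sub_self])

noncomputable instance TBmod (φ : Q →+* R) [hφ : RingHomSurjective φ] (X : Type u) [AddCommGroup X] [Module Q X] :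
    Module R (TB φ X) where
  smul r x := Function.surjInv hφ.is_surjective r • x
  one_smul x := by
    have h := TB_eq φ x (a := Function.surjInv hφ.is_surjective 1) (b := 1) (by rw [Function.surjInv_eq hφ.is_surjective, map_one])
    exact h.trans (one_smul _ _)
  mul_smul r s x := by
    have h := TB_eq φ x (a := Function.surjInv hφ.is_surjective (r * s))
      (b := Function.surjInv hφ.is_surjective r * Function.surjInv hφ.is_surjective s)
      (by rw [map_mul, Function.surjInv_eq hφ.is_surjective, Function.surjInv_eq hφ.is_surjective, Function.surjInv_eq hφ.is_surjective])
    exact h.trans (mul_smul _ _ _)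
  smul_zero r := smul_zero (Function.surjInv hφ.is_surjective r)
  smul_add r x y := smul_add (Function.surjInv hφ.is_surjective r) x y
  add_smul r s x := by
    have h := TB_eq φ x (a := Function.surjInv hφ.is_surjective (r + s))
      (b := Function.surjInv hφ.is_surjective r + Function.surjInv hφ.is_surjective s)
      (by rw [map_add, Function.surjInv_eq hφ.is_surjective, Function.surjInv_eq hφ.is_surjective, Function.surjInv_eq hφ.is_surjective])
    exact h.trans (add_smul _ _ _)
  zero_smul x := by
    have h := TB_eq φ x (a := Function.surjInv hφ.is_surjective 0) (b := 0) (by rw [Function.surjInv_eq hφ.is_surjective, map_zero])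
    exact h.trans (zero_smul _ _)

variable (φ : Q →+* R) [hφ : RingHomSurjective φ]

theorem TB_smul {X : Type u} [AddCommGroup X] [Module Q X] (a : Q) (x : TB φ X) : φ a • x = a • x :=
  TB_eq φ x (a := Function.surjInv hφ.is_surjective (φ a)) (Function.surjInv_eq _ _)

theorem TB_smul_val {X : Type u} [AddCommGroup X] [Module Q X] (a : Q) (x : TB φ X) : (φ a • x).1 = a • x.1 := by
  rw [TB_smul]; rfl

/-- functoriality -/
noncomputable def TBmap {X Y : Type u} [AddCommGroup X] [Module Q X] [AddCommGroup Y] [Module Q Y] (f : X →ₗ[Q] Y) :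
    TB φ X →ₗ[R] TB φ Y where
  toFun x := ⟨f x.1, fun a ha => by rw [← map_smul, x.2 a ha, map_zero]⟩
  map_add' x y := Subtype.ext (map_add f x.1 y.1)
  map_smul' r x := by
    obtain ⟨a, rfl⟩ := hφ.is_surjective r
    apply Subtype.ext
    exact ((congrArg f (TB_smul_val φ a x)).trans (map_smul f a x.1)).trans (TB_smul_val φ a (⟨f x.1, fun a ha => by rw [← map_smul, x.2 a ha, map_zero]⟩ : TB φ Y)).symm

theorem SE.TB {A B C : Type u} [AddCommGroup A] [Module Q A] [AddCommGroup B] [Module Q B] [AddCommGroup C] [Module Q C]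
    {f : A →ₗ[Q] B} {g : B →ₗ[Q] C} (h : SE f g) (hB : ∀ a, φ a = 0 → ∀ b : B, a • b = 0) :
    SE (TBmap φ f) (TBmap φ g) where
  inj x y hxy := Subtype.ext (h.inj (congrArg Subtype.val hxy))
  ex := by
    intro y
    constructor
    · intro hy
      obtain ⟨x, hx⟩ := (h.ex y.1).1 (congrArg Subtype.val hy)
      refine ⟨⟨x, fun a ha => h.inj ?_⟩, Subtype.ext hx⟩
      rw [map_smul, map_zero, hB a ha]
    · rintro ⟨x, rfl⟩
      exact Subtype.ext ((h.ex (f x.1)).2 ⟨_, rfl⟩)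
  surj := by
    intro z
    obtain ⟨y, hy⟩ := h.surj z.1
    exact ⟨⟨y, fun a ha => hB a ha y⟩, Subtype.ext hy⟩

theorem exists_restrict (M : Type u) [AddCommGroup M] [Module R M] :
    ∃ (M' : ModuleCat.{u} Q) (e : M' ≃+ M), ∀ a m, e (a • m) = φ a • e m :=
  ⟨@ModuleCat.of Q _ M _ (Module.compHom M φ), AddEquiv.refl M, fun _ _ => rfl⟩

theorem TB_injective (X : Type u) [AddCommGroup X] [Module Q X] (hX : Module.Injective Q X) :
    Module.Injective R (TB φ X) := by
  refine ⟨fun A B _ _ _ _ f hf g => ?_⟩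
  obtain ⟨A', eA, hA⟩ := exists_restrict φ A
  obtain ⟨B', eB, hB⟩ := exists_restrict φ B
  let f' : A' →ₗ[Q] B' :=
    { toFun := fun x => eB.symm (f (eA x))
      map_add' := fun x y => by simp
      map_smul' := fun a x => by
        apply eB.injective
        simp [hA, hB] }
  let g' : A' →ₗ[Q] X :=
    { toFun := fun x => (g (eA x)).1
      map_add' := fun x y => by simp
      map_smul' := fun a x => by
        rw [hA, map_smul, TB_smul_val]; rfl }
  obtain ⟨ψ, hψ⟩ := extend_of_injective hX (f := f') (fun x y h => eA.injective (hf (eB.symm.injective h))) g'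
  refine ⟨{ toFun := fun b => ⟨ψ (eB.symm b), fun a ha => ?_⟩, map_add' := fun x y => ?_, map_smul' := fun r x => ?_ }, fun x => ?_⟩
  · rw [← map_smul]
    have : a • eB.symm b = 0 := by
      apply eB.injective
      rw [hB, ha, zero_smul, map_zero]
    rw [this, map_zero]
  · apply Subtype.ext
    show ψ _ = ψ _ + ψ _
    rw [map_add, map_add]
  · obtain ⟨a, rfl⟩ := hφ.is_surjective r
    apply Subtype.ext
    rw [RingHom.id_apply, TB_smul_val]
    show ψ _ = a • ψ _
    rw [← map_smul]
    congr 1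
    apply eB.injective
    rw [hB]
    simp
  · apply Subtype.ext
    show ψ (eB.symm (f x)) = (g x).1
    have h := LinearMap.congr_fun hψ (eA.symm x)
    have h' : ψ (eB.symm (f (eA (eA.symm x)))) = (g (eA (eA.symm x))).1 := h
    rwa [AddEquiv.apply_symm_apply] at h'

theorem finite_restrict (M : Type u) [AddCommGroup M] [Module R M] [Module.Finite R M] (M' : Type u) [AddCommGroup M'] [Module Q M']
    (e : M' ≃+ M) (he : ∀ a m, e (a • m) = φ a • e m) : Module.Finite Q M' := by
  obtain ⟨s, hs⟩ := Module.Finite.fg_top (R := R) (M := M)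
  classical
  refine ⟨⟨s.image e.symm, ?_⟩⟩
  rw [eq_top_iff]
  intro x _
  have h : ∀ y : M, y ∈ Submodule.span R (s : Set M) → e.symm y ∈ Submodule.span Q ((s.image e.symm : Finset M') : Set M') := by
    intro y hy
    induction hy using Submodule.span_induction with
    | mem y hy => exact Submodule.subset_span (Finset.mem_coe.2 (Finset.mem_image_of_mem _ hy))
    | zero => rw [map_zero]; exact Submodule.zero_mem _
    | add y z _ _ h1 h2 => rw [map_add]; exact Submodule.add_mem _ h1 h2
    | smul r y _ h =>
      obtain ⟨a, rfl⟩ := hφ.is_surjective r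
      have : e.symm (φ a • y) = a • e.symm y := by
        apply e.injective
        rw [he]; simp
      rw [this]
      exact Submodule.smul_mem _ _ h
  have := h (e x) (by rw [hs]; trivial)
  rwa [AddEquiv.symm_apply_apply] at this

theorem finite_TB (T : Type u) [AddCommGroup T] [Module Q T] [Module.Finite Q T] (hT : ∀ a, φ a = 0 → ∀ t : T, a • t = 0) :
    Module.Finite R (TB φ T) := by
  let g : T →ₛₗ[φ] TB φ T :=
    { toFun := fun t => ⟨t, fun a ha => hT a ha t⟩
      map_add' := fun _ _ => rfl
      map_smul' := fun a t => by rw [TB_smul]; rfl }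
  exact Module.Finite.of_surjective g (fun t => ⟨t.1, rfl⟩)

/-- dualizing data for a Cohen–Macaulay module -/
structure Data (R : Type u) [CommRing R] (M : Type u) [AddCommGroup M] [Module R M] where
  T : ModuleCat.{u} R
  fin : Module.Finite R T
  D : ℕ → ModuleCat.{u} R
  inj : ∀ i, Module.Injective R (D i)
  typ : ∀ i : ℕ, TypeOn {p | p ∈ Module.support R M ∧ htM R M p = i} (D i)
  soc : ∀ (i : ℕ), ∀ p ∈ Module.support R M, htM R M p = i → ∃ y : D i, y ≠ 0 ∧ ∀ r ∈ p.asIdeal, r • y = 0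
  Z : ℕ → ModuleCat.{u} R
  f : ∀ i, Z i →ₗ[R] (T →ₗ[R] D i)
  g : ∀ i, (T →ₗ[R] D i) →ₗ[R] Z (i + 1)
  se : ∀ i, SE (f i) (g i)
  e : M ≃ₗ[R] Z 0
  ann : ∀ r : R, (∀ m : M, r • m = 0) → ∀ t : T, r • t = 0
  el : ∀ p ∈ Module.support R M, ∀ i : ℕ, (i : ℕ∞) < htM R M p → EL p i T
end
end GGP

namespace GGP
section
open GG CategoryTheory Abelian IsLocalRing
variable {Q : Type u} [CommRing Q] {R : Type u} [CommRing R]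
variable (φ : Q →+* R) [hφ : RingHomSurjective φ]

/-- target of the component map -/
noncomputable abbrev DD (P : PrimeSpectrum Q → ModuleCat.{u} Q) (S : Set (PrimeSpectrum R)) : Submodule R (Π p : PrimeSpectrum R, Opt (p ∈ S) (TB φ (P (PrimeSpectrum.comap φ p)))) :=
  finPi R (fun p : PrimeSpectrum R => Opt (p ∈ S) (TB φ (P (PrimeSpectrum.comap φ p))))

theorem DD_ext (P : PrimeSpectrum Q → ModuleCat.{u} Q) (S : Set (PrimeSpectrum R)) (x y : DD φ P S)
    (h : ∀ p hp, (x.1 p hp).1 = (y.1 p hp).1) : x = y := by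
  apply Subtype.ext
  funext p hp
  exact Subtype.ext (h p hp)

theorem DD_smul (P : PrimeSpectrum Q → ModuleCat.{u} Q) (S : Set (PrimeSpectrum R)) (x : DD φ P S) (a : Q) (p hp) :
    ((φ a • x).1 p hp).1 = a • (x.1 p hp).1 := TB_smul_val φ a (x.1 p hp)

/-- component map on elements -/
noncomputable def compEl (P : PrimeSpectrum Q → ModuleCat.{u} Q) (S : Set (PrimeSpectrum R)) (y : finPi Q (fun p => P p))
    (hy : ∀ a, φ a = 0 → a • y = 0) : DD φ P S :=
  ⟨fun p _ => ⟨y.1 (PrimeSpectrum.comap φ p), fun a ha => 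
          congrFun (congrArg Subtype.val (hy a ha)) (PrimeSpectrum.comap φ p)⟩, by
        have h0 : {q | y.1 q ≠ 0}.Finite := y.2
        refine (h0.preimage (f := PrimeSpectrum.comap φ) (PrimeSpectrum.comap_injective_of_surjective φ hφ.is_surjective).injOn).subset ?_
        intro p hp hz
        apply hp
        funext h
        exact Subtype.ext hz⟩

theorem compEl_apply (P : PrimeSpectrum Q → ModuleCat.{u} Q) (S : Set (PrimeSpectrum R)) (y : finPi Q (fun p => P p))
    (hy : ∀ a, φ a = 0 → a • y = 0) (p hp) : ((compEl φ P S y hy).1 p hp).1 = y.1 (PrimeSpectrum.comap φ p) := rfl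

/-- component map of a homomorphism -/
noncomputable def compHom1 (P : PrimeSpectrum Q → ModuleCat.{u} Q) (S : Set (PrimeSpectrum R)) 
    (T : Type u) [AddCommGroup T] [Module Q T] (hT : ∀ a, φ a = 0 → ∀ t : T, a • t = 0)
    (ψ : T →ₗ[Q] finPi Q (fun p => P p)) : TB φ T →ₗ[R] DD φ P S where
  toFun := fun t => compEl φ P S (ψ t.1) (fun a ha => by rw [← map_smul, hT a ha, map_zero])
  map_add' := fun t t' => by
    apply DD_ext
    intro p hp
    show (ψ (t.1 + t'.1)).1 _ = (ψ t.1).1 _ + (ψ t'.1).1 _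
    rw [map_add]; rfl
  map_smul' := fun r t => by
    obtain ⟨a, rfl⟩ := hφ.is_surjective r
    apply DD_ext
    intro p hp
    rw [RingHom.id_apply, DD_smul, compEl_apply, compEl_apply, TB_smul_val, map_smul]; rfl

/-- component map -/
noncomputable def compMap (P : PrimeSpectrum Q → ModuleCat.{u} Q) (S : Set (PrimeSpectrum R)) 
    (T : Type u) [AddCommGroup T] [Module Q T] (hT : ∀ a, φ a = 0 → ∀ t : T, a • t = 0)  :
    TB φ (T →ₗ[Q] finPi Q (fun p => P p)) →ₗ[R] (TB φ T →ₗ[R] DD φ P S) where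
  toFun ψ := compHom1 φ P S T hT ψ.1
  map_add' ψ ψ' := rfl
  map_smul' r ψ := by
    obtain ⟨a, rfl⟩ := hφ.is_surjective r
    apply LinearMap.ext
    intro t
    apply DD_ext
    intro p hp
    refine Eq.trans ?_ (DD_smul φ P S (compHom1 φ P S T hT ψ.1 t) a p hp).symm
    show ((φ a • ψ).1 t.1).1 _ = a • (ψ.1 t.1).1 _
    rw [TB_smul_val]; rfl

theorem compMap_apply (P : PrimeSpectrum Q → ModuleCat.{u} Q) (S : Set (PrimeSpectrum R)) 
    (T : Type u) [AddCommGroup T] [Module Q T] (hT : ∀ a, φ a = 0 → ∀ t : T, a • t = 0) (ψ t p h) :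
    (((compMap φ P S T hT ψ) t).1 p h).1 = (ψ.1 t.1).1 (PrimeSpectrum.comap φ p) := rfl

theorem compMap_bij (P : PrimeSpectrum Q → ModuleCat.{u} Q) (S : Set (PrimeSpectrum R)) 
    (T : Type u) [AddCommGroup T] [Module Q T] (hT : ∀ a, φ a = 0 → ∀ t : T, a • t = 0)
    (hbij : ∀ p, ∀ s ∉ p.asIdeal, Function.Bijective fun x : P p => s • x)
    (I : Ideal Q) (hI : ∀ a ∈ I, ∀ t : T, a • t = 0) (hIS : ∀ q : PrimeSpectrum Q, I ≤ q.asIdeal → ∃ p ∈ S, PrimeSpectrum.comap φ p = q) :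
    Function.Bijective (compMap φ P S T hT) := by
  have hcinj := PrimeSpectrum.comap_injective_of_surjective φ hφ.is_surjective
  constructor
  · intro ψ ψ' hψ
    apply Subtype.ext
    apply LinearMap.ext
    intro t
    apply Subtype.ext
    funext q
    by_contra hne
    have hIq : I ≤ q.asIdeal := by
      intro a ha
      by_contra haq
      apply hne
      apply (hbij q a haq).1
      have h : a • (ψ.1 t) = 0 := by rw [← map_smul, hI a ha, map_zero]
      have h' : a • (ψ'.1 t) = 0 := by rw [← map_smul, hI a ha, map_zero]
      exact (congrFun (congrArg Subtype.val h) q).trans (congrFun (congrArg Subtype.val h') q).symm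
    obtain ⟨p, hp, rfl⟩ := hIS q hIq
    apply hne
    have h := compMap_apply φ P S T hT ψ ⟨t, fun a ha => hT a ha t⟩ p ⟨hp⟩
    rw [hψ] at h
    exact h.symm
  · intro h
    have key : ∀ (t : T) (q : PrimeSpectrum Q), ∃ x : P q, (∀ p (hp : p ∈ S) (hq : q = PrimeSpectrum.comap φ p), hq ▸ x = ((h ⟨t, fun a ha => hT a ha t⟩).1 p ⟨hp⟩).1) ∧
        ((¬ ∃ p ∈ S, PrimeSpectrum.comap φ p = q) → x = 0) := by
      intro t q
      by_cases hq : ∃ p ∈ S, PrimeSpectrum.comap φ p = q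
      · obtain ⟨p, hp, rfl⟩ := hq
        refine ⟨((h ⟨t, fun a ha => hT a ha t⟩).1 p ⟨hp⟩).1, ?_, fun hn => (hn ⟨p, hp, rfl⟩).elim⟩
        intro p' hp' hq
        obtain rfl := hcinj hq
        rfl
      · exact ⟨0, fun p hp hq' => (hq ⟨p, hp, hq'.symm⟩).elim, fun _ => rfl⟩
    choose x hx hx0 using key
    have hx' : ∀ t p (hp : p ∈ S), x t (PrimeSpectrum.comap φ p) = ((h ⟨t, fun a ha => hT a ha t⟩).1 p ⟨hp⟩).1 :=
      fun t p hp => hx t _ p hp rfl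
    let ψ : T →ₗ[Q] finPi Q (fun p => P p) :=
      { toFun := fun t => ⟨fun q => x t q, by
          have h0 : {p | (h ⟨t, fun a ha => hT a ha t⟩).1 p ≠ 0}.Finite := (h ⟨t, fun a ha => hT a ha t⟩).2
          refine (h0.image (PrimeSpectrum.comap φ)).subset ?_
          intro q hq
          by_cases hqe : ∃ p ∈ S, PrimeSpectrum.comap φ p = q
          · obtain ⟨p, hp, rfl⟩ := hqe
            refine ⟨p, fun hz => hq ?_, rfl⟩
            show x t _ = 0
            rw [hx' t p hp, hz]; rfl
          · exact (hq (hx0 t q hqe)).elim⟩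
        map_add' := fun t t' => by
          apply Subtype.ext
          funext q
          show x (t + t') q = x t q + x t' q
          by_cases hqe : ∃ p ∈ S, PrimeSpectrum.comap φ p = q
          · obtain ⟨p, hp, rfl⟩ := hqe
            rw [hx' _ p hp, hx' _ p hp, hx' _ p hp]
            have := map_add h (⟨t, fun a ha => hT a ha t⟩ : TB φ T) ⟨t', fun a ha => hT a ha t'⟩
            exact congrArg (fun y => (y.1 p ⟨hp⟩).1) this
          · rw [hx0 _ q hqe, hx0 _ q hqe, hx0 _ q hqe, add_zero]
        map_smul' := fun a t => by
          apply Subtype.ext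
          funext q
          show x (a • t) q = a • x t q
          by_cases hqe : ∃ p ∈ S, PrimeSpectrum.comap φ p = q
          · obtain ⟨p, hp, rfl⟩ := hqe
            rw [hx' _ p hp, hx' _ p hp, ← TB_smul_val]
            have h1 : (⟨a • t, fun b hb => hT b hb (a • t)⟩ : TB φ T) = φ a • ⟨t, fun b hb => hT b hb t⟩ := by
              rw [TB_smul]; rfl
            rw [h1, map_smul]; rfl
          · rw [hx0 _ q hqe, hx0 _ q hqe, smul_zero] }
    refine ⟨⟨ψ, ?_⟩, ?_⟩
    · intro a ha
      apply LinearMap.ext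
      intro t
      show a • ψ t = 0
      rw [← map_smul, hT a ha, map_zero]
    · apply LinearMap.ext
      intro t
      apply Subtype.ext
      funext p hp
      apply Subtype.ext
      rw [compMap_apply]
      exact hx' t.1 p hp.down

end
end GGP

namespace GGP
section
open GG CategoryTheory Abelian IsLocalRing
variable {Q : Type u} [CommRing Q] {R : Type u} [CommRing R]
variable [IsNoetherianRing Q] [IsNoetherianRing R]
variable (φ : Q →+* R) [hφ : RingHomSurjective φ]

theorem DD_typ (P : PrimeSpectrum Q → ModuleCat.{u} Q) (S S' : Set (PrimeSpectrum R))
    (hbij : ∀ p, ∀ s ∉ p.asIdeal, Function.Bijective fun x : P p => s • x)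
    (htors : ∀ p, ∀ r ∈ p.asIdeal, ∀ x : P p, ∃ m : ℕ, r ^ m • x = 0)
    (hsub : ∀ p ∈ S, p ∉ S' → Subsingleton (P (PrimeSpectrum.comap φ p))) : TypeOn S' (DD φ P S) := by
  refine ⟨fun p => ModuleCat.of R (Opt (p ∈ S) (TB φ (P (PrimeSpectrum.comap φ p)))), ?_, ?_, ?_, ⟨LinearEquiv.refl R _⟩⟩
  · intro p s hs
    obtain ⟨a, rfl⟩ := hφ.is_surjective s
    have ha : a ∉ (PrimeSpectrum.comap φ p).asIdeal := hs
    constructor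
    · intro x y hxy
      funext hp
      apply Subtype.ext
      apply (hbij _ a ha).1
      have h := congrArg Subtype.val (congrFun hxy hp)
      have h2 : (φ a • x hp).1 = (φ a • y hp).1 := h
      rwa [TB_smul_val, TB_smul_val] at h2
    · intro y
      by_cases hp : p ∈ S
      · obtain ⟨x, hx⟩ := (hbij _ a ha).2 (y ⟨hp⟩).1
        have hx' : a • x = (y ⟨hp⟩).1 := hx
        refine ⟨fun _ => ⟨x, fun b hb => ?_⟩, ?_⟩
        · apply (hbij _ a ha).1
          show a • b • x = a • 0
          rw [smul_comm, hx', smul_zero]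
          exact (y ⟨hp⟩).2 b hb
        · funext hp'
          apply Subtype.ext
          refine (TB_smul_val φ a _).trans ?_
          exact hx
      · exact ⟨fun h => (hp h.down).elim, by funext h; exact (hp h.down).elim⟩
  · intro p r hr x
    obtain ⟨a, rfl⟩ := hφ.is_surjective r
    by_cases hp : p ∈ S
    · obtain ⟨m, hm⟩ := htors (PrimeSpectrum.comap φ p) a hr (x ⟨hp⟩).1
      refine ⟨m, ?_⟩
      funext hp'
      apply Subtype.ext
      show (φ a ^ m • x hp').1 = 0
      rw [← map_pow, TB_smul_val]
      exact hm
    · exact ⟨0, by funext h; exact (hp h.down).elim⟩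
  · intro p hp
    constructor
    intro x y
    funext hpS
    have := hsub p hpS.down hp
    exact Subtype.ext (Subsingleton.elim _ _)

theorem DD_soc (P : PrimeSpectrum Q → ModuleCat.{u} Q) (S : Set (PrimeSpectrum R)) (p : PrimeSpectrum R) (hp : p ∈ S)
    (h : ∃ x : P (PrimeSpectrum.comap φ p), x ≠ 0 ∧ ∀ r ∈ (PrimeSpectrum.comap φ p).asIdeal, r • x = 0) :
    ∃ y : DD φ P S, y ≠ 0 ∧ ∀ r ∈ p.asIdeal, r • y = 0 := by
  obtain ⟨x, hx, hk⟩ := h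
  have hm : ∀ a, φ a = 0 → a • x = 0 := fun a ha => hk a (by
    show φ a ∈ p.asIdeal
    rw [ha]; exact Submodule.zero_mem _)
  let z : Opt (p ∈ S) (TB φ (P (PrimeSpectrum.comap φ p))) := fun _ => ⟨x, hm⟩
  refine ⟨finSingle (R := R) (fun p : PrimeSpectrum R => Opt (p ∈ S) (TB φ (P (PrimeSpectrum.comap φ p)))) p z, fun h0 => ?_, fun r hr => ?_⟩
  · have h1 := finSingle_same (R := R) (fun p : PrimeSpectrum R => Opt (p ∈ S) (TB φ (P (PrimeSpectrum.comap φ p)))) p z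
    rw [h0] at h1
    apply hx
    have h2 := congrArg Subtype.val (congrFun h1 ⟨hp⟩)
    exact h2.symm
  · rw [← map_smul]
    have : r • z = 0 := by
      obtain ⟨a, rfl⟩ := hφ.is_surjective r
      funext h
      apply Subtype.ext
      exact (TB_smul_val φ a _).trans (hk a hr)
    rw [this, map_zero]

theorem DD_inj (P : PrimeSpectrum Q → ModuleCat.{u} Q) (S : Set (PrimeSpectrum R)) (hP : ∀ p, Module.Injective Q (P p)) :
    Module.Injective R (DD φ P S) :=
  injective_finPi _ fun p => injective_pi fun _ => TB_injective φ _ (hP _)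

/-- `M` with its restricted structure -/
theorem TB_restrict (M : Type u) [AddCommGroup M] [Module R M] (M' : Type u) [AddCommGroup M'] [Module Q M']
    (e : M' ≃+ M) (he : ∀ a m, e (a • m) = φ a • e m) : Nonempty (M ≃ₗ[R] TB φ M') := by
  have h0 : ∀ (m : M) a, φ a = 0 → a • e.symm m = 0 := by
    intro m a ha
    apply e.injective
    rw [he, ha, zero_smul, map_zero]
  refine ⟨LinearEquiv.ofBijective { toFun := fun m => ⟨e.symm m, h0 m⟩, map_add' := fun x y => ?_, map_smul' := fun r x => ?_ } ⟨?_, ?_⟩⟩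
  · exact Subtype.ext (map_add e.symm x y)
  · obtain ⟨a, rfl⟩ := hφ.is_surjective r
    apply Subtype.ext
    refine Eq.trans ?_ (TB_smul_val φ a _).symm
    apply e.injective
    rw [he]
    simp
  · intro x y h
    exact e.symm.injective (congrArg Subtype.val h)
  · intro y
    exact ⟨e y.1, Subtype.ext (e.symm_apply_apply _)⟩

theorem TB_equiv {X Y : Type u} [AddCommGroup X] [Module Q X] [AddCommGroup Y] [Module Q Y] (e : X ≃ₗ[Q] Y) :
    Nonempty (TB φ X ≃ₗ[R] TB φ Y) := by
  refine ⟨LinearEquiv.ofBijective (TBmap φ e.toLinearMap) ⟨fun x y h => ?_, fun y => ?_⟩⟩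
  · exact Subtype.ext (e.injective (congrArg Subtype.val h))
  · refine ⟨⟨e.symm y.1, fun a ha => ?_⟩, Subtype.ext (e.apply_symm_apply _)⟩
    rw [← map_smul, y.2 a ha, map_zero]

theorem data_pure (hQ : IsGorensteinRing Q) (q : QRes Q) (M : ModuleCat.{u} R) [Module.Finite R M] (hCM : CM R M)
    (c : ℕ) (hc : ∀ p ∈ Module.support R M, htM Q Q (PrimeSpectrum.comap φ p) = htM R M p + c) : Nonempty (Data R M) := by
  obtain ⟨M', e, he⟩ := exists_restrict φ M
  have hfin := finite_restrict φ M M' e he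
  have hS : ∀ q' : PrimeSpectrum Q, Module.annihilator Q M' ≤ q'.asIdeal → ∃ p ∈ Module.support R M, PrimeSpectrum.comap φ p = q' := by
    intro q' hq'
    have h1 : q' ∈ Set.range (PrimeSpectrum.comap φ) := by
      rw [range_comap_of_surjective _ φ hφ.is_surjective]
      intro a ha
      apply hq'
      rw [Module.mem_annihilator]
      intro m
      apply e.injective
      have : φ a = 0 := ha
      rw [he, this, zero_smul, map_zero]
    obtain ⟨p, rfl⟩ := h1
    refine ⟨p, ?_, rfl⟩
    rw [Module.support_eq_zeroLocus]
    intro r hr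
    obtain ⟨a, rfl⟩ := hφ.is_surjective r
    apply hq'
    rw [Module.mem_annihilator]
    intro m
    apply e.injective
    rw [he, map_zero]
    exact Module.mem_annihilator.1 hr _
  obtain ⟨T, hTf, hTann, hTev, ⟨eM⟩, hTel⟩ := pure_main hQ q M' c (fun q' => (htM Q Q q').toNat - c) (by
    intro q' hq'
    obtain ⟨p, hp, rfl⟩ := hS q' (by
      rw [Module.support_eq_zeroLocus] at hq'; exact hq')
    obtain ⟨k, hk⟩ := ENat.ne_top_iff_exists.1 (htM_lt_top M p).ne
    have h1 := hc p hp
    rw [← hk] at h1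
    have h2 : htM Q Q (PrimeSpectrum.comap φ p) = ((k + c : ℕ) : ℕ∞) := by rw [h1]; norm_cast
    have h3 : (htM Q Q (PrimeSpectrum.comap φ p)).toNat - c = k := by
      rw [h2, ENat.toNat_natCast]; omega
    show _ = (((htM Q Q (PrimeSpectrum.comap φ p)).toNat - c + c : ℕ) : ℕ∞) ∧ ∀ i < (htM Q Q (PrimeSpectrum.comap φ p)).toNat - c, _
    rw [h3]
    refine ⟨h2, ?_⟩
    refine (EL_transfer φ hφ.is_surjective p k M M' e he).2 fun i hi => hCM p hp i ?_
    rw [← hk]; exact_mod_cast hi)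
  have hker : ∀ a, φ a = 0 → ∀ t : T, a • t = 0 := by
    intro a ha
    apply hTann
    intro m
    apply e.injective
    rw [he, ha, zero_smul, map_zero]
  have hTf' := finite_TB φ T hker
  have hkH : ∀ (X : ModuleCat.{u} Q) a, φ a = 0 → ∀ b : T →ₗ[Q] X, a • b = 0 := by
    intro X a ha b
    apply LinearMap.ext
    intro t
    rw [LinearMap.smul_apply, ← map_smul, hker a ha, map_zero, LinearMap.zero_apply]
  have heq : ∀ i, Nonempty (TB φ (T →ₗ[Q] q.J (c + i)) ≃ₗ[R] (TB φ T →ₗ[R] DD φ (q.P (c + i)) (Module.support R M))) := fun i =>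
    ⟨LinearEquiv.ofBijective _ (compMap_bij φ (q.P (c + i)) (Module.support R M) T hker (q.bij (c + i)) (Module.annihilator Q M')
      (fun a ha => hTann a (Module.mem_annihilator.1 ha)) hS)⟩
  have hse : ∀ i, SE (TBmap φ (hmap T (q.f (c + i)))) (TBmap φ (hmap T (q.g (c + i)))) := by
    intro i
    apply SE.TB φ ((q.se (c + i)).hom T ?_) (hkH (ModuleCat.of Q (q.J (c + i))))
    have := (q.shift c i 0 T).2 (by
      have := hTev i
      rwa [show 0 + i + 1 = i + 1 by omega])
    exact this
  have E := fun i => (heq i).some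
  obtain ⟨e1⟩ := TB_restrict φ M M' e he
  obtain ⟨e2⟩ := TB_equiv φ eM
  refine ⟨{
    T := ModuleCat.of R (TB φ T)
    fin := hTf'
    D := fun i => ModuleCat.of R (DD φ (q.P (c + i)) (Module.support R M))
    inj := fun i => DD_inj φ _ _ (q.inj (c + i))
    typ := fun i => DD_typ φ _ _ _ (q.bij (c + i)) (q.tors (c + i)) ?_
    soc := fun i p hp hi => DD_soc φ _ _ p hp (q.soc (c + i) _ ?_)
    Z := fun i => ModuleCat.of R (TB φ (T →ₗ[Q] q.K (c + i)))
    f := fun i => (E i).toLinearMap.comp (TBmap φ (hmap T (q.f (c + i))))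
    g := fun i => (TBmap φ (hmap T (q.g (c + i)))).comp (E i).symm.toLinearMap
    se := fun i => by
      have h := (hse i).trans_equiv (B' := (TB φ T →ₗ[R] DD φ (q.P (c + i)) (Module.support R M))) (E i)
      exact h
    e := e1.trans e2
    ann := ?_
    el := ?_ }⟩
  · intro p hp hpi
    apply q.sub
    rw [hc p hp]
    intro h
    apply hpi
    refine ⟨hp, ?_⟩
    obtain ⟨k, hk⟩ := ENat.ne_top_iff_exists.1 (htM_lt_top M p).ne
    rw [← hk] at h ⊢
    have : k + c = c + i := by exact_mod_cast h
    have : k = i := by omega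
    rw [this]
  · rw [hc p hp, hi, add_comm]; norm_cast
  · intro r hr t
    obtain ⟨a, rfl⟩ := hφ.is_surjective r
    refine (TB_smul φ a t).trans (Subtype.ext (hTann a ?_ t.1))
    intro m
    apply e.injective
    rw [he, hr, map_zero]
  · intro p hp i hi
    obtain ⟨k, hk⟩ := ENat.ne_top_iff_exists.1 (htM_lt_top M p).ne
    refine (EL_transfer φ hφ.is_surjective p k (ModuleCat.of R (TB φ T)) T
      { toFun := fun t => ⟨t, fun a ha => hker a ha t⟩, invFun := fun t => t.1, left_inv := fun _ => rfl, right_inv := fun _ => rfl, map_add' := fun _ _ => rfl }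
      (fun a m => ?_)).1 (fun j hj => hTel _ j ?_) i ?_
    · exact (TB_smul φ a (⟨m, fun a ha => hker a ha m⟩ : TB φ T)).symm
    · rw [hc p hp, ← hk]
      norm_cast
      omega
    · rw [← hk] at hi
      exact_mod_cast hi

end
end GGP

namespace GGP
section
open GG CategoryTheory Abelian IsLocalRing
variable {R : Type u} [CommRing R]

theorem SE.prodMap {A B C A' B' C' : Type u} [AddCommGroup A] [Module R A] [AddCommGroup B] [Module R B] [AddCommGroup C] [Module R C]
    [AddCommGroup A'] [Module R A'] [AddCommGroup B'] [Module R B'] [AddCommGroup C'] [Module R C']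
    {f : A →ₗ[R] B} {g : B →ₗ[R] C} {f' : A' →ₗ[R] B'} {g' : B' →ₗ[R] C'} (h : SE f g) (h' : SE f' g') :
    SE (f.prodMap f') (g.prodMap g') where
  inj x y hxy := Prod.ext (h.inj (congrArg Prod.fst hxy)) (h'.inj (congrArg Prod.snd hxy))
  ex := by
    intro y
    constructor
    · intro hy
      obtain ⟨a, ha⟩ := (h.ex y.1).1 (congrArg Prod.fst hy)
      obtain ⟨b, hb⟩ := (h'.ex y.2).1 (congrArg Prod.snd hy)
      exact ⟨(a, b), Prod.ext ha hb⟩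
    · rintro ⟨x, rfl⟩
      exact Prod.ext ((h.ex _).2 ⟨_, rfl⟩) ((h'.ex _).2 ⟨_, rfl⟩)
  surj := by
    intro z
    obtain ⟨a, ha⟩ := h.surj z.1
    obtain ⟨b, hb⟩ := h'.surj z.2
    exact ⟨(a, b), Prod.ext ha hb⟩

theorem TypeOn.prod {S : Set (PrimeSpectrum R)} {N N' : Type u} [AddCommGroup N] [Module R N] [AddCommGroup N'] [Module R N']
    (h : TypeOn S N) (h' : TypeOn S N') : TypeOn S (N × N') := by
  obtain ⟨P, h1, h2, h3, ⟨e⟩⟩ := h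
  obtain ⟨P', h1', h2', h3', ⟨e'⟩⟩ := h'
  refine ⟨fun p => ModuleCat.of R (P p × P' p), ?_, ?_, ?_, ?_⟩
  · intro p s hs
    constructor
    · intro x y hxy
      exact Prod.ext ((h1 p s hs).1 (congrArg Prod.fst hxy)) ((h1' p s hs).1 (congrArg Prod.snd hxy))
    · intro y
      obtain ⟨a, ha⟩ := (h1 p s hs).2 y.1
      obtain ⟨b, hb⟩ := (h1' p s hs).2 y.2
      exact ⟨(a, b), Prod.ext ha hb⟩
  · intro p r hr x
    obtain ⟨n, hn⟩ := h2 p r hr x.1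
    obtain ⟨m, hm⟩ := h2' p r hr x.2
    refine ⟨n + m, Prod.ext ?_ ?_⟩
    · show r ^ (n + m) • x.1 = 0
      rw [add_comm, pow_add, mul_smul, hn, smul_zero]
    · show r ^ (n + m) • x.2 = 0
      rw [pow_add, mul_smul, hm, smul_zero]
  · intro p hp
    have := h3 p hp
    have := h3' p hp
    exact ⟨fun x y => Prod.ext (Subsingleton.elim _ _) (Subsingleton.elim _ _)⟩
  · let E : (finPi R (fun p => P p) × finPi R (fun p => P' p)) ≃ₗ[R] finPi R (fun p => (ModuleCat.of R (P p × P' p) : Type u)) :=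
    { toFun := fun x => ⟨fun p => (x.1.1 p, x.2.1 p), by
        have ha : {p | x.1.1 p ≠ 0}.Finite := x.1.2
        have hb : {p | x.2.1 p ≠ 0}.Finite := x.2.2
        refine (ha.union hb).subset ?_
        intro p hp
        by_contra hcon
        apply hp
        have hc1 : x.1.1 p = 0 := by
          by_contra h; exact hcon (Or.inl h)
        have hc2 : x.2.1 p = 0 := by
          by_contra h; exact hcon (Or.inr h)
        exact Prod.ext hc1 hc2⟩
      invFun := fun y => (⟨fun p => (y.1 p).1, by
        have h : {p | y.1 p ≠ 0}.Finite := y.2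
        refine h.subset ?_
        intro p hp h0
        exact hp (congrArg Prod.fst h0)⟩, ⟨fun p => (y.1 p).2, by
        have h : {p | y.1 p ≠ 0}.Finite := y.2
        refine h.subset ?_
        intro p hp h0
        exact hp (congrArg Prod.snd h0)⟩)
      map_add' := fun _ _ => rfl
      map_smul' := fun _ _ => rfl
      left_inv := fun _ => rfl
      right_inv := fun _ => rfl }
    exact ⟨(e.prodCongr e').trans E⟩

theorem TypeOn.mono {S S' : Set (PrimeSpectrum R)} {N : Type u} [AddCommGroup N] [Module R N] 
    (h : TypeOn S N) (hS : S ⊆ S') : TypeOn S' N := by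
  obtain ⟨P, h1, h2, h3, e⟩ := h
  exact ⟨P, h1, h2, fun p hp => h3 p fun h => hp (hS h), e⟩

theorem TypeOn.reg {S : Set (PrimeSpectrum R)} {N : Type u} [AddCommGroup N] [Module R N] 
    (h : TypeOn S N) (u : R) (hu : ∀ p ∈ S, u ∉ p.asIdeal) (y : N) (hy : u • y = 0) : y = 0 := by
  obtain ⟨P, h1, h2, h3, ⟨e⟩⟩ := h
  apply e.injective
  rw [map_zero]
  apply Subtype.ext
  funext p
  by_cases hp : p ∈ S
  · apply (h1 p u (hu p hp)).1
    have h : u • e y = 0 := by rw [← map_smul, hy, map_zero]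
    exact (congrFun (congrArg Subtype.val h) p).trans (smul_zero u).symm
  · have := h3 p hp
    exact Subsingleton.elim _ _

theorem EL_zero_of_unit (p : PrimeSpectrum R) (v : R) (hv : v ∉ p.asIdeal) (T : Type u) [AddCommGroup T] [Module R T]
    (hT : ∀ t : T, v • t = 0) (i : ℕ) : EL p i T := by
  suffices hsub : Subsingleton (LocalizedModule p.asIdeal.primeCompl T) from EV.of_subsingleton_right i
  constructor
  intro a b
  rw [← sub_eq_zero]
  obtain ⟨k, s, hs, hk⟩ := loc_exists_mk (S := p.asIdeal.primeCompl) (a - b)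
  have : LocalizedModule.mkLinearMap p.asIdeal.primeCompl T k = 0 := loc_mk_eq_zero.2 ⟨v, hv, hT k⟩
  rw [this] at hk
  apply (loc_smul_bij p.asIdeal.primeCompl ⟨s, hs⟩).1
  exact hk.trans (smul_zero s).symm

theorem EL_prod (p : PrimeSpectrum R) (i : ℕ) (M N : Type u) [AddCommGroup M] [Module R M] [AddCommGroup N] [Module R N] 
    (h : EL p i M) (h' : EL p i N) : EL p i (M × N) :=
  EV.mid₂ ((SE.inl_snd (R := R) (A := M) (B := N)).locR p.asIdeal.primeCompl) h h'

theorem EL_retract (p : PrimeSpectrum R) (i : ℕ) (M N : Type u) [AddCommGroup M] [Module R M] [AddCommGroup N] [Module R N] 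
    (s : M →ₗ[R] N) (r : N →ₗ[R] M) (hrs : ∀ x, r (s x) = x) (h : EL p i N) : EL p i M := by
  let s' := (lmap p.asIdeal.primeCompl s).restrictScalars R
  let r' := (lmap p.asIdeal.primeCompl r).restrictScalars R
  have hrs' : r'.comp s' = LinearMap.id := by
    apply LinearMap.ext
    intro y
    obtain ⟨k, t, ht, hk⟩ := loc_exists_mk y
    apply (loc_smul_bij p.asIdeal.primeCompl ⟨t, ht⟩).1
    show t • r' (s' y) = t • y
    rw [← map_smul, ← map_smul, hk]
    show lmap _ r (lmap _ s _) = _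
    rw [lmap_mk, lmap_mk, hrs]
  rw [EL, EV.iff] at *
  intro x
  have h1 : x.comp (Ext.mk₀ (ModuleCat.ofHom s')) (add_zero i) = 0 := h _
  have h2 : (x.comp (Ext.mk₀ (ModuleCat.ofHom s')) (add_zero i)).comp (Ext.mk₀ (ModuleCat.ofHom r')) (add_zero i) = x := by
    rw [Ext.comp_assoc_of_third_deg_zero, Ext.mk₀_comp_mk₀, ← ModuleCat.ofHom_comp, hrs']
    exact Ext.comp_mk₀_id x
  rw [← h2, h1, Ext.zero_comp]

end
end GGP

namespace GGP
section
open GG CategoryTheory Abelian IsLocalRing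
variable {R : Type u} [CommRing R]

theorem htM_congr_of_le (M M1 : Type u) [AddCommGroup M] [Module R M] [AddCommGroup M1] [Module R M1] 
    (h1 : Module.support R M1 ⊆ Module.support R M) 
    (h2 : ∀ p ∈ Module.support R M1, ∀ q ∈ Module.support R M, q ≤ p → q ∈ Module.support R M1)
    (p : PrimeSpectrum R) (hp : p ∈ Module.support R M1) : htM R M1 p = htM R M p := by
  apply le_antisymm
  · rw [htM_eq M1 hp, htM_eq M (h1 hp)]
    exact Order.height_le_height_apply_of_strictMono (fun q : Module.support R M1 => (⟨q.1, h1 q.2⟩ : Module.support R M)) (fun a b h => h) ⟨p, hp⟩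
  · have key : ∀ n : ℕ, ∀ p ∈ Module.support R M1, htM R M1 p ≤ n → htM R M p ≤ n := by
      intro n
      induction n with
      | zero =>
        intro p hp h
        rw [htM_eq M1 hp, Order.height_le_coe_iff] at h
        rw [htM_eq M (h1 hp), Order.height_le_coe_iff]
        intro y hy
        have := h ⟨y.1, h2 p hp y.1 y.2 (le_of_lt hy)⟩ hy
        simp at this
      | succ n ih =>
        intro p hp h
        rw [htM_eq M1 hp, Order.height_le_coe_iff] at h
        rw [htM_eq M (h1 hp), Order.height_le_coe_iff]
        intro y hy
        have hy1 := h2 p hp y.1 y.2 (le_of_lt hy)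
        have h3 := h ⟨y.1, hy1⟩ hy
        rw [← htM_eq] at h3
        have h4 : htM R M1 y.1 ≤ n := by
          rw [Nat.cast_add, Nat.cast_one] at h3
          exact Order.le_of_lt_add_one h3
        have h5 := ih y.1 hy1 h4
        rw [htM_eq M y.2] at h5
        refine lt_of_le_of_lt h5 ?_
        exact_mod_cast Nat.lt_succ_self n
    by_cases ht : htM R M1 p = ⊤
    · rw [ht]; exact le_top
    · obtain ⟨k, hk⟩ := ENat.ne_top_iff_exists.1 ht
      rw [← hk]
      exact key k p hp hk.ge

variable [IsNoetherianRing R]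

theorem exists_split (M : Type u) [AddCommGroup M] [Module R M] [Module.Finite R M] (S : Set (PrimeSpectrum R))
    (hS : ∀ p ∈ Module.support R M, ∀ q ∈ Module.support R M, p ≤ q → (p ∈ S ↔ q ∈ S)) :
    ∃ u v : R, u + v = 1 ∧ (∀ m : M, u • v • m = 0) ∧ (∀ p ∈ Module.support R M, u ∈ p.asIdeal → p ∈ S) ∧
      (∀ p ∈ Module.support R M, v ∈ p.asIdeal → p ∉ S) := by
  classical
  let I := Module.annihilator R M
  have hsupp : ∀ p : PrimeSpectrum R, p ∈ Module.support R M ↔ I ≤ p.asIdeal := by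
    intro p
    rw [Module.support_eq_zeroLocus]; rfl
  let F := (Ideal.finite_minimalPrimes_of_isNoetherianRing R I).toFinset
  have hF : ∀ P, P ∈ F ↔ P ∈ I.minimalPrimes := fun P => Set.Finite.mem_toFinset _
  let s1 := F.filter (fun P => ∃ h : P.IsPrime, (⟨P, h⟩ : PrimeSpectrum R) ∈ S)
  let s2 := F.filter (fun P => ¬ ∃ h : P.IsPrime, (⟨P, h⟩ : PrimeSpectrum R) ∈ S)
  let a1 := s1.inf id
  let a2 := s2.inf id
  have hS1 : ∀ p : PrimeSpectrum R, a1 ≤ p.asIdeal → p ∈ Module.support R M ∧ p ∈ S := by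
    intro p hp
    obtain ⟨P, hP, hPp⟩ := (Ideal.IsPrime.inf_le' p.2).1 hp
    obtain ⟨hPF, hPr, hPS⟩ := Finset.mem_filter.1 hP
    have hIP : I ≤ P := ((hF P).1 hPF).1.2
    have hpM := (hsupp p).2 (hIP.trans hPp)
    exact ⟨hpM, (hS ⟨P, hPr⟩ ((hsupp _).2 hIP) p hpM hPp).1 hPS⟩
  have hS2 : ∀ p : PrimeSpectrum R, a2 ≤ p.asIdeal → p ∉ S := by
    intro p hp
    obtain ⟨P, hP, hPp⟩ := (Ideal.IsPrime.inf_le' p.2).1 hp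
    obtain ⟨hPF, hPS⟩ := Finset.mem_filter.1 hP
    have hIP : I ≤ P := ((hF P).1 hPF).1.2
    have hPr := ((hF P).1 hPF).1.1
    have hpM := (hsupp p).2 (hIP.trans hPp)
    intro h
    exact hPS ⟨hPr, (hS ⟨P, hPr⟩ ((hsupp _).2 hIP) p hpM hPp).2 h⟩
  have hor : ∀ p ∈ Module.support R M, a1 ≤ p.asIdeal ∨ a2 ≤ p.asIdeal := by
    intro p hp
    obtain ⟨P, hP, hPp⟩ := Ideal.exists_minimalPrimes_le ((hsupp p).1 hp)
    by_cases h : ∃ h : P.IsPrime, (⟨P, h⟩ : PrimeSpectrum R) ∈ S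
    · exact Or.inl ((Finset.inf_le (f := id) (Finset.mem_filter.2 ⟨(hF P).2 hP, h⟩)).trans hPp)
    · exact Or.inr ((Finset.inf_le (f := id) (Finset.mem_filter.2 ⟨(hF P).2 hP, h⟩)).trans hPp)
  have hsup : a1 ⊔ a2 = ⊤ := by
    by_contra hne
    obtain ⟨m, hm, hle⟩ := Ideal.exists_le_maximal _ hne
    exact hS2 ⟨m, hm.isPrime⟩ (le_sup_right.trans hle) (hS1 ⟨m, hm.isPrime⟩ (le_sup_left.trans hle)).2
  have hrad : a1 * a2 ≤ I.radical := by
    rw [← Ideal.sInf_minimalPrimes]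
    refine Ideal.mul_le_inf.trans (le_sInf fun P hP => ?_)
    by_cases h : ∃ h : P.IsPrime, (⟨P, h⟩ : PrimeSpectrum R) ∈ S
    · exact inf_le_left.trans (Finset.inf_le (f := id) (Finset.mem_filter.2 ⟨(hF P).2 hP, h⟩))
    · exact inf_le_right.trans (Finset.inf_le (f := id) (Finset.mem_filter.2 ⟨(hF P).2 hP, h⟩))
  obtain ⟨n, hn⟩ := Ideal.exists_pow_le_of_le_radical_of_fg hrad (IsNoetherian.noetherian _)
  have htop := Ideal.pow_sup_pow_eq_top (m := n + 1) (n := n + 1) hsup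
  obtain ⟨u, hu, v, hv, huv⟩ := Submodule.mem_sup.1 (show (1 : R) ∈ a1 ^ (n + 1) ⊔ a2 ^ (n + 1) by rw [htop]; trivial)
  refine ⟨u, v, huv, ?_, ?_, ?_⟩
  · intro m
    rw [← mul_smul]
    have : u * v ∈ I := by
      apply hn
      apply Ideal.pow_le_pow_right (Nat.le_succ n)
      rw [mul_pow]
      exact Ideal.mul_mem_mul hu hv
    exact Module.mem_annihilator.1 this m
  · intro p hp hup
    rcases hor p hp with h | h
    · exact (hS1 p h).2
    · exfalso
      have hvp : v ∈ p.asIdeal := h (Ideal.pow_le_self (Nat.succ_ne_zero n) hv)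
      exact p.2.ne_top ((Ideal.eq_top_iff_one _).2 (huv ▸ Ideal.add_mem _ hup hvp))
  · intro p hp hvp
    rcases hor p hp with h | h
    · exfalso
      have hup : u ∈ p.asIdeal := h (Ideal.pow_le_self (Nat.succ_ne_zero n) hu)
      exact p.2.ne_top ((Ideal.eq_top_iff_one _).2 (huv ▸ Ideal.add_mem _ hup hvp))
    · exact hS2 p h

theorem cc_const {Q : Type u} [CommRing Q] [IsNoetherianRing Q] (φ : Q →+* R) (hφ : Function.Surjective φ) (hQ : IsGorensteinRing Q)
    (M : Type u) [AddCommGroup M] [Module R M] [Module.Finite R M] (hCM : CM R M) (cc : PrimeSpectrum R → ℕ)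
    (hc : ∀ p ∈ Module.support R M, htM Q Q (PrimeSpectrum.comap φ p) = htM R M p + cc p) :
    ∀ p ∈ Module.support R M, ∀ q ∈ Module.support R M, p ≤ q → cc p = cc q := by
  have hQCM : CM Q Q := by
    intro p _ i hi
    obtain ⟨t, h1, h2, _⟩ := gor_ht hQ p
    rw [h2] at hi
    exact (h1 i).2 (by have : i < t := by exact_mod_cast hi
                       omega)
  have hcov : ∀ p ∈ Module.support R M, ∀ q ∈ Module.support R M, p < q → (∀ q' : PrimeSpectrum R, p < q' → q' ≤ q → q' = q) → cc p = cc q := by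
    intro p hp q hq hpq hcov
    have h1 := hCM.ht_cov hp hpq hcov
    have hlt : PrimeSpectrum.comap φ p < PrimeSpectrum.comap φ q := by
      refine lt_of_le_of_ne (Ideal.comap_mono hpq.le) fun h => hpq.ne (PrimeSpectrum.comap_injective_of_surjective φ hφ h)
    have h2 := hQCM.ht_cov (mem_supp_self _) hlt (by
      intro x hx hxq
      have hxr : x ∈ Set.range (PrimeSpectrum.comap φ) := by
        rw [range_comap_of_surjective _ φ hφ]
        intro a ha
        apply hx.le
        show φ a ∈ p.asIdeal
        rw [show φ a = 0 from ha]
        exact Submodule.zero_mem _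
      obtain ⟨y, rfl⟩ := hxr
      have hle : ∀ a b : PrimeSpectrum R, PrimeSpectrum.comap φ a ≤ PrimeSpectrum.comap φ b → a ≤ b := by
        intro a b hab r hr
        obtain ⟨c, rfl⟩ := hφ r
        exact hab hr
      rw [hcov y (lt_of_le_of_ne (hle _ _ hx.le) (by rintro rfl; exact hx.ne rfl)) (hle _ _ hxq)])
    rw [hc q hq, hc p hp, h1] at h2
    obtain ⟨k, hk⟩ := ENat.ne_top_iff_exists.1 (htM_lt_top M p).ne
    rw [← hk] at h2
    have : k + 1 + cc q = k + cc p + 1 := by exact_mod_cast h2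
    omega
  have key : ∀ n : ℕ, ∀ p ∈ Module.support R M, ∀ q ∈ Module.support R M, htM R M q ≤ n → p ≤ q → cc p = cc q := by
    intro n
    induction n with
    | zero =>
      intro p hp q hq hn hpq
      rcases hpq.lt_or_eq with h | rfl
      · have := (htM_succ_le M hp h).trans hn
        simp at this
      · rfl
    | succ n ih =>
      intro p hp q hq hn hpq
      rcases hpq.lt_or_eq with h | rfl
      · obtain ⟨x, hpx, hxq, hx⟩ := exists_cov h
        have hxM := Module.mem_support_mono hpx hp
        refine (ih p hp x hxM ?_ hpx).trans (hcov x hxM q hq hxq hx)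
        have h1 := (htM_succ_le M hxM hxq).trans hn
        rw [Nat.cast_add, Nat.cast_one] at h1
        exact (ENat.add_le_add_iff_right (by simp)).1 h1
      · rfl
  intro p hp q hq hpq
  obtain ⟨k, hk⟩ := ENat.ne_top_iff_exists.1 (htM_lt_top M q).ne
  exact key k p hp q hq hk.ge hpq

end
end GGP

namespace GGP
section
open GG CategoryTheory Abelian IsLocalRing
variable {R : Type u} [CommRing R] [IsNoetherianRing R]

theorem split_supp (M M1 M2 : Type u) [AddCommGroup M] [Module R M] [AddCommGroup M1] [Module R M1] [AddCommGroup M2] [Module R M2]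
    (e : M ≃ₗ[R] (M1 × M2)) (u v : R) (huv : u + v = 1) (hu : ∀ m : M1, u • m = 0) (hv : ∀ m : M2, v • m = 0) :
    Module.support R M1 ⊆ Module.support R M ∧ Module.support R M2 ⊆ Module.support R M ∧
    (∀ p ∈ Module.support R M, p ∈ Module.support R M1 ∨ p ∈ Module.support R M2) ∧
    (∀ p ∈ Module.support R M1, v ∉ p.asIdeal) ∧ (∀ p ∈ Module.support R M2, u ∉ p.asIdeal) ∧
    (∀ p ∈ Module.support R M1, htM R M1 p = htM R M p) ∧ (∀ p ∈ Module.support R M2, htM R M2 p = htM R M p) := by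
  have h0 : Module.support R M = Module.support R M1 ∪ Module.support R M2 := by
    rw [e.support_eq]
    exact Module.support_of_exact (SE.inl_snd (R := R) (A := M1) (B := M2)).ex (SE.inl_snd (R := R) (A := M1) (B := M2)).inj (SE.inl_snd (R := R) (A := M1) (B := M2)).surj
  have h1 : Module.support R M1 ⊆ Module.support R M := h0 ▸ Set.subset_union_left
  have h2 : Module.support R M2 ⊆ Module.support R M := h0 ▸ Set.subset_union_right
  have h3 : ∀ p ∈ Module.support R M, p ∈ Module.support R M1 ∨ p ∈ Module.support R M2 := fun p hp => by
    rw [h0] at hp; exact hp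
  have h4 : ∀ p ∈ Module.support R M1, v ∉ p.asIdeal := by
    intro p hp hvp
    exact p.2.ne_top ((Ideal.eq_top_iff_one _).2 (huv ▸ Ideal.add_mem _ (le_of_mem_supp hp hu) hvp))
  have h5 : ∀ p ∈ Module.support R M2, u ∉ p.asIdeal := by
    intro p hp hvp
    exact p.2.ne_top ((Ideal.eq_top_iff_one _).2 (huv ▸ Ideal.add_mem _ hvp (le_of_mem_supp hp hv)))
  refine ⟨h1, h2, h3, h4, h5, ?_, ?_⟩
  · apply htM_congr_of_le M M1 h1
    intro p hp q hq hqp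
    refine (h3 q hq).resolve_right fun h => h4 p hp (hqp (le_of_mem_supp h hv))
  · apply htM_congr_of_le M M2 h2
    intro p hp q hq hqp
    refine (h3 q hq).resolve_left fun h => h5 p hp (hqp (le_of_mem_supp h hu))

theorem data_prod (M M1 M2 : Type u) [AddCommGroup M] [Module R M] [AddCommGroup M1] [Module R M1] [AddCommGroup M2] [Module R M2]
    (e : M ≃ₗ[R] (M1 × M2)) (u v : R) (huv : u + v = 1) (hu : ∀ m : M1, u • m = 0) (hv : ∀ m : M2, v • m = 0)
    (d1 : Data R M1) (d2 : Data R M2) : Nonempty (Data R M) := by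
  obtain ⟨hs1, hs2, hor, hv1, hu2, ht1, ht2⟩ := split_supp M M1 M2 e u v huv hu hv
  have := d1.fin
  have := d2.fin
  have h12 : ∀ i (f : d1.T →ₗ[R] d2.D i), ∀ t, f t = 0 := by
    intro i f t
    apply (d2.typ i).reg u (fun p hp => hu2 p hp.1)
    rw [← map_smul, d1.ann u hu, map_zero]
  have h21 : ∀ i (f : d2.T →ₗ[R] d1.D i), ∀ t, f t = 0 := by
    intro i f t
    apply (d1.typ i).reg v (fun p hp => hv1 p hp.1)
    rw [← map_smul, d2.ann v hv, map_zero]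
  have heq : ∀ i, Nonempty (((d1.T →ₗ[R] d1.D i) × (d2.T →ₗ[R] d2.D i)) ≃ₗ[R] ((d1.T × d2.T) →ₗ[R] (d1.D i × d2.D i))) := by
    intro i
    refine ⟨LinearEquiv.ofBijective (LinearMap.prodMapLinear R d1.T d2.T (d1.D i) (d2.D i) R) ⟨?_, ?_⟩⟩
    · intro x y hxy
      have h := fun z => LinearMap.congr_fun hxy z
      refine Prod.ext (LinearMap.ext fun t => ?_) (LinearMap.ext fun t => ?_)
      · exact congrArg Prod.fst (h (t, 0))
      · exact congrArg Prod.snd (h (0, t))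
    · intro h
      refine ⟨((LinearMap.fst R _ _).comp (h.comp (LinearMap.inl R _ _)), (LinearMap.snd R _ _).comp (h.comp (LinearMap.inr R _ _))), ?_⟩
      apply LinearMap.ext
      intro z
      have hz : h z = h (z.1, 0) + h (0, z.2) := by
        rw [← map_add]; simp
      have k1 : (h (0, z.2)).1 = 0 := h21 i ((LinearMap.fst R _ _).comp (h.comp (LinearMap.inr R _ _))) z.2
      have k2 : (h (z.1, 0)).2 = 0 := h12 i ((LinearMap.snd R _ _).comp (h.comp (LinearMap.inl R _ _))) z.1
      rw [hz]
      refine Prod.ext ?_ ?_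
      · show (h (z.1, 0)).1 = (h (z.1, 0)).1 + (h (0, z.2)).1
        rw [k1, add_zero]
      · show (h (0, z.2)).2 = (h (z.1, 0)).2 + (h (0, z.2)).2
        rw [k2, zero_add]
  have E := fun i => (heq i).some
  exact ⟨{
    T := ModuleCat.of R (d1.T × d2.T)
    fin := inferInstanceAs (Module.Finite R (d1.T × d2.T))
    D := fun i => ModuleCat.of R (d1.D i × d2.D i)
    inj := fun i => injective_prod (d1.inj i) (d2.inj i)
    typ := fun i => by
      refine TypeOn.prod ((d1.typ i).mono ?_) ((d2.typ i).mono ?_)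
      · rintro p ⟨hp, hi⟩
        exact ⟨hs1 hp, (ht1 p hp) ▸ hi⟩
      · rintro p ⟨hp, hi⟩
        exact ⟨hs2 hp, (ht2 p hp) ▸ hi⟩
    soc := fun i p hp hi => by
      rcases hor p hp with h | h
      · obtain ⟨y, hy, hk⟩ := d1.soc i p h ((ht1 p h).trans hi)
        exact ⟨(y, 0), fun h0 => hy (congrArg Prod.fst h0), fun r hr => Prod.ext (hk r hr) (smul_zero r)⟩
      · obtain ⟨y, hy, hk⟩ := d2.soc i p h ((ht2 p h).trans hi)
        exact ⟨(0, y), fun h0 => hy (congrArg Prod.snd h0), fun r hr => Prod.ext (smul_zero r) (hk r hr)⟩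
    Z := fun i => ModuleCat.of R (d1.Z i × d2.Z i)
    f := fun i => (E i).toLinearMap.comp ((d1.f i).prodMap (d2.f i))
    g := fun i => ((d1.g i).prodMap (d2.g i)).comp (E i).symm.toLinearMap
    se := fun i => ((d1.se i).prodMap (d2.se i)).trans_equiv (E i)
    e := e.trans (d1.e.prodCongr d2.e)
    ann := fun r hr t => by
      refine Prod.ext (d1.ann r (fun m => ?_) t.1) (d2.ann r (fun m => ?_) t.2)
      · have h := hr (e.symm (m, 0))
        rw [← map_smul, ← map_zero e.symm] at h
        exact congrArg Prod.fst (e.symm.injective h)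
      · have h := hr (e.symm (0, m))
        rw [← map_smul, ← map_zero e.symm] at h
        exact congrArg Prod.snd (e.symm.injective h)
    el := fun p hp i hi => by
      rcases hor p hp with h | h
      · exact EL_prod p i _ _ (d1.el p h i (by rwa [ht1 p h])) (EL_zero_of_unit p v (hv1 p h) _ (d2.ann v hv) i)
      · exact EL_prod p i _ _ (EL_zero_of_unit p u (hu2 p h) _ (d1.ann u hu) i) (d2.el p h i (by rwa [ht2 p h])) }⟩

theorem data_exists_aux {Q : Type u} [CommRing Q] [IsNoetherianRing Q] (φ : Q →+* R) (hφ : Function.Surjective φ) (hQ : IsGorensteinRing Q)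
    (q : QRes Q) (n : ℕ) : ∀ (M : ModuleCat.{u} R) [Module.Finite R M] (_ : CM R M) (cc : PrimeSpectrum R → ℕ)
    (_ : ∀ p ∈ Module.support R M, htM Q Q (PrimeSpectrum.comap φ p) = htM R M p + cc p)
    (_ : ∀ p ∈ Module.support R M, cc p < n), Nonempty (Data R M) := by
  have : RingHomSurjective φ := ⟨hφ⟩
  induction n with
  | zero =>
    intro M _ hCM cc hc hn
    exact data_pure φ hQ q M hCM 0 fun p hp => (Nat.not_lt_zero _ (hn p hp)).elim
  | succ n ih =>
    intro M _ hCM cc hc hn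
    have hconst := cc_const φ hφ hQ M hCM cc hc
    obtain ⟨u, v, huv, hkill, hSu, hSv⟩ := exists_split M {p | cc p = n} (fun p hp q hq hpq => by
      show cc p = n ↔ cc q = n
      rw [hconst p hp q hq hpq])
    let M1 := LinearMap.ker (LinearMap.lsmul R M u)
    let M2 := LinearMap.ker (LinearMap.lsmul R M v)
    have hu : ∀ m : M1, u • m = 0 := fun m => Subtype.ext m.2
    have hv : ∀ m : M2, v • m = 0 := fun m => Subtype.ext m.2
    have hsum : ∀ m : M, v • m + u • m = m := fun m => by rw [← add_smul, add_comm, huv, one_smul]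
    have hv1 : ∀ m : M1, v • m.1 = m.1 := fun m => by
      have h1 : u • m.1 = 0 := m.2
      have h2 := hsum m.1
      rwa [h1, add_zero] at h2
    have hu2 : ∀ m : M2, u • m.1 = m.1 := fun m => by
      have h1 : v • m.1 = 0 := m.2
      have h2 := hsum m.1
      rwa [h1, zero_add] at h2
    let e : M ≃ₗ[R] (M1 × M2) :=
      { toFun := fun m => (⟨v • m, hkill m⟩, ⟨u • m, by
          show v • u • m = 0
          rw [smul_comm]; exact hkill m⟩)
        invFun := fun x => x.1.1 + x.2.1
        map_add' := fun x y => Prod.ext (Subtype.ext (smul_add v x y)) (Subtype.ext (smul_add u x y))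
        map_smul' := fun r x => Prod.ext (Subtype.ext (smul_comm v r x)) (Subtype.ext (smul_comm u r x))
        left_inv := hsum
        right_inv := fun x => by
          have h1 : u • x.1.1 = 0 := x.1.2
          have h2 : v • x.2.1 = 0 := x.2.2
          refine Prod.ext (Subtype.ext ?_) (Subtype.ext ?_)
          · show v • (x.1.1 + x.2.1) = x.1.1
            rw [smul_add, h2, add_zero, hv1]
          · show u • (x.1.1 + x.2.1) = x.2.1
            rw [smul_add, h1, zero_add, hu2] }
    obtain ⟨hs1, hs2, hor, hvp1, hup2, ht1, ht2⟩ := split_supp M M1 M2 e u v huv hu hv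
    have hCM1 : CM R M1 := fun p hp i hi => EL_retract p i M1 M M1.subtype ((LinearMap.fst R M1 M2).comp e.toLinearMap)
      (fun x => Subtype.ext (hv1 x)) (hCM p (hs1 hp) i (by rwa [← ht1 p hp]))
    have hCM2 : CM R M2 := fun p hp i hi => EL_retract p i M2 M M2.subtype ((LinearMap.snd R M1 M2).comp e.toLinearMap)
      (fun x => Subtype.ext (hu2 x)) (hCM p (hs2 hp) i (by rwa [← ht2 p hp]))
    have d1 : Nonempty (Data R M1) := data_pure φ hQ q (ModuleCat.of R M1) hCM1 n fun p hp => by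
      have h1 : cc p = n := hSu p (hs1 hp) (le_of_mem_supp hp hu)
      have h2 := hc p (hs1 hp)
      rw [h1] at h2
      rw [h2]
      congr 1
      exact (ht1 p hp).symm
    have d2 : Nonempty (Data R M2) := ih (ModuleCat.of R M2) hCM2 cc (fun p hp => by
      rw [hc p (hs2 hp)]
      congr 1
      exact (ht2 p hp).symm) (fun p hp => by
      have h1 : cc p ≠ n := hSv p (hs2 hp) (le_of_mem_supp hp hv)
      have := hn p (hs2 hp)
      omega)
    exact data_prod M M1 M2 e u v huv hu hv d1.some d2.some

theorem data_exists (hR : HasDualizingComplex R) (M : ModuleCat.{u} R) [Module.Finite R M] (hCM : CM R M) : Nonempty (Data R M) := by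
  obtain ⟨Q, hN, hdim, hQ, φ, hφ⟩ := hR
  obtain ⟨q⟩ := exists_QRes hQ hdim
  obtain ⟨d, hd⟩ : ∃ d : ℕ, ∀ p : PrimeSpectrum Q, htM Q Q p ≤ d := by
    obtain ⟨d, hd⟩ := q.bd
    refine ⟨d + 1, fun p => ?_⟩
    by_contra h
    obtain ⟨k, hk⟩ := ENat.ne_top_iff_exists.1 (htM_lt_top Q p).ne
    obtain ⟨x, hx, _⟩ := q.soc k p hk.symm
    rw [← hk] at h
    have hk' : d + 1 < k := by
      have := not_le.1 h
      exact_mod_cast this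
    have := hd k (by omega)
    have h2 := hd (k + 1) (by omega)
    apply hx
    have hs : (finSingle (R := Q) (fun p => q.P k p) p x) = 0 := by
      obtain ⟨y, hy⟩ := ((q.se k).ex (finSingle (R := Q) (fun p => q.P k p) p x)).1 (Subsingleton.elim _ _)
      rw [← hy, Subsingleton.elim y 0, map_zero]
    have h3 := finSingle_same (R := Q) (fun p => q.P k p) p x
    rw [hs] at h3
    exact h3.symm
  have hle : ∀ p : PrimeSpectrum R, htM R M p ≤ htM Q Q (PrimeSpectrum.comap φ p) := by
    intro p
    obtain ⟨t, _, h1, h2⟩ := gor_ht hQ (PrimeSpectrum.comap φ p)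
    rw [h1, ← h2]
    refine (htM_le_height M p).trans (Order.height_le_height_apply_of_strictMono _ ?_ p)
    intro a b hab
    exact lt_of_le_of_ne (Ideal.comap_mono hab.le) fun h => hab.ne (PrimeSpectrum.comap_injective_of_surjective φ hφ h)
  have hcc : ∀ p : PrimeSpectrum R, ∃ c : ℕ, htM Q Q (PrimeSpectrum.comap φ p) = htM R M p + c ∧ c < d + 1 := by
    intro p
    obtain ⟨k, hk⟩ := ENat.ne_top_iff_exists.1 (htM_lt_top Q (PrimeSpectrum.comap φ p)).ne
    obtain ⟨j, hj⟩ := ENat.ne_top_iff_exists.1 (htM_lt_top M p).ne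
    have h1 := hle p
    have h2 := hd (PrimeSpectrum.comap φ p)
    rw [← hk] at h2
    rw [← hk, ← hj] at h1
    have h1' : j ≤ k := by exact_mod_cast h1
    have h2' : k ≤ d := by exact_mod_cast h2
    refine ⟨k - j, ?_, by omega⟩
    rw [← hk, ← hj]
    have : k = j + (k - j) := by omega
    exact_mod_cast this
  choose cc hc1 hc2 using hcc
  exact data_exists_aux φ hφ hQ q (d + 1) M hCM cc (fun p _ => hc1 p) (fun p _ => hc2 p)

end
end GGP

namespace GGP
section
open GG CategoryTheory Abelian IsLocalRing
variable {R : Type u} [CommRing R]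

theorem tup_num {S : Submonoid R} {D D' : Type u} [AddCommGroup D] [Module R D] [AddCommGroup D']
    [Module R D'] (g : D →ₗ[R] D') [IsLocalizedModule S g] {a : ℕ} (x : Fin a → D') :
    ∃ (v : Fin a → D) (s : R), s ∈ S ∧ ∀ j, s • x j = g (v j) := by
  classical
  choose y hy using fun j => IsLocalizedModule.surj S g (x j)
  refine ⟨fun j => (∏ i ∈ Finset.univ.erase j, ((y i).2 : R)) • (y j).1, ∏ i, ((y i).2 : R),
    S.prod_mem fun i _ => (y i).2.2, fun j => ?_⟩
  rw [map_smul, ← hy j, ← Finset.prod_erase_mul Finset.univ _ (Finset.mem_univ j), mul_smul]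
  rfl

theorem tup_zero {S : Submonoid R} {D D' : Type u} [AddCommGroup D] [Module R D] [AddCommGroup D']
    [Module R D'] (g : D →ₗ[R] D') [IsLocalizedModule S g] {a : ℕ} (v : Fin a → D)
    (h : ∀ j, g (v j) = 0) : ∃ s ∈ S, s • v = 0 := by
  classical
  choose y hy using fun j => (IsLocalizedModule.eq_zero_iff S g).1 (h j)
  refine ⟨∏ i, (y i : R), S.prod_mem fun i _ => (y i).2, ?_⟩
  funext j
  rw [← Finset.prod_erase_mul Finset.univ _ (Finset.mem_univ j)]
  rw [Pi.smul_apply, mul_smul]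
  have : (y j : R) • v j = 0 := hy j
  rw [this, smul_zero]
  rfl

theorem ker_loc (S : Submonoid R) {D : Type u} [AddCommGroup D] [Module R D] {a b : ℕ}
    (B : Matrix (Fin b) (Fin a) R) :
    Nonempty (LocalizedModule S (LinearMap.ker (act B D)) ≃ₗ[Localization S]
      LinearMap.ker (actA (Localization S) B (LocalizedModule S D))) := by
  let g := LocalizedModule.mkLinearMap S D
  let K' := LinearMap.ker (actA (Localization S) B (LocalizedModule S D))
  have hm : ∀ v : Fin a → D, act B D v = 0 → (fun i => g (v i)) ∈ K' := by
    intro v hv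
    show actA (Localization S) B (LocalizedModule S D) _ = 0
    rw [actA_eq, act_map, hv]
    funext i; exact map_zero g
  let φ : LinearMap.ker (act B D) →ₗ[R] K' :=
    { toFun := fun v => ⟨fun i => g (v.1 i), hm v.1 v.2⟩
      map_add' := fun v w => Subtype.ext (funext fun i => map_add g _ _)
      map_smul' := fun r v => Subtype.ext (funext fun i => map_smul g r _) }
  have : IsLocalizedModule S φ := by
    refine ⟨fun s => loc_units S s, ?_, ?_⟩
    · intro y
      obtain ⟨v, s, hs, hv⟩ := tup_num g (S := S) y.1
      have hy : act B (LocalizedModule S D) y.1 = 0 := by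
        rw [← actA_eq (A := Localization S)]; exact y.2
      obtain ⟨t, ht, ht'⟩ := tup_zero g (S := S) (act B D v) (fun j => by
        have h1 := congrFun (act_map B g v) j
        rw [← h1]
        have h2 : (fun i => g (v i)) = s • y.1 := funext fun i => (hv i).symm
        rw [h2, map_smul, hy, smul_zero]; rfl)
      refine ⟨(⟨t • v, by rw [LinearMap.mem_ker, map_smul, ht']⟩, ⟨t * s, S.mul_mem ht hs⟩), ?_⟩
      apply Subtype.ext
      funext i
      show (t * s) • y.1 i = g (t • v i)
      rw [mul_smul, hv, map_smul]
    · intro v w hvw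
      obtain ⟨t, ht, ht'⟩ := tup_zero g (S := S) (v.1 - w.1) (fun j => by
        have := congrFun (congrArg Subtype.val hvw) j
        have h2 : g (v.1 j) = g (w.1 j) := this
        show g (v.1 j - w.1 j) = 0
        rw [map_sub, h2, sub_self])
      refine ⟨⟨t, ht⟩, Subtype.ext ?_⟩
      show t • v.1 = t • w.1
      rw [smul_sub, sub_eq_zero] at ht'
      exact ht'
  exact ⟨(IsLocalizedModule.iso S φ).extendScalarsOfIsLocalization S (Localization S)⟩

theorem injective_loc [IsNoetherianRing R] (S : Submonoid R) {D : Type u} [AddCommGroup D] [Module R D]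
    (h : Module.Injective R D) : Module.Injective (Localization S) (LocalizedModule S D) := by
  have h1 : Module.Injective R (LocalizedModule S D) :=
    injective_of_EV fun I => EV.localize S (EV.of_injective h 0)
  refine ⟨?_⟩
  intro X Y _ _ _ _ f hf g
  let _ : Module R X := Module.compHom X (algebraMap R (Localization S))
  let _ : Module R Y := Module.compHom Y (algebraMap R (Localization S))
  have : IsScalarTower R (Localization S) X := ⟨fun r a x => by
    rw [Algebra.smul_def, mul_smul]; rfl⟩
  have : IsScalarTower R (Localization S) Y := ⟨fun r a x => by
    rw [Algebra.smul_def, mul_smul]; rfl⟩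
  obtain ⟨ψ, hψ⟩ := extend_of_injective h1 (f := f.restrictScalars R) hf (g.restrictScalars R)
  refine ⟨ψ.extendScalarsOfIsLocalization S (Localization S), fun x => ?_⟩
  exact LinearMap.congr_fun hψ x

/-- Homs out of a presented module -/
theorem hom_ker_gen {T : Type u} [AddCommGroup T] [Module R T] {a b : ℕ} (B : Matrix (Fin b) (Fin a) R)
    (E : ((Fin a → R) ⧸ LinearMap.range (act B.transpose R)) ≃ₗ[R] T) (D : Type u) [AddCommGroup D]
    [Module R D] : Nonempty ((T →ₗ[R] D) ≃ₗ[R] LinearMap.ker (act B D)) := by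
  let π : (Fin a → R) →ₗ[R] T := E.toLinearMap.comp (Submodule.mkQ _)
  have hπ : Function.Surjective π := E.surjective.comp (Submodule.mkQ_surjective _)
  have hk : ∀ v, π v = 0 ↔ v ∈ LinearMap.range (act B.transpose R) := fun v => by
    show E (Submodule.Quotient.mk v) = 0 ↔ _
    rw [LinearEquiv.map_eq_zero_iff, Submodule.Quotient.mk_eq_zero]
  have hφ : ∀ (φ : T →ₗ[R] D) (v : Fin a → R), φ (π v) = ∑ i, v i • φ (π (Pi.single i 1)) := by
    intro φ v
    conv_lhs => rw [pi_eq_sum_univ' v]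
    rw [map_sum, map_sum]
    refine Finset.sum_congr rfl fun i _ => ?_
    rw [map_smul, map_smul]
  have hm : ∀ φ : T →ₗ[R] D, (fun i => φ (π (Pi.single i 1))) ∈ LinearMap.ker (act B D) := by
    intro φ
    rw [LinearMap.mem_ker]
    funext i
    have h1 := act_pair' B (fun i => φ (π (Pi.single i 1))) (Pi.single i 1)
    rw [← hφ, (hk _).2 ⟨_, rfl⟩, map_zero] at h1
    refine Eq.trans ?_ h1
    rw [Finset.sum_eq_single i]
    · simp
    · intro j _ hj; simp [Pi.single_apply, hj]
    · intro h; exact absurd (Finset.mem_univ i) h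
  let Φ : (T →ₗ[R] D) →ₗ[R] LinearMap.ker (act B D) :=
    { toFun := fun φ => ⟨fun i => φ (π (Pi.single i 1)), hm φ⟩
      map_add' := fun v w => rfl
      map_smul' := fun r v => rfl }
  refine ⟨LinearEquiv.ofBijective Φ ⟨?_, ?_⟩⟩
  · intro φ ψ h
    apply LinearMap.ext; intro t
    obtain ⟨v, rfl⟩ := hπ t
    rw [hφ, hφ]
    refine Finset.sum_congr rfl fun i _ => ?_
    have := congrFun (congrArg Subtype.val h) i
    have h2 : φ (π (Pi.single i 1)) = ψ (π (Pi.single i 1)) := this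
    rw [h2]
  · intro y
    obtain ⟨φ, h⟩ := exists_desc hπ (Fintype.linearCombination R y.1) (by
      intro v hv
      obtain ⟨w, rfl⟩ := (hk v).1 hv
      rw [Fintype.linearCombination_apply, ← act_pair']
      have : act B D y.1 = 0 := y.2
      rw [this]; simp)
    refine ⟨φ, Subtype.ext (funext fun i => ?_)⟩
    show φ (π _) = _
    rw [h, Fintype.linearCombination_apply_single, one_smul]

theorem hom_ker {T : Type u} [AddCommGroup T] [Module R T] (m : MC R T) (D : Type u) [AddCommGroup D]
    [Module R D] : Nonempty ((T →ₗ[R] D) ≃ₗ[R] LinearMap.ker (act (m.B 0) D)) :=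
  hom_ker_gen (m.B 0) m.e D

theorem TypeOn.hom {S : Set (PrimeSpectrum R)} {D : Type u} [AddCommGroup D] [Module R D]
    (h : TypeOn S D) (T : Type u) [AddCommGroup T] [Module R T] [hT : Module.Finite R T] :
    TypeOn S (T →ₗ[R] D) := by
  classical
  obtain ⟨P, h1, h2, h3, ⟨e⟩⟩ := h
  obtain ⟨s, hs⟩ := hT.fg_top
  have hz : ∀ {N : Type u} [AddCommGroup N] [Module R N] (φ : T →ₗ[R] N), (∀ t ∈ s, φ t = 0) → φ = 0 := by
    intro N _ _ φ h
    have : (⊤ : Submodule R T) ≤ LinearMap.ker φ := by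
      rw [← hs, Submodule.span_le]; exact fun t ht => h t ht
    apply LinearMap.ext; intro t; exact this trivial
  refine ⟨fun p => ModuleCat.of R (T →ₗ[R] P p), ?_, ?_, ?_, ?_⟩
  · intro p r hr
    have hb := h1 p r hr
    constructor
    · intro φ ψ h
      apply LinearMap.ext; intro t
      exact hb.1 (LinearMap.congr_fun h t)
    · intro φ
      let E : P p ≃ₗ[R] P p := LinearEquiv.ofBijective (LinearMap.lsmul R (P p) r) hb
      refine ⟨E.symm.toLinearMap.comp φ, ?_⟩
      apply LinearMap.ext; intro t
      exact E.apply_symm_apply (φ t)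
  · intro p r hr φ
    choose n hn using fun t => h2 p r hr (φ t)
    refine ⟨∑ t ∈ s, n t, ?_⟩
    apply hz (r ^ (∑ t ∈ s, n t) • (φ : T →ₗ[R] P p))
    intro t ht
    show r ^ (∑ t ∈ s, n t) • (φ t : P p) = 0
    rw [← Finset.sum_erase_add s _ ht, pow_add, mul_smul, hn, smul_zero]
  · intro p hp
    have := h3 p hp
    exact ⟨fun φ ψ => LinearMap.ext fun t => Subsingleton.elim _ _⟩
  · have hfin : ∀ φ : T →ₗ[R] D, (fun p => (finEval (fun p => P p) p).comp (e.toLinearMap.comp φ)) ∈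
        finPi R (fun p => (T →ₗ[R] P p)) := by
      intro φ
      refine Set.Finite.subset (s := ⋃ t ∈ s, {p | (e (φ t)).1 p ≠ 0})
        (Set.Finite.biUnion s.finite_toSet fun t _ => (e (φ t)).2) ?_
      intro p hp
      by_contra h
      simp only [Set.mem_iUnion, Set.mem_ofPred_eq, exists_prop, not_exists, not_and, not_not] at h
      exact hp (hz _ fun t ht => h t ht)
    let Φ : (T →ₗ[R] D) →ₗ[R] finPi R (fun p => (T →ₗ[R] P p)) :=
      { toFun := fun φ => ⟨_, hfin φ⟩
        map_add' := fun φ ψ => Subtype.ext (funext fun p => LinearMap.ext fun t => by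
          show finEval (fun p => P p) p (e ((φ + ψ) t)) = finEval (fun p => P p) p (e (φ t)) + finEval (fun p => P p) p (e (ψ t))
          rw [LinearMap.add_apply, map_add, map_add])
        map_smul' := fun r φ => Subtype.ext (funext fun p => LinearMap.ext fun t => by
          show finEval (fun p => P p) p (e ((r • φ) t)) = r • finEval (fun p => P p) p (e (φ t))
          rw [LinearMap.smul_apply, map_smul, map_smul]) }
    refine ⟨LinearEquiv.ofBijective Φ ⟨?_, ?_⟩⟩
    · intro φ ψ h
      apply LinearMap.ext; intro t
      apply e.injective
      apply Subtype.ext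
      funext p
      have := congrFun (congrArg Subtype.val h) p
      exact LinearMap.congr_fun this t
    · intro y
      have hy : ∀ t, (fun p => (y.1 p : T →ₗ[R] P p) t) ∈ finPi R (fun p => P p) := by
        intro t
        refine Set.Finite.subset y.2 ?_
        intro p hp h
        apply hp
        show (y.1 p : T →ₗ[R] P p) t = 0
        rw [h]; rfl
      let φ0 : T →ₗ[R] finPi R (fun p => P p) :=
        { toFun := fun t => ⟨_, hy t⟩
          map_add' := fun t t' => Subtype.ext (funext fun p => map_add (y.1 p) t t')
          map_smul' := fun r t => Subtype.ext (funext fun p => map_smul (y.1 p) r t) }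
      refine ⟨e.symm.toLinearMap.comp φ0, Subtype.ext (funext fun p => LinearMap.ext fun t => ?_)⟩
      show finEval (fun p => P p) p (e (e.symm (φ0 t))) = _
      rw [LinearEquiv.apply_symm_apply]; rfl
end
end GGP

namespace GGP
section
open GG CategoryTheory Abelian IsLocalRing
variable {R : Type u} [CommRing R]

theorem TypeOn.comp0 {S : Set (PrimeSpectrum R)} {D : Type u} [AddCommGroup D] [Module R D]
    (h : TypeOn S D) (p : PrimeSpectrum R) (y : D) (hy : ∀ s ∉ p.asIdeal, s • y ≠ 0) :
    ∃ q ∈ S, q ≤ p ∧ ∀ s ∉ q.asIdeal, s • y ≠ 0 := by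
  obtain ⟨P, h1, h2, h3, ⟨e⟩⟩ := h
  by_contra hc
  push Not at hc
  obtain ⟨s, hs, hs'⟩ := finPi_kill (P := fun p => P p) h2 p (e y) (by
    intro q hq
    by_cases hqS : q ∈ S
    · obtain ⟨s, hs, hs'⟩ := hc q hqS hq
      apply (h1 q s hs).1
      show s • (e y).1 q = s • (0 : P q)
      rw [smul_zero]
      have : (e (s • y)).1 q = 0 := by rw [hs', map_zero]; rfl
      rw [map_smul] at this
      exact this
    · have := h3 q hqS
      exact Subsingleton.elim _ _)
  rw [← map_smul, LinearEquiv.map_eq_zero_iff] at hs'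
  exact hy s hs hs'

theorem TypeOn.comp_glob {S : Set (PrimeSpectrum R)} {D : Type u} [AddCommGroup D] [Module R D]
    (h : TypeOn S D) (y : D) (hy : y ≠ 0) :
    ∃ q ∈ S, ∀ s ∉ q.asIdeal, s • y ≠ 0 := by
  have hne : (LinearMap.ker (LinearMap.toSpanSingleton R D y)) ≠ ⊤ := by
    intro h
    apply hy
    have : (1 : R) ∈ LinearMap.ker (LinearMap.toSpanSingleton R D y) := h ▸ trivial
    rw [LinearMap.mem_ker, LinearMap.toSpanSingleton_apply, one_smul] at this
    exact this
  obtain ⟨I, hI, hle⟩ := Ideal.exists_le_maximal _ hne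
  obtain ⟨q, hq, _, h⟩ := h.comp0 ⟨I, hI.isPrime⟩ y (fun s hs h0 => hs (hle h0))
  exact ⟨q, hq, h⟩

theorem TypeOn.comp_loc {S : Set (PrimeSpectrum R)} {D : Type u} [AddCommGroup D] [Module R D]
    (h : TypeOn S D) (p : PrimeSpectrum R) (y : LocalizedModule p.asIdeal.primeCompl D) (hy : y ≠ 0) :
    ∃ q ∈ S, q ≤ p ∧ ∀ s ∉ q.asIdeal, s • y ≠ 0 := by
  obtain ⟨k, t, ht, htk⟩ := loc_exists_mk y
  obtain ⟨q, hq, hqp, hs⟩ := h.comp0 p k (by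
    intro s hs hs0
    apply hy
    have h1 : LocalizedModule.mkLinearMap p.asIdeal.primeCompl D k = 0 := loc_mk_eq_zero.2 ⟨s, hs, hs0⟩
    apply (loc_smul_bij p.asIdeal.primeCompl ⟨t, ht⟩).1
    show t • y = t • (0 : LocalizedModule p.asIdeal.primeCompl D)
    rw [htk, h1, smul_zero])
  refine ⟨q, hq, hqp, fun s hsq h0 => ?_⟩
  have h1 : LocalizedModule.mkLinearMap p.asIdeal.primeCompl D (s • k) = 0 := by
    rw [map_smul, ← htk, smul_comm, h0, smul_zero]
  obtain ⟨r, hr, hr0⟩ := loc_mk_eq_zero.1 h1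
  rw [← mul_smul] at hr0
  refine hs (r * s) (fun hm => ?_) hr0
  rcases q.2.mem_or_mem hm with h | h
  · exact hr (hqp h)
  · exact hsq h

variable [IsNoetherianRing R] {M : Type u} [AddCommGroup M] [Module R M]

theorem Data.iso_loc (d : Data R M) (m : MC R d.T) (S : Submonoid R) (i : ℕ) :
    Nonempty (LocalizedModule S (d.T →ₗ[R] d.D i) ≃ₗ[Localization S]
      LinearMap.ker (actA (Localization S) (m.B 0) (LocalizedModule S (d.D i)))) := by
  obtain ⟨e⟩ := hom_ker m (d.D i)
  obtain ⟨e2⟩ := ker_loc S (D := d.D i) (m.B 0)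
  have hb : Function.Bijective (lmap S e.toLinearMap) :=
    ⟨LocalizedModule.map_injective S e.toLinearMap e.injective,
      LocalizedModule.map_surjective S e.toLinearMap e.surjective⟩
  exact ⟨(LinearEquiv.ofBijective _ hb).trans e2⟩

theorem Data.GI_loc (d : Data R M) (m : MC R d.T) (p : PrimeSpectrum R) (i : ℕ)
    (h : ∀ q ∈ Module.support R M, q ≤ p → htM R M q = i → m.TR q.asIdeal) :
    GI (Localization p.asIdeal.primeCompl) (LocalizedModule p.asIdeal.primeCompl (d.T →ₗ[R] d.D i)) := by
  obtain ⟨e⟩ := d.iso_loc m p.asIdeal.primeCompl i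
  refine GI.congr e.symm (GI_of_TR (IR_loc _) m (injective_loc _ (d.inj i)) fun y hy => ?_)
  obtain ⟨q, hq, hqp, hs⟩ := (d.typ i).comp_loc p y hy
  exact ⟨q.asIdeal, h q hq.1 hqp hq.2, hs⟩

theorem Data.sub_loc (d : Data R M) (m : MC R d.T) (p : PrimeSpectrum R) (i : ℕ)
    (h : htM R M p < i) :
    Subsingleton (LocalizedModule p.asIdeal.primeCompl (d.T →ₗ[R] d.D i)) := by
  obtain ⟨e⟩ := d.iso_loc m p.asIdeal.primeCompl i
  have h0 : ∀ y : LocalizedModule p.asIdeal.primeCompl (d.D i), y = 0 := by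
    intro y
    by_contra hy
    obtain ⟨q, hq, hqp, hs⟩ := (d.typ i).comp_loc p y hy
    have := htM_mono M hq.1 hqp
    rw [hq.2] at this
    exact absurd h (not_lt.2 this)
  have : Subsingleton (LinearMap.ker (actA (Localization p.asIdeal.primeCompl) (m.B 0)
      (LocalizedModule p.asIdeal.primeCompl (d.D i)))) :=
    ⟨fun x y => Subtype.ext (funext fun j => by rw [h0 (x.1 j), h0 (y.1 j)])⟩
  exact e.toEquiv.subsingleton

theorem Data.GI_glob (d : Data R M) (m : MC R d.T) (i : ℕ)
    (h : ∀ q ∈ Module.support R M, m.TR q.asIdeal) : GI R (d.T →ₗ[R] d.D i) := by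
  obtain ⟨e⟩ := hom_ker m (d.D i)
  refine GI.congr e.symm ?_
  have := GI_of_TR (IR_self R) m (d.inj i) (fun y hy => by
    obtain ⟨q, hq, hs⟩ := (d.typ i).comp_glob y hy
    exact ⟨q.asIdeal, h q hq.1, hs⟩)
  have h2 : actA R (m.B 0) (d.D i) = act (m.B 0) (d.D i) := LinearMap.ext fun v => actA_eq _ _
  rwa [h2] at this

theorem Data.TR_glob (d : Data R M) (m : MC R d.T) (i : ℕ) (p : PrimeSpectrum R)
    (hp : p ∈ Module.support R M) (hi : htM R M p = i) (h : GI R (d.T →ₗ[R] d.D i)) :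
    m.TR p.asIdeal := by
  obtain ⟨e⟩ := hom_ker m (d.D i)
  obtain ⟨y, hy, hy'⟩ := d.soc i p hp hi
  have h2 : actA R (m.B 0) (d.D i) = act (m.B 0) (d.D i) := LinearMap.ext fun v => actA_eq _ _
  exact TR_of_GI (IR_self R) m (d.inj i) (by rw [h2]; exact GI.congr e h) p.asIdeal y hy hy'

theorem Data.TR_loc (d : Data R M) (m : MC R d.T) (i : ℕ) (p : PrimeSpectrum R)
    (hp : p ∈ Module.support R M) (hi : htM R M p = i)
    (h : GI (Localization p.asIdeal.primeCompl)
      (LocalizedModule p.asIdeal.primeCompl (d.T →ₗ[R] d.D i))) :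
    m.TR p.asIdeal := by
  obtain ⟨e⟩ := d.iso_loc m p.asIdeal.primeCompl i
  obtain ⟨y, hy, hy'⟩ := d.soc i p hp hi
  refine TR_of_GI (IR_loc _) m (injective_loc _ (d.inj i)) (GI.congr e h) p.asIdeal
    (LocalizedModule.mkLinearMap p.asIdeal.primeCompl (d.D i) y) ?_ ?_
  · obtain ⟨q, hq, hs⟩ := (d.typ i).comp_glob y hy
    have hpq : p ≤ q := by
      intro r hr
      by_contra hrq
      exact hs r hrq (hy' r hr)
    rw [Ne, loc_mk_eq_zero]
    rintro ⟨s, hsp, hs0⟩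
    rcases hpq.lt_or_eq with hlt | rfl
    · have h1 := htM_succ_le M hp hlt
      rw [hi, hq.2] at h1
      have : i + 1 ≤ i := by exact_mod_cast h1
      omega
    · exact hs s hsp hs0
  · intro r hr
    rw [← map_smul, hy' r hr, map_zero]

/-- dimension shift along the localized coresolution, downwards -/
theorem Data.GD_Z (d : Data R M) (p : PrimeSpectrum R) (n : ℕ)
    (h : GD (Localization p.asIdeal.primeCompl) n
      (ModuleCat.of _ (LocalizedModule p.asIdeal.primeCompl M)))
    (hY : ∀ i < n, GI (Localization p.asIdeal.primeCompl)
      (LocalizedModule p.asIdeal.primeCompl (d.T →ₗ[R] d.D i))) :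
    ∀ i k, i + k = n → GD (Localization p.asIdeal.primeCompl) k
      (ModuleCat.of _ (LocalizedModule p.asIdeal.primeCompl (d.Z i))) := by
  intro i
  induction i with
  | zero =>
    intro k hk
    have hb : Function.Bijective (lmap p.asIdeal.primeCompl d.e.toLinearMap) :=
      ⟨LocalizedModule.map_injective _ d.e.toLinearMap d.e.injective,
        LocalizedModule.map_surjective _ d.e.toLinearMap d.e.surjective⟩
    rw [zero_add] at hk
    subst hk
    exact GD.congr (LinearEquiv.ofBijective _ hb) h
  | succ i ih =>
    intro k hk
    exact GD.step ((d.se i).loc p.asIdeal.primeCompl) (hY i (by omega)) (ih (k+1) (by omega))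

theorem Data.GD_M (d : Data R M) (m : MC R d.T) (p : PrimeSpectrum R) (n : ℕ) (hn : htM R M p = n)
    (hY : ∀ i ≤ n, GI (Localization p.asIdeal.primeCompl)
      (LocalizedModule p.asIdeal.primeCompl (d.T →ₗ[R] d.D i))) :
    GD (Localization p.asIdeal.primeCompl) n
      (ModuleCat.of _ (LocalizedModule p.asIdeal.primeCompl M)) := by
  have key : ∀ k i, i + k = n → GD (Localization p.asIdeal.primeCompl) k
      (ModuleCat.of _ (LocalizedModule p.asIdeal.primeCompl (d.Z i))) := by
    intro k
    induction k with
    | zero =>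
      intro i hi
      have hs := (d.se i).loc p.asIdeal.primeCompl
      have hs1 := (d.se (i+1)).loc p.asIdeal.primeCompl
      have : Subsingleton (LocalizedModule p.asIdeal.primeCompl (d.Z (i+1))) := by
        have := d.sub_loc m p (i+1) (by rw [hn]; exact_mod_cast (by omega))
        exact hs1.inj.subsingleton
      refine GI.congr (LinearEquiv.ofBijective _ ⟨hs.inj, ?_⟩).symm (hY i (by omega))
      intro y
      exact (hs.ex y).1 (Subsingleton.elim _ _)
    | succ k ih =>
      intro i hi
      exact ⟨ModuleCat.of _ (LocalizedModule p.asIdeal.primeCompl (d.T →ₗ[R] d.D i)),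
        ModuleCat.of _ (LocalizedModule p.asIdeal.primeCompl (d.Z (i+1))), _, _, (d.se i).loc p.asIdeal.primeCompl,
        hY i (by omega), ih (i+1) (by omega)⟩
  have hb : Function.Bijective (lmap p.asIdeal.primeCompl d.e.toLinearMap) :=
    ⟨LocalizedModule.map_injective _ d.e.toLinearMap d.e.injective,
      LocalizedModule.map_surjective _ d.e.toLinearMap d.e.surjective⟩
  exact GD.congr (LinearEquiv.ofBijective _ hb).symm (key n 0 (by omega))

/-- top term of the localized coresolution -/
theorem Data.TR_top (d : Data R M) (m : MC R d.T) (p : PrimeSpectrum R)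
    (hp : p ∈ Module.support R M) (n : ℕ) (hn : htM R M p = n)
    (h : GD (Localization p.asIdeal.primeCompl) n
      (ModuleCat.of _ (LocalizedModule p.asIdeal.primeCompl M)))
    (hY : ∀ i < n, GI (Localization p.asIdeal.primeCompl)
      (LocalizedModule p.asIdeal.primeCompl (d.T →ₗ[R] d.D i))) : m.TR p.asIdeal := by
  have h0 := d.GD_Z p n h hY n 0 (by omega)
  have hs := (d.se n).loc p.asIdeal.primeCompl
  have hs1 := (d.se (n+1)).loc p.asIdeal.primeCompl
  have : Subsingleton (LocalizedModule p.asIdeal.primeCompl (d.Z (n+1))) := by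
    have := d.sub_loc m p (n+1) (by rw [hn]; exact_mod_cast (by omega))
    exact hs1.inj.subsingleton
  refine d.TR_loc m n p hp hn (GI.congr (LinearEquiv.ofBijective _ ⟨hs.inj, ?_⟩) h0)
  intro y
  exact (hs.ex y).1 (Subsingleton.elim _ _)

theorem Data.TR_all (d : Data R M) (m : MC R d.T)
    (h : ∀ p ∈ Module.support R M, ∀ n : ℕ, htM R M p = n →
      GD (Localization p.asIdeal.primeCompl) n
        (ModuleCat.of _ (LocalizedModule p.asIdeal.primeCompl M))) :
    ∀ p ∈ Module.support R M, m.TR p.asIdeal := by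
  have key : ∀ n : ℕ, ∀ p ∈ Module.support R M, htM R M p = n → m.TR p.asIdeal := by
    intro n
    induction n using Nat.strong_induction_on with
    | _ n ih =>
      intro p hp hn
      exact d.TR_top m p hp n hn (h p hp n hn) fun i hi => d.GI_loc m p i fun q hq _ hqi => ih i hi q hq hqi
  intro p hp
  exact key (htM R M p).toNat p hp (ENat.natCast_toNat (htM_lt_top M p).ne).symm

theorem Data.cousin {M : ModuleCat.{u} R} (d : Data R M) :
    CExact (heightFiltration R M) M ∧
      ∀ n, Nonempty (cousinC R (heightFiltration R M) M n ≃ₗ[R] (d.T →ₗ[R] d.D n)) := by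
  have := d.fin
  exact cousin_unique (filt_height M) M d.Z (fun n => ModuleCat.of R (d.T →ₗ[R] d.D n)) d.f d.g d.se
    (fun n => TypeOn.mono (TypeOn.hom (d.typ n) d.T) (by
      rintro p ⟨hp, hpn⟩
      refine ⟨⟨hp, hpn.ge⟩, fun h => ?_⟩
      have := h.2
      rw [hpn] at this
      have : n + 1 ≤ n := by exact_mod_cast this
      omega)) d.e

theorem nat_ht (M : Type u) [AddCommGroup M] [Module R M] (p : PrimeSpectrum R) :
    ∃ n : ℕ, htM R M p = n := ⟨_, (ENat.natCast_toNat (htM_lt_top M p).ne).symm⟩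
end
end GGP

namespace GGP
section
open GG CategoryTheory Abelian IsLocalRing

section
variable {R : Type u} [CommRing R] [IsNoetherianRing R] [IsLocalRing R]

theorem reg_chain (d : ℕ) : ∀ (L0 : Type u) [AddCommGroup L0] [Module R L0] [Module.Finite R L0],
    (∀ i < d, EV R i (R ⧸ maximalIdeal R) L0) →
    ∃ (L : ModuleCat.{u} R), Module.Finite R L ∧ (∀ (N : Type u) [AddCommGroup N] [Module R N] (m : ℕ),
        (∀ i > m, EV R i L0 N) → ∀ i > m + d, EV R i L N) ∧
      ∀ (N : Type u) [AddCommGroup N] [Module R N] [Module.Finite R N] (m : ℕ),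
        EV R (m + d) L N → EV R m L0 N := by
  induction d with
  | zero =>
    intro L0 _ _ _ _
    exact ⟨ModuleCat.of R L0, inferInstance, fun N _ _ m h => h, fun N _ _ _ m h => h⟩
  | succ d ih =>
    intro L0 _ _ _ h0
    obtain ⟨x, hx, hxi⟩ := exists_reg (h0 0 (Nat.succ_pos _))
    have hse : SE (LinearMap.lsmul R L0 x) (LinearMap.range (LinearMap.lsmul R L0 x)).mkQ :=
      SE.coker _ hxi
    obtain ⟨L, hL, h, h'⟩ := ih (L0 ⧸ LinearMap.range (LinearMap.lsmul R L0 x))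
      (fun i hi => EV.right₂ hse (h0 i (by omega)) (h0 (i+1) (by omega)))
    refine ⟨L, hL, ?_, ?_⟩
    · intro N _ _ m hm i hi
      refine h N (m + 1) ?_ i (by omega)
      intro j hj
      obtain ⟨j, rfl⟩ : ∃ j', j = j' + 1 := ⟨j - 1, by omega⟩
      exact EV.right₁ hse (hm j (by omega)) (hm (j+1) (by omega))
    · intro N _ _ _ m hm
      have e : m + (d + 1) = (m + 1) + d := by omega
      rw [e] at hm
      exact EV.mul_surj₁ hx hxi (h' N (m+1) hm)

theorem depth_le_gd {N : Type u} [AddCommGroup N] [Module R N] [Module.Finite R N] [Nontrivial N]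
    (d g : ℕ) (hd : ∀ i < d, EV R i (R ⧸ maximalIdeal R) R) (hg : GD R g (ModuleCat.of R N)) :
    d ≤ g := by
  by_contra hlt
  obtain ⟨L, _, h1, h2⟩ := reg_chain d R hd
  have h3 := GD.ev_pd (L := L) (j := d + 1) (fun K _ _ i hi => h1 K 0 (by
    intro i hi
    obtain ⟨i, rfl⟩ : ∃ i', i = i' + 1 := ⟨i - 1, by omega⟩
    exact EV.of_projective i) i (by omega)) g _ hg (d - g - 1)
  have e : g + (d - g - 1) + 1 = 0 + d := by omega
  rw [e] at h3
  have h4 := h2 N 0 h3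
  rw [EV.zero_iff] at h4
  obtain ⟨y, hy⟩ := exists_ne (0 : N)
  apply hy
  have := LinearMap.congr_fun (h4 (LinearMap.toSpanSingleton R N y)) 1
  rwa [LinearMap.toSpanSingleton_apply, one_smul] at this
end

variable {R : Type u} [CommRing R]

theorem exact_loc (S : Submonoid R) {a b c : ℕ} (B : Matrix (Fin b) (Fin a) R)
    (C : Matrix (Fin a) (Fin c) R)
    (h : ∃ s ∈ S, ∀ v, act B R v = 0 → ∃ w, act C R w = s • v)
    (v : Fin a → Localization S) (hv : actA (Localization S) B (Localization S) v = 0) :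
    ∃ w, actA (Localization S) C (Localization S) w = v := by
  let g := Algebra.linearMap R (Localization S)
  obtain ⟨s, hs, h⟩ := h
  obtain ⟨x, t, ht, hx⟩ := tup_num g (S := S) v
  rw [actA_eq] at hv
  obtain ⟨r, hr, hr'⟩ := tup_zero g (S := S) (act B R x) (fun j => by
    have h1 := congrFun (act_map B g x) j
    rw [← h1]
    have h2 : (fun i => g (x i)) = t • v := funext fun i => (hx i).symm
    rw [h2, map_smul, hv, smul_zero]; rfl)
  obtain ⟨w, hw⟩ := h (r • x) (by rw [map_smul, hr'])
  have hu : (s * r * t) ∈ S := S.mul_mem (S.mul_mem hs hr) ht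
  obtain ⟨w', hw'⟩ := (loc_smul_bij (V := Fin c → Localization S) S ⟨s * r * t, hu⟩).2 (fun i => g (w i))
  refine ⟨w', ?_⟩
  apply (loc_smul_bij (V := Fin a → Localization S) S ⟨s * r * t, hu⟩).1
  show (s * r * t) • _ = (s * r * t) • v
  rw [actA_eq, ← map_smul]
  have h3 : (s * r * t) • w' = fun i => g (w i) := hw'
  rw [h3, act_map, hw]
  funext i
  show g (s • r • x i) = (s * r * t) • v i
  rw [map_smul, map_smul, ← hx, mul_smul, mul_smul]

variable {T : Type u} [AddCommGroup T] [Module R T]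

/-- syzygies of the localized complex -/
abbrev MC.W (m : MC R T) (A : Type u) [CommRing A] [Algebra R A] (n : ℤ) : Type u :=
  (Fin (m.k (n+1)) → A) ⧸ LinearMap.range (actA A (m.B n) A)

theorem MC.TR_exact {m : MC R T} {p : PrimeSpectrum R} (h : m.TR p.asIdeal) (n : ℤ)
    (v : Fin (m.k (n+1)) → Localization p.asIdeal.primeCompl)
    (hv : actA (Localization p.asIdeal.primeCompl) (m.B (n+1)) (Localization p.asIdeal.primeCompl) v = 0) :
    ∃ w, actA (Localization p.asIdeal.primeCompl) (m.B n) (Localization p.asIdeal.primeCompl) w = v := by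
  obtain ⟨s, hs, h1⟩ := h.1 n
  exact exact_loc _ _ _ ⟨s, hs, h1⟩ v hv

theorem MC.TR_exactT {m : MC R T} {p : PrimeSpectrum R} (h : m.TR p.asIdeal) (n : ℤ)
    (v : Fin (m.k (n+1)) → Localization p.asIdeal.primeCompl)
    (hv : actA (Localization p.asIdeal.primeCompl) (m.B n).transpose (Localization p.asIdeal.primeCompl) v = 0) :
    ∃ w, actA (Localization p.asIdeal.primeCompl) (m.B (n+1)).transpose
      (Localization p.asIdeal.primeCompl) w = v := by
  obtain ⟨s, hs, h1⟩ := h.2 n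
  exact exact_loc _ _ _ ⟨s, hs, h1⟩ v hv

theorem lin_eq {A : Type u} [CommRing A] {a : ℕ} (φ : (Fin a → A) →ₗ[A] A) (v : Fin a → A) :
    φ v = ∑ i, v i • φ (Pi.single i 1) := by
  conv_lhs => rw [pi_eq_sum_univ' v]
  rw [map_sum]
  refine Finset.sum_congr rfl fun i _ => ?_
  rw [map_smul]

theorem MC.W_EV {m : MC R T} {p : PrimeSpectrum R} (h : m.TR p.asIdeal) (i : ℕ) : ∀ n : ℤ,
    EV (Localization p.asIdeal.primeCompl) (i+1) (m.W (Localization p.asIdeal.primeCompl) n)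
      (Localization p.asIdeal.primeCompl) := by
  let A := Localization p.asIdeal.primeCompl
  have hf : ∀ n : ℤ, Function.Injective (Submodule.liftQ _ (actA A (m.B (n+1)) A) (act_range_le m n)) := by
    intro n
    rw [injective_iff_map_eq_zero]
    intro z hz
    obtain ⟨v, rfl⟩ := Submodule.Quotient.mk_surjective _ z
    rw [Submodule.liftQ_apply] at hz
    obtain ⟨w, hw⟩ := MC.TR_exact h n v hz
    rw [Submodule.Quotient.mk_eq_zero]
    exact ⟨w, hw⟩
  have hse : ∀ n : ℤ, SE (Submodule.liftQ _ (actA A (m.B (n+1)) A) (act_range_le m n))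
      (Submodule.mkQ (LinearMap.range (actA A (m.B (n+1)) A))) := by
    intro n
    refine ⟨hf n, ?_, Submodule.mkQ_surjective _⟩
    intro y
    rw [Submodule.mkQ_apply, Submodule.Quotient.mk_eq_zero]
    constructor
    · rintro ⟨x, rfl⟩
      exact ⟨Submodule.Quotient.mk x, by rw [Submodule.liftQ_apply]⟩
    · rintro ⟨z, rfl⟩
      obtain ⟨v, rfl⟩ := Submodule.Quotient.mk_surjective _ z
      exact ⟨v, by rw [Submodule.liftQ_apply]⟩
  induction i with
  | zero =>
    intro n
    obtain ⟨n, rfl⟩ : ∃ n', n = n' + 1 := ⟨n - 1, by omega⟩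
    refine EV.one_of_extend (hse n) (EV.of_projective 0) fun φ => ?_
    let φ' : (Fin (m.k (n+1)) → A) →ₗ[A] A := φ.comp (Submodule.mkQ _)
    obtain ⟨w, hw⟩ := MC.TR_exactT h n (fun i => φ' (Pi.single i 1)) (by
      funext j
      have h1 : φ' (actA A (m.B n) A (Pi.single j 1)) = 0 := by
        have h0 : (Submodule.mkQ (LinearMap.range (actA A (m.B n) A)))
            (actA A (m.B n) A (Pi.single j 1)) = 0 :=
          (Submodule.Quotient.mk_eq_zero _).2 ⟨_, rfl⟩
        rw [LinearMap.comp_apply, h0, map_zero]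
      rw [lin_eq] at h1
      refine Eq.trans ?_ h1
      unfold actA
      rw [act_apply]
      refine Finset.sum_congr rfl fun i _ => ?_
      rw [act_apply, Finset.sum_eq_single j]
      · simp
        rfl
      · intro b _ hb; simp [hb]
      · intro hb; exact absurd (Finset.mem_univ j) hb)
    refine ⟨Fintype.linearCombination A w, ?_⟩
    apply LinearMap.ext; intro z
    obtain ⟨v, rfl⟩ := Submodule.Quotient.mk_surjective _ z
    rw [LinearMap.comp_apply, Submodule.liftQ_apply, Fintype.linearCombination_apply]
    have h2 : φ (Submodule.Quotient.mk v) = φ' v := rfl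
    rw [h2, lin_eq φ' v]
    have h3 := act_pair' (((m.B (n+1)).map (algebraMap R A)).transpose) w v
    rw [Matrix.transpose_transpose] at h3
    refine h3.symm.trans (Finset.sum_congr rfl fun i _ => ?_)
    rw [← congrFun hw i]
    rfl
  | succ i ih =>
    intro n
    obtain ⟨n, rfl⟩ : ∃ n', n = n' + 1 := ⟨n - 1, by omega⟩
    exact (EV.shift_iff (hse n)).2 (ih n)

theorem MC.hom_W {m : MC R T} {p : PrimeSpectrum R} (h : m.TR p.asIdeal) (n : ℤ) :
    Nonempty (LocalizedModule p.asIdeal.primeCompl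
      ((Fin (m.k (n+1+1)) → R) ⧸ LinearMap.range (act (m.B (n+1+1)).transpose R))
      ≃ₗ[Localization p.asIdeal.primeCompl] (m.W (Localization p.asIdeal.primeCompl) n
        →ₗ[Localization p.asIdeal.primeCompl] LocalizedModule p.asIdeal.primeCompl R)) := by
  let S := p.asIdeal.primeCompl
  obtain ⟨e1⟩ := ker_loc S (D := R) (m.B n).transpose
  obtain ⟨e2⟩ := hom_ker_gen (R := Localization S) ((m.B n).map (algebraMap R (Localization S))).transpose
    (LinearEquiv.refl (Localization S) _) (LocalizedModule S R)
  have hz : ∀ (j : ℤ) (v : Fin (m.k (j+1+1)) → R),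
      act (m.B j).transpose R (act (m.B (j+1)).transpose R v) = 0 := by
    intro j v
    rw [act_mul, ← Matrix.transpose_mul, m.hz, Matrix.transpose_zero, act_zero]
  let g : ((Fin (m.k (n+1+1)) → R) ⧸ LinearMap.range (act (m.B (n+1+1)).transpose R)) →ₗ[R]
      LinearMap.ker (act (m.B n).transpose R) :=
    Submodule.liftQ _ (LinearMap.codRestrict _ (act (m.B (n+1)).transpose R) (fun v => hz n v)) (by
      rintro _ ⟨w, rfl⟩
      rw [LinearMap.mem_ker]
      exact Subtype.ext (hz (n+1) w))
  have hg : ∀ v, (g (Submodule.Quotient.mk v)).1 = act (m.B (n+1)).transpose R v := fun v => rfl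
  have hb : Function.Bijective (lmap S g) := by
    constructor
    · rw [injective_iff_map_eq_zero]
      intro z hz'
      obtain ⟨k, t, ht, htk⟩ := loc_exists_mk z
      have h1 : LocalizedModule.mkLinearMap S _ (g k) = 0 := by
        have : lmap S g (LocalizedModule.mkLinearMap S _ k) = 0 := by
          rw [← htk, ← algebraMap_smul (Localization S) t z, map_smul, hz', smul_zero]
        rw [← this]
        exact (lmap_mk S g k).symm
      obtain ⟨s, hs, hs0⟩ := loc_mk_eq_zero.1 h1
      obtain ⟨v, rfl⟩ := Submodule.Quotient.mk_surjective _ k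
      obtain ⟨r, hr, hr'⟩ := h.2 (n+1)
      obtain ⟨w, hw⟩ := hr' (s • v) (by
        rw [map_smul, ← hg]
        exact congrArg Subtype.val hs0)
      have h2 : LocalizedModule.mkLinearMap S ((Fin (m.k (n+1+1)) → R) ⧸
          LinearMap.range (act (m.B (n+1+1)).transpose R)) (Submodule.Quotient.mk v) = 0 := by
        refine loc_mk_eq_zero.2 ⟨r * s, S.mul_mem hr hs, ?_⟩
        rw [← Submodule.Quotient.mk_smul, Submodule.Quotient.mk_eq_zero, mul_smul]
        exact ⟨w, hw⟩
      apply (loc_smul_bij S ⟨t, ht⟩).1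
      show t • z = t • (0 : LocalizedModule S _)
      rw [htk, h2, smul_zero]
    · intro z
      obtain ⟨k, t, ht, htk⟩ := loc_exists_mk z
      obtain ⟨r, hr, hr'⟩ := h.2 n
      obtain ⟨w, hw⟩ := hr' k.1 k.2
      obtain ⟨y, hy⟩ := (loc_smul_bij (V := LocalizedModule S ((Fin (m.k (n+1+1)) → R) ⧸
          LinearMap.range (act (m.B (n+1+1)).transpose R))) S ⟨r * t, S.mul_mem hr ht⟩).2
          (LocalizedModule.mkLinearMap S _ (Submodule.Quotient.mk w))
      refine ⟨y, ?_⟩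
      apply (loc_smul_bij S ⟨r * t, S.mul_mem hr ht⟩).1
      show (r * t) • lmap S g y = (r * t) • z
      have hy' : (r * t) • y = LocalizedModule.mkLinearMap S _ (Submodule.Quotient.mk w) := hy
      rw [← algebraMap_smul (Localization S) (r * t) (lmap S g y), ← map_smul, algebraMap_smul, hy',
        mul_smul, htk, ← map_smul]
      refine (lmap_mk S g _).trans ?_
      congr 1
      exact Subtype.ext hw
  exact ⟨(LinearEquiv.ofBijective _ hb).trans (e1.trans e2.symm)⟩

theorem MC.hom_T {m : MC R T} {p : PrimeSpectrum R} (h : m.TR p.asIdeal) : ∃ n : ℤ,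
    Nonempty (LocalizedModule p.asIdeal.primeCompl T
      ≃ₗ[Localization p.asIdeal.primeCompl] (m.W (Localization p.asIdeal.primeCompl) n
        →ₗ[Localization p.asIdeal.primeCompl] LocalizedModule p.asIdeal.primeCompl R)) := by
  have key : ∀ j : ℤ, ∃ n : ℤ, Nonempty (LocalizedModule p.asIdeal.primeCompl
      ((Fin (m.k j) → R) ⧸ LinearMap.range (act (m.B j).transpose R))
      ≃ₗ[Localization p.asIdeal.primeCompl] (m.W (Localization p.asIdeal.primeCompl) n
        →ₗ[Localization p.asIdeal.primeCompl] LocalizedModule p.asIdeal.primeCompl R)) := by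
    intro j
    obtain ⟨n, rfl⟩ : ∃ n, j = n + 1 + 1 := ⟨j - 2, by omega⟩
    exact ⟨n, MC.hom_W h n⟩
  obtain ⟨n, ⟨e⟩⟩ := key 0
  have hb : Function.Bijective (lmap p.asIdeal.primeCompl m.e.symm.toLinearMap) :=
    ⟨LocalizedModule.map_injective _ m.e.symm.toLinearMap m.e.symm.injective,
      LocalizedModule.map_surjective _ m.e.symm.toLinearMap m.e.symm.surjective⟩
  exact ⟨n, ⟨(LinearEquiv.ofBijective _ hb).trans e⟩⟩
end
end GGP

namespace GGP
section
open GG CategoryTheory Abelian IsLocalRing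
variable {R : Type u} [CommRing R]

theorem gid_mem {M : Type u} [AddCommGroup M] [Module R M] (n : ℕ) (h : gid R M ≤ n) :
    ∃ g : ℕ, gid R M = g ∧ GD R g (ModuleCat.of R M) := by
  have hne : ({c : ℕ∞ | ∃ n : ℕ, c = n ∧ gidLE R M n}).Nonempty := by
    by_contra hc
    rw [Set.not_nonempty_iff_eq_empty] at hc
    unfold gid at h
    rw [hc, sInf_empty, top_le_iff] at h
    exact ENat.coe_ne_top n h
  obtain ⟨g, hg, hg'⟩ := csInf_mem hne
  exact ⟨g, hg, gidLE_iff.1 hg'⟩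

theorem gid_le {M : Type u} [AddCommGroup M] [Module R M] (n : ℕ) (h : GD R n (ModuleCat.of R M)) :
    gid R M ≤ n := sInf_le ⟨n, rfl, gidLE_iff.2 h⟩

variable [IsNoetherianRing R]

theorem exists_depth (M : Type u) [AddCommGroup M] [Module R M] [Module.Finite R M]
    (p : PrimeSpectrum R) (hp : p ∈ Module.support R M) :
    ∃ d : ℕ, (∀ i < d, EL p i M) ∧ ¬ EL p d M ∧
      mdepth (Localization.AtPrime p.asIdeal) (LocalizedModule p.asIdeal.primeCompl M) = d := by
  classical
  obtain ⟨n, hn⟩ := nat_ht M p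
  obtain ⟨i, _, hi⟩ := depth_le_ht M n p hp hn
  have hex : ∃ i, ¬ EL p i M := ⟨i, hi⟩
  have h1 : ∀ i < Nat.find hex, EL p i M := fun i hi => not_not.1 (Nat.find_min hex hi)
  have h2 := Nat.find_spec hex
  refine ⟨Nat.find hex, h1, h2, ?_⟩
  have : Nontrivial (LocalizedModule p.asIdeal.primeCompl M) := hp
  exact mdepth_eq (fun i hi => (EL_iff_res p i).1 (h1 i hi)) (fun h => h2 ((EL_iff_res p _).2 h))

theorem CM.depth {M : Type u} [AddCommGroup M] [Module R M] [Module.Finite R M] (h : CM R M)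
    (p : PrimeSpectrum R) (hp : p ∈ Module.support R M) :
    mdepth (Localization.AtPrime p.asIdeal) (LocalizedModule p.asIdeal.primeCompl M) = htM R M p := by
  obtain ⟨n, hn⟩ := nat_ht M p
  obtain ⟨d, h1, h2, h3⟩ := exists_depth M p hp
  obtain ⟨i, hi, hi'⟩ := depth_le_ht M n p hp hn
  have hge : n ≤ i := by
    by_contra hc
    exact hi' (h p hp i (by rw [hn]; exact_mod_cast (by omega)))
  have hd : d ≤ i := by
    by_contra hc
    exact hi' (h1 i (by omega))
  have hd' : n ≤ d := by
    by_contra hc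
    exact h2 (h p hp d (by rw [hn]; exact_mod_cast (by omega)))
  have : d = n := by omega
  rw [h3, hn, this]

theorem CM.of_depth {M : Type u} [AddCommGroup M] [Module R M] [Module.Finite R M]
    (h : ∀ p ∈ Module.support R M,
      mdepth (Localization.AtPrime p.asIdeal) (LocalizedModule p.asIdeal.primeCompl M) = htM R M p) :
    CM R M := by
  intro p hp i hi
  obtain ⟨d, h1, h2, h3⟩ := exists_depth M p hp
  rw [← h p hp, h3] at hi
  exact h1 i (by exact_mod_cast hi)

theorem Data.supp_T {M : Type u} [AddCommGroup M] [Module R M] (d : Data R M) (p : PrimeSpectrum R)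
    (hp : p ∈ Module.support R M) : p ∈ Module.support R d.T := by
  have := d.fin
  rw [Module.mem_support_iff_of_finite]
  intro s hs
  by_contra hsp
  rw [mem_supp_iff] at hp
  obtain ⟨k, hk⟩ := hp
  refine hsp (hk s ?_)
  apply d.e.injective
  apply (d.se 0).inj
  rw [map_smul, map_smul, map_zero, map_zero]
  apply LinearMap.ext; intro t
  rw [LinearMap.smul_apply, ← map_smul, Module.mem_annihilator.1 hs t, map_zero]
  rfl

theorem Data.depth_ge {M : Type u} [AddCommGroup M] [Module R M] (d : Data R M) (m : MC R d.T)
    (p : PrimeSpectrum R) (hp : p ∈ Module.support R M) (h : m.TR p.asIdeal) (n : ℕ)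
    (hn : htM R M p = n) : ∀ i < n, EL p i R := by
  intro i hi
  obtain ⟨j, ⟨e⟩⟩ := MC.hom_T h
  have hT : Nontrivial (LocalizedModule p.asIdeal.primeCompl d.T) := d.supp_T p hp
  have hW : Nontrivial (m.W (Localization p.asIdeal.primeCompl) j) := by
    by_contra hc
    rw [not_nontrivial_iff_subsingleton] at hc
    have : Subsingleton (LocalizedModule p.asIdeal.primeCompl d.T) :=
      (e.trans (LinearEquiv.refl _ _)).toEquiv.subsingleton_congr.2
        ⟨fun a b => LinearMap.ext fun w => by
          rw [Subsingleton.elim w 0, map_zero, map_zero]⟩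
    exact not_subsingleton _ this
  obtain ⟨e2⟩ := locSelf p.asIdeal.primeCompl
  rw [EL_iff_res]
  have hF : Module.Finite (Localization p.asIdeal.primeCompl) (LocalizedModule p.asIdeal.primeCompl R) :=
    Module.Finite.equiv e2
  have key := EV_of_hom (R := Localization.AtPrime p.asIdeal) (n - 1)
    (m.W (Localization p.asIdeal.primeCompl) j) (LocalizedModule p.asIdeal.primeCompl R)
    (fun i => EV.congr_right e2 (MC.W_EV h i j))
    (fun i hi' => EV.congr_right e ((EL_iff_res p i).1 (d.el p hp i (by
      rw [hn]; exact_mod_cast (by omega)))))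
  exact key i (by omega)

theorem final_mp (hR : HasDualizingComplex R) (M : ModuleCat.{u} R) (hMf : Module.Finite R M)
    (h : CousinResolves R (heightFiltration R M) M (fun N => IsGorensteinInjective R N)) :
    ∀ p ∈ Module.support R M,
        mdepth (Localization.AtPrime p.asIdeal) (LocalizedModule p.asIdeal.primeCompl M)
            = htM R M p ∧
        htM R M p
            = gid (Localization.AtPrime p.asIdeal) (LocalizedModule p.asIdeal.primeCompl M) ∧
        gid (Localization.AtPrime p.asIdeal) (LocalizedModule p.asIdeal.primeCompl M)
            = mdepth (Localization.AtPrime p.asIdeal) (Localization.AtPrime p.asIdeal) := by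
  rw [cexact_iff] at h
  obtain ⟨hex, hGI⟩ := h
  have hCM : CM R M := by
    intro p hp i hi
    refine EL_of_cexact (filt_height M) M hex ⟨hp, ?_⟩
    exact Order.add_one_le_of_lt hi
  obtain ⟨d⟩ := data_exists hR M hCM
  have := d.fin
  obtain ⟨m⟩ := exists_MC R d.T
  have hTR : ∀ p ∈ Module.support R M, m.TR p.asIdeal := by
    intro p hp
    obtain ⟨n, hn⟩ := nat_ht M p
    obtain ⟨e⟩ := d.cousin.2 n
    exact d.TR_glob m n p hp hn (GI.congr e (isGI_iff.1 (hGI n)))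
  intro p hp
  obtain ⟨n, hn⟩ := nat_ht M p
  have hdep := hCM.depth p hp
  have hGD := d.GD_M m p n hn fun i _ => d.GI_loc m p i fun q hq _ _ => hTR q hq
  have hle := gid_le n hGD
  obtain ⟨g, hg, hg'⟩ := gid_mem n hle
  have hgn : g ≤ n := by
    rw [hg] at hle
    exact_mod_cast hle
  obtain ⟨δ, h1, h2, _⟩ := exists_depth R p (mem_supp_self p)
  obtain ⟨e2⟩ := locSelf p.asIdeal.primeCompl
  have h1' : ∀ i < δ, EV (Localization.AtPrime p.asIdeal) i
      (Localization.AtPrime p.asIdeal ⧸ maximalIdeal (Localization.AtPrime p.asIdeal))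
      (Localization.AtPrime p.asIdeal) := fun i hi =>
    EV.congr_right e2.symm ((EL_iff_res p i).1 (h1 i hi))
  have h2' : ¬ EV (Localization.AtPrime p.asIdeal) δ
      (Localization.AtPrime p.asIdeal ⧸ maximalIdeal (Localization.AtPrime p.asIdeal))
      (Localization.AtPrime p.asIdeal) := fun h =>
    h2 ((EL_iff_res p δ).2 (EV.congr_right e2 h))
  have h3 := mdepth_eq h1' h2'
  have hnt : Nontrivial (LocalizedModule p.asIdeal.primeCompl M) := hp
  have hδg : δ ≤ g := depth_le_gd (R := Localization.AtPrime p.asIdeal)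
    (N := LocalizedModule p.asIdeal.primeCompl M) δ g h1' hg'
  have hnδ : n ≤ δ := by
    by_contra hc
    exact h2 (d.depth_ge m p hp (hTR p hp) n hn δ (by omega))
  have e1 : g = n := by omega
  have e2 : δ = n := by omega
  refine ⟨hdep, ?_, ?_⟩
  · rw [hn, ← e1]; exact hg.symm
  · rw [h3, e2, ← e1]; exact hg

theorem final_mpr (hR : HasDualizingComplex R) (M : ModuleCat.{u} R) (hMf : Module.Finite R M)
    (h : ∀ p ∈ Module.support R M,
        mdepth (Localization.AtPrime p.asIdeal) (LocalizedModule p.asIdeal.primeCompl M)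
            = htM R M p ∧
        htM R M p
            = gid (Localization.AtPrime p.asIdeal) (LocalizedModule p.asIdeal.primeCompl M)) :
    CousinResolves R (heightFiltration R M) M (fun N => IsGorensteinInjective R N) := by
  have hCM : CM R M := CM.of_depth fun p hp => (h p hp).1
  obtain ⟨d⟩ := data_exists hR M hCM
  have := d.fin
  obtain ⟨m⟩ := exists_MC R d.T
  have hTR := d.TR_all m (fun p hp n hn => by
    have h1 := (h p hp).2
    obtain ⟨g, hg, hg'⟩ := gid_mem (R := Localization.AtPrime p.asIdeal)
      (M := LocalizedModule p.asIdeal.primeCompl M) n (by rw [← h1, hn])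
    have : g = n := by
      rw [hg, hn] at h1
      exact_mod_cast h1.symm
    subst this
    exact hg')
  rw [cexact_iff]
  refine ⟨d.cousin.1, fun n => ?_⟩
  obtain ⟨e⟩ := d.cousin.2 n
  exact isGI_iff.2 (GI.congr e.symm (d.GI_glob m n hTR))
end
end GGP

open GG in
/-- Characterization of G–Gorenstein modules over a ring with a dualizing complex. -/
theorem stmt1 (R : Type u) [CommRing R] [IsNoetherianRing R] (hR : HasDualizingComplex R)
    (M : ModuleCat.{u} R) (hM0 : ∃ x : M, x ≠ 0) (hMf : Module.Finite R M) :
    IsGGorenstein R M ↔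
      ∀ p ∈ Module.support R M,
        mdepth (Localization.AtPrime p.asIdeal) (LocalizedModule p.asIdeal.primeCompl M)
            = htM R M p ∧
        htM R M p
            = gid (Localization.AtPrime p.asIdeal) (LocalizedModule p.asIdeal.primeCompl M) ∧
        gid (Localization.AtPrime p.asIdeal) (LocalizedModule p.asIdeal.primeCompl M)
            = mdepth (Localization.AtPrime p.asIdeal) (Localization.AtPrime p.asIdeal) := by
  constructor
  · intro h
    exact GGP.final_mp hR M hMf h.2.2
  · intro h
    exact ⟨hM0, hMf, GGP.final_mpr hR M hMf fun p hp => ⟨(h p hp).1, (h p hp).2.1⟩⟩
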